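/- If ε₂·ε_{p₁p₂}·ε_{2p₁p₂} is not a square in K₃⁺, then Cl₂(K₃) is isomorphic to ℤ/2^m ℤ × ℤ/2^{n+1} ℤ. -/

import Mathlib

open NumberField IntermediateField

/-- `ε` is the fundamental unit of the real quadratic field `ℚ(√D)` (for `D > 1` squarefree):
elements of the ring of integers of `ℚ(√D)` are exactly the numbers `(x + y√D)/2` with
`x ≡ y·D (mod 2)`, and units are those with `x² - Dy² = ±4`.  The fundamental unit is the
least unit `> 1`; equivalently, every unit is of the form `±ε^k` with `k ∈ ℤ`. -/
def IsFundUnit (D : ℕ) (ε : ℝ) : Prop :=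
  1 < ε ∧
  (∃ x y : ℤ, ε = ((x : ℝ) + (y : ℝ) * Real.sqrt D) / 2 ∧
    (x ^ 2 - (D : ℤ) * y ^ 2 = 4 ∨ x ^ 2 - (D : ℤ) * y ^ 2 = -4)) ∧
  ∀ x y : ℤ, (x ^ 2 - (D : ℤ) * y ^ 2 = 4 ∨ x ^ 2 - (D : ℤ) * y ^ 2 = -4) →
    1 < ((x : ℝ) + (y : ℝ) * Real.sqrt D) / 2 →
    ε ≤ ((x : ℝ) + (y : ℝ) * Real.sqrt D) / 2

open scoped Pointwise nonZeroDivisors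

set_option linter.unusedSectionVars false

section Galois
variable {k K : Type*} [Field k] [NumberField k] [Field K] [NumberField K] [Algebra k K]

/-- `k` is, via the algebra map, the subfield of `K` fixed by the group `H`. -/
def IsFixedField (k : Type*) {K : Type*} [Field k] [Field K] [NumberField K] [Algebra k K]
    (H : Subgroup Gal(K/ℚ)) : Prop :=
  ∀ x : K, x ∈ Set.range (algebraMap k K) ↔ ∀ g ∈ H, g x = x

theorem IsFixedField.isGaloisGroup {H : Subgroup Gal(K/ℚ)} (h : IsFixedField k H) :
    IsGaloisGroup H k K where
  faithful := ⟨fun {a b} hab => by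
    ext x
    exact hab x⟩
  commutes := ⟨fun g c x => by
    have := (h (algebraMap k K c)).1 ⟨c, rfl⟩ g g.2
    rw [Algebra.smul_def, Algebra.smul_def, smul_mul']
    congr 1⟩
  isInvariant := ⟨fun x hx => (h x).2 fun g hg => hx ⟨g, hg⟩⟩

theorem IsFixedField.algebraMap_norm {H : Subgroup Gal(K/ℚ)} (h : IsFixedField k H) (x : K)
    [Fintype H] :
    algebraMap k K (Algebra.norm k x) = ∏ g : H, (g : Gal(K/ℚ)) x := by
  have := h.isGaloisGroup
  have : IsGalois k K := IsGaloisGroup.isGalois H k K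
  rw [Algebra.norm_eq_prod_automorphisms]
  exact (Fintype.prod_equiv (IsGaloisGroup.mulEquivAlgEquiv H k K).toEquiv _ _ fun g => rfl).symm

theorem IsFixedField.algebraMap_intNorm {H : Subgroup Gal(K/ℚ)} (h : IsFixedField k H) (x : 𝓞 K)
    [Fintype H] :
    algebraMap (𝓞 k) (𝓞 K) (Algebra.intNorm (𝓞 k) (𝓞 K) x) = ∏ g : H, (g : Gal(K/ℚ)) • x := by
  apply RingOfIntegers.ext
  have h1 := Algebra.algebraMap_intNorm (A := 𝓞 k) (B := 𝓞 K) (K := k) (L := K) x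
  have h2 := h.algebraMap_norm (x : K)
  rw [← h1] at h2
  change algebraMap (𝓞 K) K _ = algebraMap (𝓞 K) K _
  rw [map_prod]
  exact h2

/-- Extending the relative norm of an ideal gives the product of its conjugates. -/
theorem IsFixedField.map_relNorm {H : Subgroup Gal(K/ℚ)} (h : IsFixedField k H) (I : Ideal (𝓞 K))
    [Fintype H] :
    (Ideal.relNorm (𝓞 k) I).map (algebraMap (𝓞 k) (𝓞 K)) = ∏ g : H, (g : Gal(K/ℚ)) • I := by
  have sub (I : Ideal (𝓞 K)) : (Ideal.relNorm (𝓞 k) I).map (algebraMap (𝓞 k) (𝓞 K)) ≤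
      ∏ g : H, (g : Gal(K/ℚ)) • I := by
    rw [← Ideal.spanNorm_eq, Ideal.spanNorm, Ideal.map_le_iff_le_comap, Ideal.map,
      Ideal.span_le]
    rintro _ ⟨x, hx, rfl⟩
    change algebraMap (𝓞 k) (𝓞 K) (Algebra.intNorm (𝓞 k) (𝓞 K) x) ∈
      ∏ g : H, (g : Gal(K/ℚ)) • I
    rw [h.algebraMap_intNorm]
    exact Ideal.prod_mem_prod fun g _ => Ideal.smul_mem_pointwise_smul _ _ _ hx
  rcases eq_or_ne I ⊥ with rfl | hI
  · refine le_antisymm (sub ⊥) ?_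
    rw [Finset.prod_eq_zero (Finset.mem_univ (1 : H))]
    · exact bot_le
    · simp
  obtain ⟨a, haI, ha0⟩ := Submodule.exists_mem_ne_zero_of_ne_bot hI
  obtain ⟨J, hJ⟩ := Ideal.dvd_span_singleton.2 haI
  have key : (Ideal.relNorm (𝓞 k) (I * J)).map (algebraMap (𝓞 k) (𝓞 K)) =
      ∏ g : H, (g : Gal(K/ℚ)) • (I * J) := by
    rw [← hJ, Ideal.relNorm_singleton, Ideal.map_span, Set.image_singleton,
      h.algebraMap_intNorm, ← Ideal.prod_span_singleton]
    refine Finset.prod_congr rfl fun g _ => ?_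
    rw [Ideal.pointwise_smul_def, Ideal.map_span, Set.image_singleton]
    rfl
  have hprod : ∏ g : H, (g : Gal(K/ℚ)) • (I * J) ≠ ⊥ := by
    rw [← hJ]
    refine Finset.prod_ne_zero_iff.2 fun g _ => ?_
    rw [Ideal.pointwise_smul_def, Ideal.map_span, Set.image_singleton, Ne,
      Ideal.zero_eq_bot, Ideal.span_singleton_eq_bot]
    rwa [MulSemiringAction.toRingHom_apply, smul_eq_zero_iff_eq]
  simp only [smul_mul', Finset.prod_mul_distrib] at key hprod
  rw [map_mul, Ideal.map_mul] at key
  obtain ⟨X, hX⟩ := Ideal.dvd_iff_le.2 (sub I)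
  obtain ⟨Y, hY⟩ := Ideal.dvd_iff_le.2 (sub J)
  rw [hX, hY] at key
  have h1 : X * Y = 1 := by
    apply mul_left_cancel₀ hprod
    rw [mul_one]
    conv_rhs => rw [← key]
    ring
  have : X = 1 := by
    rw [Ideal.one_eq_top]
    rw [Ideal.one_eq_top] at h1
    exact top_le_iff.1 (h1 ▸ Ideal.mul_le_left)
  rw [hX, this, mul_one]

theorem IsFixedField.exists_of_smul_eq {H : Subgroup Gal(K/ℚ)} (h : IsFixedField k H) {x : 𝓞 K}
    (hx : ∀ g ∈ H, g • x = x) : ∃ y : 𝓞 k, algebraMap (𝓞 k) (𝓞 K) y = x := by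
  obtain ⟨y, hy⟩ := (h x).2 fun g hg => by
    have := congrArg (algebraMap (𝓞 K) K) (hx g hg)
    exact this
  have : IsIntegral ℤ y := by
    have h1 : IsIntegral ℤ (algebraMap k K y) := hy ▸ x.2
    exact (isIntegral_algebraMap_iff (algebraMap k K).injective).1 h1
  exact ⟨⟨y, this⟩, RingOfIntegers.ext hy⟩

theorem IsFixedField.smul_algebraMap {H : Subgroup Gal(K/ℚ)} (h : IsFixedField k H) {g : Gal(K/ℚ)}
    (hg : g ∈ H) (y : 𝓞 k) : g • algebraMap (𝓞 k) (𝓞 K) y = algebraMap (𝓞 k) (𝓞 K) y :=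
  RingOfIntegers.ext ((h _).1 ⟨y, rfl⟩ g hg)

end Galois

section Subgroups
variable {G : Type*} [Group G]

/-- The subgroup `{1, a}` for an involution `a`. -/
def pairSubgroup (a : G) (ha : a * a = 1) : Subgroup G where
  carrier := {g | g = 1 ∨ g = a}
  one_mem' := Or.inl rfl
  mul_mem' := by
    rintro x y (rfl | rfl) (rfl | rfl) <;> simp [ha]
  inv_mem' := by
    rintro x (rfl | rfl)
    · simp
    · right; exact inv_eq_of_mul_eq_one_left ha

/-- The subgroup `{1, a, b, ab}` for commuting involutions `a`, `b`. -/
def quadSubgroup (a b : G) (ha : a * a = 1) (hb : b * b = 1) (hab : a * b = b * a) :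
    Subgroup G where
  carrier := {g | g = 1 ∨ g = a ∨ g = b ∨ g = a * b}
  one_mem' := Or.inl rfl
  mul_mem' := by
    have h1 : a * (a * b) = b := by rw [← mul_assoc, ha, one_mul]
    have h2 : b * (a * b) = a := by rw [hab, ← mul_assoc, hb, one_mul]
    have h3 : a * b * a = b := by rw [hab, mul_assoc, ha, mul_one]
    have h4 : a * b * b = a := by rw [mul_assoc, hb, mul_one]
    have h5 : a * b * (a * b) = 1 := by rw [← mul_assoc, h3, hb]
    rintro x y (rfl | rfl | rfl | rfl) (rfl | rfl | rfl | rfl) <;> simp [ha, hb, h1, h2, h3, h4, h5, hab.symm]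
  inv_mem' := by
    rintro x (rfl | rfl | rfl | rfl)
    · simp
    · right; left; exact inv_eq_of_mul_eq_one_left ha
    · right; right; left; exact inv_eq_of_mul_eq_one_left hb
    · right; right; right
      rw [mul_inv_rev, inv_eq_of_mul_eq_one_left ha, inv_eq_of_mul_eq_one_left hb, hab]

theorem mem_pairSubgroup {a : G} {ha : a * a = 1} {g : G} :
    g ∈ pairSubgroup a ha ↔ g = 1 ∨ g = a := Iff.rfl

theorem mem_quadSubgroup {a b : G} {ha : a * a = 1} {hb : b * b = 1} {hab : a * b = b * a} {g : G} :
    g ∈ quadSubgroup a b ha hb hab ↔ g = 1 ∨ g = a ∨ g = b ∨ g = a * b := Iff.rfl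

theorem prod_pairSubgroup {M : Type*} [CommMonoid M] {a : G} (ha : a * a = 1) (h1 : a ≠ 1)
    [Fintype (pairSubgroup a ha)] (f : G → M) : ∏ g : pairSubgroup a ha, f g = f 1 * f a := by
  classical
  rw [← Finset.prod_subtype ({1, a} : Finset G) (by simp [mem_pairSubgroup]) f,
    Finset.prod_pair h1.symm]

theorem prod_quadSubgroup {M : Type*} [CommMonoid M] {a b : G} (ha : a * a = 1) (hb : b * b = 1)
    (hab : a * b = b * a) (h1 : a ≠ 1) (h2 : b ≠ 1) (h3 : a ≠ b)
    [Fintype (quadSubgroup a b ha hb hab)] (f : G → M) :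
    ∏ g : quadSubgroup a b ha hb hab, f g = f 1 * f a * f b * f (a * b) := by
  classical
  have h4 : a * b ≠ 1 := fun h => h3 <| by
    rw [← mul_one a, ← hb, ← mul_assoc, h, one_mul]
  rw [← Finset.prod_subtype ({1, a, b, a * b} : Finset G) (by simp [mem_quadSubgroup]) f,
    Finset.prod_insert (by simp [h1.symm, h2.symm, h4.symm]), Finset.prod_insert (by simp [h2, h3]),
    Finset.prod_pair (by simp [h1])]
  simp only [mul_assoc]

end Subgroups

section Ideals
variable {K : Type*} [Field K] [NumberField K]

theorem smul_span_singleton {R G : Type*} [CommRing R] [Group G] [MulSemiringAction G R] (g : G)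
    (x : R) : g • Ideal.span {x} = Ideal.span {g • x} := by
  rw [Ideal.pointwise_smul_def, Ideal.map_span, Set.image_singleton]
  rfl

variable {k : Type*} [Field k] [NumberField k] [Algebra k K]

theorem IsFixedField.map_relNorm_pair {a : Gal(K/ℚ)} {ha : a * a = 1}
    (h : IsFixedField k (pairSubgroup a ha)) (h1 : a ≠ 1) (I : Ideal (𝓞 K)) :
    (Ideal.relNorm (𝓞 k) I).map (algebraMap (𝓞 k) (𝓞 K)) = I * a • I := by
  have := Fintype.ofFinite (pairSubgroup a ha)
  rw [h.map_relNorm, prod_pairSubgroup ha h1 (fun g => g • I), one_smul]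

theorem IsFixedField.map_relNorm_quad {a b : Gal(K/ℚ)} {ha : a * a = 1} {hb : b * b = 1}
    {hab : a * b = b * a} (h : IsFixedField k (quadSubgroup a b ha hb hab)) (h1 : a ≠ 1)
    (h2 : b ≠ 1) (h3 : a ≠ b) (I : Ideal (𝓞 K)) :
    (Ideal.relNorm (𝓞 k) I).map (algebraMap (𝓞 k) (𝓞 K)) = I * a • I * b • I * (a * b) • I := by
  have := Fintype.ofFinite (quadSubgroup a b ha hb hab)
  rw [h.map_relNorm, prod_quadSubgroup ha hb hab h1 h2 h3 (fun g => g • I), one_smul]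

theorem IsFixedField.exists_of_smul_eq_pair {a : Gal(K/ℚ)} {ha : a * a = 1}
    (h : IsFixedField k (pairSubgroup a ha)) {x : 𝓞 K} (hx : a • x = x) :
    ∃ y : 𝓞 k, algebraMap (𝓞 k) (𝓞 K) y = x :=
  h.exists_of_smul_eq fun g hg => by
    rcases mem_pairSubgroup.1 hg with rfl | rfl
    · exact one_smul _ _
    · exact hx

theorem IsFixedField.exists_of_smul_eq_quad {a b : Gal(K/ℚ)} {ha : a * a = 1} {hb : b * b = 1}
    {hab : a * b = b * a} (h : IsFixedField k (quadSubgroup a b ha hb hab)) {x : 𝓞 K}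
    (hx : a • x = x) (hx' : b • x = x) : ∃ y : 𝓞 k, algebraMap (𝓞 k) (𝓞 K) y = x :=
  h.exists_of_smul_eq fun g hg => by
    rcases mem_quadSubgroup.1 hg with rfl | rfl | rfl | rfl
    · exact one_smul _ _
    · exact hx
    · exact hx'
    · rw [mul_smul, hx', hx]

theorem smul_eq_of_mul_eq_span {a : Gal(K/ℚ)} {I J L : Ideal (𝓞 K)} (hI : a • I = I) (hI0 : I ≠ ⊥)
    (hL : a • L = L) (h : I * J = L) : a • J = J := by
  have h2 : I * a • J = I * J := by
    rw [h]; nth_rewrite 1 [← hI]; rw [← smul_mul', h, hL]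
  exact mul_left_cancel₀ hI0 h2

/-- Over a principal ideal domain, an ideal invariant under the Galois group of a quadratic
extension is, up to a divisor of `ω - ω'`, extended from the base. -/
theorem IsFixedField.exists_mul_eq_span {τ : Gal(K/ℚ)} {hτ : τ * τ = 1}
    (h : IsFixedField k (pairSubgroup τ hτ)) [IsPrincipalIdealRing (𝓞 k)] (ω : 𝓞 K)
    {I : Ideal (𝓞 K)} (hI : I ≠ ⊥) (hτI : τ • I = I) :
    ∃ f : 𝓞 k, f ≠ 0 ∧ ∃ J : Ideal (𝓞 K),
      I * J = Ideal.span {algebraMap (𝓞 k) (𝓞 K) f} ∧ ω - τ • ω ∈ J ∧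
      ∀ g : Gal(K/ℚ), g * τ = τ * g → g • I = I → g • J = J := by
  have hττ (x : 𝓞 K) : τ • τ • x = x := by rw [smul_smul, hτ, one_smul]
  have hmem {x : 𝓞 K} (hx : x ∈ I) : τ • x ∈ I := by
    rw [← hτI]; exact Ideal.smul_mem_pointwise_smul _ _ _ hx
  obtain ⟨f, hf⟩ := IsPrincipalIdealRing.principal (I.comap (algebraMap (𝓞 k) (𝓞 K)))
  change _ = Ideal.span {f} at hf
  have hfI : algebraMap (𝓞 k) (𝓞 K) f ∈ I := by
    have : f ∈ I.comap (algebraMap (𝓞 k) (𝓞 K)) := hf ▸ Ideal.mem_span_singleton_self f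
    exact this
  have hfix {x : 𝓞 K} (hx : x ∈ I) (hx' : τ • x = x) :
      x ∈ Ideal.span {algebraMap (𝓞 k) (𝓞 K) f} := by
    obtain ⟨y, rfl⟩ := h.exists_of_smul_eq_pair hx'
    have : y ∈ I.comap (algebraMap (𝓞 k) (𝓞 K)) := hx
    rw [hf, Ideal.mem_span_singleton] at this
    rw [Ideal.mem_span_singleton]
    exact map_dvd _ this
  have hinj := FaithfulSMul.algebraMap_injective (𝓞 k) (𝓞 K)
  have hf0 : f ≠ 0 := by
    rintro rfl
    obtain ⟨x, hx, hx0⟩ := Submodule.exists_mem_ne_zero_of_ne_bot hI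
    have h1 := hfix (x := x * τ • x) (I.mul_mem_right _ hx) (by rw [smul_mul', hττ, mul_comm])
    rw [map_zero, Ideal.span_singleton_zero, Ideal.mem_bot, mul_eq_zero, smul_eq_zero_iff_eq,
      or_self] at h1
    exact hx0 h1
  refine ⟨f, hf0, ?_⟩
  obtain ⟨J, hJ⟩ := Ideal.dvd_span_singleton.2 hfI
  refine ⟨J, hJ.symm, ?_, fun g hg hgI => ?_⟩
  swap
  · have aux (g : Gal(K/ℚ)) (hg : g * τ = τ * g) (hgI : g • I = I) :
        g • algebraMap (𝓞 k) (𝓞 K) f ∈ Ideal.span {algebraMap (𝓞 k) (𝓞 K) f} := by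
      apply hfix
      · rw [← hgI]; exact Ideal.smul_mem_pointwise_smul _ _ _ hfI
      · rw [smul_smul, ← hg, ← smul_smul, h.smul_algebraMap (Or.inr rfl)]
    refine smul_eq_of_mul_eq_span hgI hI ?_ hJ.symm
    rw [smul_span_singleton]
    apply le_antisymm <;> rw [Ideal.span_singleton_le_iff_mem]
    · exact aux g hg hgI
    · have h1 := aux g⁻¹ (inv_mul_eq_iff_eq_mul.2 (by rw [← mul_assoc, hg, mul_assoc,
        mul_inv_cancel, mul_one])) (inv_smul_eq_iff.2 hgI.symm)
      rw [Ideal.mem_span_singleton] at h1 ⊢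
      have h2 := map_dvd (MulSemiringAction.toRingHom Gal(K/ℚ) (𝓞 K) g) h1
      simpa using h2
  rw [← Ideal.dvd_span_singleton, ← mul_dvd_mul_iff_left hI, ← hJ, Ideal.dvd_iff_le, mul_comm,
    Ideal.span_singleton_mul_le_iff]
  intro x hx
  have h1 : (ω - τ • ω) * x = (ω * x + τ • (ω * x)) - τ • ω * (x + τ • x) := by
    rw [smul_mul']; ring
  rw [h1]
  refine sub_mem (hfix (add_mem (I.mul_mem_left _ hx) (hmem (I.mul_mem_left _ hx))) ?_)
    (Ideal.mul_mem_left _ _ (hfix (add_mem hx (hmem hx)) ?_)) <;> rw [smul_add, hττ, add_comm]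

/-- An ideal whose square is `(z)`, with norm `(f)` such that `f² = z z'`, is equivalent to an
invariant ideal. -/
theorem exists_smul_mul_eq {τ : Gal(K/ℚ)} (hτ : τ * τ = 1) {I : Ideal (𝓞 K)} (hI0 : I ≠ ⊥)
    {z f : 𝓞 K} (hz : I ^ 2 = Ideal.span {z}) (hf : I * τ • I = Ideal.span {f}) (hτf : τ • f = f)
    (hfz : f ^ 2 = z * τ • z) :
    ∃ c : 𝓞 K, c ≠ 0 ∧ (c = 1 ∨ c = τ • z * (z + f)) ∧
      τ • (Ideal.span {c} * I) = Ideal.span {c} * I := by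
  have hττ : τ • τ • z = z := by rw [smul_smul, hτ, one_smul]
  have hz0 : z ≠ 0 := by
    rintro rfl
    rw [Ideal.span_singleton_zero] at hz
    exact hI0 (pow_eq_zero_iff (two_ne_zero) |>.1 hz)
  by_cases hc : z + f = 0
  · refine ⟨1, one_ne_zero, Or.inl rfl, ?_⟩
    rw [Ideal.span_singleton_one, ← Ideal.one_eq_top, one_mul]
    apply mul_left_cancel₀ hI0
    rw [hf, ← pow_two, hz, eq_neg_of_add_eq_zero_right hc, Ideal.span_singleton_neg]
  · refine ⟨τ • z * (z + f), mul_ne_zero ?_ hc, Or.inr rfl, ?_⟩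
    · rwa [Ne, smul_eq_zero_iff_eq]
    apply mul_left_cancel₀ hI0
    rw [smul_mul', smul_span_singleton, smul_mul', smul_add, hττ, hτf]
    have e1 : I * (Ideal.span {τ • z * (z + f)} * I) = Ideal.span {τ • z * (z + f)} * I ^ 2 := by
      ring
    have e2 : I * (Ideal.span {z * (τ • z + f)} * τ • I) =
        Ideal.span {z * (τ • z + f)} * (I * τ • I) := by ring
    rw [e1, e2, hz, hf, Ideal.span_singleton_mul_span_singleton,
      Ideal.span_singleton_mul_span_singleton]
    congr 2
    linear_combination z * hfz
end Ideals

section ClassGroup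
variable {R : Type*} [CommRing R] [IsDedekindDomain R]

/-- The class of a nonzero ideal; the zero ideal gets the trivial class. -/
noncomputable def idealClass (I : Ideal R) : ClassGroup R :=
  open Classical in if h : I = ⊥ then 1 else ClassGroup.mk0 ⟨I, mem_nonZeroDivisors_of_ne_zero h⟩

theorem idealClass_of_ne {I : Ideal R} (h : I ≠ ⊥) :
    idealClass I = ClassGroup.mk0 ⟨I, mem_nonZeroDivisors_of_ne_zero h⟩ := by
  rw [idealClass, dif_neg h]

theorem idealClass_mul {I J : Ideal R} (hI : I ≠ ⊥) (hJ : J ≠ ⊥) :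
    idealClass (I * J) = idealClass I * idealClass J := by
  rw [idealClass_of_ne hI, idealClass_of_ne hJ, idealClass_of_ne (mul_ne_zero hI hJ), ← map_mul]
  rfl

theorem idealClass_one : idealClass (1 : Ideal R) = 1 := by
  rw [idealClass_of_ne (one_ne_zero : (1 : Ideal R) ≠ 0), ← map_one ClassGroup.mk0]
  rfl

theorem idealClass_pow {I : Ideal R} (hI : I ≠ ⊥) (n : ℕ) :
    idealClass (I ^ n) = idealClass I ^ n := by
  induction n with
  | zero => simp [idealClass_one, -Ideal.one_eq_top]
  | succ n ih => rw [pow_succ, pow_succ, idealClass_mul (pow_ne_zero _ hI) hI, ih]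

theorem idealClass_eq_one_iff {I : Ideal R} (hI : I ≠ ⊥) :
    idealClass I = 1 ↔ ∃ x, I = Ideal.span {x} := by
  rw [idealClass_of_ne hI, ClassGroup.mk0_eq_one_iff]
  exact ⟨fun h => h.principal, fun ⟨x, hx⟩ => ⟨x, hx⟩⟩

theorem idealClass_span (x : R) : idealClass (Ideal.span {x}) = 1 := by
  by_cases h : Ideal.span {x} = ⊥
  · rw [idealClass, dif_pos h]
  · exact (idealClass_eq_one_iff h).2 ⟨x, rfl⟩

theorem exists_idealClass_eq (c : ClassGroup R) : ∃ I : Ideal R, I ≠ ⊥ ∧ idealClass I = c := by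
  obtain ⟨I, rfl⟩ := ClassGroup.mk0_surjective c
  exact ⟨I, nonZeroDivisors.coe_ne_zero I, idealClass_of_ne (nonZeroDivisors.coe_ne_zero I)⟩

/-- Every class contains an inverse ideal coprime to a given one. -/
theorem exists_mul_eq_span_coprime {I M : Ideal R} (hI : I ≠ ⊥) (hM : M ≠ ⊥) :
    ∃ J : Ideal R, J ≠ ⊥ ∧ J ⊔ M = ⊤ ∧ ∃ x, I * J = Ideal.span {x} := by
  obtain ⟨a, ha⟩ := IsDedekindDomain.exists_sup_span_eq (I := I * M) (J := I)
    Ideal.mul_le_left (mul_ne_zero hI hM)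
  have haI : a ∈ I := by
    rw [← ha]; exact Ideal.mem_sup_right (Ideal.mem_span_singleton_self a)
  obtain ⟨J, hJ⟩ := Ideal.dvd_span_singleton.2 haI
  rw [hJ, ← Ideal.mul_sup] at ha
  have h1 : J ⊔ M = ⊤ := by
    rw [sup_comm, ← Ideal.one_eq_top]
    exact mul_left_cancel₀ hI (ha.trans (mul_one I).symm)
  by_cases hJ0 : J = ⊥
  · subst hJ0
    rw [bot_sup_eq] at h1
    obtain ⟨a, ha, ha0⟩ := Submodule.exists_mem_ne_zero_of_ne_bot hI
    obtain ⟨J, hJ⟩ := Ideal.dvd_span_singleton.2 ha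
    refine ⟨J, ?_, by rw [h1, sup_top_eq], a, hJ.symm⟩
    rintro rfl
    rw [Ideal.mul_bot, Ideal.span_singleton_eq_bot] at hJ
    exact ha0 hJ
  · exact ⟨J, hJ0, h1, a, hJ.symm⟩

/-- A multiplicative function on enough ideals, trivial on the principal ones, factors through the
class group. -/
theorem exists_classGroup_hom {M : Type*} [CommMonoid M] (good : Ideal R → Prop) (f : Ideal R → M)
    (h0 : ∀ I, good I → I ≠ ⊥)
    (hmul : ∀ I J, good I → good J → good (I * J) ∧ f (I * J) = f I * f J)
    (hspan : ∀ x, good (Ideal.span {x}) → f (Ideal.span {x}) = 1)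
    (hex : ∀ I, I ≠ ⊥ → ∃ J, good J ∧ ∃ x, I * J = Ideal.span {x}) :
    ∃ φ : ClassGroup R →* M, ∀ I, good I → φ (idealClass I) = f I := by
  have heq {I J : Ideal R} (hI : good I) (hJ : good J) (h : idealClass I = idealClass J) :
      f I = f J := by
    obtain ⟨L, hL, x, hx⟩ := hex I (h0 I hI)
    have h1 : f I * f L = 1 := by
      rw [← (hmul I L hI hL).2, hx, hspan]
      rw [← hx]; exact (hmul I L hI hL).1
    have h2 : f J * f L = 1 := by
      have h3 : idealClass (J * L) = 1 := by
        rw [idealClass_mul (h0 J hJ) (h0 L hL), ← h, ← idealClass_mul (h0 I hI) (h0 L hL), hx,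
          idealClass_span]
      obtain ⟨y, hy⟩ := (idealClass_eq_one_iff (mul_ne_zero (h0 J hJ) (h0 L hL))).1 h3
      rw [← (hmul J L hJ hL).2, hy, hspan]
      rw [← hy]; exact (hmul J L hJ hL).1
    calc f I = f I * (f J * f L) := by rw [h2, mul_one]
      _ = f J * (f I * f L) := by rw [mul_left_comm]
      _ = f J := by rw [h1, mul_one]
  have hrep (c : ClassGroup R) : ∃ J, good J ∧ idealClass J = c := by
    obtain ⟨I, hI, hIc⟩ := exists_idealClass_eq c⁻¹
    obtain ⟨J, hJ, x, hx⟩ := hex I hI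
    refine ⟨J, hJ, ?_⟩
    have h1 := idealClass_mul hI (h0 J hJ)
    rw [hx, idealClass_span, hIc] at h1
    rw [eq_comm, inv_mul_eq_one] at h1
    exact h1.symm
  choose rep hgood hcl using hrep
  obtain ⟨one, hone, x, hx⟩ := hex 1 one_ne_zero
  rw [one_mul] at hx
  refine ⟨⟨⟨fun c => f (rep c), ?_⟩, ?_⟩, fun I hI => heq (hgood _) hI (hcl _)⟩
  · rw [heq (hgood 1) hone, hx, hspan x (hx ▸ hone)]
    rw [hcl, hx, idealClass_span]
  · intro c d
    change f (rep (c * d)) = f (rep c) * f (rep d)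
    rw [← (hmul _ _ (hgood c) (hgood d)).2]
    refine heq (hgood _) (hmul _ _ (hgood c) (hgood d)).1 ?_
    rw [idealClass_mul (h0 _ (hgood c)) (h0 _ (hgood d)), hcl, hcl, hcl]

theorem mem_closure_of_forall_prime {S : Set (Ideal R)} {I : Ideal R} (hI : I ≠ ⊥)
    (h : ∀ P : Ideal R, P.IsPrime → I ≤ P → P ∈ S) : I ∈ Submonoid.closure S := by
  rw [← Ideal.prod_normalizedFactors_eq_self hI]
  refine Submonoid.multiset_prod_mem _ _ fun P hP => Submonoid.subset_closure (h P ?_ ?_)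
  · exact Ideal.isPrime_of_prime (UniqueFactorizationMonoid.prime_of_normalized_factor P hP)
  · exact Ideal.dvd_iff_le.1 (UniqueFactorizationMonoid.dvd_of_mem_normalizedFactors hP)

theorem idealClass_mem_of_mem_closure {S : Set (Ideal R)} {H : Subgroup (ClassGroup R)}
    (h : ∀ P ∈ S, P ≠ ⊥ ∧ idealClass P ∈ H) {I : Ideal R} (hI : I ∈ Submonoid.closure S) :
    I ≠ ⊥ ∧ idealClass I ∈ H := by
  induction hI using Submonoid.closure_induction with
  | mem P hP => exact h P hP
  | one => exact ⟨one_ne_zero, by rw [idealClass_one]; exact H.one_mem⟩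
  | mul I J _ _ hI hJ =>
    exact ⟨mul_ne_zero hI.1 hJ.1, by
      rw [idealClass_mul hI.1 hJ.1]; exact H.mul_mem hI.2 hJ.2⟩

/-- An invariant ideal all of whose primes are moved by the involution `τ` is a product of
ideals `P τ(P)`. -/
theorem mem_closure_of_smul_eq {G : Type*} [Group G] [MulSemiringAction G R] {τ : G}
    (hτ : τ * τ = 1) {S : Set (Ideal R)} {I : Ideal R} (hI : I ≠ ⊥)
    (hτI : τ • I = I)
    (h : ∀ P : Ideal R, P.IsPrime → I ≤ P → τ • P ≠ P ∧ P * τ • P ∈ S) :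
    I ∈ Submonoid.closure S := by
  suffices H : ∀ s : Multiset (Ideal R), (∀ P ∈ s, Prime P) → τ • s.prod = s.prod →
      (∀ P : Ideal R, P.IsPrime → s.prod ≤ P → τ • P ≠ P ∧ P * τ • P ∈ S) →
      s.prod ∈ Submonoid.closure S by
    rw [← Ideal.prod_normalizedFactors_eq_self hI] at hτI h ⊢
    exact H _ (fun P hP => UniqueFactorizationMonoid.prime_of_normalized_factor P hP) hτI h
  intro s
  induction hn : s.card using Nat.strong_induction_on generalizing s with
  | _ n ih =>
  intro hs hτs h
  rcases s.empty_or_exists_mem with rfl | ⟨P, hP⟩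
  · simp [-Ideal.one_eq_top]
  obtain ⟨t, rfl⟩ := Multiset.exists_cons_of_mem hP
  have hPp := hs P hP
  have hPP : P.IsPrime := Ideal.isPrime_of_prime hPp
  have hle : (P ::ₘ t).prod ≤ P := by
    rw [Multiset.prod_cons]; exact Ideal.mul_le_left
  obtain ⟨hne, hmem⟩ := h P hPP hle
  have hle' : (P ::ₘ t).prod ≤ τ • P := by
    rw [← hτs]; exact Ideal.pointwise_smul_le_pointwise_smul_iff.2 hle
  have hτP : (τ • P).IsPrime := by
    rw [Ideal.pointwise_smul_eq_comap]
    exact Ideal.comap_isPrime _ _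
  have hτP0 : τ • P ≠ ⊥ := by
    intro h0
    apply hPp.ne_zero
    have : τ • τ • P = ⊥ := by rw [h0]; simp
    rw [smul_smul, hτ, one_smul] at this
    exact this
  have hτPp : Prime (τ • P) := Ideal.prime_of_isPrime hτP0 hτP
  obtain ⟨Q, hQ, hdvd⟩ := hτPp.exists_mem_multiset_dvd (Ideal.dvd_iff_le.2 hle')
  have hQe : Q = τ • P := by
    have := (hτPp.dvd_prime_iff_associated (hs Q hQ)).1 hdvd
    exact (associated_iff_eq.1 this).symm
  subst hQe
  have hQt : τ • P ∈ t := by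
    rcases Multiset.mem_cons.1 hQ with h1 | h1
    · exact absurd h1 hne
    · exact h1
  obtain ⟨u, rfl⟩ := Multiset.exists_cons_of_mem hQt
  have hprod : (P ::ₘ (τ • P) ::ₘ u).prod = P * τ • P * u.prod := by
    rw [Multiset.prod_cons, Multiset.prod_cons, mul_assoc]
  have hu0 : P * τ • P ≠ 0 := mul_ne_zero hPp.ne_zero hτP0
  rw [hprod] at hτs ⊢
  refine Submonoid.mul_mem _ (Submonoid.subset_closure hmem) (ih u.card ?_ u rfl ?_ ?_ ?_)
  · rw [← hn]; simp
  · exact fun Q hQ => hs Q (Multiset.mem_cons_of_mem (Multiset.mem_cons_of_mem hQ))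
  · rw [smul_mul', smul_mul', smul_smul, hτ, one_smul, mul_comm (τ • P) P] at hτs
    exact mul_left_cancel₀ hu0 hτs
  · intro Q hQ hle
    refine h Q hQ (le_trans ?_ hle)
    rw [hprod]
    exact Ideal.mul_le_right

end ClassGroup

section NormChar
variable {k : Type*} [Field k] [NumberField k]

theorem coprime_absNorm_of_sup_eq_top {J : Ideal (𝓞 k)} (hJ : J ≠ ⊥) {N : ℕ}
    (h : J ⊔ Ideal.span {(N : 𝓞 k)} = ⊤) : (Ideal.absNorm J).Coprime N := by
  refine Nat.coprime_of_dvd fun p hp hpJ hpN => ?_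
  have := Fact.mk hp
  have hcard : p ∣ Nat.card (𝓞 k ⧸ J) := hpJ
  have := Ideal.finiteQuotientOfFreeOfNeBot J hJ
  obtain ⟨x, hx⟩ := exists_prime_addOrderOf_dvd_card' p hcard
  have hx0 : x ≠ 0 := by
    rintro rfl
    rw [addOrderOf_zero] at hx
    exact hp.one_lt.ne hx
  have hpx : (p : 𝓞 k ⧸ J) * x = 0 := by
    rw [← nsmul_eq_mul, ← hx, addOrderOf_nsmul_eq_zero]
  apply hx0
  have h1 : (1 : 𝓞 k) ∈ J ⊔ Ideal.span {(N : 𝓞 k)} := h ▸ Submodule.mem_top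
  obtain ⟨j, hj, y, hy, hjy⟩ := Submodule.mem_sup.1 h1
  obtain ⟨c, rfl⟩ := Ideal.mem_span_singleton'.1 hy
  obtain ⟨m, rfl⟩ := hpN
  have h2 : Ideal.Quotient.mk J 1 = Ideal.Quotient.mk J (c * ((p * m : ℕ) : 𝓞 k)) := by
    rw [← hjy, map_add, Ideal.Quotient.eq_zero_iff_mem.2 hj, zero_add]
  calc x = Ideal.Quotient.mk J 1 * x := by rw [map_one, one_mul]
    _ = Ideal.Quotient.mk J c * m * (p * x) := by rw [h2]; simp; ring
    _ = 0 := by rw [hpx, mul_zero]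

/-- A Dirichlet character of the norm that is trivial on principal ideals is a character of the
class group. -/
theorem exists_normChar {N : ℕ} (hN : N ≠ 0) (χ : MulChar (ZMod N) ℤ)
    (h : ∀ x : 𝓞 k, (Ideal.absNorm (Ideal.span {x})).Coprime N →
      χ (Ideal.absNorm (Ideal.span {x}) : ℕ) = 1) :
    ∃ φ : ClassGroup (𝓞 k) →* ℤ, ∀ I : Ideal (𝓞 k), I ≠ ⊥ → (Ideal.absNorm I).Coprime N →
      φ (idealClass I) = χ (Ideal.absNorm I : ℕ) := by
  obtain ⟨φ, hφ⟩ := exists_classGroup_hom (R := 𝓞 k)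
    (fun I => I ≠ ⊥ ∧ (Ideal.absNorm I).Coprime N) (fun I => χ (Ideal.absNorm I : ℕ))
    (fun I hI => hI.1) (fun I J hI hJ => ⟨⟨mul_ne_zero hI.1 hJ.1, by
      rw [map_mul]; exact Nat.Coprime.mul_left hI.2 hJ.2⟩, by simp⟩)
    (fun x hx => h x hx.2) (fun I hI => by
      have hM : Ideal.span {(N : 𝓞 k)} ≠ ⊥ := by
        rw [Ne, Ideal.span_singleton_eq_bot]; exact_mod_cast hN
      obtain ⟨J, hJ, hs, hx⟩ := exists_mul_eq_span_coprime hI hM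
      exact ⟨J, ⟨hJ, coprime_absNorm_of_sup_eq_top hJ hs⟩, hx⟩)
  exact ⟨φ, fun I hI hN => hφ I ⟨hI, hN⟩⟩

theorem Ideal.sq_eq_span_ne_bot {R : Type*} [CommRing R] [IsDomain R] {I : Ideal R} {x : R}
    (h : I ^ 2 = Ideal.span {x}) (hx : x ≠ 0) : I ≠ ⊥ := by
  rintro rfl
  rw [Ideal.bot_pow two_ne_zero, eq_comm, Ideal.span_singleton_eq_bot] at h
  exact hx h

theorem Ideal.IsPrime.eq_of_sq_eq_span {R : Type*} [CommRing R] [IsDedekindDomain R]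
    {I : Ideal R} [I.IsPrime] {x : R}
    (h : I ^ 2 = Ideal.span {x}) (hx : x ≠ 0) {P : Ideal R} (hP : P.IsPrime) (hxP : x ∈ P) :
    P = I := by
  have h1 : I ≤ P := by
    apply (hP.pow_le_iff (two_ne_zero)).1
    rw [h, Ideal.span_singleton_le_iff_mem]
    exact hxP
  have := Ideal.IsPrime.isMaximal (inferInstanceAs I.IsPrime) (Ideal.sq_eq_span_ne_bot h hx)
  exact (this.eq_of_le hP.ne_top h1).symm

theorem sq_span_pair {R : Type*} [CommRing R] {p q u v x c : R}
    (hx : x ^ 2 = p * (q + c * x)) (hpq : u * p + v * q = 1) :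
    Ideal.span {p, x} ^ 2 = Ideal.span {p} := by
  apply le_antisymm
  · rw [pow_two, Ideal.span_mul_span', Ideal.span_le]
    rintro _ ⟨y, (rfl | rfl), z, (rfl | rfl), rfl⟩ <;>
      rw [SetLike.mem_coe, Ideal.mem_span_singleton]
    · exact dvd_mul_right _ _
    · exact dvd_mul_right _ _
    · exact dvd_mul_left _ _
    · exact ⟨q + c * z, (pow_two z).symm.trans hx⟩
  · rw [Ideal.span_singleton_le_iff_mem]
    have h1 : p ∈ Ideal.span {p, x} := Ideal.subset_span (by simp)
    have h2 : x ∈ Ideal.span {p, x} := Ideal.subset_span (by simp)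
    have : p = u * (p * p) + v * (x * x) - v * c * (p * x) := by
      linear_combination -p * hpq - v * hx
    rw [pow_two]
    have h3 : u * (p * p) + v * (x * x) - v * c * (p * x) ∈ Ideal.span {p, x} * Ideal.span {p, x} :=
      sub_mem (add_mem (Ideal.mul_mem_left _ _ (Ideal.mul_mem_mul h1 h1))
      (Ideal.mul_mem_left _ _ (Ideal.mul_mem_mul h2 h2)))
      (Ideal.mul_mem_left _ _ (Ideal.mul_mem_mul h1 h2))
    rwa [← this] at h3

end NormChar

section PIDRat

instance : IsPrincipalIdealRing (𝓞 ℚ) :=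
  IsPrincipalIdealRing.of_surjective Rat.ringOfIntegersEquiv.symm
    Rat.ringOfIntegersEquiv.symm.surjective

theorem exists_intCast_eq_of_rat (x : 𝓞 ℚ) : ∃ n : ℤ, (n : 𝓞 ℚ) = x :=
  ⟨Rat.ringOfIntegersEquiv x, by
    apply Rat.ringOfIntegersEquiv.injective
    rw [map_intCast, Int.cast_id]⟩

end PIDRat

/-- `k` is the quadratic field `ℚ(√D)`. -/
structure QuadField (D : ℤ) (k : Type*) [Field k] [NumberField k] where
  rt : 𝓞 k
  sq : rt ^ 2 = (D : 𝓞 k)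
  τ : Gal(k/ℚ)
  τ_rt : τ • rt = -rt
  invol : τ * τ = 1
  fix : ∀ x : k, τ x = x → x ∈ Set.range (algebraMap ℚ k)
  D_ne : D ≠ 0

namespace QuadField
variable {D : ℤ} {k : Type*} [Field k] [NumberField k] (S : QuadField D k)
include S

theorem rt_ne : S.rt ≠ 0 := by
  intro h
  have := S.sq
  rw [h, zero_pow two_ne_zero, eq_comm, Int.cast_eq_zero] at this
  exact S.D_ne this

theorem τ_ne : S.τ ≠ 1 := by
  intro h
  have := S.τ_rt
  rw [h, one_smul, eq_comm, neg_eq_iff_add_eq_zero, ← two_mul, mul_eq_zero] at this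
  exact this.elim two_ne_zero S.rt_ne

theorem ττ (x : 𝓞 k) : S.τ • S.τ • x = x := by rw [smul_smul, S.invol, one_smul]

theorem isFixedField : IsFixedField ℚ (pairSubgroup S.τ S.invol) := fun x => by
  constructor
  · rintro ⟨q, rfl⟩ g -
    exact g.commutes q
  · intro h
    exact S.fix x (h S.τ (Or.inr rfl))

theorem exists_int {x : 𝓞 k} (hx : S.τ • x = x) : ∃ n : ℤ, (n : 𝓞 k) = x := by
  obtain ⟨y, rfl⟩ := S.isFixedField.exists_of_smul_eq_pair hx
  obtain ⟨n, rfl⟩ := exists_intCast_eq_of_rat y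
  exact ⟨n, by simp⟩

theorem smul_int (n : ℤ) : S.τ • (n : 𝓞 k) = n :=
  map_intCast (MulSemiringAction.toRingHom Gal(k/ℚ) (𝓞 k) S.τ) n

theorem smul_natCast (n : ℕ) : S.τ • (n : 𝓞 k) = n :=
  map_natCast (MulSemiringAction.toRingHom Gal(k/ℚ) (𝓞 k) S.τ) n

theorem exists_coords (hD : Squarefree D) (y : 𝓞 k) : ∃ a b N : ℤ, 2 * y = a + b * S.rt ∧
    y * S.τ • y = N ∧ y + S.τ • y = a ∧ a ^ 2 - D * b ^ 2 = 4 * N := by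
  obtain ⟨a, ha⟩ := S.exists_int (x := y + S.τ • y) (by rw [smul_add, S.ττ, add_comm])
  obtain ⟨N, hN⟩ := S.exists_int (x := y * S.τ • y) (by rw [smul_mul', S.ττ, mul_comm])
  obtain ⟨w, hw⟩ := S.exists_int (x := (y - S.τ • y) * S.rt) (by
    rw [smul_mul', smul_sub, S.ττ, S.τ_rt]; ring)
  have h1 : w ^ 2 = D * (a ^ 2 - 4 * N) := by
    have : ((w ^ 2 : ℤ) : 𝓞 k) = ((D * (a ^ 2 - 4 * N) : ℤ) : 𝓞 k) := by
      push_cast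
      rw [hw, ha, hN, ← S.sq]
      ring
    exact_mod_cast this
  have h2 : D ∣ w := by
    exact (hD.dvd_pow_iff_dvd two_ne_zero).1 ⟨_, h1⟩
  obtain ⟨b, rfl⟩ := h2
  refine ⟨a, b, N, ?_, hN.symm, ha.symm, ?_⟩
  · apply mul_right_cancel₀ S.rt_ne
    have h3 : ((D * b : ℤ) : 𝓞 k) = b * S.rt * S.rt := by
      push_cast; rw [← S.sq]; ring
    rw [h3] at hw
    rw [add_mul, hw, ha]
    ring
  · apply mul_left_cancel₀ S.D_ne
    linear_combination -h1

theorem mul_smul_eq_span (I : Ideal (𝓞 k)) :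
    I * S.τ • I = Ideal.span {(Ideal.absNorm I : 𝓞 k)} := by
  rw [← S.isFixedField.map_relNorm_pair S.τ_ne I]
  obtain ⟨x, hx⟩ := IsPrincipalIdealRing.principal (Ideal.relNorm (𝓞 ℚ) I)
  change _ = Ideal.span {x} at hx
  obtain ⟨n, rfl⟩ := exists_intCast_eq_of_rat x
  have h1 := Ideal.absNorm_relNorm (R := 𝓞 ℚ) (S := 𝓞 k) I
  have h2 : Ideal.absNorm (Ideal.span {(n : 𝓞 ℚ)}) = n.natAbs := by
    rw [Ideal.absNorm_span_singleton, ← eq_intCast (algebraMap ℤ (𝓞 ℚ)), Algebra.norm_algebraMap,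
      RingOfIntegers.rank, Module.finrank_self, pow_one]
  rw [hx] at h1 ⊢
  rw [← h1, h2, Ideal.map_span, Set.image_singleton, map_intCast]
  rcases Int.natAbs_eq n with h | h
  · nth_rewrite 1 [h]; simp
  · nth_rewrite 1 [h]; simp

theorem absNorm_span {y : 𝓞 k} {N : ℤ} (h : y * S.τ • y = N) :
    Ideal.absNorm (Ideal.span {y}) = N.natAbs := by
  have h1 := S.mul_smul_eq_span (Ideal.span {y})
  rw [smul_span_singleton, Ideal.span_singleton_mul_span_singleton, h,
    Ideal.span_singleton_eq_span_singleton, ← Int.cast_natCast,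
    ← eq_intCast (algebraMap ℤ (𝓞 k)), ← eq_intCast (algebraMap ℤ (𝓞 k))] at h1
  have h2 : ∀ a b : ℤ, algebraMap ℤ (𝓞 k) a ∣ algebraMap ℤ (𝓞 k) b → a ∣ b := by
    intro a b ⟨c, hc⟩
    rcases eq_or_ne a 0 with rfl | ha
    · rw [map_zero, zero_mul] at hc
      have : b = 0 := by simpa using hc
      rw [this]
    have hc' : S.τ • c = c := by
      have ha' : algebraMap ℤ (𝓞 k) a ≠ 0 := by simpa using ha
      apply mul_left_cancel₀ ha'
      have := congrArg (S.τ • ·) hc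
      simp only [smul_mul', eq_intCast, S.smul_int] at this
      rw [eq_intCast, ← this, ← eq_intCast (algebraMap ℤ (𝓞 k)), hc, eq_intCast]
    obtain ⟨n, rfl⟩ := S.exists_int hc'
    refine ⟨n, ?_⟩
    have : (b : 𝓞 k) = ((a * n : ℤ) : 𝓞 k) := by simpa using hc
    exact_mod_cast this
  have h3 := Int.natAbs_dvd_natAbs.2 (h2 _ _ h1.dvd)
  have h4 := Int.natAbs_dvd_natAbs.2 (h2 _ _ h1.symm.dvd)
  rw [Int.natAbs_natCast] at h3 h4
  exact Nat.dvd_antisymm h4 h3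

theorem absNorm_of_sq {I : Ideal (𝓞 k)} {p : ℕ} (h : I ^ 2 = Ideal.span {(p : 𝓞 k)}) :
    Ideal.absNorm I = p := by
  have h1 := congrArg Ideal.absNorm h
  rw [map_pow, S.absNorm_span (N := p ^ 2)] at h1
  · rw [Int.natAbs_pow, Int.natAbs_natCast] at h1
    exact Nat.pow_left_injective two_ne_zero h1
  · rw [S.smul_natCast]; push_cast; ring

theorem isPrime_of_sq {I : Ideal (𝓞 k)} {p : ℕ} (hp : p.Prime)
    (h : I ^ 2 = Ideal.span {(p : 𝓞 k)}) : I.IsPrime :=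
  Ideal.isPrime_of_irreducible_absNorm (by rw [S.absNorm_of_sq h]; exact hp)

/-- The ramified prime `(p, √D)`. -/
noncomputable def ram (p : ℕ) : Ideal (𝓞 k) := Ideal.span {(p : 𝓞 k), S.rt}

theorem rt_mem_ram (p : ℕ) : S.rt ∈ S.ram p := Ideal.subset_span (by simp)

theorem ram_sq {p : ℕ} {q : ℤ} (hD : D = p * q) (h : IsCoprime (p : ℤ) q) :
    S.ram p ^ 2 = Ideal.span {(p : 𝓞 k)} := by
  obtain ⟨u, v, huv⟩ := h
  refine sq_span_pair (q := (q : 𝓞 k)) (c := 0) (u := u) (v := v) ?_ ?_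
  · rw [S.sq, congrArg (Int.cast : ℤ → 𝓞 k) hD]; push_cast; ring
  · have := congrArg (Int.cast : ℤ → 𝓞 k) huv
    push_cast at this
    linear_combination this

/-- The ramified ideals of complementary norms multiply to `(√D)`. -/
theorem ram_mul_ram {p q : ℕ} (hD : D = p * q ∨ D = -(p * q)) (h : Nat.Coprime p q) :
    S.ram p * S.ram q = Ideal.span {S.rt} := by
  have hpq := Nat.isCoprime_iff_coprime.2 h
  obtain ⟨u, v, huv⟩ := hpq
  have h1 := congrArg (Int.cast : ℤ → 𝓞 k) huv
  push_cast at h1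
  apply le_antisymm
  · rw [ram, ram, Ideal.span_mul_span', Ideal.span_le]
    rintro _ ⟨x, (rfl | rfl), y, (rfl | rfl), rfl⟩ <;> rw [SetLike.mem_coe, Ideal.mem_span_singleton]
    · rcases hD with hD | hD
      · refine ⟨S.rt, ?_⟩
        rw [← pow_two, S.sq, congrArg (Int.cast : ℤ → 𝓞 k) hD]; push_cast; ring
      · refine ⟨-S.rt, ?_⟩
        rw [mul_neg, ← pow_two, S.sq, congrArg (Int.cast : ℤ → 𝓞 k) hD]; push_cast; ring
    · exact dvd_mul_left _ _
    · exact dvd_mul_right _ _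
    · exact dvd_mul_right _ _
  · rw [Ideal.span_singleton_le_iff_mem]
    have : S.rt = u * (p * S.rt) + v * (S.rt * q) := by linear_combination -S.rt * h1
    rw [this]
    exact add_mem (Ideal.mul_mem_left _ _ (Ideal.mul_mem_mul (Ideal.subset_span (by simp))
      (S.rt_mem_ram q))) (Ideal.mul_mem_left _ _ (Ideal.mul_mem_mul (S.rt_mem_ram p)
      (Ideal.subset_span (by simp))))

end QuadField

theorem Ideal.sq_inj {R : Type*} [CommRing R] [IsDedekindDomain R] {I J : Ideal R}
    (h : I ^ 2 = J ^ 2) : I = J := by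
  apply dvd_antisymm'
  · exact (UniqueFactorizationMonoid.pow_dvd_pow_iff_dvd two_ne_zero).1 h.symm.dvd
  · exact (UniqueFactorizationMonoid.pow_dvd_pow_iff_dvd two_ne_zero).1 h.dvd

namespace QuadField
variable {D : ℤ} {k : Type*} [Field k] [NumberField k] (S : QuadField D k)
include S

theorem exists_closure_of_smul_eq (ω : 𝓞 k) {R : Set (Ideal (𝓞 k))}
    (hR : ∀ P : Ideal (𝓞 k), P.IsPrime → ω - S.τ • ω ∈ P → P ∈ R) {I : Ideal (𝓞 k)} (hI : I ≠ ⊥)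
    (hτ : S.τ • I = I) :
    ∃ J ∈ Submonoid.closure R, ∃ n : ℤ, n ≠ 0 ∧ I * J = Ideal.span {(n : 𝓞 k)} := by
  obtain ⟨f, hf, J, hJ, hδ, -⟩ := S.isFixedField.exists_mul_eq_span ω hI hτ
  obtain ⟨n, rfl⟩ := exists_intCast_eq_of_rat f
  have hn : n ≠ 0 := by rintro rfl; simp at hf
  refine ⟨J, mem_closure_of_forall_prime ?_ fun P hP hJP => hR P hP (hJP hδ), n, hn, by simpa using hJ⟩
  rintro rfl
  rw [Ideal.mul_bot, eq_comm, Ideal.span_singleton_eq_bot] at hJ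
  simp [hn] at hJ

theorem exists_closure_of_sq (ω : 𝓞 k) {R : Set (Ideal (𝓞 k))}
    (hR : ∀ P : Ideal (𝓞 k), P.IsPrime → ω - S.τ • ω ∈ P → P ∈ R) {I : Ideal (𝓞 k)} (hI : I ≠ ⊥)
    {z : 𝓞 k} (hz : I ^ 2 = Ideal.span {z}) (hN : (Ideal.absNorm I : 𝓞 k) ^ 2 = z * S.τ • z) :
    ∃ J ∈ Submonoid.closure R, idealClass I * idealClass J = 1 := by
  obtain ⟨c, hc, -, h⟩ := exists_smul_mul_eq S.invol hI hz (S.mul_smul_eq_span I) (S.smul_natCast _) hN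
  have hc' : Ideal.span {c} ≠ ⊥ := by rwa [Ne, Ideal.span_singleton_eq_bot]
  obtain ⟨J, hJ, n, hn, hIJ⟩ := S.exists_closure_of_smul_eq ω hR (mul_ne_zero hc' hI) h
  have hJ0 : J ≠ ⊥ := by
    rintro rfl
    rw [Ideal.mul_bot, eq_comm, Ideal.span_singleton_eq_bot] at hIJ
    simp [hn] at hIJ
  refine ⟨J, hJ, ?_⟩
  have := idealClass_span (n : 𝓞 k)
  rwa [← hIJ, idealClass_mul (mul_ne_zero hc' hI) hJ0, idealClass_mul hc' hI, idealClass_span,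
    one_mul] at this

theorem exists_closure_of_unit (ω : 𝓞 k) {R : Set (Ideal (𝓞 k))}
    (hR : ∀ P : Ideal (𝓞 k), P.IsPrime → ω - S.τ • ω ∈ P → P ∈ R) {η : 𝓞 k} (hη : η * S.τ • η = 1)
    (h1 : η ≠ -1) :
    ∃ J ∈ Submonoid.closure R, ∃ n : ℤ, n ≠ 0 ∧
      Ideal.span {1 + η} * J = Ideal.span {(n : 𝓞 k)} := by
  apply S.exists_closure_of_smul_eq ω hR
  · rw [Ne, Ideal.span_singleton_eq_bot]
    intro h
    exact h1 (eq_neg_of_add_eq_zero_right h)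
  · rw [smul_span_singleton, smul_add, smul_one, Ideal.span_singleton_eq_span_singleton]
    exact ⟨⟨η, S.τ • η, hη, by rw [mul_comm, hη]⟩, by simp only [add_mul, one_mul]; rw [mul_comm, hη, add_comm]⟩

theorem mul_smul_of_isUnit {v : 𝓞 k} (hv : IsUnit v) : v * S.τ • v = 1 ∨ v * S.τ • v = -1 := by
  obtain ⟨n, hn⟩ := S.exists_int (x := v * S.τ • v) (by rw [smul_mul', S.ττ, mul_comm])
  have h1 := S.absNorm_span hn.symm
  rw [Ideal.span_singleton_eq_top.2 hv, Ideal.absNorm_top] at h1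
  rcases Int.natAbs_eq n with h | h
  · left; rw [← hn, h, ← h1]; simp
  · right; rw [← hn, h, ← h1]; simp

theorem exists_sq_of_nice {η : 𝓞 k} (hη : η * S.τ • η = 1) {J : Ideal (𝓞 k)} {n m : ℤ} (hn : n ≠ 0)
    (hm : m ≠ 0) (hJ : Ideal.span {1 + η} * J = Ideal.span {(n : 𝓞 k)}) {x : 𝓞 k}
    (hx : J * Ideal.span {(m : 𝓞 k)} = Ideal.span {x}) (hτx : S.τ • x = x ∨ S.τ • x = -x) :
    ∃ v, IsUnit v ∧ (η = v ^ 2 ∨ η = -v ^ 2) := by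
  have h1 : Ideal.span {(1 + η) * x} = Ideal.span {((n * m : ℤ) : 𝓞 k)} := by
    rw [← Ideal.span_singleton_mul_span_singleton, ← hx, ← mul_assoc, hJ,
      Ideal.span_singleton_mul_span_singleton, Int.cast_mul]
  rw [Ideal.span_singleton_eq_span_singleton] at h1
  obtain ⟨v, hv⟩ := h1.symm
  have hnm : ((n * m : ℤ) : 𝓞 k) ≠ 0 := by exact_mod_cast mul_ne_zero hn hm
  have h2 := congrArg (S.τ • ·) hv
  simp only [smul_mul', S.smul_int, smul_add, smul_one] at h2
  have h3 : (v : 𝓞 k) = η * S.τ • (v : 𝓞 k) ∨ (v : 𝓞 k) = -(η * S.τ • (v : 𝓞 k)) := by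
    rcases hτx with h | h
    · left
      apply mul_left_cancel₀ hnm
      rw [h] at h2
      linear_combination hv - η * h2 - x * hη
    · right
      apply mul_left_cancel₀ hnm
      rw [h] at h2
      linear_combination hv + η * h2 - x * hη
  refine ⟨v, v.isUnit, ?_⟩
  rcases S.mul_smul_of_isUnit v.isUnit with h4 | h4 <;> rcases h3 with h3 | h3
  · left; linear_combination -(v : 𝓞 k) * h3 - η * h4
  · right; linear_combination (v : 𝓞 k) * h3 - η * h4
  · right; linear_combination (v : 𝓞 k) * h3 + η * h4
  · left; linear_combination -(v : 𝓞 k) * h3 + η * h4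

end QuadField

theorem sq_eq_one_of_monoidHom {G : Type*} [Group G] (φ : G →* ℤ) (g : G) : φ g ^ 2 = 1 := by
  have h : IsUnit (φ g) := (Group.isUnit g).map φ
  rcases Int.isUnit_iff.1 h with h | h <;> rw [h] <;> norm_num

theorem eq_or_of_monoidHom {G : Type*} [Group G] (φ : G →* ℤ) (g : G) : φ g = 1 ∨ φ g = -1 :=
  Int.isUnit_iff.1 ((Group.isUnit g).map φ)

theorem quadraticChar_natAbs {p : ℕ} [Fact p.Prime] (hp : p % 4 = 1) {D a b N : ℤ}
    (hpD : (p : ℤ) ∣ D) (h : a ^ 2 - D * b ^ 2 = 4 * N) (hN : N.natAbs.Coprime p) :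
    quadraticChar (ZMod p) (N.natAbs : ℕ) = 1 := by
  have hp' : p.Prime := Fact.out
  have hN0 : ((N.natAbs : ℕ) : ZMod p) ≠ 0 := by
    rw [Ne, ZMod.natCast_eq_zero_iff]
    exact (hp'.coprime_iff_not_dvd).1 hN.symm
  rw [quadraticChar_one_iff_isSquare hN0]
  have h2 : (2 : ZMod p) ≠ 0 := by
    intro h
    have : ((2 : ℕ) : ZMod p) = 0 := by exact_mod_cast h
    rw [ZMod.natCast_eq_zero_iff] at this
    have := (Nat.prime_dvd_prime_iff_eq hp' Nat.prime_two).1 this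
    omega
  have h3 : (a : ZMod p) ^ 2 = 4 * N := by
    have hD0 : (D : ZMod p) = 0 := (ZMod.intCast_zmod_eq_zero_iff_dvd _ _).2 hpD
    have := congrArg (Int.cast : ℤ → ZMod p) h
    push_cast at this
    rw [hD0] at this
    linear_combination this
  have h4 : IsSquare (N : ZMod p) := ⟨a / 2, by field_simp; linear_combination -h3⟩
  rcases Int.natAbs_eq N with h | h
  · rw [h] at h4; simpa using h4
  · obtain ⟨i, hi⟩ := ZMod.exists_sq_eq_neg_one_iff.2 (show p % 4 ≠ 3 by omega)
    obtain ⟨r, hr⟩ := h4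
    rw [h] at hr
    refine ⟨i * r, ?_⟩
    generalize N.natAbs = t at hr ⊢
    push_cast at hr ⊢
    linear_combination (-1 : ZMod p) * hr + r * r * hi

namespace QuadField
variable {D : ℤ} {k : Type*} [Field k] [NumberField k] (S : QuadField D k)
include S

theorem exists_primeChar (hD : Squarefree D) {p : ℕ} [Fact p.Prime] (hp : p % 4 = 1)
    (hpD : (p : ℤ) ∣ D) :
    ∃ φ : ClassGroup (𝓞 k) →* ℤ, ∀ I : Ideal (𝓞 k), I ≠ ⊥ → (Ideal.absNorm I).Coprime p →
      φ (idealClass I) = quadraticChar (ZMod p) (Ideal.absNorm I : ℕ) := by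
  refine exists_normChar (Fact.out : p.Prime).ne_zero _ fun x hx => ?_
  obtain ⟨a, b, N, -, hN, -, h⟩ := S.exists_coords hD x
  rw [S.absNorm_span hN] at hx ⊢
  exact quadraticChar_natAbs hp hpD h hx

theorem exists_sign {I : Ideal (𝓞 k)} {z : 𝓞 k} (hz : I ^ 2 = Ideal.span {z}) :
    (Ideal.absNorm I : 𝓞 k) ^ 2 = z * S.τ • z ∨ (Ideal.absNorm I : 𝓞 k) ^ 2 = -(z * S.τ • z) := by
  obtain ⟨n, hn⟩ := S.exists_int (x := z * S.τ • z) (by rw [smul_mul', S.ττ, mul_comm])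
  have h1 := S.absNorm_span hn.symm
  rw [← hz, map_pow] at h1
  rw [← hn, ← Nat.cast_pow, h1]
  rcases Int.natAbs_eq n with h | h
  · left; nth_rewrite 2 [h]; simp
  · right; nth_rewrite 2 [h]; simp

theorem mul_smul_ne_neg (hD : Squarefree D) (hD0 : D < 0) (z : 𝓞 k) {n : ℕ} (hn : n ≠ 0) :
    (n : 𝓞 k) ≠ -(z * S.τ • z) := by
  obtain ⟨a, b, N, -, hN, -, h⟩ := S.exists_coords hD z
  rw [hN]
  intro h1
  have h2 : (n : ℤ) = -N := by exact_mod_cast h1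
  have h3 : 0 ≤ a ^ 2 - D * b ^ 2 := by nlinarith [sq_nonneg a, sq_nonneg b]
  omega

/-- Classes of order two, when norms are positive or there is a unit of norm `-1`. -/
theorem exists_closure_of_class (hD : Squarefree D)
    (hs : D < 0 ∨ ∃ η : 𝓞 k, IsUnit η ∧ η * S.τ • η = -1) (ω : 𝓞 k) {R : Set (Ideal (𝓞 k))}
    (hR : ∀ P : Ideal (𝓞 k), P.IsPrime → ω - S.τ • ω ∈ P → P ∈ R) {c : ClassGroup (𝓞 k)}
    (hc : c ^ 2 = 1) : ∃ J ∈ Submonoid.closure R, c * idealClass J = 1 := by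
  obtain ⟨I, hI, rfl⟩ := exists_idealClass_eq c
  rw [← idealClass_pow hI, idealClass_eq_one_iff (pow_ne_zero _ hI)] at hc
  obtain ⟨z, hz⟩ := hc
  rcases S.exists_sign hz with h | h
  · exact S.exists_closure_of_sq ω hR hI hz h
  · rcases hs with hs | ⟨η, hη, hN⟩
    · exfalso
      refine S.mul_smul_ne_neg hD hs z (n := (Ideal.absNorm I) ^ 2)
        (pow_ne_zero _ (by rwa [Ne, Ideal.absNorm_eq_zero_iff])) (by push_cast; exact h)
    · refine S.exists_closure_of_sq ω hR (z := z * η) hI ?_ ?_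
      · rw [hz, Ideal.span_singleton_eq_span_singleton]
        exact ⟨hη.unit, rfl⟩
      · rw [h, smul_mul']
        linear_combination (-z * S.τ • z) * hN

/-- Generators of ideals that are visibly invariant. -/
def Nice (I : Ideal (𝓞 k)) : Prop := ∃ x, I = Ideal.span {x} ∧ (S.τ • x = x ∨ S.τ • x = -x)

theorem nice_mul {I J : Ideal (𝓞 k)} (hI : S.Nice I) (hJ : S.Nice J) : S.Nice (I * J) := by
  obtain ⟨x, rfl, hx⟩ := hI
  obtain ⟨y, rfl, hy⟩ := hJ
  refine ⟨x * y, Ideal.span_singleton_mul_span_singleton _ _, ?_⟩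
  rw [smul_mul']
  rcases hx with hx | hx <;> rcases hy with hy | hy <;> rw [hx, hy] <;> simp

theorem nice_natCast (n : ℕ) : S.Nice (Ideal.span {(n : 𝓞 k)}) := ⟨n, rfl, Or.inl (S.smul_natCast n)⟩

theorem nice_rt : S.Nice (Ideal.span {S.rt}) := ⟨_, rfl, Or.inr S.τ_rt⟩

theorem nice_one : S.Nice 1 := ⟨1, by simp, Or.inl (smul_one _)⟩

end QuadField

theorem quadraticChar_two_eq {p : ℕ} [Fact p.Prime] (h : p % 8 = 5) :
    quadraticChar (ZMod p) ((2 : ℕ) : ZMod p) = -1 := by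
  rw [quadraticChar_neg_one_iff_not_isSquare, Nat.cast_ofNat,
    ZMod.exists_sq_eq_two_iff (by rintro rfl; omega)]
  omega

theorem quadraticChar_reciprocity {p q : ℕ} [Fact p.Prime] [Fact q.Prime] (hp : p % 8 = 5)
    (hq : q % 8 = 5) : quadraticChar (ZMod p) (q : ZMod p) = quadraticChar (ZMod q) (p : ZMod q) := by
  have := legendreSym.quadratic_reciprocity_one_mod_four (p := p) (q := q) (by omega) (by omega)
  rw [legendreSym, legendreSym] at this
  exact_mod_cast this.symm

namespace QuadField
variable {D : ℤ} {k : Type*} [Field k] [NumberField k] (S : QuadField D k)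
include S

theorem eq_ram_of_mem {p : ℕ} (hp : p.Prime) {q : ℤ} (hD : D = p * q) (h : IsCoprime (p : ℤ) q)
    {P : Ideal (𝓞 k)} (hP : P.IsPrime) (hpP : (p : 𝓞 k) ∈ P) : P = S.ram p := by
  have h1 := S.ram_sq hD h
  have := S.isPrime_of_sq hp h1
  exact Ideal.IsPrime.eq_of_sq_eq_span h1 (by exact_mod_cast hp.ne_zero) hP hpP

theorem ram_ne_bot {p : ℕ} (hp : p ≠ 0) : S.ram p ≠ ⊥ := by
  intro h
  have : (p : 𝓞 k) ∈ S.ram p := Ideal.subset_span (by simp)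
  rw [h, Ideal.mem_bot] at this
  exact hp (by exact_mod_cast this)

theorem absNorm_ram {p : ℕ} {q : ℤ} (hD : D = p * q) (h : IsCoprime (p : ℤ) q) :
    Ideal.absNorm (S.ram p) = p := S.absNorm_of_sq (S.ram_sq hD h)

section EvenDisc
variable {p₁ p₂ : ℕ} [hp₁ : Fact p₁.Prime] [hp₂ : Fact p₂.Prime] (hne : p₁ ≠ p₂) (hm₁ : p₁ % 8 = 5)
  (hm₂ : p₂ % 8 = 5) (hD : D = 2 * p₁ * p₂ ∨ D = -(2 * p₁ * p₂))

include hne hm₁ hm₂ hD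

theorem even_decomp : (∃ q : ℤ, D = (2 : ℕ) * q ∧ IsCoprime ((2 : ℕ) : ℤ) q) ∧
    (∃ q : ℤ, D = p₁ * q ∧ IsCoprime (p₁ : ℤ) q) ∧ (∃ q : ℤ, D = p₂ * q ∧ IsCoprime (p₂ : ℤ) q) := by
  have c1 : IsCoprime ((2 : ℕ) : ℤ) p₁ := Nat.isCoprime_iff_coprime.2
    ((Nat.coprime_primes Nat.prime_two hp₁.out).2 (by omega))
  have c2 : IsCoprime ((2 : ℕ) : ℤ) p₂ := Nat.isCoprime_iff_coprime.2
    ((Nat.coprime_primes Nat.prime_two hp₂.out).2 (by omega))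
  have c3 : IsCoprime (p₁ : ℤ) p₂ := Nat.isCoprime_iff_coprime.2
    ((Nat.coprime_primes hp₁.out hp₂.out).2 hne)
  rcases hD with hD | hD
  · exact ⟨⟨p₁ * p₂, by rw [hD]; push_cast; ring, c1.mul_right c2⟩,
      ⟨(2 : ℕ) * p₂, by rw [hD]; push_cast; ring, c1.symm.mul_right c3⟩,
      ⟨(2 : ℕ) * p₁, by rw [hD]; push_cast; ring, c2.symm.mul_right c3.symm⟩⟩
  · exact ⟨⟨-(p₁ * p₂), by rw [hD]; push_cast; ring, (c1.mul_right c2).neg_right⟩,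
      ⟨-((2 : ℕ) * p₂), by rw [hD]; push_cast; ring, (c1.symm.mul_right c3).neg_right⟩,
      ⟨-((2 : ℕ) * p₁), by rw [hD]; push_cast; ring, (c2.symm.mul_right c3.symm).neg_right⟩⟩

theorem even_squarefree : Squarefree D := by
  have h : Squarefree (2 * p₁ * p₂) := by
    rw [Nat.squarefree_mul, Nat.squarefree_mul]
    · exact ⟨⟨Nat.prime_two.squarefree, hp₁.out.squarefree⟩, hp₂.out.squarefree⟩
    · exact (Nat.coprime_primes Nat.prime_two hp₁.out).2 (by omega)
    · exact Nat.Coprime.mul_left ((Nat.coprime_primes Nat.prime_two hp₂.out).2 (by omega))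
        ((Nat.coprime_primes hp₁.out hp₂.out).2 hne)
  rw [← Int.squarefree_natAbs]
  rcases hD with hD | hD
  · rw [hD]; convert h using 1; simp [Int.natAbs_mul]
  · rw [hD]; convert h using 1; simp [Int.natAbs_mul]

theorem even_ramified (P : Ideal (𝓞 k)) (hP : P.IsPrime) (h : S.rt - S.τ • S.rt ∈ P) :
    P ∈ ({S.ram 2, S.ram p₁, S.ram p₂} : Set (Ideal (𝓞 k))) := by
  obtain ⟨⟨a, ha, ha'⟩, ⟨b, hb, hb'⟩, ⟨c, hc, hc'⟩⟩ := S.even_decomp hne hm₁ hm₂ hD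
  have h2 : ((2 : ℕ) : 𝓞 k) * S.rt ∈ P := by
    rw [S.τ_rt] at h; convert h using 1; push_cast; ring
  have h3 : ((2 : ℕ) : 𝓞 k) ∈ P ∨ (p₁ : 𝓞 k) ∈ P ∨ (p₂ : 𝓞 k) ∈ P := by
    rcases hP.mem_or_mem h2 with h2 | h2
    · exact Or.inl h2
    · have h4 : (((2 * p₁ * p₂ : ℕ)) : 𝓞 k) ∈ P := by
        have h5 := P.mul_mem_left S.rt h2
        rw [← pow_two, S.sq] at h5
        rcases hD with hD | hD
        · rw [congrArg (Int.cast : ℤ → 𝓞 k) hD] at h5; exact_mod_cast h5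
        · rw [congrArg (Int.cast : ℤ → 𝓞 k) hD] at h5
          push_cast at h5 ⊢
          exact neg_mem_iff.1 h5
      push_cast at h4
      rcases hP.mem_or_mem h4 with h4 | h4
      · rcases hP.mem_or_mem h4 with h4 | h4
        · exact Or.inl (by exact_mod_cast h4)
        · exact Or.inr (Or.inl h4)
      · exact Or.inr (Or.inr h4)
  rcases h3 with h3 | h3 | h3
  · exact Or.inl (S.eq_ram_of_mem Nat.prime_two ha ha' hP h3)
  · exact Or.inr (Or.inl (S.eq_ram_of_mem hp₁.out hb hb' hP h3))
  · exact Or.inr (Or.inr (S.eq_ram_of_mem hp₂.out hc hc' hP h3))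

theorem even_ram_mul : S.ram p₂ * (S.ram 2 * S.ram p₁) = Ideal.span {S.rt} := by
  obtain ⟨⟨a, ha, ha'⟩, ⟨b, hb, hb'⟩, ⟨c, hc, hc'⟩⟩ := S.even_decomp hne hm₁ hm₂ hD
  apply Ideal.sq_inj
  rw [mul_pow, mul_pow, S.ram_sq ha ha', S.ram_sq hb hb', S.ram_sq hc hc',
    Ideal.span_singleton_mul_span_singleton, Ideal.span_singleton_mul_span_singleton,
    Ideal.span_singleton_pow, S.sq]
  rcases hD with hD | hD
  · congr 2; rw [congrArg (Int.cast : ℤ → 𝓞 k) hD]; push_cast; ring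
  · rw [← Ideal.span_singleton_neg]
    congr 2; rw [congrArg (Int.cast : ℤ → 𝓞 k) hD]; push_cast; ring

theorem even_closure {J : Ideal (𝓞 k)}
    (hJ : J ∈ Submonoid.closure ({S.ram 2, S.ram p₁, S.ram p₂} : Set (Ideal (𝓞 k)))) :
    J ≠ ⊥ ∧ ∃ e f : ℕ, S.Nice (J * (S.ram 2 ^ e * S.ram p₁ ^ f)) := by
  obtain ⟨⟨a, ha, ha'⟩, ⟨b, hb, hb'⟩, ⟨c, hc, hc'⟩⟩ := S.even_decomp hne hm₁ hm₂ hD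
  induction hJ using Submonoid.closure_induction with
  | mem P hP =>
    rcases hP with rfl | rfl | rfl
    · refine ⟨S.ram_ne_bot two_ne_zero, 1, 0, ?_⟩
      rw [pow_one, pow_zero, mul_one, ← pow_two, S.ram_sq ha ha']
      exact S.nice_natCast _
    · refine ⟨S.ram_ne_bot hp₁.out.ne_zero, 0, 1, ?_⟩
      rw [pow_one, pow_zero, one_mul, ← pow_two, S.ram_sq hb hb']
      exact S.nice_natCast _
    · refine ⟨S.ram_ne_bot hp₂.out.ne_zero, 1, 1, ?_⟩
      rw [pow_one, pow_one, S.even_ram_mul hne hm₁ hm₂ hD]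
      exact S.nice_rt
  | one => exact ⟨one_ne_zero, 0, 0, by simpa [-Ideal.one_eq_top] using S.nice_one⟩
  | mul I J _ _ hI hJ =>
    obtain ⟨hI0, e, f, h⟩ := hI
    obtain ⟨hJ0, e', f', h'⟩ := hJ
    refine ⟨mul_ne_zero hI0 hJ0, e + e', f + f', ?_⟩
    convert S.nice_mul h h' using 1
    ring

theorem even_chars : ∃ χ₁ χ₂ : ClassGroup (𝓞 k) →* ℤ, χ₁ (idealClass (S.ram 2)) = -1 ∧
    χ₂ (idealClass (S.ram 2)) = -1 ∧
    χ₁ (idealClass (S.ram p₁)) * χ₂ (idealClass (S.ram p₁)) = -1 := by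
  obtain ⟨⟨a, ha, ha'⟩, ⟨b, hb, hb'⟩, ⟨c, hc, hc'⟩⟩ := S.even_decomp hne hm₁ hm₂ hD
  have hsf := S.even_squarefree hne hm₁ hm₂ hD
  obtain ⟨χ₁, h1⟩ := S.exists_primeChar (p := p₁) hsf (by omega) (hb ▸ dvd_mul_right _ _)
  obtain ⟨χ₂, h2⟩ := S.exists_primeChar (p := p₂) hsf (by omega) (hc ▸ dvd_mul_right _ _)
  have n2 := S.ram_ne_bot (two_ne_zero)
  have n3 := S.ram_ne_bot hp₁.out.ne_zero
  have n4 := S.ram_ne_bot hp₂.out.ne_zero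
  have e1 : χ₁ (idealClass (S.ram 2)) = -1 := by
    rw [h1 _ n2, S.absNorm_ram ha ha', quadraticChar_two_eq hm₁]
    rw [S.absNorm_ram ha ha']
    exact (Nat.coprime_primes Nat.prime_two hp₁.out).2 (by omega)
  have e2 : χ₂ (idealClass (S.ram 2)) = -1 := by
    rw [h2 _ n2, S.absNorm_ram ha ha', quadraticChar_two_eq hm₂]
    rw [S.absNorm_ram ha ha']
    exact (Nat.coprime_primes Nat.prime_two hp₂.out).2 (by omega)
  refine ⟨χ₁, χ₂, e1, e2, ?_⟩
  have e3 : χ₁ (idealClass (S.ram p₂)) = χ₂ (idealClass (S.ram p₁)) := by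
    rw [h1 _ n4, h2 _ n3, S.absNorm_ram hb hb', S.absNorm_ram hc hc',
      quadraticChar_reciprocity hm₁ hm₂]
    · rw [S.absNorm_ram hb hb']; exact (Nat.coprime_primes hp₁.out hp₂.out).2 hne
    · rw [S.absNorm_ram hc hc']; exact (Nat.coprime_primes hp₂.out hp₁.out).2 hne.symm
  have e4 := idealClass_span S.rt
  rw [← S.even_ram_mul hne hm₁ hm₂ hD, idealClass_mul n4 (mul_ne_zero n2 n3),
    idealClass_mul n2 n3] at e4
  have e5 := congrArg χ₁ e4
  rw [map_mul, map_mul, map_one, e1, e3] at e5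
  linear_combination -e5

theorem even_parity {χ₁ χ₂ : ClassGroup (𝓞 k) →* ℤ} (h1 : χ₁ (idealClass (S.ram 2)) = -1)
    (h2 : χ₂ (idealClass (S.ram 2)) = -1)
    (h3 : χ₁ (idealClass (S.ram p₁)) * χ₂ (idealClass (S.ram p₁)) = -1) {e f : ℕ}
    {c : ClassGroup (𝓞 k)}
    (h : c ^ 2 * (idealClass (S.ram 2) ^ e * idealClass (S.ram p₁) ^ f) = 1) : Even e ∧ Even f := by
  have k1 := congrArg χ₁ h
  have k2 := congrArg χ₂ h
  simp only [map_mul, map_pow, h1, h2, map_one, sq_eq_one_of_monoidHom, one_mul] at k1 k2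
  have k3 : (χ₁ (idealClass (S.ram p₁)) * χ₂ (idealClass (S.ram p₁))) ^ f = 1 := by
    have : ((-1 : ℤ) ^ e) * (-1) ^ e = 1 := by rw [← mul_pow]; simp
    rw [mul_pow]
    have k4 : ((-1 : ℤ) ^ e * χ₁ (idealClass (S.ram p₁)) ^ f) *
        ((-1 : ℤ) ^ e * χ₂ (idealClass (S.ram p₁)) ^ f) = 1 := by rw [k1, k2, one_mul]
    linear_combination k4 -
      (χ₁ (idealClass (S.ram p₁)) ^ f * χ₂ (idealClass (S.ram p₁)) ^ f) * this
  rw [h3] at k3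
  have hf : Even f := (neg_one_pow_eq_one_iff_even (by norm_num)).1 k3
  refine ⟨?_, hf⟩
  obtain ⟨t, rfl⟩ := hf
  rw [← two_mul, pow_mul, sq_eq_one_of_monoidHom, one_pow, mul_one] at k1
  exact (neg_one_pow_eq_one_iff_even (by norm_num)).1 k1

theorem even_sq_eq_one : idealClass (S.ram 2) ^ 2 = 1 ∧ idealClass (S.ram p₁) ^ 2 = 1 := by
  obtain ⟨⟨a, ha, ha'⟩, ⟨b, hb, hb'⟩, -⟩ := S.even_decomp hne hm₁ hm₂ hD
  rw [← idealClass_pow (S.ram_ne_bot two_ne_zero), ← idealClass_pow (S.ram_ne_bot hp₁.out.ne_zero),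
    S.ram_sq ha ha', S.ram_sq hb hb']
  exact ⟨idealClass_span _, idealClass_span _⟩

/-- A unit that is not a square up to sign has norm `-1`. -/
theorem even_norm_eq {η : 𝓞 k} (hη : IsUnit η) (hns : ∀ v, IsUnit v → η ≠ v ^ 2 ∧ η ≠ -v ^ 2) :
    η * S.τ • η = -1 := by
  refine (S.mul_smul_of_isUnit hη).resolve_left fun h => ?_
  have hη1 : η ≠ -1 := fun h => (hns 1 isUnit_one).2 (by rw [h, one_pow])
  obtain ⟨J, hJ, n, hn, hJn⟩ := S.exists_closure_of_unit S.rt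
    (S.even_ramified hne hm₁ hm₂ hD) h hη1
  obtain ⟨hJ0, e, f, x, hx, hτx⟩ := S.even_closure hne hm₁ hm₂ hD hJ
  obtain ⟨χ₁, χ₂, h1, h2, h3⟩ := S.even_chars hne hm₁ hm₂ hD
  obtain ⟨⟨a, ha, ha'⟩, ⟨b, hb, hb'⟩, -⟩ := S.even_decomp hne hm₁ hm₂ hD
  have hη0 : Ideal.span {1 + η} ≠ ⊥ := by
    rw [Ne, Ideal.span_singleton_eq_bot]
    exact fun h => hη1 (eq_neg_of_add_eq_zero_right h)
  have n2 := S.ram_ne_bot (two_ne_zero)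
  have n3 := S.ram_ne_bot hp₁.out.ne_zero
  have hJ1 : idealClass J = 1 := by
    have := idealClass_span (n : 𝓞 k)
    rwa [← hJn, idealClass_mul hη0 hJ0, idealClass_span, one_mul] at this
  have hx1 := idealClass_span x
  rw [← hx, idealClass_mul hJ0 (mul_ne_zero (pow_ne_zero _ n2) (pow_ne_zero _ n3)),
    idealClass_mul (pow_ne_zero _ n2) (pow_ne_zero _ n3), idealClass_pow n2, idealClass_pow n3,
    hJ1] at hx1
  obtain ⟨⟨e, rfl⟩, ⟨f, rfl⟩⟩ := S.even_parity hne hm₁ hm₂ hD h1 h2 h3 (c := 1)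
    (by rwa [one_pow])
  rw [← two_mul, ← two_mul, pow_mul, pow_mul, S.ram_sq ha ha', S.ram_sq hb hb',
    Ideal.span_singleton_pow, Ideal.span_singleton_pow, Ideal.span_singleton_mul_span_singleton]
    at hx
  obtain ⟨v, hv, h⟩ := S.exists_sq_of_nice h hn (m := 2 ^ e * p₁ ^ f)
    (mul_ne_zero (pow_ne_zero _ two_ne_zero) (pow_ne_zero _ (by exact_mod_cast hp₁.out.ne_zero)))
    hJn (by push_cast at hx ⊢; exact hx) hτx
  exact h.elim (hns v hv).1 (hns v hv).2

/-- All classes of two-power order are represented by ramified ideals. -/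
theorem even_class (hs : D < 0 ∨ ∃ η : 𝓞 k, IsUnit η ∧ η * S.τ • η = -1)
    {c : ClassGroup (𝓞 k)} {t : ℕ} (hc : c ^ 2 ^ t = 1) :
    ∃ e f : ℕ, c * (idealClass (S.ram 2) ^ e * idealClass (S.ram p₁) ^ f) = 1 := by
  have base {c : ClassGroup (𝓞 k)} (hc : c ^ 2 = 1) :
      ∃ e f : ℕ, c * (idealClass (S.ram 2) ^ e * idealClass (S.ram p₁) ^ f) = 1 := by
    obtain ⟨J, hJ, h⟩ := S.exists_closure_of_class (S.even_squarefree hne hm₁ hm₂ hD) hs S.rt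
      (S.even_ramified hne hm₁ hm₂ hD) hc
    obtain ⟨hJ0, e, f, x, hx, hτx⟩ := S.even_closure hne hm₁ hm₂ hD hJ
    have n2 := S.ram_ne_bot (two_ne_zero)
    have n3 := S.ram_ne_bot hp₁.out.ne_zero
    have hx1 := idealClass_span x
    rw [← hx, idealClass_mul hJ0 (mul_ne_zero (pow_ne_zero _ n2) (pow_ne_zero _ n3)),
      idealClass_mul (pow_ne_zero _ n2) (pow_ne_zero _ n3), idealClass_pow n2,
      idealClass_pow n3] at hx1
    refine ⟨e, f, ?_⟩
    have hcJ : c = idealClass J := by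
      rw [eq_inv_of_mul_eq_one_right h, eq_comm]
      exact inv_eq_of_mul_eq_one_left (by rw [← pow_two, hc])
    rwa [hcJ]
  obtain ⟨χ₁, χ₂, h1, h2, h3⟩ := S.even_chars hne hm₁ hm₂ hD
  obtain ⟨q2, q1⟩ := S.even_sq_eq_one hne hm₁ hm₂ hD
  have step : ∀ t, ∀ c : ClassGroup (𝓞 k), c ^ 2 ^ t = 1 → c ^ 2 = 1 := by
    intro t
    induction t with
    | zero => intro c hc; rw [pow_zero, pow_one] at hc; rw [hc, one_pow]
    | succ t ih =>
      intro c hc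
      rw [pow_succ', pow_mul] at hc
      obtain ⟨e, f, h⟩ := base (ih _ hc)
      obtain ⟨⟨e, rfl⟩, ⟨f, rfl⟩⟩ := S.even_parity hne hm₁ hm₂ hD h1 h2 h3 h
      rwa [← two_mul, ← two_mul, pow_mul, pow_mul, q2, q1, one_pow, one_pow, one_mul,
        mul_one] at h
  exact base (step t c hc)

end EvenDisc
end QuadField

theorem span_pair_mul_span_pair {R : Type*} [CommRing R] {p x y t a b c : R} (hxy : x * y = p * t)
    (h : p = a * (p * p) + b * (p * y) + c * (x * p)) :
    Ideal.span {p, x} * Ideal.span {p, y} = Ideal.span {p} := by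
  apply le_antisymm
  · rw [Ideal.span_mul_span', Ideal.span_le]
    rintro _ ⟨z, (rfl | rfl), w, (rfl | rfl), rfl⟩ <;> rw [SetLike.mem_coe, Ideal.mem_span_singleton]
    · exact dvd_mul_right _ _
    · exact dvd_mul_right _ _
    · exact dvd_mul_left _ _
    · exact ⟨t, hxy⟩
  · rw [Ideal.span_singleton_le_iff_mem]
    have e : ∀ z : R, p ∈ Ideal.span {p, z} := fun z => Ideal.subset_span (Set.mem_insert _ _)
    have e' : ∀ z : R, z ∈ Ideal.span {p, z} := fun z =>
      Ideal.subset_span (Set.mem_insert_of_mem _ rfl)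
    have h2 := add_mem (add_mem (Ideal.mul_mem_left _ a (Ideal.mul_mem_mul (e x) (e y)))
      (Ideal.mul_mem_left _ b (Ideal.mul_mem_mul (e x) (e' y))))
      (Ideal.mul_mem_left _ c (Ideal.mul_mem_mul (e' x) (e y)))
    rwa [← h] at h2

theorem exists_of_mul_span_eq {R : Type*} [CommRing R] [IsDomain R] {I : Ideal R} {c x : R}
    (hc : c ≠ 0) (h : I * Ideal.span {c} = Ideal.span {x}) :
    ∃ y, x = c * y ∧ I = Ideal.span {y} := by
  have h1 : Ideal.span {x} ≤ Ideal.span {c} := h ▸ Ideal.mul_le_right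
  obtain ⟨y, hy⟩ := Ideal.mem_span_singleton.1 ((Ideal.span_singleton_le_iff_mem _).1 h1)
  refine ⟨y, hy, ?_⟩
  rw [hy, mul_comm I, ← Ideal.span_singleton_mul_span_singleton] at h
  exact (Ideal.span_singleton_mul_right_inj hc).1 h

namespace QuadField
variable {D : ℤ} {k : Type*} [Field k] [NumberField k] (S : QuadField D k)
include S

theorem exists_half (hD : D % 4 = 1) : ∃ ω : 𝓞 k, 2 * ω = 1 + S.rt := by
  have h1 : (2 : k) * ((1 + (S.rt : k)) / 2) = 1 + S.rt := by field_simp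
  have h2 : IsIntegral ℤ ((1 + (S.rt : k)) / 2) := by
    refine ⟨Polynomial.X ^ 2 - Polynomial.X - Polynomial.C ((D - 1) / 4), ?_, ?_⟩
    · monicity!
    · have h3 : (S.rt : k) ^ 2 = D := by
        have := congrArg (algebraMap (𝓞 k) k) S.sq
        simpa using this
      have h4 : ((D : ℤ) : k) = 4 * (((D - 1) / 4 : ℤ) : k) + 1 := by
        have : D = 4 * ((D - 1) / 4) + 1 := by omega
        exact_mod_cast congrArg (Int.cast : ℤ → k) this
      rw [Polynomial.eval₂_sub, Polynomial.eval₂_sub, Polynomial.eval₂_pow, Polynomial.eval₂_X,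
        Polynomial.eval₂_C, eq_intCast]
      field_simp
      linear_combination h3 + h4
  obtain ⟨ω, hω⟩ := (IsIntegralClosure.isIntegral_iff (A := 𝓞 k)).1 h2
  refine ⟨ω, RingOfIntegers.coe_injective ?_⟩
  rw [map_mul, map_add, map_one, map_ofNat, hω]
  exact h1

theorem absNorm_of_mul {I : Ideal (𝓞 k)} {n : ℕ} (h : I * S.τ • I = Ideal.span {(n : 𝓞 k)}) :
    Ideal.absNorm I = n := by
  have h1 := h ▸ S.mul_smul_eq_span I
  have h2 := congrArg Ideal.absNorm h1
  rw [S.absNorm_span (N := (n : ℤ) ^ 2), S.absNorm_span (N := (Ideal.absNorm I : ℤ) ^ 2)] at h2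
  · simp only [Int.natAbs_pow, Int.natAbs_natCast] at h2
    exact (Nat.pow_left_injective two_ne_zero h2).symm
  · rw [S.smul_natCast]; push_cast; ring
  · rw [S.smul_natCast]; push_cast; ring

/-- A split prime `(ℓ, √D - c)` has norm `ℓ`. -/
theorem exists_absNorm_eq {l : ℕ} {c : ℤ} (hc : (l : ℤ) ∣ D - c ^ 2)
    (hl : IsCoprime (l : ℤ) (2 * c)) : ∃ I : Ideal (𝓞 k), Ideal.absNorm I = l := by
  refine ⟨Ideal.span {(l : 𝓞 k), S.rt - c}, S.absNorm_of_mul ?_⟩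
  rw [Ideal.pointwise_smul_def, Ideal.map_span, Set.image_pair]
  change _ * Ideal.span {S.τ • (l : 𝓞 k), S.τ • (S.rt - (c : 𝓞 k))} = _
  rw [S.smul_natCast, smul_sub, S.τ_rt, S.smul_int]
  obtain ⟨t, ht⟩ := hc
  obtain ⟨u, v, huv⟩ := hl
  have h1 := congrArg (Int.cast : ℤ → 𝓞 k) huv
  have h2 := congrArg (Int.cast : ℤ → 𝓞 k) ht
  have h3 := S.sq
  push_cast at h1 h2
  refine span_pair_mul_span_pair (t := -t) (a := u) (b := -v) (c := -v) ?_ ?_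
  · linear_combination -h3 - h2
  · linear_combination -l * h1

section OddDisc
variable {p₁ p₂ : ℕ} [hp₁ : Fact p₁.Prime] [hp₂ : Fact p₂.Prime] (hne : p₁ ≠ p₂)
  (hD : D = p₁ * p₂ ∨ D = -(p₁ * p₂))

include hne hD

theorem odd_decomp : (∃ q : ℤ, D = p₁ * q ∧ IsCoprime (p₁ : ℤ) q) ∧
    (∃ q : ℤ, D = p₂ * q ∧ IsCoprime (p₂ : ℤ) q) := by
  have c3 : IsCoprime (p₁ : ℤ) p₂ := Nat.isCoprime_iff_coprime.2
    ((Nat.coprime_primes hp₁.out hp₂.out).2 hne)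
  rcases hD with hD | hD
  · exact ⟨⟨p₂, by rw [hD], c3⟩, ⟨p₁, by rw [hD]; ring, c3.symm⟩⟩
  · exact ⟨⟨-p₂, by rw [hD]; ring, c3.neg_right⟩, ⟨-p₁, by rw [hD]; ring, c3.symm.neg_right⟩⟩

theorem odd_squarefree : Squarefree D := by
  have h : Squarefree (p₁ * p₂) := by
    rw [Nat.squarefree_mul ((Nat.coprime_primes hp₁.out hp₂.out).2 hne)]
    exact ⟨hp₁.out.squarefree, hp₂.out.squarefree⟩
  rw [← Int.squarefree_natAbs]
  rcases hD with hD | hD <;> (rw [hD]; convert h using 1; simp [Int.natAbs_mul])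

theorem odd_eq_ram (P : Ideal (𝓞 k)) (hP : P.IsPrime) (h : S.rt ∈ P) :
    P = S.ram p₁ ∨ P = S.ram p₂ := by
  obtain ⟨⟨b, hb, hb'⟩, ⟨c, hc, hc'⟩⟩ := S.odd_decomp hne hD
  have h4 : (((p₁ * p₂ : ℕ)) : 𝓞 k) ∈ P := by
    have h5 := P.mul_mem_left S.rt h
    rw [← pow_two, S.sq] at h5
    rcases hD with hD | hD
    · rw [congrArg (Int.cast : ℤ → 𝓞 k) hD] at h5; exact_mod_cast h5
    · rw [congrArg (Int.cast : ℤ → 𝓞 k) hD] at h5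
      push_cast at h5 ⊢
      exact neg_mem_iff.1 h5
  push_cast at h4
  rcases hP.mem_or_mem h4 with h4 | h4
  · exact Or.inl (S.eq_ram_of_mem hp₁.out hb hb' hP h4)
  · exact Or.inr (S.eq_ram_of_mem hp₂.out hc hc' hP h4)

theorem odd_ram_mul : S.ram p₁ * S.ram p₂ = Ideal.span {S.rt} :=
  S.ram_mul_ram hD ((Nat.coprime_primes hp₁.out hp₂.out).2 hne)

theorem odd_closure {J : Ideal (𝓞 k)}
    (hJ : J ∈ Submonoid.closure ({S.ram p₁, S.ram p₂} : Set (Ideal (𝓞 k)))) :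
    J ≠ ⊥ ∧ (S.Nice J ∨ S.Nice (J * S.ram p₁)) := by
  obtain ⟨⟨b, hb, hb'⟩, ⟨c, hc, hc'⟩⟩ := S.odd_decomp hne hD
  suffices h : J ≠ ⊥ ∧ ∃ e : ℕ, S.Nice (J * S.ram p₁ ^ e) by
    obtain ⟨h0, e, he⟩ := h
    refine ⟨h0, ?_⟩
    have hsq := S.ram_sq hb hb'
    have hp0 : (p₁ : 𝓞 k) ≠ 0 := by exact_mod_cast hp₁.out.ne_zero
    have key : ∀ (I : Ideal (𝓞 k)) (t : ℕ), S.Nice (I * S.ram p₁ ^ (2 * t)) → S.Nice I := by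
      rintro I t ⟨x, hx, hτ⟩
      rw [pow_mul, hsq, Ideal.span_singleton_pow] at hx
      have hpt : (p₁ : 𝓞 k) ^ t ≠ 0 := pow_ne_zero _ hp0
      obtain ⟨y, rfl, hy⟩ := exists_of_mul_span_eq hpt hx
      refine ⟨y, hy, ?_⟩
      rw [smul_mul', smul_pow', S.smul_natCast, ← mul_neg] at hτ
      exact hτ.imp (mul_left_cancel₀ hpt) (mul_left_cancel₀ hpt)
    rcases Nat.even_or_odd' e with ⟨t, rfl | rfl⟩
    · exact Or.inl (key J t he)
    · refine Or.inr (key _ t ?_)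
      convert he using 1; ring
  induction hJ using Submonoid.closure_induction with
  | mem P hP =>
    rcases hP with rfl | rfl
    · refine ⟨S.ram_ne_bot hp₁.out.ne_zero, 1, ?_⟩
      rw [pow_one, ← pow_two, S.ram_sq hb hb']
      exact S.nice_natCast _
    · refine ⟨S.ram_ne_bot hp₂.out.ne_zero, 1, ?_⟩
      rw [pow_one, mul_comm, S.odd_ram_mul hne hD]
      exact S.nice_rt
  | one => exact ⟨one_ne_zero, 0, by simpa [-Ideal.one_eq_top] using S.nice_one⟩
  | mul I J _ _ hI hJ =>
    obtain ⟨hI0, e, h⟩ := hI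
    obtain ⟨hJ0, e', h'⟩ := hJ
    refine ⟨mul_ne_zero hI0 hJ0, e + e', ?_⟩
    convert S.nice_mul h h' using 1
    ring

theorem odd_class {J : Ideal (𝓞 k)}
    (hJ : J ∈ Submonoid.closure ({S.ram p₁, S.ram p₂} : Set (Ideal (𝓞 k)))) :
    idealClass J = 1 ∨ idealClass J = (idealClass (S.ram p₁))⁻¹ := by
  obtain ⟨h0, ⟨x, hx, -⟩ | ⟨x, hx, -⟩⟩ := S.odd_closure hne hD hJ
  · left; rw [hx, idealClass_span]
  · right
    rw [eq_inv_iff_mul_eq_one, ← idealClass_mul h0 (S.ram_ne_bot hp₁.out.ne_zero), hx,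
      idealClass_span]

end OddDisc

section Real
variable {p₁ p₂ : ℕ} [hp₁ : Fact p₁.Prime] [hp₂ : Fact p₂.Prime] (hne : p₁ ≠ p₂)
  (hD : D = p₁ * p₂) {ω : 𝓞 k} (hω : 2 * ω = 1 + S.rt)

include hne hD hω

theorem sub_smul_half : ω - S.τ • ω = S.rt := by
  have h1 := congrArg (S.τ • ·) hω
  simp only [smul_mul', smul_add, smul_one, S.τ_rt] at h1
  have h2 : S.τ • (2 : 𝓞 k) = 2 := by exact_mod_cast S.smul_natCast 2
  rw [h2] at h1
  apply mul_left_cancel₀ (two_ne_zero (α := 𝓞 k))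
  linear_combination hω - h1

theorem real_ramified (P : Ideal (𝓞 k)) (hP : P.IsPrime) (h : ω - S.τ • ω ∈ P) :
    P ∈ ({S.ram p₁, S.ram p₂} : Set (Ideal (𝓞 k))) :=
  S.odd_eq_ram hne (Or.inl hD) P hP ((S.sub_smul_half hne hD hω) ▸ h)

/-- If all units have norm `1`, then the ramified primes are principal. -/
theorem real_ram_principal {η : 𝓞 k} (h1 : η * S.τ • η = 1)
    (hns : ∀ v, IsUnit v → η ≠ v ^ 2 ∧ η ≠ -v ^ 2) : idealClass (S.ram p₁) = 1 := by
  have hη1 : η ≠ -1 := fun h => (hns 1 isUnit_one).2 (by rw [h, one_pow])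
  obtain ⟨J, hJ, n, hn, hJn⟩ := S.exists_closure_of_unit ω (S.real_ramified hne hD hω) h1 hη1
  obtain ⟨hJ0, h⟩ := S.odd_closure hne (Or.inl hD) hJ
  have hη0 : Ideal.span {1 + η} ≠ ⊥ := by
    rw [Ne, Ideal.span_singleton_eq_bot]
    exact fun h => hη1 (eq_neg_of_add_eq_zero_right h)
  have hJ1 : idealClass J = 1 := by
    have := idealClass_span (n : 𝓞 k)
    rwa [← hJn, idealClass_mul hη0 hJ0, idealClass_span, one_mul] at this
  rcases h with ⟨x, hx, hτ⟩ | ⟨x, hx, -⟩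
  · obtain ⟨v, hv, h⟩ := S.exists_sq_of_nice h1 hn (m := 1) one_ne_zero hJn (x := x)
      (by rw [Int.cast_one, Ideal.span_singleton_one, Ideal.mul_top, hx]) hτ
    exact (h.elim (hns v hv).1 (hns v hv).2).elim
  · have := idealClass_span x
    rwa [← hx, idealClass_mul hJ0 (S.ram_ne_bot hp₁.out.ne_zero), hJ1, one_mul] at this

theorem real_two_torsion {η : 𝓞 k} (hη : IsUnit η)
    (hns : ∀ v, IsUnit v → η ≠ v ^ 2 ∧ η ≠ -v ^ 2) :
    ∃ b : ClassGroup (𝓞 k), ∀ c, c ^ 2 = 1 → c = 1 ∨ c = b := by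
  rcases S.mul_smul_of_isUnit hη with h1 | h1
  · have hr := S.real_ram_principal hne hD hω h1 hns
    have key : ∀ (I : Ideal (𝓞 k)) z, I ≠ ⊥ → I ^ 2 = Ideal.span {z} →
        (Ideal.absNorm I : 𝓞 k) ^ 2 = z * S.τ • z → idealClass I = 1 := by
      intro I z hI hz hN
      obtain ⟨J, hJ, h⟩ := S.exists_closure_of_sq ω (S.real_ramified hne hD hω) hI hz hN
      have := S.odd_class hne (Or.inl hD) hJ
      rw [hr, inv_one, or_self] at this
      rwa [this, mul_one] at h
    by_cases hb : ∃ (I : Ideal (𝓞 k)) (z : 𝓞 k), I ≠ ⊥ ∧ I ^ 2 = Ideal.span {z} ∧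
        (Ideal.absNorm I : 𝓞 k) ^ 2 = -(z * S.τ • z)
    · obtain ⟨I', z', hI', hz', hN'⟩ := hb
      refine ⟨(idealClass I')⁻¹, fun c hc => ?_⟩
      obtain ⟨I, hI, rfl⟩ := exists_idealClass_eq c
      rw [← idealClass_pow hI, idealClass_eq_one_iff (pow_ne_zero _ hI)] at hc
      obtain ⟨z, hz⟩ := hc
      rcases S.exists_sign hz with h | h
      · exact Or.inl (key I z hI hz h)
      · right
        rw [eq_inv_iff_mul_eq_one, ← idealClass_mul hI hI']
        refine key _ (z * z') (mul_ne_zero hI hI') ?_ ?_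
        · rw [mul_pow, hz, hz', Ideal.span_singleton_mul_span_singleton]
        · rw [map_mul, smul_mul']; push_cast
          linear_combination (Ideal.absNorm I' : 𝓞 k) ^ 2 * h - z * S.τ • z * hN'
    · refine ⟨1, fun c hc => Or.inl ?_⟩
      obtain ⟨I, hI, rfl⟩ := exists_idealClass_eq c
      rw [← idealClass_pow hI, idealClass_eq_one_iff (pow_ne_zero _ hI)] at hc
      obtain ⟨z, hz⟩ := hc
      rcases S.exists_sign hz with h | h
      · exact key I z hI hz h
      · exact (hb ⟨I, z, hI, hz, h⟩).elim
  · refine ⟨idealClass (S.ram p₁), fun c hc => ?_⟩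
    obtain ⟨J, hJ, h⟩ := S.exists_closure_of_class (S.odd_squarefree hne (Or.inl hD))
      (Or.inr ⟨η, hη, h1⟩) ω (S.real_ramified hne hD hω) hc
    have := S.odd_class hne (Or.inl hD) hJ
    rw [mul_eq_one_iff_eq_inv] at h
    rcases this with h' | h' <;> rw [h, h']
    · left; simp
    · right; simp

end Real

section Imag
variable {p₁ p₂ : ℕ} [hp₁ : Fact p₁.Prime] [hp₂ : Fact p₂.Prime] (hne : p₁ ≠ p₂)
  (hm₁ : p₁ % 8 = 5) (hm₂ : p₂ % 8 = 5) (hD : D = -(p₁ * p₂))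

/-- The prime above `2` when `D ≡ 3 (mod 4)`. -/
noncomputable def two : Ideal (𝓞 k) := Ideal.span {(2 : 𝓞 k), 1 + S.rt}

omit S in
include hm₁ hm₂ hD in
theorem imag_mod : D % 8 = 7 := by
  have h1 : ((p₁ : ℤ) * p₂) % 8 = 1 := by
    rw [Int.mul_emod]
    have : (p₁ : ℤ) % 8 = 5 := by omega
    have : (p₂ : ℤ) % 8 = 5 := by omega
    simp [*]
  omega

theorem two_sq (hD : D % 4 = 3) : S.two ^ 2 = Ideal.span {(2 : 𝓞 k)} := by
  have h : D = 2 * ((D - 1) / 2) + 1 := by omega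
  have h' : (D - 1) / 2 = 2 * ((D - 1) / 4) + 1 := by omega
  refine sq_span_pair (q := (((D - 1) / 2 : ℤ) : 𝓞 k)) (c := 1)
    (u := ((-((D - 1) / 4) : ℤ) : 𝓞 k)) (v := 1) ?_ ?_
  · have h1 := congrArg (Int.cast : ℤ → 𝓞 k) h
    push_cast at h1
    linear_combination S.sq + h1
  · have h1 := congrArg (Int.cast : ℤ → 𝓞 k) h'
    push_cast at h1 ⊢
    linear_combination h1

include hne hm₁ hm₂ hD

theorem imag_ramified (P : Ideal (𝓞 k)) (hP : P.IsPrime) (h : S.rt - S.τ • S.rt ∈ P) :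
    P ∈ ({S.two, S.ram p₁, S.ram p₂} : Set (Ideal (𝓞 k))) := by
  have h2 : (2 : 𝓞 k) * S.rt ∈ P := by
    rw [S.τ_rt] at h; convert h using 1; ring
  rcases hP.mem_or_mem h2 with h2 | h2
  · left
    have h3 := S.two_sq (by have := imag_mod hm₁ hm₂ hD; omega)
    have := S.isPrime_of_sq Nat.prime_two (p := 2) (by exact_mod_cast h3)
    exact Ideal.IsPrime.eq_of_sq_eq_span h3 two_ne_zero hP h2
  · right; exact S.odd_eq_ram hne (Or.inr hD) P hP h2

theorem two_ne_bot : S.two ≠ ⊥ := by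
  intro h
  have : (2 : 𝓞 k) ∈ S.two := Ideal.subset_span (by simp)
  rw [h, Ideal.mem_bot] at this
  exact two_ne_zero this

theorem imag_two_torsion {c : ClassGroup (𝓞 k)} (hc : c ^ 2 = 1) :
    c = 1 ∨ c = idealClass S.two ∨ c = idealClass (S.ram p₁) ∨
      c = idealClass S.two * idealClass (S.ram p₁) := by
  obtain ⟨J, hJ, h⟩ := S.exists_closure_of_class (S.odd_squarefree hne (Or.inr hD))
    (Or.inl (by
      rw [hD, neg_lt_zero]
      exact_mod_cast Nat.mul_pos hp₁.out.pos hp₂.out.pos)) S.rt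
    (S.imag_ramified hne hm₁ hm₂ hD) hc
  obtain ⟨⟨b, hb, hb'⟩, -⟩ := S.odd_decomp hne (Or.inr hD)
  have n2 := S.two_ne_bot hne hm₁ hm₂ hD
  have n1 := S.ram_ne_bot hp₁.out.ne_zero
  have q2 : idealClass S.two ^ 2 = 1 := by
    rw [← idealClass_pow n2, S.two_sq (by have := imag_mod hm₁ hm₂ hD; omega), idealClass_span]
  have q1 : idealClass (S.ram p₁) ^ 2 = 1 := by
    rw [← idealClass_pow n1, S.ram_sq hb hb', idealClass_span]
  have hp : idealClass (S.ram p₂) = idealClass (S.ram p₁) := by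
    have := idealClass_span S.rt
    rw [← S.odd_ram_mul hne (Or.inr hD), idealClass_mul n1 (S.ram_ne_bot hp₂.out.ne_zero)] at this
    rw [eq_inv_of_mul_eq_one_right this]
    exact inv_eq_of_mul_eq_one_left (by rw [← pow_two, q1])
  have hcl := idealClass_mem_of_mem_closure
    (H := Subgroup.closure {idealClass S.two, idealClass (S.ram p₁)}) (fun P hP => by
      rcases hP with rfl | rfl | rfl
      · exact ⟨n2, Subgroup.subset_closure (by simp)⟩
      · exact ⟨n1, Subgroup.subset_closure (by simp)⟩
      · exact ⟨S.ram_ne_bot hp₂.out.ne_zero, hp ▸ Subgroup.subset_closure (by simp)⟩) hJ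
  obtain ⟨e, f, hef⟩ := Subgroup.mem_closure_pair.1 hcl.2
  have hcJ : c = idealClass J := by
    rw [eq_inv_of_mul_eq_one_right h, eq_comm]
    exact inv_eq_of_mul_eq_one_left (by rw [← pow_two, hc])
  have red : ∀ {x : ClassGroup (𝓞 k)}, x ^ 2 = 1 → ∀ e : ℤ, x ^ e = 1 ∨ x ^ e = x := by
    intro x hx e
    rcases Int.even_or_odd' e with ⟨t, rfl | rfl⟩
    · left; rw [zpow_mul]; norm_cast; rw [hx, one_zpow]
    · right; rw [zpow_add, zpow_mul, zpow_one]; norm_cast; rw [hx, one_zpow, one_mul]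
  rw [hcJ, ← hef]
  rcases red q2 e with h | h <;> rcases red q1 f with h' | h' <;> rw [h, h'] <;> simp

theorem exists_fourChar : ∃ φ : ClassGroup (𝓞 k) →* ℤ, ∀ I : Ideal (𝓞 k), I ≠ ⊥ →
    (Ideal.absNorm I).Coprime 4 → φ (idealClass I) = ZMod.χ₄ (Ideal.absNorm I : ℕ) := by
  refine exists_normChar four_ne_zero _ fun x hx => ?_
  obtain ⟨a, b, N, -, hN, -, h⟩ := S.exists_coords (S.odd_squarefree hne (Or.inr hD)) x
  rw [S.absNorm_span hN] at hx ⊢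
  have hD8 := imag_mod hm₁ hm₂ hD
  have hD0 : D ≤ 0 := by
    rw [hD, neg_nonpos]; positivity
  have hN0 : 0 ≤ N := by nlinarith [sq_nonneg a, sq_nonneg b]
  have hodd : N.natAbs % 2 = 1 := by
    rw [← Nat.odd_iff]
    rw [show 4 = 2 ^ 2 by norm_num] at hx
    exact Nat.coprime_two_right.1 ((Nat.coprime_pow_right_iff (by norm_num) _ _).1 hx)
  apply ZMod.χ₄_nat_one_mod_four
  obtain ⟨e, rfl⟩ : ∃ e, D = 8 * e + 7 := ⟨D / 8, by omega⟩
  rcases Int.even_or_odd' a with ⟨a', rfl | rfl⟩ <;> rcases Int.even_or_odd' b with ⟨b', rfl | rfl⟩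
  · have h1 : N = a' ^ 2 - (8 * e + 7) * b' ^ 2 := by linarith
    rcases Int.even_or_odd' a' with ⟨a', rfl | rfl⟩ <;>
    rcases Int.even_or_odd' b' with ⟨b', rfl | rfl⟩ <;> ring_nf at h1 <;> omega
  · ring_nf at h; omega
  · ring_nf at h; omega
  · ring_nf at h; omega

theorem fourChar_two {φ : ClassGroup (𝓞 k) →* ℤ} (hφ : ∀ I : Ideal (𝓞 k), I ≠ ⊥ →
    (Ideal.absNorm I).Coprime 4 → φ (idealClass I) = ZMod.χ₄ (Ideal.absNorm I : ℕ)) :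
    φ (idealClass S.two) = 1 := by
  have h8 := imag_mod hm₁ hm₂ hD
  have h1 : 1 + S.rt ∈ S.two := Ideal.subset_span (by simp)
  rw [← Ideal.span_singleton_le_iff_mem, ← Ideal.dvd_iff_le] at h1
  obtain ⟨J, hJ⟩ := h1
  have hN : Ideal.absNorm (Ideal.span {1 + S.rt}) = (1 - D).natAbs := by
    apply S.absNorm_span
    rw [smul_add, smul_one, S.τ_rt]
    push_cast
    linear_combination -S.sq
  have h2 : Ideal.absNorm S.two = 2 := S.absNorm_of_sq (by exact_mod_cast S.two_sq (by omega))
  rw [hJ, map_mul, h2] at hN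
  have h3 : Ideal.absNorm J % 4 = 1 := by
    have : D ≤ 0 := by rw [hD, neg_nonpos]; positivity
    omega
  have hJ0 : J ≠ ⊥ := by
    rintro rfl; simp at h3
  have h4 := idealClass_span (1 + S.rt)
  rw [hJ, idealClass_mul (S.two_ne_bot hne hm₁ hm₂ hD) hJ0] at h4
  have h5 := hφ J hJ0 (by
    rw [Nat.Coprime, Nat.gcd_comm, Nat.gcd_rec, h3, Nat.gcd_one_left])
  rw [ZMod.χ₄_nat_one_mod_four h3] at h5
  rw [mul_eq_one_iff_eq_inv] at h4
  rw [h4]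
  have := map_mul φ (idealClass J)⁻¹ (idealClass J)
  rw [inv_mul_cancel, map_one, h5, mul_one] at this
  exact this.symm

end Imag

end QuadField

section TwoGroups

theorem card_ker_mul_card_range {A B : Type*} [CommGroup A] [CommGroup B] (f : A →* B) :
    Nat.card f.ker * Nat.card f.range = Nat.card A := by
  rw [← Subgroup.index_ker, Subgroup.card_mul_index]

theorem card_ker_subgroup_le {A : Type*} [CommGroup A] [Finite A] (K : Subgroup A) :
    Nat.card (powMonoidHom 2 : K →* K).ker ≤ Nat.card (powMonoidHom 2 : A →* A).ker := by
  refine Nat.card_le_card_of_injective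
    (fun x => (⟨(x : K), ?_⟩ : (powMonoidHom 2 : A →* A).ker)) ?_
  · have := x.2
    rw [MonoidHom.mem_ker, powMonoidHom_apply] at this ⊢
    exact_mod_cast congrArg Subtype.val this
  · intro x y hxy
    simp only [Subtype.mk.injEq] at hxy
    exact Subtype.ext (Subtype.ext hxy)

theorem two_le_card_of_ne {A : Type*} [Group A] [Finite A] {x : A} (hx : x ≠ 1) :
    2 ≤ Nat.card A := by
  have : Nontrivial A := ⟨x, 1, hx⟩
  exact Finite.one_lt_card

theorem card_le_of_forall_pow_eq_one {c : ℕ} (t : ℕ) :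
    ∀ (H : Type*) [CommGroup H] [Finite H], Nat.card (powMonoidHom 2 : H →* H).ker ≤ c →
      (∀ x : H, x ^ 2 ^ t = 1) → Nat.card H ≤ c ^ t := by
  induction t with
  | zero =>
    intro H _ _ _ h
    have : Subsingleton H := ⟨fun x y => by
      have hx := h x; have hy := h y
      rw [pow_zero, pow_one] at hx hy; rw [hx, hy]⟩
    rw [pow_zero]
    exact Finite.card_le_one_iff_subsingleton.2 this
  | succ t ih =>
    intro H _ _ hc h
    rw [← card_ker_mul_card_range (powMonoidHom 2 : H →* H), pow_succ']
    refine Nat.mul_le_mul hc (ih _ ((card_ker_subgroup_le _).trans hc) ?_)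
    · rintro ⟨_, y, rfl⟩
      apply Subtype.ext
      have := h y
      rw [pow_succ', pow_mul] at this
      simpa using this

theorem eq_pow_of_mem_zpowers {A : Type*} [CommGroup A] {x z : A} {t : ℕ}
    (hx : (x ^ 2 ^ t) ^ 2 = 1) (hx1 : x ^ 2 ^ t ≠ 1) (hz : z ∈ Subgroup.zpowers x) (hz2 : z ^ 2 = 1)
    (hz1 : z ≠ 1) : z = x ^ 2 ^ t := by
  obtain ⟨i, rfl⟩ := hz
  have ho : orderOf x = 2 ^ (t + 1) :=
    orderOf_eq_prime_pow hx1 (by rw [pow_succ, pow_mul, hx])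
  have h1 : ((2 ^ (t + 1) : ℕ) : ℤ) ∣ i * 2 := by
    rw [← ho]; apply orderOf_dvd_iff_zpow_eq_one.2
    rw [zpow_mul]; exact_mod_cast hz2
  obtain ⟨j, hj⟩ := h1
  have h2 : i = 2 ^ t * j := by push_cast at hj; rw [pow_succ] at hj; linarith
  subst h2
  simp only at hz1 ⊢
  have h3 : x ^ (2 ^ t * j) = (x ^ 2 ^ t) ^ j := by
    rw [zpow_mul]; norm_cast
  rw [h3] at hz1 ⊢
  rcases Int.even_or_odd' j with ⟨l, rfl | rfl⟩
  · rw [zpow_mul] at hz1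
    norm_cast at hz1
    rw [hx, one_zpow] at hz1
    exact (hz1 rfl).elim
  · rw [zpow_add, zpow_mul, zpow_one]
    norm_cast
    rw [hx, one_zpow, one_mul]

theorem nonempty_addEquiv_of_pow {A : Type*} [CommGroup A] [Finite A] {X Y : A} {s t : ℕ}
    (hX : (X ^ 2 ^ s) ^ 2 = 1) (hX1 : X ^ 2 ^ s ≠ 1) (hY : (Y ^ 2 ^ t) ^ 2 = 1)
    (hY1 : Y ^ 2 ^ t ≠ 1) (hXY : X ^ 2 ^ s ≠ Y ^ 2 ^ t)
    (hA : Nat.card A ≤ 2 ^ (t + 1) * 2 ^ (s + 1)) :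
    Nonempty (Additive A ≃+ (ZMod (2 ^ (t + 1)) × ZMod (2 ^ (s + 1)))) := by
  have oX : orderOf X = 2 ^ (s + 1) :=
    orderOf_eq_prime_pow hX1 (by rw [pow_succ, pow_mul, hX])
  have oY : orderOf Y = 2 ^ (t + 1) :=
    orderOf_eq_prime_pow hY1 (by rw [pow_succ, pow_mul, hY])
  have key : ∀ i j : ℤ, Y ^ i * X ^ j = 1 → Y ^ i = 1 := by
    intro i j h
    by_contra hw
    have hwX : Y ^ i ∈ Subgroup.zpowers X := by
      rw [eq_inv_of_mul_eq_one_left h]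
      exact inv_mem (Subgroup.zpow_mem_zpowers _ _)
    have hwY : Y ^ i ∈ Subgroup.zpowers Y := Subgroup.zpow_mem_zpowers _ _
    have hd : orderOf (Y ^ i) ∣ 2 ^ (t + 1) := by
      rw [← oY]; exact orderOf_dvd_of_mem_zpowers hwY
    obtain ⟨l, -, hl⟩ := (Nat.dvd_prime_pow Nat.prime_two).1 hd
    cases l with
    | zero => exact hw (orderOf_eq_one_iff.1 (by rw [hl, pow_zero]))
    | succ l =>
      have h1 : ((Y ^ i) ^ 2 ^ l) ^ 2 = 1 := by
        rw [← pow_mul, ← pow_succ, ← hl, pow_orderOf_eq_one]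
      have h2 : (Y ^ i) ^ 2 ^ l ≠ 1 := by
        intro h
        have := orderOf_dvd_of_pow_eq_one h
        rw [hl, Nat.pow_dvd_pow_iff_le_right (by norm_num)] at this
        omega
      exact hXY ((eq_pow_of_mem_zpowers hX hX1 (pow_mem hwX _) h1 h2).symm.trans
        (eq_pow_of_mem_zpowers hY hY1 (pow_mem hwY _) h1 h2))
  let fY : ZMod (2 ^ (t + 1)) →+ Additive A := ZMod.lift _ ⟨zmultiplesHom _ (Additive.ofMul Y), by
    rw [zmultiplesHom_apply, natCast_zsmul, ← ofMul_pow, ← oY, pow_orderOf_eq_one, ofMul_one]⟩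
  let fX : ZMod (2 ^ (s + 1)) →+ Additive A := ZMod.lift _ ⟨zmultiplesHom _ (Additive.ofMul X), by
    rw [zmultiplesHom_apply, natCast_zsmul, ← ofMul_pow, ← oX, pow_orderOf_eq_one, ofMul_one]⟩
  have hfX (j : ℤ) : fX j = Additive.ofMul (X ^ j) := by
    simp only [fX, ZMod.lift_coe, zmultiplesHom_apply, ofMul_zpow]
  have hfY (j : ℤ) : fY j = Additive.ofMul (Y ^ j) := by
    simp only [fY, ZMod.lift_coe, zmultiplesHom_apply, ofMul_zpow]
  have hinj : Function.Injective (fY.coprod fX) := by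
    rw [injective_iff_map_eq_zero]
    rintro ⟨a, b⟩ h
    obtain ⟨i, rfl⟩ := ZMod.intCast_surjective a
    obtain ⟨j, rfl⟩ := ZMod.intCast_surjective b
    rw [AddMonoidHom.coprod_apply, hfX, hfY, ← ofMul_mul, ofMul_eq_zero] at h
    have h1 := key i j h
    rw [h1, one_mul] at h
    have h2 := orderOf_dvd_iff_zpow_eq_one.2 h1
    have h3 := orderOf_dvd_iff_zpow_eq_one.2 h
    rw [oY] at h2
    rw [oX] at h3
    rw [Prod.mk_eq_zero, ZMod.intCast_zmod_eq_zero_iff_dvd, ZMod.intCast_zmod_eq_zero_iff_dvd]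
    exact ⟨h2, h3⟩
  have hbij : Function.Bijective (fY.coprod fX) := by
    rw [Nat.bijective_iff_injective_and_card]
    refine ⟨hinj, le_antisymm (Nat.card_le_card_of_injective _ hinj) ?_⟩
    rw [Nat.card_prod, Nat.card_zmod, Nat.card_zmod]
    exact hA
  exact ⟨(AddEquiv.ofBijective _ hbij).symm⟩

theorem exists_sq_of_chars {A : Type*} [CommGroup A] [Finite A]
    (h4 : Nat.card (powMonoidHom 2 : A →* A).ker ≤ 4) (φ₁ φ₃ : A →* ℤ) {u v : A} (hu : φ₁ u = -1)
    (hv : φ₁ v = 1) (hv' : φ₃ v = -1) {a : A} (h1 : φ₁ a = 1) (h3 : φ₃ a = 1) :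
    ∃ b, b ^ 2 = a := by
  let φ : A →* ℤˣ × ℤˣ := φ₁.toHomUnits.prod φ₃.toHomUnits
  have hφ (x : A) : φ x = 1 ↔ φ₁ x = 1 ∧ φ₃ x = 1 := by
    simp [φ, Prod.ext_iff, Units.ext_iff]
  have hle : (powMonoidHom 2 : A →* A).range ≤ φ.ker := by
    rintro _ ⟨x, rfl⟩
    rw [MonoidHom.mem_ker, hφ, powMonoidHom_apply, map_pow, map_pow]
    exact ⟨sq_eq_one_of_monoidHom _ _, sq_eq_one_of_monoidHom _ _⟩
  have hsurj : Nat.card φ.range = 4 := by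
    have : φ.range = ⊤ := by
      rw [eq_top_iff]
      have hv1 : φ v = (1, -1) := by
        simp [φ, Prod.ext_iff, Units.ext_iff, hv, hv']
      have hu1 : φ u = (-1, 1) ∨ φ u = (-1, -1) := by
        rcases eq_or_of_monoidHom φ₃ u with h | h
        · left; simp [φ, Prod.ext_iff, Units.ext_iff, hu, h]
        · right; simp [φ, Prod.ext_iff, Units.ext_iff, hu, h]
      have m1 : ((1, -1) : ℤˣ × ℤˣ) ∈ φ.range := ⟨v, hv1⟩
      have m2 : ((-1, 1) : ℤˣ × ℤˣ) ∈ φ.range := by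
        rcases hu1 with h | h
        · exact ⟨u, h⟩
        · exact ⟨u * v, by rw [map_mul, h, hv1]; rfl⟩
      have m3 : ((-1, -1) : ℤˣ × ℤˣ) ∈ φ.range := by simpa using mul_mem m1 m2
      rintro ⟨x, y⟩ -
      rcases Int.units_eq_one_or x with rfl | rfl <;> rcases Int.units_eq_one_or y with rfl | rfl
      · exact one_mem _
      · exact m1
      · exact m2
      · exact m3
    rw [this, Subgroup.card_top]
    rw [Nat.card_prod, Nat.card_eq_fintype_card]; rfl
  have c1 := card_ker_mul_card_range φ
  have c2 := card_ker_mul_card_range (powMonoidHom 2 : A →* A)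
  have heq : (powMonoidHom 2 : A →* A).range = φ.ker := by
    refine Subgroup.eq_of_le_of_card_ge hle ?_
    rw [hsurj] at c1
    nlinarith
  have : a ∈ φ.ker := (hφ a).2 ⟨h1, h3⟩
  rw [← heq] at this
  exact this

theorem card_ker_two_le {A : Type*} [CommGroup A] {n : ℕ} (s : Finset A) (hs : s.card ≤ n)
    (h : ∀ c : A, c ^ 2 = 1 → c ∈ s) : Nat.card (powMonoidHom 2 : A →* A).ker ≤ n := by
  refine le_trans ?_ hs
  have h1 : ((powMonoidHom 2 : A →* A).ker : Set A) ⊆ s := fun c hc => h c hc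
  have h2 := Set.ncard_le_ncard h1 s.finite_toSet
  rwa [Set.ncard_coe_finset] at h2

theorem pow_ne_one_of_char {D : Type*} [CommGroup D] [Finite D] {n : ℕ} (hn : 1 ≤ n)
    (hD : Nat.card D = 2 ^ n) (hD2 : Nat.card (powMonoidHom 2 : D →* D).ker ≤ 2) (χ : D →* ℤ) {g : D}
    (hg : χ g = -1) : g ^ 2 ^ (n - 1) ≠ 1 := by
  intro h
  obtain ⟨n, rfl⟩ := Nat.exists_eq_add_of_le' hn
  rw [Nat.add_sub_cancel] at h
  let K := (powMonoidHom (2 ^ n) : D →* D).ker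
  have hK : Nat.card K ≤ 2 ^ n := card_le_of_forall_pow_eq_one n K
    ((card_ker_subgroup_le _).trans hD2) fun x => by
      have := x.2
      rw [MonoidHom.mem_ker, powMonoidHom_apply] at this
      exact Subtype.ext (by exact_mod_cast this)
  have hle : (powMonoidHom 2 : D →* D).range ≤ K := by
    rintro _ ⟨x, rfl⟩
    rw [MonoidHom.mem_ker, powMonoidHom_apply, powMonoidHom_apply, ← pow_mul, ← pow_succ', ← hD,
      pow_card_eq_one']
  have c := card_ker_mul_card_range (powMonoidHom 2 : D →* D)
  rw [hD, pow_succ] at c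
  have heq := Subgroup.eq_of_le_of_card_ge hle (by nlinarith)
  have : g ∈ K := h
  rw [← heq] at this
  obtain ⟨y, rfl⟩ := this
  rw [powMonoidHom_apply, map_pow, sq_eq_one_of_monoidHom] at hg
  norm_num at hg

theorem exists_pow_generator {B : Type*} [CommGroup B] [Finite B] {m : ℕ} (hm : 2 ≤ m)
    (hB : Nat.card B = 2 ^ (m + 1)) {q r : B} (hq2 : q ^ 2 = 1) (hr2 : r ^ 2 = 1)
    (hB2 : ∀ c : B, c ^ 2 = 1 → c = 1 ∨ c = q ∨ c = r ∨ c = q * r)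
    (χp : B →* ℤ) (hχpq : χp q = -1) :
    Nat.card (powMonoidHom 2 : B →* B).ker ≤ 4 ∧
    Nat.card (powMonoidHom 2 : B →* B).range = 2 ^ (m - 1) ∧
    ∃ h : B, (h ^ 2 ^ (m - 1) = r ∨ h ^ 2 ^ (m - 1) = q * r) ∧ h ^ 2 ^ (m - 1) ≠ 1 := by
  classical
  obtain ⟨m, rfl⟩ := Nat.exists_eq_add_of_le' hm
  obtain ⟨r', hr', hr'2, hχr', hr'B⟩ : ∃ r', (r' = r ∨ r' = q * r) ∧ r' ^ 2 = 1 ∧ χp r' = 1 ∧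
      ∀ c, c ^ 2 = 1 → χp c = 1 → c = 1 ∨ c = r' := by
    rcases eq_or_of_monoidHom χp r with h | h
    · refine ⟨r, Or.inl rfl, hr2, h, fun c hc hχ => ?_⟩
      rcases hB2 c hc with rfl | rfl | rfl | rfl
      · exact Or.inl rfl
      · rw [hχ] at hχpq; norm_num at hχpq
      · exact Or.inr rfl
      · rw [map_mul, hχpq, h] at hχ; norm_num at hχ
    · refine ⟨q * r, Or.inr rfl, by rw [mul_pow, hq2, hr2, one_mul], by rw [map_mul, hχpq, h]; rfl,
        fun c hc hχ => ?_⟩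
      rcases hB2 c hc with rfl | rfl | rfl | rfl
      · exact Or.inl rfl
      · rw [hχ] at hχpq; norm_num at hχpq
      · rw [hχ] at h; norm_num at h
      · exact Or.inr rfl
  have h4 : Nat.card (powMonoidHom 2 : B →* B).ker ≤ 4 :=
    card_ker_two_le {1, q, r, q * r} Finset.card_le_four fun c hc => by simpa using hB2 c hc
  have c1 := card_ker_mul_card_range (powMonoidHom 2 : B →* B)
  have hS2 : Nat.card (powMonoidHom 2 :
      (powMonoidHom 2 : B →* B).range →* (powMonoidHom 2 : B →* B).range).ker ≤ 2 := by
    refine card_ker_two_le {1, if h : r' ∈ (powMonoidHom 2 : B →* B).range then ⟨r', h⟩ else 1}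
      Finset.card_le_two ?_
    rintro ⟨c, hc⟩ h
    have h1 : c ^ 2 = 1 := congrArg Subtype.val h
    have h2 : χp c = 1 := by
      obtain ⟨y, rfl⟩ := hc
      rw [powMonoidHom_apply, map_pow, sq_eq_one_of_monoidHom]
    rw [Finset.mem_insert, Finset.mem_singleton]
    rcases hr'B c h1 h2 with rfl | rfl
    · exact Or.inl rfl
    · right; rw [dif_pos hc]
  obtain ⟨h, hh⟩ : ∃ h : B, h ^ 2 ^ (m + 1) ≠ 1 := by
    by_contra! hcon
    have := card_le_of_forall_pow_eq_one m (powMonoidHom 2 : B →* B).range hS2 (by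
      rintro ⟨_, y, rfl⟩
      apply Subtype.ext
      have := hcon y
      rw [pow_succ', pow_mul] at this
      simpa using this)
    rw [hB] at c1
    have h3 : 2 ^ (m + 2 + 1) = 8 * 2 ^ m := by ring
    have h5 : 0 < 2 ^ m := by positivity
    nlinarith
  have hro : ∀ x : B, x ≠ 1 → x ^ 2 = 1 → χp x = 1 → x = r' := fun x h1 h2 h3 =>
    (hr'B x h2 h3).resolve_left h1
  have hr'1 : r' ≠ 1 := by
    intro hr1
    have hd : orderOf h ∣ 2 ^ (m + 2 + 1) := by rw [← hB]; exact orderOf_dvd_natCard h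
    obtain ⟨l, -, hl⟩ := (Nat.dvd_prime_pow Nat.prime_two).1 hd
    have hl' : m + 1 < l := by
      by_contra! hcon
      exact hh (orderOf_dvd_iff_pow_eq_one.1 (hl ▸ pow_dvd_pow 2 hcon))
    obtain ⟨l, rfl⟩ : ∃ l', l = l' + 2 := ⟨l - 2, by omega⟩
    have h1 : h ^ 2 ^ (l + 1) ≠ 1 := fun h1 => by
      have := orderOf_dvd_of_pow_eq_one h1
      rw [hl, Nat.pow_dvd_pow_iff_le_right (by norm_num)] at this
      omega
    refine h1 ((hro _ h1 ?_ ?_).trans hr1)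
    · rw [← pow_mul, ← pow_succ, ← hl, pow_orderOf_eq_one]
    · rw [pow_succ, pow_mul, map_pow, sq_eq_one_of_monoidHom]
  have hq1 : q ≠ 1 := by rintro rfl; rw [map_one] at hχpq; norm_num at hχpq
  have hqr : q ≠ r' := by rintro rfl; rw [hχr'] at hχpq; norm_num at hχpq
  have hK : Nat.card (powMonoidHom 2 : B →* B).ker = 4 := by
    refine le_antisymm h4 ?_
    have h1 : (({1, q, r', q * r'} : Finset B) : Set B) ⊆ ((powMonoidHom 2 : B →* B).ker : Set B) := by
      intro c hc
      simp only [Finset.coe_insert, Finset.coe_singleton, Set.mem_insert_iff,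
        Set.mem_singleton_iff] at hc
      change c ^ 2 = 1
      rcases hc with rfl | rfl | rfl | rfl
      · exact one_pow 2
      · exact hq2
      · exact hr'2
      · rw [mul_pow, hq2, hr'2, one_mul]
    have h2 := Set.ncard_le_ncard h1 (Set.toFinite _)
    rw [Set.ncard_coe_finset] at h2
    refine le_trans (le_of_eq ?_) h2
    have hqq : q * q = 1 := by rw [← pow_two, hq2]
    have h1q : 1 ≠ q * r' := fun h => hqr (by
      have := congrArg (q * ·) h; simpa [← mul_assoc, hqq] using this)
    rw [Finset.card_insert_of_notMem, Finset.card_insert_of_notMem, Finset.card_insert_of_notMem,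
      Finset.card_singleton]
    · simpa using hq1
    · simp [hqr, hr'1]
    · simp [hq1.symm, hr'1.symm, h1q]
  have hS : Nat.card (powMonoidHom 2 : B →* B).range = 2 ^ (m + 1) := by
    rw [hK, hB, show m + 2 + 1 = 2 + (m + 1) by ring, pow_add] at c1
    exact Nat.eq_of_mul_eq_mul_left four_pos c1
  refine ⟨h4, hS, h, ?_, hh⟩
  change h ^ 2 ^ (m + 1) = _ ∨ h ^ 2 ^ (m + 1) = _
  have : h ^ 2 ^ (m + 1) = r' := by
    apply hro _ hh
    · rw [← pow_mul, mul_comm, pow_mul]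
      have : (⟨h ^ 2, h, rfl⟩ : (powMonoidHom 2 : B →* B).range) ^ 2 ^ (m + 1) = 1 := by
        rw [← hS, pow_card_eq_one']
      exact congrArg Subtype.val this
    · rw [pow_succ, pow_mul, map_pow, sq_eq_one_of_monoidHom]
  rw [this]
  exact hr'

theorem two_group_structure {A D B : Type*} [CommGroup A] [CommGroup D] [CommGroup B] [Finite A]
    [Finite D] [Finite B] {n m : ℕ} (hn : 1 ≤ n) (hm : 2 ≤ m)
    (hA : ∀ a : A, ∃ t, a ^ 2 ^ t = 1)
    (hA4 : Nat.card (powMonoidHom 2 : A →* A).ker ≤ 4)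
    (φ₁ φ₃ : A →* ℤ) {u v : A} (hu : φ₁ u = -1) (hv : φ₁ v = 1) (hv' : φ₃ v = -1)
    (jd : D →* A) (jm : B →* A) (Nd : A →* D) (Nm : A →* B)
    (hjd₁ : ∀ c, φ₁ (jd c) = 1) (hjd₃ : ∀ c, φ₃ (jd c) = 1)
    (hjm₁ : ∀ c, φ₁ (jm c) = 1) (hjm₃ : ∀ c, φ₃ (jm c) = 1)
    (h4 : ∀ a, a ^ 4 = jd (Nd a) * jm (Nm a))
    (hjd : ∀ c, jd c = 1 ↔ c ^ 2 = 1)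
    (hD : Nat.card D = 2 ^ n) {b₀ : D} (hD2 : ∀ c : D, c ^ 2 = 1 → c = 1 ∨ c = b₀)
    (χ : D →* ℤ) (hχ : ∀ a, χ (Nd a) = φ₁ a)
    (hB : Nat.card B = 2 ^ (m + 1)) {q r : B} (hq2 : q ^ 2 = 1) (hr2 : r ^ 2 = 1)
    (hB2 : ∀ c : B, c ^ 2 = 1 → c = 1 ∨ c = q ∨ c = r ∨ c = q * r)
    (hjq : jm q = 1) (hjr : jm r = 1) (χp χ4 : B →* ℤ) (hχpq : χp q = -1) (hχ4q : χ4 q = 1)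
    {w : B} (hχ4w : χ4 w = -1) (hχ4 : ∀ a, χ4 (Nm a) = 1)
    (M : Subgroup A) (hM : ∀ c, jd c ∈ M) (hM' : ∀ c : B, c ^ 2 = r ∨ c ^ 2 = q * r → jm c ∉ M)
    {x₀ : A} (hx₀ : x₀ ∈ M) (hx₀1 : x₀ ≠ 1) (hx₀φ₁ : φ₁ x₀ = 1) (hx₀φ₃ : φ₃ x₀ = 1) :
    Nonempty (Additive A ≃+ (ZMod (2 ^ m) × ZMod (2 ^ (n + 1)))) := by
  classical
  have hD4 : Nat.card (powMonoidHom 2 : D →* D).ker ≤ 2 :=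
    card_ker_two_le {1, b₀} Finset.card_le_two fun c hc => by simpa using hD2 c hc
  obtain ⟨hB4, hS, h, hh, hh1⟩ := exists_pow_generator hm hB hq2 hr2 hB2 χp hχpq
  have hg := pow_ne_one_of_char hn hD hD4 χ ((hχ u).trans hu)
  have hg2 : (Nd u) ^ 2 ^ n = 1 := by rw [← hD, pow_card_eq_one']
  have hjh : jm (h ^ 2 ^ (m - 1)) = 1 := by
    rcases hh with e | e <;> rw [e]
    · exact hjr
    · rw [map_mul, hjq, hjr, one_mul]
  have hE : ∀ b, χ4 b = 1 → ∃ y, jm b = jm (y ^ 2) := by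
    intro b hb
    rcases eq_or_of_monoidHom χp b with h | h
    · obtain ⟨y, rfl⟩ := exists_sq_of_chars hB4 χ4 χp hχ4w hχ4q hχpq hb h
      exact ⟨y, rfl⟩
    · obtain ⟨y, hy⟩ := exists_sq_of_chars hB4 χ4 χp hχ4w hχ4q hχpq (a := q * b)
        (by rw [map_mul, hχ4q, hb, one_mul]) (by rw [map_mul, hχpq, h]; rfl)
      exact ⟨y, by rw [hy, map_mul, hjq, one_mul]⟩
  have hsq {a : A} (h1 : φ₁ a = 1) (h3 : φ₃ a = 1) : ∃ b, b ^ 2 = a :=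
    exists_sq_of_chars hA4 φ₁ φ₃ hu hv hv' h1 h3
  obtain ⟨n, rfl⟩ := Nat.exists_eq_add_of_le' hn
  obtain ⟨m, rfl⟩ := Nat.exists_eq_add_of_le' hm
  rw [Nat.add_sub_cancel] at hg
  change h ^ 2 ^ (m + 1) = _ ∨ h ^ 2 ^ (m + 1) = _ at hh
  change h ^ 2 ^ (m + 1) ≠ 1 at hh1
  change jm (h ^ 2 ^ (m + 1)) = 1 at hjh
  change Nat.card _ = 2 ^ (m + 1) at hS
  obtain ⟨Y, hY⟩ := hsq (hjm₁ h) (hjm₃ h)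
  have hY' : Y ^ 2 ^ (m + 1) = jm (h ^ 2 ^ m) := by
    rw [pow_succ', pow_mul, hY, map_pow]
  have hYM : Y ^ 2 ^ (m + 1) ∉ M := by
    rw [hY']
    apply hM'
    rwa [← pow_mul, ← pow_succ]
  obtain ⟨X, hXM, hX1, hX2⟩ : ∃ X : A, X ^ 2 ^ (n + 1) ∈ M ∧ X ^ 2 ^ (n + 1) ≠ 1 ∧
      (X ^ 2 ^ (n + 1)) ^ 2 = 1 := by
    cases n with
    | zero =>
      obtain ⟨t, ht⟩ := hA x₀
      have hex : ∃ t, x₀ ^ 2 ^ t = 1 := ⟨t, ht⟩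
      obtain ⟨l, hl⟩ : ∃ l, Nat.find hex = l + 1 := by
        apply Nat.exists_eq_succ_of_ne_zero
        rw [Ne, Nat.find_eq_zero hex]
        simpa using hx₀1
      obtain ⟨X, hX⟩ := hsq (a := x₀ ^ 2 ^ l) (by rw [map_pow, hx₀φ₁, one_pow])
        (by rw [map_pow, hx₀φ₃, one_pow])
      refine ⟨X, ?_⟩
      rw [zero_add, pow_one, hX]
      refine ⟨pow_mem hx₀ _, Nat.find_min hex (m := l) (by omega), ?_⟩
      rw [← pow_mul, ← pow_succ, ← hl]
      exact Nat.find_spec hex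
    | succ n =>
      obtain ⟨y, hy⟩ := hE _ (hχ4 u)
      obtain ⟨z, hz⟩ := hsq (hjm₁ y) (hjm₃ y)
      have h5 : (u * z⁻¹) ^ 4 = jd (Nd u) := by
        rw [mul_pow, h4, hy, map_pow, ← hz, ← pow_mul, mul_assoc, inv_pow, mul_inv_cancel, mul_one]
      have h6 : (u * z⁻¹) ^ 2 ^ (n + 1 + 1) = jd (Nd u ^ 2 ^ n) := by
        rw [pow_succ', pow_succ', ← mul_assoc, pow_mul]
        change ((u * z⁻¹) ^ 4) ^ 2 ^ n = _
        rw [h5, map_pow]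
      refine ⟨u * z⁻¹, ?_⟩
      rw [h6]
      refine ⟨hM _, ?_, ?_⟩
      · rwa [Ne, hjd, ← pow_mul, ← pow_succ]
      · rw [← map_pow, hjd, ← pow_mul, ← pow_mul]
        rw [pow_succ, pow_succ, mul_assoc] at hg2
        exact hg2
  refine nonempty_addEquiv_of_pow hX2 hX1 (Y := Y) (s := n + 1) (t := m + 1) ?_ ?_ ?_ ?_
  · rw [hY', ← map_pow, ← pow_mul, ← pow_succ]
    exact hjh
  · exact fun e => hYM (e ▸ one_mem _)
  · exact fun e => hYM (e ▸ hXM)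
  have c1 := card_ker_mul_card_range (powMonoidHom 4 : A →* A)
  have k1 : Nat.card (powMonoidHom 4 : A →* A).ker ≤ 4 ^ 2 :=
    card_le_of_forall_pow_eq_one 2 _ ((card_ker_subgroup_le _).trans hA4) fun x =>
      Subtype.ext x.2
  let f : (powMonoidHom 2 : B →* B).range →* A := jm.comp (Subgroup.subtype _)
  have k2 : Nat.card f.range ≤ 2 ^ m := by
    have e := card_ker_mul_card_range f
    have hr : h ^ 2 ^ (m + 1) ∈ (powMonoidHom 2 : B →* B).range :=
      ⟨h ^ 2 ^ m, by rw [powMonoidHom_apply, ← pow_mul, ← pow_succ]⟩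
    have hk : f ⟨_, hr⟩ = 1 := by
      rw [MonoidHom.comp_apply]
      exact hjh
    have : (⟨⟨_, hr⟩, hk⟩ : f.ker) ≠ 1 := fun e => hh1 (congrArg
      (fun x : f.ker => ((x : (powMonoidHom 2 : B →* B).range) : B)) e)
    have := two_le_card_of_ne this
    rw [hS, pow_succ] at e
    nlinarith
  have k3 : Nat.card jd.range ≤ 2 ^ n := by
    have e := card_ker_mul_card_range jd
    have : (⟨Nd u ^ 2 ^ n, by rw [MonoidHom.mem_ker, hjd, ← pow_mul, ← pow_succ]; exact hg2⟩ :
        jd.ker) ≠ 1 := fun e => hg (congrArg Subtype.val e)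
    have := two_le_card_of_ne this
    rw [hD, pow_succ] at e
    nlinarith
  have k4 : Nat.card (powMonoidHom 4 : A →* A).range ≤ Nat.card jd.range * Nat.card f.range := by
    rw [← Nat.card_prod]
    choose g hg using fun x : (powMonoidHom 4 : A →* A).range => x.2
    choose y hy using fun a => hE _ (hχ4 a)
    refine Nat.card_le_card_of_injective (fun x => (⟨jd (Nd (g x)), _, rfl⟩,
      ⟨jm (y (g x) ^ 2), ⟨y (g x) ^ 2, y (g x), rfl⟩, rfl⟩)) fun x x' hxx => ?_
    have e1 : jd (Nd (g x)) = jd (Nd (g x')) := congrArg (fun p => (p.1 : A)) hxx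
    have e2 : jm (y (g x) ^ 2) = jm (y (g x') ^ 2) := congrArg (fun p => (p.2 : A)) hxx
    apply Subtype.ext
    rw [← hg x, ← hg x', powMonoidHom_apply, powMonoidHom_apply, h4, h4, hy, hy, e1, e2]
  rw [← c1]
  calc _ ≤ 4 ^ 2 * (2 ^ n * 2 ^ m) :=
        Nat.mul_le_mul k1 (k4.trans (Nat.mul_le_mul k3 k2))
    _ = _ := by ring

end TwoGroups

section Restrict
variable {k K : Type*} [Field k] [NumberField k] [Field K] [NumberField K] [Algebra k K]

theorem isFixedField_fixedField (H : Subgroup Gal(K/ℚ)) : IsFixedField (fixedField H) H := by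
  intro x
  constructor
  · rintro ⟨y, rfl⟩ g hg
    exact y.2 ⟨g, hg⟩
  · intro h
    exact ⟨⟨x, fun g => h g g.2⟩, rfl⟩

theorem IsFixedField.exists_restrict {H : Subgroup Gal(K/ℚ)} (h : IsFixedField k H)
    (g : Gal(K/ℚ)) (hg : ∀ a ∈ H, a * g = g * a) :
    ∃ τ : Gal(k/ℚ), ∀ x : 𝓞 k,
      algebraMap (𝓞 k) (𝓞 K) (τ • x) = g • algebraMap (𝓞 k) (𝓞 K) x := by
  have key (x : k) : ∃ y : k, algebraMap k K y = g (algebraMap k K x) := (h _).2 fun a ha => by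
    rw [← AlgEquiv.mul_apply, hg a ha, AlgEquiv.mul_apply, (h _).1 ⟨x, rfl⟩ a ha]
  choose f hf using key
  have inj := (algebraMap k K).injective
  let F : k →ₐ[ℚ] k :=
    { toFun := f
      map_one' := inj (by rw [hf, map_one, map_one])
      map_zero' := inj (by rw [hf, map_zero, map_zero])
      map_mul' := fun x y => inj (by simp only [hf, map_mul])
      map_add' := fun x y => inj (by simp only [hf, map_add])
      commutes' := fun q => inj (by
        rw [hf, ← IsScalarTower.algebraMap_apply, g.commutes]) }
  refine ⟨AlgEquiv.ofBijective F (Algebra.IsAlgebraic.algHom_bijective F), fun x => ?_⟩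
  apply RingOfIntegers.ext
  exact hf x

theorem algebraMap_ringOfIntegers_injective :
    Function.Injective (algebraMap (𝓞 k) (𝓞 K)) := fun x y hxy => by
  apply RingOfIntegers.ext
  apply (algebraMap k K).injective
  exact congrArg (algebraMap (𝓞 K) K) hxy

end Restrict

/-- The field `ℚ(√2, √(p₁p₂), i)` together with generators of its Galois group. -/
structure Octic (p₁ p₂ : ℕ) (K : Type*) [Field K] [NumberField K] where
  im : 𝓞 K
  r2 : 𝓞 K
  rd : 𝓞 K
  im_sq : im ^ 2 = -1
  r2_sq : r2 ^ 2 = 2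
  rd_sq : rd ^ 2 = p₁ * p₂
  σ : Gal(K/ℚ)
  J : Gal(K/ℚ)
  s : Gal(K/ℚ)
  σ_im : σ • im = im
  σ_r2 : σ • r2 = r2
  σ_rd : σ • rd = -rd
  J_im : J • im = -im
  J_r2 : J • r2 = r2
  J_rd : J • rd = rd
  s_im : s • im = im
  s_r2 : s • r2 = -r2
  s_rd : s • rd = rd
  comm : ∀ g h : Gal(K/ℚ), g * h = h * g
  invol : ∀ g : Gal(K/ℚ), g * g = 1
  fix : ∀ x : K, σ x = x → J x = x → s x = x → x ∈ Set.range (algebraMap ℚ K)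
  conj : ∀ (φ : K →+* ℂ) (x : K), φ (J x) = starRingEnd ℂ (φ x)
  rank : Module.finrank ℚ K = 8

namespace Octic
variable {p₁ p₂ : ℕ} {K : Type*} [Field K] [NumberField K] (S : Octic p₁ p₂ K)
include S

theorem smul_smul_self {α : Type*} [MulAction Gal(K/ℚ) α] (g : Gal(K/ℚ)) (x : α) :
    g • g • x = x := by rw [smul_smul, S.invol, one_smul]

theorem smul_smul_comm {α : Type*} [MulAction Gal(K/ℚ) α] (g h : Gal(K/ℚ)) (x : α) :
    g • h • x = h • g • x := by rw [smul_smul, S.comm, ← smul_smul]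

theorem im_ne : S.im ≠ 0 := fun h => by have := S.im_sq; rw [h] at this; simp at this

theorem r2_ne : S.r2 ≠ 0 := fun h => by have := S.r2_sq; rw [h] at this; simp at this

theorem rd_ne [Fact p₁.Prime] [Fact p₂.Prime] : S.rd ≠ 0 := fun h => by
  have := S.rd_sq
  rw [h, zero_pow two_ne_zero, eq_comm, mul_eq_zero, Nat.cast_eq_zero, Nat.cast_eq_zero] at this
  rcases this with h | h
  · exact (Fact.out : p₁.Prime).ne_zero h
  · exact (Fact.out : p₂.Prime).ne_zero h

theorem exists_int {x : 𝓞 K} (h1 : S.σ • x = x) (h2 : S.J • x = x) (h3 : S.s • x = x) :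
    ∃ n : ℤ, (n : 𝓞 K) = x := by
  obtain ⟨q, hq⟩ := S.fix x (congrArg (algebraMap (𝓞 K) K) h1)
    (congrArg (algebraMap (𝓞 K) K) h2) (congrArg (algebraMap (𝓞 K) K) h3)
  have hint : IsIntegral ℤ q := by
    rw [← isIntegral_algebraMap_iff (algebraMap ℚ K).injective, hq]
    exact x.isIntegral_coe
  obtain ⟨n, rfl⟩ := IsIntegrallyClosed.isIntegral_iff.1 hint
  refine ⟨n, RingOfIntegers.ext ?_⟩
  rw [← hq]
  simp

theorem exists_zeta : ∃ z : 𝓞 K, z ^ 2 = S.im ∧ 2 * z = S.r2 * (1 + S.im) := by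
  have hr : (S.r2 : K) ^ 2 = 2 := congrArg (algebraMap (𝓞 K) K) S.r2_sq
  have hi : (S.im : K) ^ 2 = -1 := congrArg (algebraMap (𝓞 K) K) S.im_sq
  have hz : ((S.r2 : K) * (1 + S.im) / 2) ^ 2 = S.im := by
    linear_combination ((1 + S.im : K) ^ 2 / 4) * hr + (1 / 2 : K) * hi
  have hint : IsIntegral ℤ ((S.r2 : K) * (1 + S.im) / 2) := by
    refine IsIntegral.of_pow two_pos ?_
    rw [hz]
    exact S.im.isIntegral_coe
  obtain ⟨z, hz'⟩ := (IsIntegralClosure.isIntegral_iff (A := 𝓞 K)).1 hint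
  refine ⟨z, RingOfIntegers.ext ?_, RingOfIntegers.ext ?_⟩
  · change algebraMap (𝓞 K) K _ = _
    rw [map_pow, hz', hz]
  · change algebraMap (𝓞 K) K _ = algebraMap (𝓞 K) K _
    rw [map_mul, hz', map_mul, map_add, map_one, map_ofNat]
    ring

theorem exists_half (hd : (p₁ * p₂) % 4 = 1) : ∃ w : 𝓞 K, 2 * w = 1 + S.rd := by
  have hr : (S.rd : K) ^ 2 = p₁ * p₂ := by simpa using congrArg (algebraMap (𝓞 K) K) S.rd_sq
  obtain ⟨t, ht⟩ : ∃ t, p₁ * p₂ = 4 * t + 1 := ⟨p₁ * p₂ / 4, by omega⟩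
  have ht' : (p₁ : K) * p₂ = 4 * t + 1 := by exact_mod_cast ht
  have hint : IsIntegral ℤ ((1 + (S.rd : K)) / 2) := by
    refine ⟨Polynomial.X ^ 2 - Polynomial.X - Polynomial.C (t : ℤ), by monicity!, ?_⟩
    simp
    linear_combination (1 / 4 : K) * hr + (1 / 4 : K) * ht'
  obtain ⟨z, hz'⟩ := (IsIntegralClosure.isIntegral_iff (A := 𝓞 K)).1 hint
  refine ⟨z, RingOfIntegers.ext ?_⟩
  change algebraMap (𝓞 K) K _ = algebraMap (𝓞 K) K _
  rw [map_mul, hz', map_add, map_one, map_ofNat]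
  ring

/-- A primitive eighth root of unity. -/
noncomputable def ζ : 𝓞 K := S.exists_zeta.choose

theorem ζ_sq : S.ζ ^ 2 = S.im := S.exists_zeta.choose_spec.1

theorem two_mul_ζ : 2 * S.ζ = S.r2 * (1 + S.im) := S.exists_zeta.choose_spec.2

theorem ζ_pow_eight : S.ζ ^ 8 = 1 := by
  linear_combination (S.ζ ^ 6 + S.ζ ^ 4 * S.im + S.ζ ^ 2 * S.im ^ 2 + S.im ^ 3) * S.ζ_sq +
    (S.im ^ 2 - 1) * S.im_sq

theorem ζ_isUnit : IsUnit S.ζ := IsUnit.of_pow_eq_one S.ζ_pow_eight (by norm_num)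

theorem im_isUnit : IsUnit S.im := S.ζ_sq ▸ S.ζ_isUnit.pow 2

theorem smul_two (g : Gal(K/ℚ)) : g • (2 : 𝓞 K) = 2 := map_ofNat (MulSemiringAction.toRingHom _ _ g) 2

theorem smul_natCast (g : Gal(K/ℚ)) (n : ℕ) : g • (n : 𝓞 K) = n :=
  map_natCast (MulSemiringAction.toRingHom _ _ g) n

theorem smul_intCast (g : Gal(K/ℚ)) (n : ℤ) : g • (n : 𝓞 K) = n :=
  map_intCast (MulSemiringAction.toRingHom _ _ g) n

theorem σ_ζ : S.σ • S.ζ = S.ζ := by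
  apply mul_left_cancel₀ (two_ne_zero (α := 𝓞 K))
  rw [← S.smul_two S.σ, ← smul_mul', S.smul_two, S.two_mul_ζ, smul_mul', smul_add, smul_one, S.σ_im,
    S.σ_r2]

theorem s_ζ : S.s • S.ζ = -S.ζ := by
  apply mul_left_cancel₀ (two_ne_zero (α := 𝓞 K))
  nth_rw 1 [← S.smul_two S.s]
  rw [← smul_mul', mul_neg, S.two_mul_ζ, smul_mul', smul_add, smul_one, S.s_im, S.s_r2]
  ring

theorem J_ζ : S.J • S.ζ = -(S.im * S.ζ) := by
  apply mul_left_cancel₀ (two_ne_zero (α := 𝓞 K))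
  nth_rw 1 [← S.smul_two S.J]
  rw [← smul_mul', S.two_mul_ζ, smul_mul', smul_add, smul_one, S.J_im, S.J_r2]
  linear_combination S.im * S.two_mul_ζ + S.r2 * S.im_sq

theorem exists_quadField {k : Type*} [Field k] [NumberField k] [Algebra k K]
    {H : Subgroup Gal(K/ℚ)} (hk : IsFixedField k H) {D : ℤ} (hD : D ≠ 0)
    (hH : ∀ x : K, (∀ g ∈ H, g x = x) → S.σ x = x → x ∈ Set.range (algebraMap ℚ K))
    {x : 𝓞 K} (hx : ∀ g ∈ H, g • x = x) (hσ : S.σ • x = -x) (hxD : x ^ 2 = (D : 𝓞 K)) :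
    ∃ Q : QuadField D k, algebraMap (𝓞 k) (𝓞 K) Q.rt = x ∧
      ∀ y : 𝓞 k, algebraMap (𝓞 k) (𝓞 K) (Q.τ • y) = S.σ • algebraMap (𝓞 k) (𝓞 K) y := by
  obtain ⟨τ, hτ⟩ := hk.exists_restrict S.σ fun a _ => S.comm _ _
  obtain ⟨y, rfl⟩ := hk.exists_of_smul_eq hx
  have inj := algebraMap_ringOfIntegers_injective (k := k) (K := K)
  have h1 : τ * τ = 1 := by
    ext x
    obtain ⟨a, b, -, rfl⟩ := IsFractionRing.div_surjective (A := 𝓞 k) x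
    have (c : 𝓞 k) : τ • τ • c = c := inj (by rw [hτ, hτ, S.smul_smul_self])
    have h (c : 𝓞 k) : τ (τ (algebraMap (𝓞 k) k c)) = algebraMap (𝓞 k) k c :=
      congrArg (algebraMap (𝓞 k) k) (this c)
    rw [AlgEquiv.mul_apply, map_div₀, map_div₀, h, h]
    rfl
  refine ⟨⟨y, inj ?_, τ, inj ?_, h1, fun c hc => ?_, hD⟩, rfl, hτ⟩
  · rw [map_pow, hxD, map_intCast]
  · rw [hτ, hσ, map_neg]
  · obtain ⟨a, b, hb, rfl⟩ := IsFractionRing.div_surjective (A := 𝓞 k) c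
    have hτ' (c : k) : algebraMap k K (τ c) = S.σ (algebraMap k K c) := by
      obtain ⟨a, b, hb, rfl⟩ := IsFractionRing.div_surjective (A := 𝓞 k) c
      have h (c : 𝓞 k) : algebraMap k K (τ (algebraMap (𝓞 k) k c)) =
          S.σ (algebraMap k K (algebraMap (𝓞 k) k c)) := congrArg (algebraMap (𝓞 K) K) (hτ c)
      simp only [map_div₀, h]
    obtain ⟨q, hq⟩ := hH (algebraMap k K (algebraMap (𝓞 k) k a / algebraMap (𝓞 k) k b))
      (fun g hg => (hk _).1 ⟨_, rfl⟩ g hg) (by rw [← hτ', hc])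
    exact ⟨q, (algebraMap k K).injective (by rw [← hq, ← IsScalarTower.algebraMap_apply])⟩

end Octic

section MapInjective
variable {k K : Type*} [Field k] [NumberField k] [Field K] [NumberField K] [Algebra k K]

theorem map_algebraMap_injective {I J : Ideal (𝓞 k)}
    (h : I.map (algebraMap (𝓞 k) (𝓞 K)) = J.map (algebraMap (𝓞 k) (𝓞 K))) : I = J := by
  have h0 : Module.finrank (𝓞 k) (𝓞 K) ≠ 0 := by
    rw [← IsFractionRing.finrank_eq (𝓞 k) k (𝓞 K) K]
    exact Module.finrank_pos.ne'
  have h1 := congrArg (Ideal.relNorm (𝓞 k)) h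
  rw [Ideal.relNorm_algebraMap, Ideal.relNorm_algebraMap] at h1
  apply dvd_antisymm'
  · exact (UniqueFactorizationMonoid.pow_dvd_pow_iff_dvd h0).1 h1.symm.dvd
  · exact (UniqueFactorizationMonoid.pow_dvd_pow_iff_dvd h0).1 h1.dvd

end MapInjective

theorem QuadField.sq_ne_span_two {D : ℤ} {k : Type*} [Field k] [NumberField k] (Q : QuadField D k)
    (hD : D % 8 = 1) (I : Ideal (𝓞 k)) : I ^ 2 ≠ Ideal.span {2} := by
  intro h
  have hP := Q.isPrime_of_sq Nat.prime_two (I := I) (by exact_mod_cast h)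
  obtain ⟨ω, hω⟩ := Q.exists_half (by omega)
  have h1 := congrArg (Q.τ • ·) hω
  simp only [smul_mul', smul_add, smul_one, Q.τ_rt] at h1
  have h2 : Q.τ • (2 : 𝓞 k) = 2 := by exact_mod_cast Q.smul_natCast 2
  rw [h2] at h1
  have hs : ω + Q.τ • ω = 1 := by
    apply mul_left_cancel₀ (two_ne_zero (α := 𝓞 k))
    linear_combination hω + h1
  have h2I : (2 : 𝓞 k) ∈ I := Ideal.pow_le_self two_ne_zero
    (h ▸ Ideal.mem_span_singleton_self _)
  obtain ⟨t, ht⟩ : ∃ t : ℤ, D = 8 * t + 1 := ⟨D / 8, by omega⟩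
  have ht' := congrArg (Int.cast : ℤ → 𝓞 k) ht
  push_cast at ht'
  have hω2 : ω * Q.τ • ω = 2 * (-t) := by
    apply mul_left_cancel₀ (mul_ne_zero (two_ne_zero (α := 𝓞 k)) two_ne_zero)
    linear_combination (2 * Q.τ • ω) * hω + (1 + Q.rt) * h1 - Q.sq - ht'
  have hmem : ω * Q.τ • ω ∈ I := hω2 ▸ I.mul_mem_right _ h2I
  have hτI : Q.τ • I = I := Ideal.sq_inj (by
    rw [← smul_pow', h, smul_span_singleton, h2])
  have hboth (x : 𝓞 k) (hx : x ∈ I) : Q.τ • x ∈ I := by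
    have h := Ideal.smul_mem_pointwise_smul Q.τ x I hx
    rwa [hτI] at h
  apply hP.ne_top
  rw [Ideal.eq_top_iff_one, ← hs]
  rcases hP.mem_or_mem hmem with hm | hm
  · exact I.add_mem hm (hboth _ hm)
  · have := hboth _ hm
    rw [Q.ττ] at this
    exact I.add_mem this hm

namespace Octic
variable {p₁ p₂ : ℕ} {K : Type*} [Field K] [NumberField K] (S : Octic p₁ p₂ K)
include S

theorem ζ_ne : S.ζ ≠ 0 := S.ζ_isUnit.ne_zero

theorem ζ_mul_J : S.ζ * S.J • S.ζ = 1 := by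
  rw [S.J_ζ]
  linear_combination -S.im * S.ζ_sq - S.im_sq

theorem sq_ne_ζ (x : 𝓞 K) : x ^ 2 ≠ S.ζ := by
  intro h
  have hx : x ≠ 0 := by rintro rfl; exact S.ζ_ne (by rw [← h]; ring)
  have h1 : (S.s • x) ^ 2 = (S.im * x) ^ 2 := by
    rw [← smul_pow', h, S.s_ζ, mul_pow, h, S.im_sq, neg_one_mul]
  have h2 : S.s • S.s • x = -x := by
    rcases sq_eq_sq_iff_eq_or_eq_neg.1 h1 with e | e
    · rw [e, smul_mul', S.s_im, e, ← mul_assoc, ← pow_two, S.im_sq, neg_one_mul]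
    · rw [e, smul_neg, smul_mul', S.s_im, e, mul_neg, neg_neg, ← mul_assoc, ← pow_two, S.im_sq,
        neg_one_mul]
  rw [S.smul_smul_self] at h2
  exact hx (self_eq_neg.1 h2)

theorem sq_ne_ζ_pow_odd (x : 𝓞 K) (j : ℕ) : x ^ 2 ≠ S.ζ ^ (2 * j + 1) := by
  intro h
  apply S.sq_ne_ζ (x * S.ζ ^ (7 * j))
  rw [mul_pow, h, ← pow_mul, ← pow_add, show 2 * j + 1 + 7 * j * 2 = 8 * (2 * j) + 1 by ring,
    pow_succ, pow_mul, S.ζ_pow_eight, one_pow, one_mul]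

theorem ζ_pow_four : S.ζ ^ 4 = -1 := by
  linear_combination (S.ζ ^ 2 + S.im) * S.ζ_sq + S.im_sq

theorem exists_eq_ζ_pow (e : ℕ) {x : 𝓞 K} (hx : x ^ 2 ^ e = 1) : ∃ j, x = S.ζ ^ j := by
  induction e generalizing x with
  | zero => exact ⟨0, by simpa using hx⟩
  | succ e ih =>
    obtain ⟨j, hj⟩ := ih (x := x ^ 2) (by rw [← pow_mul, ← pow_succ', hx])
    obtain ⟨k, rfl | rfl⟩ := Nat.even_or_odd' j
    · rw [mul_comm 2, pow_mul, sq_eq_sq_iff_eq_or_eq_neg] at hj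
      rcases hj with e | e
      · exact ⟨k, e⟩
      · exact ⟨k + 4, by rw [e, pow_add, S.ζ_pow_four, mul_neg_one]⟩
    · exact absurd hj (S.sq_ne_ζ_pow_odd x k)

theorem exists_pow_eq_ζ_pow {x : 𝓞 K} (hx : x * S.J • x = 1) :
    ∃ w j, x ^ (2 * w + 1) = S.ζ ^ j := by
  have h1 : ∀ φ : K →+* ℂ, ‖φ x‖ = 1 := by
    intro φ
    have := congrArg (fun y : 𝓞 K => φ y) hx
    simp only [map_mul, map_one] at this
    rw [show algebraMap (𝓞 K) K (S.J • x) = S.J (x : K) from rfl, S.conj, Complex.mul_conj,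
      Complex.normSq_eq_norm_sq] at this
    have h2 : ‖φ x‖ ^ 2 = 1 := by exact_mod_cast this
    nlinarith [norm_nonneg (φ x)]
  obtain ⟨n, hn, h⟩ := NumberField.Embeddings.pow_eq_one_of_norm_eq_one K ℂ x.isIntegral_coe h1
  have h : x ^ n = 1 := RingOfIntegers.ext (by
    change algebraMap (𝓞 K) K (x ^ n) = algebraMap (𝓞 K) K 1
    rw [map_pow, h, map_one])
  obtain ⟨e, u, hu, rfl⟩ := Nat.exists_eq_two_pow_mul_odd hn.ne'
  obtain ⟨w, rfl⟩ := hu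
  obtain ⟨j, hj⟩ := S.exists_eq_ζ_pow e (x := x ^ (2 * w + 1)) (by
    rw [← pow_mul, mul_comm, h])
  exact ⟨w, j, hj⟩

theorem J_ne_one : S.J ≠ 1 := fun h => by
  have := S.J_im
  rw [h, one_smul] at this
  exact S.im_ne (self_eq_neg.1 this)

theorem σ_ne_one [Fact p₁.Prime] [Fact p₂.Prime] : S.σ ≠ 1 := fun h => by
  have := S.σ_rd
  rw [h, one_smul] at this
  exact S.rd_ne (self_eq_neg.1 this)

theorem s_ne_one : S.s ≠ 1 := fun h => by
  have := S.s_r2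
  rw [h, one_smul] at this
  exact S.r2_ne (self_eq_neg.1 this)

theorem J_ne_s : S.J ≠ S.s := fun h => by
  have := S.J_im
  rw [h, S.s_im] at this
  exact S.im_ne (self_eq_neg.1 this)

/-- `k` is the field `ℚ(√d)`. -/
abbrev IsReal (k : Type*) [Field k] [Algebra k K] : Prop :=
  IsFixedField k (quadSubgroup S.J S.s (S.invol _) (S.invol _) (S.comm _ _))

theorem exists_quadField_real [Fact p₁.Prime] [Fact p₂.Prime]
    {k : Type*} [Field k] [NumberField k] [Algebra k K] (hk : S.IsReal k) :
    ∃ Q : QuadField (p₁ * p₂ : ℤ) k, algebraMap (𝓞 k) (𝓞 K) Q.rt = S.rd ∧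
      ∀ y : 𝓞 k, algebraMap (𝓞 k) (𝓞 K) (Q.τ • y) = S.σ • algebraMap (𝓞 k) (𝓞 K) y := by
  have h1 := (Fact.out : p₁.Prime).ne_zero
  have h2 := (Fact.out : p₂.Prime).ne_zero
  refine S.exists_quadField hk (by positivity) (fun x hx hσ => S.fix x hσ (hx _ (Or.inr (Or.inl rfl)))
    (hx _ (Or.inr (Or.inr (Or.inl rfl))))) ?_ S.σ_rd (by rw [S.rd_sq]; push_cast; rfl)
  rintro g (rfl | rfl | rfl | rfl)
  · exact one_smul _ _
  · exact S.J_rd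
  · exact S.s_rd
  · rw [mul_smul, S.s_rd, S.J_rd]

/-- Hilbert 90 for units and complex conjugation. -/
theorem exists_smul_eq_of_mul_smul_eq_map [Fact p₁.Prime] [Fact p₂.Prime]
    (hd : (p₁ * p₂) % 8 = 1)
    {k : Type*} [Field k] [NumberField k] [Algebra k K] (hk : S.IsReal k)
    {g θ : 𝓞 K} (hg : g ≠ 0) (hθ : g = θ * S.J • g) {I : Ideal (𝓞 k)}
    (hI : Ideal.span {g * S.s • g} = I.map (algebraMap (𝓞 k) (𝓞 K))) :
    ∃ ξ : 𝓞 K, ξ * S.J • ξ = 1 ∧ (∀ h : Gal(K/ℚ), h • S.ζ = S.ζ → h • θ = θ → h • ξ = ξ) ∧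
      S.J • (ξ * g) = ξ * g := by
  have hJg : S.J • g = S.J • θ * g := by
    have := congrArg (S.J • ·) hθ
    simpa only [smul_mul', S.smul_smul_self] using this
  have hθ1 : θ * S.J • θ = 1 := by
    apply mul_right_cancel₀ hg
    rw [mul_assoc, ← hJg, ← hθ, one_mul]
  obtain ⟨w, j, hw⟩ := S.exists_pow_eq_ζ_pow hθ1
  have key (l : ℕ) : ((S.J • S.ζ) ^ l * θ ^ w) * S.J • ((S.J • S.ζ) ^ l * θ ^ w) = 1 := by
    rw [smul_mul', smul_pow', smul_pow', S.smul_smul_self]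
    calc _ = (S.ζ * S.J • S.ζ) ^ l * (θ * S.J • θ) ^ w := by ring
      _ = 1 := by rw [S.ζ_mul_J, hθ1, one_pow, one_pow, one_mul]
  have hfix (l : ℕ) (h : Gal(K/ℚ)) (h1 : h • S.ζ = S.ζ) (h2 : h • θ = θ) :
      h • ((S.J • S.ζ) ^ l * θ ^ w) = (S.J • S.ζ) ^ l * θ ^ w := by
    rw [smul_mul', smul_pow', smul_pow', S.smul_smul_comm, h1, h2]
  obtain ⟨l, rfl | rfl⟩ := Nat.even_or_odd' j
  · refine ⟨(S.J • S.ζ) ^ l * θ ^ w, key l, hfix l, ?_⟩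
    have h1 : ((S.J • S.ζ) ^ l * θ ^ w) ^ 2 * θ = 1 := by
      calc _ = (S.J • S.ζ) ^ (2 * l) * θ ^ (2 * w + 1) := by ring
        _ = 1 := by rw [hw, ← mul_pow, mul_comm, S.ζ_mul_J, one_pow]
    have h2 := key l
    generalize (S.J • S.ζ) ^ l * θ ^ w = ξ at *
    rw [smul_mul', hJg]
    calc _ = (S.J • ξ * S.J • θ * g) * (ξ ^ 2 * θ) := by rw [h1, mul_one, mul_assoc]
      _ = ξ * g * (ξ * S.J • ξ) * (θ * S.J • θ) := by ring
      _ = _ := by rw [h2, hθ1, mul_one, mul_one]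
  · exfalso
    set ξ := (S.J • S.ζ) ^ l * θ ^ w with hξ
    have h2 : ξ * S.J • ξ = 1 := key l
    have h1 : ξ ^ 2 * θ = S.ζ := by
      calc _ = (S.J • S.ζ) ^ (2 * l) * θ ^ (2 * w + 1) := by rw [hξ]; ring
        _ = (S.ζ * S.J • S.ζ) ^ (2 * l) * S.ζ := by rw [hw]; ring
        _ = _ := by rw [S.ζ_mul_J, one_pow, one_mul]
    clear_value ξ
    have h3 : S.J • (ξ * g) = S.J • S.ζ * (ξ * g) := by
      have h4 : S.J • S.ζ = (S.J • ξ) ^ 2 * S.J • θ := by rw [← h1, smul_mul', smul_pow']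
      rw [smul_mul', hJg, h4]
      calc _ = S.J • ξ * S.J • θ * g * (ξ * S.J • ξ) := by rw [h2, mul_one, mul_assoc]
        _ = _ := by ring
    set G := (1 + S.J • S.ζ) * (ξ * g) with hG
    have hJG : S.J • G = G := by
      rw [hG, smul_mul', smul_add, smul_one, S.smul_smul_self, h3]
      linear_combination (ξ * g) * S.ζ_mul_J
    have hJs : S.J • (G * S.s • G) = G * S.s • G := by
      rw [smul_mul', S.smul_smul_comm, hJG]
    have hss : S.s • (G * S.s • G) = G * S.s • G := by
      rw [smul_mul', S.smul_smul_self, mul_comm]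
    obtain ⟨y, hy⟩ := hk.exists_of_smul_eq_quad hJs hss
    have hGG : G * S.s • G = (1 + S.im) * (ξ * S.s • ξ) * (g * S.s • g) := by
      have : S.J • S.ζ * S.J • S.ζ = -S.im := by
        rw [← smul_mul', ← pow_two, S.ζ_sq, S.J_im]
      rw [hG, smul_mul', smul_mul', smul_add, smul_one, S.smul_smul_comm, S.s_ζ, smul_neg]
      linear_combination (-ξ * g * S.s • ξ * S.s • g) * this
    have hξu : IsUnit (ξ * S.s • ξ) := by
      apply IsUnit.of_mul_eq_one (b := S.J • (ξ * S.s • ξ))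
      rw [smul_mul', S.smul_smul_comm S.J S.s]
      calc _ = (ξ * S.J • ξ) * (S.s • (ξ * S.J • ξ)) := by rw [smul_mul']; ring
        _ = 1 := by rw [h2, smul_one, one_mul]
    have hspan : Ideal.span {y} ^ 2 = Ideal.span {2} * I ^ 2 := by
      apply map_algebraMap_injective (K := K)
      rw [Ideal.map_pow, Ideal.map_mul, Ideal.map_pow, Ideal.map_span, Ideal.map_span,
        Set.image_singleton, Set.image_singleton, hy, hGG, ← hI, map_ofNat,
        Ideal.span_singleton_pow, Ideal.span_singleton_pow, Ideal.span_singleton_mul_span_singleton]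
      have hu : IsUnit (S.im * (ξ * S.s • ξ) ^ 2) := S.im_isUnit.mul (hξu.pow 2)
      rw [← Ideal.span_singleton_mul_right_unit hu (2 * _)]
      congr 2
      linear_combination ((ξ * S.s • ξ) * (g * S.s • g)) ^ 2 * S.im_sq
    obtain ⟨Q, -, -⟩ := S.exists_quadField_real hk
    have hI0 : I ≠ ⊥ := by
      rintro rfl
      rw [Ideal.map_bot, Ideal.span_singleton_eq_bot, mul_eq_zero, smul_eq_zero_iff_eq] at hI
      exact hg (or_self_iff.1 hI)
    have hdvd : I ∣ Ideal.span {y} :=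
      (UniqueFactorizationMonoid.pow_dvd_pow_iff_dvd two_ne_zero).1 (hspan ▸ Dvd.intro_left _ rfl)
    obtain ⟨L, hL⟩ := hdvd
    refine Q.sq_ne_span_two (by exact_mod_cast hd) L (mul_right_cancel₀ (pow_ne_zero 2 hI0) ?_)
    rw [← hspan, hL]
    ring

end Octic

section EightPid
variable {K : Type*} [Field K] [NumberField K]

/-- The ring of integers of the eighth cyclotomic field is a principal ideal domain. -/
theorem isPrincipalIdealRing_of_primitive_eighth_root (hr : Module.finrank ℚ K = 4) (ζ : 𝓞 K)
    (hζ : ζ ^ 4 = -1) : IsPrincipalIdealRing (𝓞 K) := by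
  have hζK : (ζ : K) ^ 4 = -1 := by simpa using congrArg (algebraMap (𝓞 K) K) hζ
  have hprim : IsPrimitiveRoot (ζ : K) (2 ^ 3) := by
    apply IsPrimitiveRoot.iff_orderOf.2
    apply orderOf_eq_prime_pow
    · norm_num [hζK]
    · calc (ζ : K) ^ 2 ^ (2 + 1) = ((ζ : K) ^ 4) ^ 2 := by ring
        _ = 1 := by rw [hζK]; norm_num
  have hrank : Module.finrank ℚ ℚ⟮(ζ : K)⟯ = 4 := by
    rw [adjoin.finrank (hprim.isIntegral (by norm_num)).tower_top,
      ← Polynomial.cyclotomic_eq_minpoly_rat hprim (by norm_num), Polynomial.natDegree_cyclotomic]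
    decide
  have htop : ℚ⟮(ζ : K)⟯ = ⊤ := by
    rw [← IntermediateField.finrank_eq_one_iff_eq_top]
    have := Module.finrank_mul_finrank ℚ ℚ⟮(ζ : K)⟯ K
    rw [hrank, hr] at this
    omega
  have hcyc : IsCyclotomicExtension {2 ^ 3} ℚ K := by
    refine (IsCyclotomicExtension.iff_adjoin_eq_top _ _ _).2 ⟨?_, ?_⟩
    · rintro n rfl -
      exact ⟨ζ, hprim⟩
    · refine top_unique fun x _ => ?_
      have hx : x ∈ ℚ⟮(ζ : K)⟯ := htop ▸ IntermediateField.mem_top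
      rw [← IntermediateField.mem_toSubalgebra,
        IntermediateField.adjoin_simple_toSubalgebra_of_isAlgebraic
          (Algebra.IsAlgebraic.isAlgebraic _)] at hx
      refine Algebra.adjoin_mono ?_ hx
      rintro _ rfl
      exact ⟨2 ^ 3, rfl, by norm_num, hprim.pow_eq_one⟩
  have hdisc : discr K = 256 := by
    rw [IsCyclotomicExtension.Rat.discr_prime_pow 2 3 K]
    norm_num
    decide
  have hcp : InfinitePlace.nrComplexPlaces K = 2 := by
    rw [IsCyclotomicExtension.Rat.nrComplexPlaces_eq_totient_div_two (2 ^ 3) K (h := hcyc)]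
    decide
  refine RingOfIntegers.isPrincipalIdealRing_of_isPrincipal_of_norm_le_of_isPrime fun I hI hle => ?_
  rw [hr, hcp, hdisc] at hle
  have hpi : (4 / Real.pi) ^ 2 < 16 / 9 := by
    have := Real.pi_gt_three
    rw [div_pow, div_lt_div_iff₀ (by positivity) (by norm_num)]
    nlinarith
  have hsq : √|((256 : ℤ) : ℝ)| = 16 := by
    rw [Int.cast_ofNat, abs_of_nonneg (by norm_num), show (256 : ℝ) = 16 ^ 2 by norm_num,
      Real.sqrt_sq (by norm_num)]
  rw [hsq] at hle
  have hlt : (Ideal.absNorm (I : Ideal (𝓞 K)) : ℝ) < 3 := by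
    refine hle.trans_lt ?_
    norm_num [Nat.factorial] at hpi ⊢
    linarith
  have hlt' : Ideal.absNorm (I : Ideal (𝓞 K)) < 3 := by exact_mod_cast hlt
  have h0 : Ideal.absNorm (I : Ideal (𝓞 K)) ≠ 0 := Ideal.absNorm_ne_zero_of_nonZeroDivisors I
  have h1 : Ideal.absNorm (I : Ideal (𝓞 K)) ≠ 1 := fun h => hI.ne_top (Ideal.absNorm_eq_one_iff.1 h)
  have h2 : Ideal.absNorm (I : Ideal (𝓞 K)) = 2 := by omega
  have hmem : (2 : 𝓞 K) ∈ (I : Ideal (𝓞 K)) := by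
    have := Ideal.absNorm_mem (I : Ideal (𝓞 K))
    rwa [h2, Nat.cast_ofNat] at this
  have hfour : (1 - ζ) ^ 4 = 2 * (-2 * ζ + 3 * ζ ^ 2 - 2 * ζ ^ 3) := by
    linear_combination hζ
  have hz : 1 - ζ ∈ (I : Ideal (𝓞 K)) := hI.mem_of_pow_mem 4 (hfour ▸ Ideal.mul_mem_right _ _ hmem)
  have hu : IsUnit (-2 * ζ + 3 * ζ ^ 2 - 2 * ζ ^ 3) :=
    IsUnit.of_mul_eq_one (-2 * ζ ^ 3 - 3 * ζ ^ 2 - 2 * ζ) (by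
      linear_combination (4 * ζ ^ 2 - 1) * hζ)
  have hN : Ideal.absNorm (Ideal.span {1 - ζ}) = 2 := by
    have : Ideal.absNorm (Ideal.span {1 - ζ}) ^ 4 = 2 ^ 4 := by
      rw [← map_pow, Ideal.span_singleton_pow, hfour, Ideal.span_singleton_mul_right_unit hu,
        Ideal.absNorm_span_singleton, ← map_ofNat (algebraMap ℤ (𝓞 K)) 2, Algebra.norm_algebraMap,
        RingOfIntegers.rank, hr]
      rfl
    exact Nat.pow_left_injective (by norm_num : 4 ≠ 0) this
  have hle : Ideal.span {1 - ζ} ≤ (I : Ideal (𝓞 K)) := (Ideal.span_singleton_le_iff_mem _).2 hz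
  obtain ⟨L, hL⟩ := Ideal.dvd_iff_le.2 hle
  have hLN := congrArg Ideal.absNorm hL
  rw [map_mul, hN, h2] at hLN
  have hL1 : L = ⊤ := Ideal.absNorm_eq_one_iff.1 (by omega)
  rw [hL1, Ideal.mul_top] at hL
  exact ⟨1 - ζ, hL.symm⟩

end EightPid

namespace Octic
variable {p₁ p₂ : ℕ} {K : Type*} [Field K] [NumberField K] (S : Octic p₁ p₂ K)
include S

/-- The subgroup whose fixed field is `ℚ(ζ₈)`. -/
def subF : Subgroup Gal(K/ℚ) := pairSubgroup S.σ (S.invol S.σ)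

theorem isFixedField_F : IsFixedField (fixedField S.subF) (pairSubgroup S.σ (S.invol S.σ)) :=
  isFixedField_fixedField _

theorem isPrincipalIdealRing_F [Fact p₁.Prime] [Fact p₂.Prime] :
    IsPrincipalIdealRing (𝓞 (fixedField S.subF)) := by
  obtain ⟨z, hz⟩ := S.isFixedField_F.exists_of_smul_eq_pair S.σ_ζ
  refine isPrincipalIdealRing_of_primitive_eighth_root ?_ z ?_
  · have h1 := IntermediateField.finrank_fixedField_eq_card (F := ℚ) S.subF
    have h2 := Module.finrank_mul_finrank ℚ (fixedField S.subF) K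
    have h3 : Nat.card S.subF = 2 := by
      have : (S.subF : Set Gal(K/ℚ)) = {1, S.σ} := by
        ext g
        exact mem_pairSubgroup
      change Nat.card (S.subF : Set Gal(K/ℚ)) = 2
      rw [this, Nat.card_coe_set_eq, Set.ncard_pair S.σ_ne_one.symm]
    rw [h1, h3, S.rank] at h2
    omega
  · apply algebraMap_ringOfIntegers_injective (K := K)
    rw [map_pow, hz, S.ζ_pow_four, map_neg, map_one]

/-- The subgroup whose fixed field is `ℚ(i)`. -/
def subI : Subgroup Gal(K/ℚ) := quadSubgroup S.σ S.s (S.invol _) (S.invol _) (S.comm _ _)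

theorem isFixedField_I : IsFixedField (fixedField S.subI)
    (quadSubgroup S.σ S.s (S.invol _) (S.invol _) (S.comm _ _)) :=
  isFixedField_fixedField _

/-- The subring `ℤ[i]`. -/
def gauss : GaussianInt →+* 𝓞 K := Zsqrtd.lift ⟨S.im, by rw [← pow_two, S.im_sq]; simp⟩

theorem gauss_apply (x : GaussianInt) : S.gauss x = x.re + x.im * S.im := rfl

theorem gauss_injective : Function.Injective S.gauss :=
  Zsqrtd.lift_injective _ fun n => by nlinarith [mul_self_nonneg n]

theorem σ_gauss (x : GaussianInt) : S.σ • S.gauss x = S.gauss x := by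
  rw [S.gauss_apply, smul_add, smul_mul', S.smul_intCast, S.smul_intCast, S.σ_im]

theorem s_gauss (x : GaussianInt) : S.s • S.gauss x = S.gauss x := by
  rw [S.gauss_apply, smul_add, smul_mul', S.smul_intCast, S.smul_intCast, S.s_im]

theorem J_gauss (x : GaussianInt) : S.J • S.gauss x = S.gauss (star x) := by
  rw [S.gauss_apply, S.gauss_apply, smul_add, smul_mul', S.smul_intCast, S.smul_intCast, S.J_im,
    Zsqrtd.re_star, Zsqrtd.im_star, Int.cast_neg, mul_neg, neg_mul]

theorem exists_gauss {x : 𝓞 K} (hσ : S.σ • x = x) (hs : S.s • x = x) :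
    ∃ y : GaussianInt, S.gauss y = x := by
  have hi := S.im_sq
  obtain ⟨a, ha⟩ := S.exists_int (x := x + S.J • x)
    (by rw [smul_add, S.smul_smul_comm, hσ]) (by rw [smul_add, S.smul_smul_self, add_comm])
    (by rw [smul_add, S.smul_smul_comm, hs])
  obtain ⟨w, hw⟩ := S.exists_int (x := (x - S.J • x) * S.im)
    (by rw [smul_mul', smul_sub, S.smul_smul_comm, hσ, S.σ_im])
    (by rw [smul_mul', smul_sub, S.smul_smul_self, S.J_im]; ring)
    (by rw [smul_mul', smul_sub, S.smul_smul_comm, hs, S.s_im])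
  obtain ⟨N, hN⟩ := S.exists_int (x := x * S.J • x)
    (by rw [smul_mul', S.smul_smul_comm, hσ]) (by rw [smul_mul', S.smul_smul_self, mul_comm])
    (by rw [smul_mul', S.smul_smul_comm, hs])
  have h4 : a ^ 2 + w ^ 2 = 4 * N := by
    have : ((a ^ 2 + w ^ 2 : ℤ) : 𝓞 K) = (4 * N : ℤ) := by
      push_cast
      rw [ha, hw, hN]
      linear_combination (x - S.J • x) ^ 2 * hi
    exact_mod_cast this
  have hev : a % 2 = 0 ∧ w % 2 = 0 := by
    have h1 : (a ^ 2 + w ^ 2) % 4 = 0 := by omega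
    rcases Int.emod_two_eq_zero_or_one a with h | h <;>
      rcases Int.emod_two_eq_zero_or_one w with h' | h'
    · exact ⟨h, h'⟩
    all_goals
      exfalso
      have e1 : a % 4 = 0 ∨ a % 4 = 1 ∨ a % 4 = 2 ∨ a % 4 = 3 := by omega
      have e2 : w % 4 = 0 ∨ w % 4 = 1 ∨ w % 4 = 2 ∨ w % 4 = 3 := by omega
      rcases e1 with e1 | e1 | e1 | e1 <;> rcases e2 with e2 | e2 | e2 | e2 <;>
        first
        | omega
        | (simp [pow_two, Int.add_emod, Int.mul_emod, e1, e2] at h1)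
  obtain ⟨b, rfl⟩ := Int.dvd_of_emod_eq_zero hev.1
  obtain ⟨c, rfl⟩ := Int.dvd_of_emod_eq_zero hev.2
  refine ⟨⟨b, -c⟩, ?_⟩
  rw [S.gauss_apply]
  apply mul_left_cancel₀ (two_ne_zero (α := 𝓞 K))
  push_cast at ha hw ⊢
  linear_combination ha - S.im * hw - (x - S.J • x) * hi

theorem exists_gaussEquiv :
    ∃ e : GaussianInt ≃+* 𝓞 (fixedField S.subI), ∀ x, algebraMap _ (𝓞 K) (e x) = S.gauss x := by
  have inj := algebraMap_ringOfIntegers_injective (k := fixedField S.subI) (K := K)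
  obtain ⟨z, hz⟩ := S.isFixedField_I.exists_of_smul_eq_quad S.σ_im S.s_im
  have hz2 : z * z = ((-1 : ℤ) : 𝓞 (fixedField S.subI)) := inj (by
    rw [map_mul, hz, ← pow_two, S.im_sq]; simp)
  have hf (x : GaussianInt) : algebraMap _ (𝓞 K) (Zsqrtd.lift ⟨z, hz2⟩ x) = S.gauss x := by
    rw [S.gauss_apply, Zsqrtd.lift_apply_apply, map_add, map_mul, map_intCast, map_intCast, hz]
  refine ⟨RingEquiv.ofBijective (Zsqrtd.lift ⟨z, hz2⟩) ⟨fun x y hxy => ?_, fun y => ?_⟩, hf⟩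
  · apply S.gauss_injective
    rw [← hf, ← hf, hxy]
  · obtain ⟨x, hx⟩ := S.exists_gauss
      (S.isFixedField_I.smul_algebraMap (Or.inr (Or.inl rfl)) y)
      (S.isFixedField_I.smul_algebraMap (Or.inr (Or.inr (Or.inl rfl))) y)
    exact ⟨x, inj (by rw [hf, hx])⟩

/-- Units of the subfields of an octic field. -/
structure Units where
  two : ∀ u : 𝓞 K, IsUnit u → S.σ • u = u → S.J • u = u →
    ∃ w : 𝓞 K, IsUnit w ∧ S.σ • w = w ∧ S.J • w = w ∧
      (u = w ^ 2 ∨ u = -w ^ 2 ∨ u = (1 + S.r2) * w ^ 2 ∨ u = -((1 + S.r2) * w ^ 2))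
  ed : 𝓞 K
  ed_isUnit : IsUnit ed
  J_ed : S.J • ed = ed
  s_ed : S.s • ed = ed
  ed_ne : ∀ v : 𝓞 K, IsUnit v → S.J • v = v → S.s • v = v → ed ≠ v ^ 2 ∧ ed ≠ -v ^ 2
  e2d : 𝓞 K
  e2d_isUnit : IsUnit e2d
  J_e2d : S.J • e2d = e2d
  sσ_e2d : S.s • S.σ • e2d = e2d
  e2d_ne : ∀ v : 𝓞 K, IsUnit v → S.J • v = v → S.s • S.σ • v = v → e2d ≠ v ^ 2 ∧ e2d ≠ -v ^ 2
  sq_ne : ∀ w : 𝓞 K, S.J • w = w →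
    w ^ 2 ≠ (1 + S.r2) * ed * e2d ∧ w ^ 2 ≠ -((1 + S.r2) * ed * e2d)

variable {S}

theorem Units.exists_of_smul_eq [Fact p₁.Prime] [Fact p₂.Prime] (U : S.Units)
    (hd : (p₁ * p₂) % 8 = 1) {u : 𝓞 K} (hu : IsUnit u) (hσ : S.σ • u = u) :
    ∃ w : 𝓞 K, IsUnit w ∧ S.σ • w = w ∧ ∃ l b : ℕ, u = S.ζ ^ l * (1 + S.r2) ^ b * w ^ 2 := by
  obtain ⟨v, hv⟩ := hu.exists_right_inv
  have hσv : S.σ • v = v := by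
    apply hu.mul_left_cancel
    nth_rw 1 [← hσ]
    rw [← smul_mul', hv, smul_one]
  have hJv : S.J • u * S.J • v = 1 := by rw [← smul_mul', hv, smul_one]
  obtain ⟨ξ, hξ, hfix, hJ⟩ := S.exists_smul_eq_of_mul_smul_eq_map hd
    (k := fixedField (quadSubgroup S.J S.s (S.invol _) (S.invol _) (S.comm _ _)))
    (isFixedField_fixedField _) (g := u) (θ := u * S.J • v) (I := ⊤) hu.ne_zero
    (by rw [mul_right_comm, mul_assoc, hJv, mul_one]) (by
      rw [Ideal.map_top, Ideal.span_singleton_eq_top]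
      exact hu.mul ((MulSemiringAction.toRingHom _ _ S.s).isUnit_map hu))
  have hσξ : S.σ • ξ = ξ := hfix _ S.σ_ζ (by rw [smul_mul', S.smul_smul_comm, hσ, hσv])
  have hξu : IsUnit ξ := IsUnit.of_mul_eq_one _ hξ
  obtain ⟨w, hw, hσw, -, hc⟩ := U.two (ξ * u) (hξu.mul hu) (by rw [smul_mul', hσ, hσξ]) hJ
  obtain ⟨n, j, hj⟩ := S.exists_pow_eq_ζ_pow hξ
  have hJξ : S.J • ξ = S.ζ ^ (7 * j) * (ξ ^ n) ^ 2 := by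
    apply hξu.mul_left_cancel
    rw [hξ]
    calc (1 : 𝓞 K) = (S.ζ ^ 8) ^ j := by rw [S.ζ_pow_eight, one_pow]
      _ = S.ζ ^ (7 * j) * S.ζ ^ j := by ring
      _ = _ := by rw [← hj]; ring
  obtain ⟨l, b, hlb⟩ : ∃ l b : ℕ, ξ * u = S.ζ ^ l * (1 + S.r2) ^ b * w ^ 2 := by
    rcases hc with h | h | h | h
    · exact ⟨0, 0, by rw [h]; ring⟩
    · exact ⟨4, 0, by rw [h, S.ζ_pow_four]; ring⟩
    · exact ⟨0, 1, by rw [h]; ring⟩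
    · exact ⟨4, 1, by rw [h, S.ζ_pow_four]; ring⟩
  refine ⟨ξ ^ n * w, (hξu.pow n).mul hw, by rw [smul_mul', smul_pow', hσξ, hσw], 7 * j + l, b, ?_⟩
  calc u = (ξ * S.J • ξ) * u := by rw [hξ, one_mul]
    _ = S.J • ξ * (ξ * u) := by ring
    _ = _ := by rw [hlb, hJξ]; ring

end Octic

namespace Octic
variable {p₁ p₂ : ℕ} {K : Type*} [Field K] [NumberField K] (S : Octic p₁ p₂ K)
include S

theorem eq_zero_of_sq_add_sq {a b : 𝓞 K} (ha : S.J • a = a) (hb : S.J • b = b)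
    (h : a ^ 2 + b ^ 2 = 0) : a = 0 := by
  have h1 : (a - S.im * b) * (a + S.im * b) = 0 := by
    linear_combination h - b ^ 2 * S.im_sq
  rcases mul_eq_zero.1 h1 with h2 | h2
  · have h3 := congrArg (S.J • ·) h2
    simp only [smul_sub, smul_mul', ha, hb, S.J_im, smul_zero] at h3
    exact (mul_eq_zero.1 (show (2 : 𝓞 K) * a = 0 by linear_combination h2 + h3)).resolve_left
      two_ne_zero
  · have h3 := congrArg (S.J • ·) h2
    simp only [smul_add, smul_mul', ha, hb, S.J_im, smul_zero] at h3
    exact (mul_eq_zero.1 (show (2 : 𝓞 K) * a = 0 by linear_combination h2 + h3)).resolve_left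
      two_ne_zero

theorem smul_isUnit {u : 𝓞 K} (hu : IsUnit u) (g : Gal(K/ℚ)) : IsUnit (g • u) :=
  (MulSemiringAction.toRingHom _ _ g).isUnit_map hu

theorem exists_real_unit [Fact p₁.Prime] [Fact p₂.Prime] (hd : (p₁ * p₂) % 8 = 1) {u : 𝓞 K}
    (hu : IsUnit u) : ∃ ξ : 𝓞 K, ξ * S.J • ξ = 1 ∧ S.J • (ξ * u) = ξ * u := by
  obtain ⟨v, hv⟩ := (S.smul_isUnit hu S.J).exists_right_inv
  obtain ⟨ξ, h1, -, h2⟩ := S.exists_smul_eq_of_mul_smul_eq_map hd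
    (k := fixedField (quadSubgroup S.J S.s (S.invol _) (S.invol _) (S.comm _ _)))
    (isFixedField_fixedField _) (g := u) (θ := u * v) (I := ⊤) hu.ne_zero
    (by rw [mul_assoc, mul_comm v, hv, mul_one]) (by
      rw [Ideal.map_top, Ideal.span_singleton_eq_top]
      exact hu.mul (S.smul_isUnit hu _))
  exact ⟨ξ, h1, h2⟩

/-- The ideal generated by a Gaussian integer and `√d`. -/
def P (x : GaussianInt) : Ideal (𝓞 K) := Ideal.span {S.gauss x, S.rd}

theorem rd_mem_P (x : GaussianInt) : S.rd ∈ S.P x := Ideal.subset_span (Or.inr rfl)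

theorem gauss_mem_P (x : GaussianInt) : S.gauss x ∈ S.P x := Ideal.subset_span (Or.inl rfl)

omit S in
theorem smul_span_pair (g : Gal(K/ℚ)) (a b : 𝓞 K) :
    g • Ideal.span {a, b} = Ideal.span {g • a, g • b} := by
  rw [Ideal.span_insert, Ideal.span_insert, Ideal.smul_sup, smul_span_singleton,
    smul_span_singleton]

theorem J_P (x : GaussianInt) : S.J • S.P x = S.P (star x) := by
  rw [P, smul_span_pair, S.J_gauss, S.J_rd, P]

section
variable {p q : ℕ} {x : GaussianInt}

theorem gauss_mul_gauss_star (hx : x * star x = p) : S.gauss x * S.gauss (star x) = p := by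
  rw [← map_mul, hx, map_natCast]

omit S in
theorem star_mul_star_star (hx : x * star x = p) : star x * star (star x) = p := by
  rw [star_star, mul_comm, hx]

theorem exists_bezout (hp : p.Prime) (hp8 : p % 8 = 5) (hx : x * star x = p) :
    ∃ u v : ℤ, (u + v * S.gauss (star x)) * S.gauss x + u * S.gauss (star x) = 1 := by
  have hN : x.re ^ 2 + x.im ^ 2 = (p : ℤ) := by
    have := congrArg Zsqrtd.re hx
    simp [Zsqrtd.re_mul] at this
    linarith
  have hcop : IsCoprime (2 * x.re) (p : ℤ) := by
    have hpZ : Prime (p : ℤ) := Nat.prime_iff_prime_int.1 hp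
    rw [isCoprime_comm, hpZ.irreducible.coprime_iff_not_dvd]
    intro h
    rcases hpZ.dvd_or_dvd h with h | h
    · have := Int.le_of_dvd (by norm_num) h
      omega
    · obtain ⟨c, hc⟩ := h
      have h2 : (p : ℤ) ∣ x.im ^ 2 := ⟨1 - p * c ^ 2, by rw [hc] at hN; linear_combination hN⟩
      obtain ⟨e, he⟩ := hpZ.dvd_of_dvd_pow h2
      rw [hc, he] at hN
      have hp0 : (p : ℤ) ≠ 0 := hpZ.ne_zero
      have h3 : (p : ℤ) * (c ^ 2 + e ^ 2) = 1 := mul_left_cancel₀ hp0 (by linear_combination hN)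
      exact hpZ.not_isUnit (IsUnit.of_mul_eq_one _ h3)
  obtain ⟨u, v, huv⟩ := hcop
  refine ⟨u, v, ?_⟩
  have h1 : S.gauss x + S.gauss (star x) = (2 * x.re : ℤ) := by
    rw [S.gauss_apply, S.gauss_apply, Zsqrtd.re_star, Zsqrtd.im_star]
    push_cast
    ring
  have h2 := S.gauss_mul_gauss_star hx
  have h3 : ((u * (2 * x.re) + v * p : ℤ) : 𝓞 K) = 1 := by rw [huv, Int.cast_one]
  rw [Int.cast_add, Int.cast_mul, ← h1, Int.cast_mul, Int.cast_natCast, ← h2] at h3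
  linear_combination h3

theorem P_sq (hp : p.Prime) (hp8 : p % 8 = 5) (hpq : p.Coprime q) (hS : S.rd ^ 2 = p * q)
    (hx : x * star x = p) : S.P x ^ 2 = Ideal.span {S.gauss x} := by
  obtain ⟨u, v, huv⟩ := S.exists_bezout hp hp8 hx
  have h2 := S.gauss_mul_gauss_star hx
  obtain ⟨a, b, hab⟩ : IsCoprime (p : ℤ) q := Nat.isCoprime_iff_coprime.2 hpq
  have hab' : (a : 𝓞 K) * p + b * q = 1 := by exact_mod_cast congrArg (Int.cast : ℤ → 𝓞 K) hab
  refine sq_span_pair (q := S.gauss (star x) * q) (c := 0) (u := u + v * S.gauss (star x) +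
    u * S.gauss (star x) * a * S.gauss (star x)) (v := u * b) ?_ ?_
  · rw [hS, ← h2]; ring
  · rw [← h2] at hab'
    linear_combination huv + u * S.gauss (star x) * hab'

omit S in
theorem absNorm_smul (g : Gal(K/ℚ)) (I : Ideal (𝓞 K)) :
    Ideal.absNorm (g • I) = Ideal.absNorm I := by
  rw [Ideal.absNorm_apply, Ideal.absNorm_apply, Submodule.cardQuot_apply, Submodule.cardQuot_apply]
  exact (Nat.card_congr (Ideal.quotientEquiv I (g • I) (MulSemiringAction.toRingEquiv _ _ g)
    rfl).toEquiv).symm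

theorem absNorm_P (hp : p.Prime) (hp8 : p % 8 = 5) (hpq : p.Coprime q) (hS : S.rd ^ 2 = p * q)
    (hx : x * star x = p) : Ideal.absNorm (S.P x) = p ^ 2 := by
  have h1 := S.P_sq hp hp8 hpq hS hx
  have h2 : S.P (star x) ^ 2 = _ := S.P_sq hp hp8 hpq hS (star_mul_star_star hx)
  have h3 : Ideal.absNorm (S.P (star x)) = Ideal.absNorm (S.P x) := by
    rw [← S.J_P, absNorm_smul]
  have h4 : Ideal.absNorm (S.P x) ^ 4 = (p ^ 2) ^ 4 := by
    calc _ = Ideal.absNorm (S.P x ^ 2 * S.P (star x) ^ 2) := by rw [map_mul, map_pow, map_pow, h3]; ring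
      _ = _ := by
        rw [h1, h2, Ideal.span_singleton_mul_span_singleton, S.gauss_mul_gauss_star hx,
          Ideal.absNorm_span_singleton, ← map_natCast (algebraMap ℤ (𝓞 K)) p,
          Algebra.norm_algebraMap, RingOfIntegers.rank, S.rank, Int.natAbs_pow, Int.natAbs_natCast]
        ring
  exact Nat.pow_left_injective (by norm_num : 4 ≠ 0) h4

omit S in
theorem isSquare_two_of_absNorm (hp : p.Prime) {Q : Ideal (𝓞 K)} (hQ : Ideal.absNorm Q = p)
    {r : 𝓞 K} {n : ℤ} (hr : r ^ 2 = n) : IsSquare (n : ZMod p) := by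
  rw [Ideal.absNorm_apply, Submodule.cardQuot_apply] at hQ
  have : Finite (𝓞 K ⧸ Q) := Nat.finite_of_card_ne_zero (hQ ▸ hp.ne_zero)
  have := Fintype.ofFinite (𝓞 K ⧸ Q)
  let e := ZMod.ringEquivOfPrime (𝓞 K ⧸ Q) hp (by rw [← Nat.card_eq_fintype_card, hQ])
  refine ⟨e.symm (Ideal.Quotient.mk Q r), ?_⟩
  rw [← map_mul, ← map_mul, ← pow_two, hr, map_intCast, map_intCast]

theorem P_isPrime (hp : p.Prime) (hp8 : p % 8 = 5) (hpq : p.Coprime q) (hS : S.rd ^ 2 = p * q)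
    (hx : x * star x = p) : (S.P x).IsPrime := by
  have hN := S.absNorm_P hp hp8 hpq hS hx
  have hne : S.P x ≠ ⊤ := fun h => by
    rw [h, Ideal.absNorm_top] at hN
    have := hp.two_le
    nlinarith
  obtain ⟨M, hM, hle⟩ := Ideal.exists_le_maximal _ hne
  obtain ⟨L, hL⟩ := Ideal.dvd_iff_le.2 hle
  have h1 := congrArg Ideal.absNorm hL
  rw [map_mul, hN] at h1
  obtain ⟨i, hi, hMi⟩ := (Nat.dvd_prime_pow hp).1 (Dvd.intro _ h1.symm)
  have hp0 := hp.pos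
  interval_cases i
  · exact absurd (Ideal.absNorm_eq_one_iff.1 (by simpa using hMi)) hM.ne_top
  · exfalso
    have := isSquare_two_of_absNorm hp (by simpa using hMi) (r := S.r2) (n := 2)
      (by rw [S.r2_sq]; norm_num)
    have hF := Fact.mk hp
    rw [Int.cast_ofNat, ZMod.exists_sq_eq_two_iff (by rintro rfl; omega)] at this
    omega
  · rw [hMi] at h1
    have : L = ⊤ := Ideal.absNorm_eq_one_iff.1 (by nlinarith [pow_pos hp0 2])
    rw [this, Ideal.mul_top] at hL
    rw [hL]
    exact hM.isPrime

theorem P_star_ne (hp : p.Prime) (hp8 : p % 8 = 5) (hpq : p.Coprime q) (hS : S.rd ^ 2 = p * q)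
    (hx : x * star x = p) : S.P (star x) ≠ S.P x := fun h => by
  obtain ⟨u, v, huv⟩ := S.exists_bezout hp hp8 hx
  refine (S.P_isPrime hp hp8 hpq hS hx).ne_top ((Ideal.eq_top_iff_one _).2 ?_)
  rw [← huv]
  exact add_mem (Ideal.mul_mem_left _ _ (S.gauss_mem_P x))
    (Ideal.mul_mem_left _ _ (h ▸ S.gauss_mem_P (star x)))

end

/-- The ideal generated by a rational prime and `√d`. -/
def B (p : ℕ) : Ideal (𝓞 K) := Ideal.span {(p : 𝓞 K), S.rd}

theorem B_sq {p q : ℕ} (hpq : p.Coprime q) (hS : S.rd ^ 2 = p * q) :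
    S.B p ^ 2 = Ideal.span {(p : 𝓞 K)} := by
  obtain ⟨a, b, hab⟩ : IsCoprime (p : ℤ) q := Nat.isCoprime_iff_coprime.2 hpq
  have hab' : (a : 𝓞 K) * p + b * q = 1 := by exact_mod_cast congrArg (Int.cast : ℤ → 𝓞 K) hab
  exact sq_span_pair (q := (q : 𝓞 K)) (c := 0) (by rw [hS]; ring) hab'

theorem P_mul_P_star {p q : ℕ} {x : GaussianInt} (hp : p.Prime) (hp8 : p % 8 = 5)
    (hpq : p.Coprime q) (hS : S.rd ^ 2 = p * q)
    (hx : x * star x = p) : S.P x * S.P (star x) = S.B p := by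
  apply Ideal.sq_inj
  rw [mul_pow, S.P_sq hp hp8 hpq hS hx, S.P_sq hp hp8 hpq hS (star_mul_star_star hx),
    S.B_sq hpq hS, Ideal.span_singleton_mul_span_singleton, S.gauss_mul_gauss_star hx]

end Octic

theorem exists_mul_star_eq {p : ℕ} (hp : p.Prime) (hp8 : p % 8 = 5) :
    ∃ x : GaussianInt, x * star x = p := by
  have := Fact.mk hp
  obtain ⟨a, b, hab⟩ := Nat.Prime.sq_add_sq (p := p) (by omega)
  refine ⟨⟨a, b⟩, ?_⟩
  ext
  · simp [Zsqrtd.re_mul]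
    exact_mod_cast (by rw [← hab]; ring : a * a + b * b = p)
  · simp [Zsqrtd.im_mul]
    ring

namespace Octic
variable {p₁ p₂ : ℕ} {K : Type*} [Field K] [NumberField K] (S : Octic p₁ p₂ K)
include S

theorem exists_quadField_quad {k : Type*} [Field k] [NumberField k] [Algebra k K]
    {a b : Gal(K/ℚ)} {ha : a * a = 1} {hb : b * b = 1} {hab : a * b = b * a}
    (hk : IsFixedField k (quadSubgroup a b ha hb hab)) {D : ℤ} (hD : D ≠ 0)
    (hH : ∀ x : K, a x = x → b x = x → S.σ x = x → x ∈ Set.range (algebraMap ℚ K))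
    {x : 𝓞 K} (hxa : a • x = x) (hxb : b • x = x) (hσ : S.σ • x = -x) (hxD : x ^ 2 = (D : 𝓞 K)) :
    ∃ Q : QuadField D k, algebraMap (𝓞 k) (𝓞 K) Q.rt = x ∧
      ∀ y : 𝓞 k, algebraMap (𝓞 k) (𝓞 K) (Q.τ • y) = S.σ • algebraMap (𝓞 k) (𝓞 K) y := by
  refine S.exists_quadField hk hD (fun x hx hσ => hH x (hx _ (Or.inr (Or.inl rfl)))
    (hx _ (Or.inr (Or.inr (Or.inl rfl)))) hσ) ?_ hσ hxD
  rintro g (rfl | rfl | rfl | rfl)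
  · exact one_smul _ _
  · exact hxa
  · exact hxb
  · rw [mul_smul, hxb, hxa]

/-- The subgroup whose fixed field is `ℚ(√(2d))`. -/
def sub2d : Subgroup Gal(K/ℚ) :=
  quadSubgroup S.J (S.s * S.σ) (S.invol _) (S.invol _) (S.comm _ _)

theorem isFixedField_2d : IsFixedField (fixedField S.sub2d)
    (quadSubgroup S.J (S.s * S.σ) (S.invol _) (S.invol _) (S.comm _ _)) :=
  isFixedField_fixedField _

/-- The subgroup whose fixed field is `ℚ(√(-2d))`. -/
def subm2d : Subgroup Gal(K/ℚ) :=
  quadSubgroup (S.J * S.σ) (S.s * S.σ) (S.invol _) (S.invol _) (S.comm _ _)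

theorem isFixedField_m2d : IsFixedField (fixedField S.subm2d)
    (quadSubgroup (S.J * S.σ) (S.s * S.σ) (S.invol _) (S.invol _) (S.comm _ _)) :=
  isFixedField_fixedField _

/-- The fixed field is `ℚ(√(-d))`. -/
abbrev IsImag (k : Type*) [Field k] [Algebra k K] : Prop :=
  IsFixedField k (quadSubgroup (S.J * S.σ) S.s (S.invol _) (S.invol _) (S.comm _ _))

section
variable [hp₁ : Fact p₁.Prime] [hp₂ : Fact p₂.Prime]

theorem exists_quadField_imag {k : Type*} [Field k] [NumberField k] [Algebra k K]
    (hk : S.IsImag k) :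
    ∃ Q : QuadField (-(p₁ * p₂)) k, algebraMap (𝓞 k) (𝓞 K) Q.rt = S.im * S.rd ∧
      ∀ y : 𝓞 k, algebraMap (𝓞 k) (𝓞 K) (Q.τ • y) = S.σ • algebraMap (𝓞 k) (𝓞 K) y := by
  have h1 := hp₁.out.ne_zero
  have h2 := hp₂.out.ne_zero
  refine S.exists_quadField_quad hk (neg_ne_zero.2 (by positivity)) (fun x ha hb hσ =>
    S.fix x hσ ?_ hb) ?_ ?_ ?_ ?_
  · rwa [AlgEquiv.mul_apply, hσ] at ha
  · rw [mul_smul, smul_mul', S.σ_im, S.σ_rd, smul_mul', smul_neg, S.J_im, S.J_rd, neg_mul_neg]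
  · rw [smul_mul', S.s_im, S.s_rd]
  · rw [smul_mul', S.σ_im, S.σ_rd, mul_neg]
  · rw [mul_pow, S.im_sq, S.rd_sq]
    push_cast
    ring

theorem exists_quadField_2d :
    ∃ Q : QuadField (2 * p₁ * p₂) (fixedField S.sub2d), algebraMap _ (𝓞 K) Q.rt = S.r2 * S.rd ∧
      ∀ y : 𝓞 (fixedField S.sub2d), algebraMap _ (𝓞 K) (Q.τ • y) = S.σ • algebraMap _ (𝓞 K) y := by
  have h1 := hp₁.out.ne_zero
  have h2 := hp₂.out.ne_zero
  refine S.exists_quadField_quad S.isFixedField_2d (by positivity) (fun x ha hb hσ =>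
    S.fix x hσ ha ?_) ?_ ?_ ?_ ?_
  · rwa [AlgEquiv.mul_apply, hσ] at hb
  · rw [smul_mul', S.J_r2, S.J_rd]
  · rw [mul_smul, smul_mul', S.σ_r2, S.σ_rd, smul_mul', smul_neg, S.s_r2, S.s_rd, neg_mul_neg]
  · rw [smul_mul', S.σ_r2, S.σ_rd, mul_neg]
  · rw [mul_pow, S.r2_sq, S.rd_sq]
    push_cast
    ring

theorem exists_quadField_m2d :
    ∃ Q : QuadField (-(2 * p₁ * p₂)) (fixedField S.subm2d),
      algebraMap _ (𝓞 K) Q.rt = S.im * (S.r2 * S.rd) ∧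
      ∀ y : 𝓞 (fixedField S.subm2d), algebraMap _ (𝓞 K) (Q.τ • y) = S.σ • algebraMap _ (𝓞 K) y := by
  have h1 := hp₁.out.ne_zero
  have h2 := hp₂.out.ne_zero
  have hσ : S.σ • (S.im * (S.r2 * S.rd)) = -(S.im * (S.r2 * S.rd)) := by
    rw [smul_mul', smul_mul', S.σ_im, S.σ_r2, S.σ_rd, mul_neg, mul_neg]
  refine S.exists_quadField_quad S.isFixedField_m2d (neg_ne_zero.2 (by positivity))
    (fun x ha hb hx => S.fix x hx ?_ ?_) ?_ ?_ hσ ?_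
  · rwa [AlgEquiv.mul_apply, hx] at ha
  · rwa [AlgEquiv.mul_apply, hx] at hb
  · rw [mul_smul, hσ, smul_neg, smul_mul', smul_mul', S.J_im, S.J_r2, S.J_rd]
    ring
  · rw [mul_smul, hσ, smul_neg, smul_mul', smul_mul', S.s_im, S.s_r2, S.s_rd]
    ring
  · rw [mul_pow, mul_pow, S.im_sq, S.r2_sq, S.rd_sq]
    push_cast
    ring

variable {S} in
theorem Units.e2d_mul_σ (U : S.Units) (hne : p₁ ≠ p₂) (hm₁ : p₁ % 8 = 5) (hm₂ : p₂ % 8 = 5) :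
    U.e2d * S.σ • U.e2d = -1 := by
  obtain ⟨Q, -, hQ⟩ := S.exists_quadField_2d
  have inj := algebraMap_ringOfIntegers_injective (k := fixedField S.sub2d) (K := K)
  have hdesc {x : 𝓞 K} (hJ : S.J • x = x) (hs : S.s • S.σ • x = x) :
      ∃ y : 𝓞 (fixedField S.sub2d), algebraMap _ (𝓞 K) y = x :=
    S.isFixedField_2d.exists_of_smul_eq_quad hJ (by rw [mul_smul, hs])
  obtain ⟨e, he⟩ := hdesc U.J_e2d U.sσ_e2d
  obtain ⟨f, hf⟩ := U.e2d_isUnit.exists_right_inv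
  have hJf : S.J • f = f := by
    apply U.e2d_isUnit.mul_left_cancel
    nth_rw 1 [← U.J_e2d]
    rw [← smul_mul', hf, smul_one]
  have hsf : S.s • S.σ • f = f := by
    apply U.e2d_isUnit.mul_left_cancel
    nth_rw 1 [← U.sσ_e2d]
    rw [← smul_mul', ← smul_mul', hf, smul_one, smul_one]
  obtain ⟨f', hf'⟩ := hdesc hJf hsf
  have heu : IsUnit e := IsUnit.of_mul_eq_one f' (inj (by rw [map_mul, he, hf', hf, map_one]))
  have := Q.even_norm_eq hne hm₁ hm₂ (Or.inl rfl) heu fun v hv => by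
    have h1 : S.J • algebraMap _ (𝓞 K) v = algebraMap _ (𝓞 K) v :=
      S.isFixedField_2d.smul_algebraMap (Or.inr (Or.inl rfl)) v
    have h2 : (S.s * S.σ) • algebraMap _ (𝓞 K) v = algebraMap _ (𝓞 K) v :=
      S.isFixedField_2d.smul_algebraMap (Or.inr (Or.inr (Or.inl rfl))) v
    rw [mul_smul] at h2
    have h3 := U.e2d_ne _ (hv.map (algebraMap _ (𝓞 K))) h1 h2
    rw [← he, ← map_pow, ← map_neg] at h3
    exact ⟨fun h => h3.1 (congrArg _ h), fun h => h3.2 (congrArg _ h)⟩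
  rw [← he, ← hQ, ← map_mul, this, map_neg, map_one]

theorem eq_P_of_rd_mem (hne : p₁ ≠ p₂) (hm₁ : p₁ % 8 = 5) (hm₂ : p₂ % 8 = 5)
    {x₁ x₂ : GaussianInt} (hx₁ : x₁ * star x₁ = p₁) (hx₂ : x₂ * star x₂ = p₂)
    {Q : Ideal (𝓞 K)} (hQ : Q.IsPrime) (h : S.rd ∈ Q) :
    (Q = S.P x₁ ∨ Q = S.P (star x₁)) ∨ (Q = S.P x₂ ∨ Q = S.P (star x₂)) := by
  have hc := (Nat.coprime_primes hp₁.out hp₂.out).2 hne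
  have hS' : S.rd ^ 2 = p₂ * p₁ := by rw [S.rd_sq, mul_comm]
  have key {x : GaussianInt} (hP : (S.P x).IsPrime) (hx : S.gauss x ∈ Q) : Q = S.P x := by
    have hle : S.P x ≤ Q := by
      rw [P, Ideal.span_le]
      rintro y (rfl | rfl)
      exacts [hx, h]
    have : (S.P x).IsMaximal := hP.isMaximal fun h0 => S.rd_ne (by
      rw [← Ideal.mem_bot, ← h0]; exact S.rd_mem_P x)
    exact (this.eq_of_le hQ.ne_top hle).symm
  have h1 : S.gauss x₁ * S.gauss (star x₁) * (S.gauss x₂ * S.gauss (star x₂)) ∈ Q := by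
    rw [S.gauss_mul_gauss_star hx₁, S.gauss_mul_gauss_star hx₂, ← S.rd_sq]
    exact Ideal.pow_mem_of_mem _ h _ two_pos
  rcases hQ.mem_or_mem h1 with h2 | h2 <;> rcases hQ.mem_or_mem h2 with h3 | h3
  · exact Or.inl (Or.inl (key (S.P_isPrime hp₁.out hm₁ hc S.rd_sq hx₁) h3))
  · exact Or.inl (Or.inr (key (S.P_isPrime hp₁.out hm₁ hc S.rd_sq (star_mul_star_star hx₁)) h3))
  · exact Or.inr (Or.inl (key (S.P_isPrime hp₂.out hm₂ hc.symm hS' hx₂) h3))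
  · exact Or.inr (Or.inr (key (S.P_isPrime hp₂.out hm₂ hc.symm hS' (star_mul_star_star hx₂)) h3))

theorem J_smul_of_rd_mem (hne : p₁ ≠ p₂) (hm₁ : p₁ % 8 = 5) (hm₂ : p₂ % 8 = 5)
    {Q : Ideal (𝓞 K)} (hQ : Q.IsPrime) (h : S.rd ∈ Q) :
    S.J • Q ≠ Q ∧ Q * S.J • Q ∈ ({S.B p₁, S.B p₂} : Set (Ideal (𝓞 K))) := by
  obtain ⟨x₁, hx₁⟩ := exists_mul_star_eq hp₁.out hm₁
  obtain ⟨x₂, hx₂⟩ := exists_mul_star_eq hp₂.out hm₂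
  have hc := (Nat.coprime_primes hp₁.out hp₂.out).2 hne
  have hS' : S.rd ^ 2 = p₂ * p₁ := by rw [S.rd_sq, mul_comm]
  rcases S.eq_P_of_rd_mem hne hm₁ hm₂ hx₁ hx₂ hQ h with (rfl | rfl) | (rfl | rfl) <;>
    rw [S.J_P]
  · exact ⟨S.P_star_ne hp₁.out hm₁ hc S.rd_sq hx₁,
      Or.inl (S.P_mul_P_star hp₁.out hm₁ hc S.rd_sq hx₁)⟩
  · exact ⟨S.P_star_ne hp₁.out hm₁ hc S.rd_sq (star_mul_star_star hx₁),
      Or.inl (S.P_mul_P_star hp₁.out hm₁ hc S.rd_sq (star_mul_star_star hx₁))⟩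
  · exact ⟨S.P_star_ne hp₂.out hm₂ hc.symm hS' hx₂,
      Or.inr (S.P_mul_P_star hp₂.out hm₂ hc.symm hS' hx₂)⟩
  · exact ⟨S.P_star_ne hp₂.out hm₂ hc.symm hS' (star_mul_star_star hx₂),
      Or.inr (S.P_mul_P_star hp₂.out hm₂ hc.symm hS' (star_mul_star_star hx₂))⟩

theorem map_ram {k : Type*} [Field k] [NumberField k] [Algebra k K] {D : ℤ} (Q : QuadField D k)
    (hQ : algebraMap (𝓞 k) (𝓞 K) Q.rt = S.rd ∨ algebraMap (𝓞 k) (𝓞 K) Q.rt = S.im * S.rd) (p : ℕ) :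
    (Q.ram p).map (algebraMap (𝓞 k) (𝓞 K)) = S.B p := by
  rw [QuadField.ram, Ideal.map_span, Set.image_pair, map_natCast, B]
  rcases hQ with h | h <;> rw [h]
  rw [Ideal.span_insert, Ideal.span_insert, mul_comm,
    Ideal.span_singleton_mul_right_unit S.im_isUnit]

/-- A `J`-invariant divisor of `√d` is extended from a quadratic field. -/
theorem exists_map_eq (hne : p₁ ≠ p₂) (hm₁ : p₁ % 8 = 5) (hm₂ : p₂ % 8 = 5)
    {k : Type*} [Field k] [NumberField k] [Algebra k K] {D : ℤ} (Q : QuadField D k)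
    (hQ : algebraMap (𝓞 k) (𝓞 K) Q.rt = S.rd ∨ algebraMap (𝓞 k) (𝓞 K) Q.rt = S.im * S.rd)
    {I : Ideal (𝓞 K)} (hI0 : I ≠ ⊥) (hJ : S.J • I = I) (hrd : S.rd ∈ I) :
    ∃ L ∈ Submonoid.closure ({Q.ram p₁, Q.ram p₂} : Set (Ideal (𝓞 k))),
      L.map (algebraMap (𝓞 k) (𝓞 K)) = I := by
  have h := mem_closure_of_smul_eq (S.invol S.J) hI0 hJ fun P hP hle =>
    S.J_smul_of_rd_mem hne hm₁ hm₂ hP (hle hrd)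
  have hmap := S.map_ram Q hQ
  have himg : ({S.B p₁, S.B p₂} : Set (Ideal (𝓞 K))) =
      (Ideal.mapHom (algebraMap (𝓞 k) (𝓞 K)) : _ →* _) ''
        ({Q.ram p₁, Q.ram p₂} : Set (Ideal (𝓞 k))) := by
    rw [Set.image_pair]
    congr 1
    · exact (hmap _).symm
    · exact congrArg _ (hmap _).symm
  rw [himg, ← MonoidHom.map_mclosure] at h
  exact h

end
end Octic

theorem IsFixedField.smul_map {k K : Type*} [Field k] [NumberField k] [Field K] [NumberField K]
    [Algebra k K] {H : Subgroup Gal(K/ℚ)} (h : IsFixedField k H) {g : Gal(K/ℚ)} (hg : g ∈ H)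
    (I : Ideal (𝓞 k)) :
    g • I.map (algebraMap (𝓞 k) (𝓞 K)) = I.map (algebraMap (𝓞 k) (𝓞 K)) := by
  rw [Ideal.pointwise_smul_def, Ideal.map_map]
  congr 1
  exact RingHom.ext fun y => h.smul_algebraMap hg y

namespace Octic
variable {p₁ p₂ : ℕ} {K : Type*} [Field K] [NumberField K] {S : Octic p₁ p₂ K}
section
variable [hp₁ : Fact p₁.Prime] [hp₂ : Fact p₂.Prime]

omit hp₁ hp₂ in
theorem one_add_r2_mul : (1 + S.r2) * (1 - S.r2) = -1 := by
  linear_combination -S.r2_sq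

/-- A totally real unit of relative norm one that is not, up to sign and `1 + √2`, a square. -/
theorem Units.exists_unit (U : S.Units) (hne : p₁ ≠ p₂) (hm₁ : p₁ % 8 = 5) (hm₂ : p₂ % 8 = 5) :
    ∃ η : 𝓞 K, IsUnit η ∧ S.J • η = η ∧ η * S.σ • η = 1 ∧ ∀ V : 𝓞 K, IsUnit V → S.J • V = V →
      (η ≠ V ^ 2 ∧ η ≠ -V ^ 2) ∧ (η ≠ (1 + S.r2) * V ^ 2 ∧ η ≠ -((1 + S.r2) * V ^ 2)) := by
  have hd8 : (p₁ * p₂) % 8 = 1 := by rw [Nat.mul_mod, hm₁, hm₂]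
  have hk : S.IsReal (fixedField (quadSubgroup S.J S.s (S.invol _) (S.invol _) (S.comm _ _))) :=
    isFixedField_fixedField _
  obtain ⟨Q, -, hQ⟩ := S.exists_quadField_real hk
  generalize (fixedField (quadSubgroup S.J S.s (S.invol _) (S.invol _) (S.comm _ _))) = k at *
  have inj := algebraMap_ringOfIntegers_injective (k := k) (K := K)
  have hdesc {x : 𝓞 K} (hJ : S.J • x = x) (hs : S.s • x = x) :
      ∃ y : 𝓞 k, algebraMap _ (𝓞 K) y = x := hk.exists_of_smul_eq_quad hJ hs
  obtain ⟨e, he⟩ := hdesc U.J_ed U.s_ed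
  obtain ⟨f, hf⟩ := U.ed_isUnit.exists_right_inv
  have hfix {g : Gal(K/ℚ)} (hg : g • U.ed = U.ed) : g • f = f := by
    apply U.ed_isUnit.mul_left_cancel
    nth_rw 1 [← hg]
    rw [← smul_mul', hf, smul_one]
  obtain ⟨f', hf'⟩ := hdesc (hfix U.J_ed) (hfix U.s_ed)
  have heu : IsUnit e := IsUnit.of_mul_eq_one f' (inj (by rw [map_mul, he, hf', hf, map_one]))
  have hnorm : U.ed * S.σ • U.ed = 1 ∨ U.ed * S.σ • U.ed = -1 := by
    refine (Q.mul_smul_of_isUnit heu).imp (fun h => ?_) fun h => ?_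
    · rw [← he, ← hQ, ← map_mul, h, map_one]
    · rw [← he, ← hQ, ← map_mul, h, map_neg, map_one]
  have hcomm {V : 𝓞 K} (hJ : S.J • V = V) : S.J • (V * S.s • V) = V * S.s • V := by
    rw [smul_mul', S.smul_smul_comm, hJ]
  have contra {V : 𝓞 K} (hJ : S.J • V = V) : U.ed ^ 2 ≠ -(V * S.s • V) ^ 2 := fun h =>
    U.ed_isUnit.ne_zero (S.eq_zero_of_sq_add_sq U.J_ed (hcomm hJ) (by linear_combination h))
  have hs1 : S.s • (1 + S.r2) = 1 - S.r2 := by rw [smul_add, smul_one, S.s_r2, sub_eq_add_neg]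
  rcases hnorm with hN | hN
  · refine ⟨U.ed, U.ed_isUnit, U.J_ed, hN, fun V hV hJ => ⟨?_, ?_⟩⟩
    · suffices h : ¬ (U.ed = V ^ 2 ∨ U.ed = -V ^ 2) from not_or.1 h
      intro h
      have hsV : S.s • V = V ∨ S.s • V = -V := by
        apply sq_eq_sq_iff_eq_or_eq_neg.1
        have := U.s_ed
        rcases h with h | h
        · rwa [h, smul_pow'] at this
        · rwa [h, smul_neg, smul_pow', neg_inj] at this
      rcases hsV with hsV | hsV
      · have := U.ed_ne V hV hJ hsV
        tauto
      · obtain ⟨y, hy⟩ := hdesc (x := S.r2 * V) (by rw [smul_mul', S.J_r2, hJ])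
          (by rw [smul_mul', S.s_r2, hsV, neg_mul_neg])
        apply Q.sq_ne_span_two (by exact_mod_cast hd8) (Ideal.span {y})
        rw [Ideal.span_singleton_pow, Ideal.span_singleton_eq_span_singleton]
        obtain ⟨u, hu⟩ := heu
        rcases h with h | h
        · refine Associated.symm ⟨u, inj ?_⟩
          rw [hu, map_mul, map_pow, hy, he, map_ofNat]
          linear_combination 2 * h - V ^ 2 * S.r2_sq
        · refine Associated.symm ⟨-u, inj ?_⟩
          rw [Units.val_neg, hu, map_mul, map_pow, hy, map_neg, he, map_ofNat]
          linear_combination -2 * h - V ^ 2 * S.r2_sq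
    · suffices h : ¬ (U.ed = (1 + S.r2) * V ^ 2 ∨ U.ed = -((1 + S.r2) * V ^ 2)) from not_or.1 h
      intro h
      refine contra hJ ?_
      have hs := U.s_ed
      rcases h with h | h
      · have h' := congrArg (S.s • ·) h
        simp only [smul_mul', smul_pow', hs1, hs] at h'
        linear_combination U.ed * h + (1 + S.r2) * V ^ 2 * h' +
          V ^ 2 * (S.s • V) ^ 2 * one_add_r2_mul (S := S)
      · have h' := congrArg (S.s • ·) h
        simp only [smul_neg, smul_mul', smul_pow', hs1, hs] at h'
        linear_combination U.ed * h - (1 + S.r2) * V ^ 2 * h' +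
          V ^ 2 * (S.s • V) ^ 2 * one_add_r2_mul (S := S)
  · have hN' := U.e2d_mul_σ hne hm₁ hm₂
    have hs2 : S.s • U.e2d = S.σ • U.e2d := by
      nth_rw 1 [← U.sσ_e2d]
      rw [S.smul_smul_self]
    refine ⟨U.ed * U.e2d, U.ed_isUnit.mul U.e2d_isUnit, by rw [smul_mul', U.J_ed, U.J_e2d],
      by rw [smul_mul', mul_mul_mul_comm, hN, hN', neg_mul_neg, one_mul], fun V hV hJ => ⟨?_, ?_⟩⟩
    · suffices h : ¬ (U.ed * U.e2d = V ^ 2 ∨ U.ed * U.e2d = -V ^ 2) from not_or.1 h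
      intro h
      refine contra hJ ?_
      rcases h with h | h
      · have h' := congrArg (S.s • ·) h
        simp only [smul_mul', smul_pow', U.s_ed, hs2] at h'
        linear_combination U.ed ^ 2 * hN' - (U.ed * S.σ • U.e2d) * h - V ^ 2 * h'
      · have h' := congrArg (S.s • ·) h
        simp only [smul_neg, smul_mul', smul_pow', U.s_ed, hs2] at h'
        linear_combination U.ed ^ 2 * hN' - (U.ed * S.σ • U.e2d) * h + V ^ 2 * h'
    · have h := U.sq_ne ((1 + S.r2) * V) (by
        rw [smul_mul', smul_add, smul_one, S.J_r2, hJ])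
      exact ⟨fun h1 => h.1 (by linear_combination -(1 + S.r2) * h1),
        fun h1 => h.2 (by linear_combination (1 + S.r2) * h1)⟩

/-- The ideal `(p₁, √d)` has a totally real generator. -/
theorem Units.exists_B_eq (U : S.Units) (hne : p₁ ≠ p₂) (hm₁ : p₁ % 8 = 5) (hm₂ : p₂ % 8 = 5) :
    ∃ g : 𝓞 K, S.J • g = g ∧ Ideal.span {g} = S.B p₁ := by
  obtain ⟨η, hηu, hJη, hη1, hη⟩ := U.exists_unit hne hm₁ hm₂
  have hd8 : (p₁ * p₂) % 8 = 1 := by rw [Nat.mul_mod, hm₁, hm₂]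
  have hk : S.IsReal (fixedField (quadSubgroup S.J S.s (S.invol _) (S.invol _) (S.comm _ _))) :=
    isFixedField_fixedField _
  obtain ⟨Q, hQrt, hQ⟩ := S.exists_quadField_real hk
  generalize (fixedField (quadSubgroup S.J S.s (S.invol _) (S.invol _) (S.comm _ _))) = k at *
  have inj := algebraMap_ringOfIntegers_injective (k := k) (K := K)
  have hη0 : 1 + η ≠ 0 := fun h => (hη 1 isUnit_one (smul_one _)).1.2 (by linear_combination h)
  have := S.isPrincipalIdealRing_F
  obtain ⟨ω, hω⟩ := S.exists_half (by omega)
  have hωσ : ω - S.σ • ω = S.rd := by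
    have h := congrArg (S.σ • ·) hω
    simp only [smul_mul', smul_add, smul_one, S.smul_two, S.σ_rd] at h
    apply mul_left_cancel₀ (two_ne_zero (α := 𝓞 K))
    linear_combination hω - h
  have hση : S.σ • (1 + η) * η = 1 + η := by
    rw [smul_add, smul_one]
    linear_combination hη1
  have hσI : S.σ • Ideal.span {1 + η} = Ideal.span {1 + η} := by
    rw [smul_span_singleton]
    conv_rhs => rw [← hση, Ideal.span_singleton_mul_right_unit hηu]
  have hJ1 : S.J • (1 + η) = 1 + η := by rw [smul_add, smul_one, hJη]
  obtain ⟨f, hf0, I, hI, hrd, hinv⟩ := S.isFixedField_F.exists_mul_eq_span ω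
    (I := Ideal.span {1 + η}) (by simpa using hη0) hσI
  have hJI := hinv S.J (S.comm _ _) (by rw [smul_span_singleton, hJ1])
  rw [hωσ] at hrd
  obtain ⟨g, hg, rfl⟩ := exists_of_mul_span_eq hη0 (by rw [mul_comm, hI])
  have hg0 : g ≠ 0 := by
    rintro rfl
    rw [mul_zero] at hg
    exact hf0 (algebraMap_ringOfIntegers_injective (k := fixedField S.subF) (K := K)
      (by rw [hg, map_zero]))
  have hI0 : Ideal.span {g} ≠ ⊥ := by simpa using hg0
  have hσf := S.isFixedField_F.smul_algebraMap (Or.inr rfl : S.σ ∈ pairSubgroup S.σ _) f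
  obtain ⟨L, hL, hLg⟩ := S.exists_map_eq hne hm₁ hm₂ Q (Or.inl hQrt) hI0 hJI hrd
  obtain ⟨u, hu⟩ := Ideal.span_singleton_eq_span_singleton.1
    ((smul_span_singleton S.J g).symm.trans hJI)
  have hsL : S.s • Ideal.span {g} = Ideal.span {g} := by
    rw [← hLg]
    exact hk.smul_map (Or.inr (Or.inr (Or.inl rfl))) L
  obtain ⟨ξ, hξ, -, hξg⟩ := S.exists_smul_eq_of_mul_smul_eq_map hd8 hk hg0 (θ := u) (I := L ^ 2)
    (by rw [mul_comm, hu]) (by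
      rw [← Ideal.span_singleton_mul_span_singleton, ← smul_span_singleton, hsL, Ideal.map_pow,
        hLg, pow_two])
  have hξu : IsUnit ξ := IsUnit.of_mul_eq_one _ hξ
  have hspan : Ideal.span {ξ * g} = Ideal.span {g} := by
    rw [mul_comm, Ideal.span_singleton_mul_right_unit hξu]
  have hg0' : ξ * g ≠ 0 := mul_ne_zero hξu.ne_zero hg0
  have hJk (y : 𝓞 k) : S.J • algebraMap (𝓞 k) (𝓞 K) y = algebraMap (𝓞 k) (𝓞 K) y :=
    hk.smul_algebraMap (Or.inr (Or.inl rfl)) y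
  rcases (Q.odd_closure hne (Or.inl rfl) hL).2 with ⟨x, hx, hτx⟩ | ⟨x, hx, -⟩
  · exfalso
    have hx' := congrArg (Ideal.map (algebraMap (𝓞 k) (𝓞 K))) hx
    rw [hLg, Ideal.map_span, Set.image_singleton] at hx'
    obtain ⟨v, hv⟩ := Ideal.span_singleton_eq_span_singleton.1 hx'
    have hσx : S.σ • algebraMap (𝓞 k) (𝓞 K) x = algebraMap (𝓞 k) (𝓞 K) x ∨
        S.σ • algebraMap (𝓞 k) (𝓞 K) x = -algebraMap (𝓞 k) (𝓞 K) x := by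
      rw [← hQ, ← map_neg]
      exact hτx.imp (congrArg _) (congrArg _)
    generalize algebraMap (𝓞 k) (𝓞 K) x = X at *
    rw [hg] at hσf
    have hσX : S.σ • X = η * S.σ • (v : 𝓞 K) * g := by
      apply mul_left_cancel₀ hη0
      have h := congrArg (S.σ • ·) (congrArg ((1 + η) * ·) hv)
      simp only [← mul_assoc] at h
      rw [smul_mul', hσf, smul_mul'] at h
      linear_combination (-η) * h - (S.σ • X) * hση
    have hvσ : (v : 𝓞 K) = η * S.σ • (v : 𝓞 K) ∨ (v : 𝓞 K) = -(η * S.σ • (v : 𝓞 K)) := by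
      refine hσx.imp (fun h => ?_) fun h => ?_
      · apply mul_left_cancel₀ hg0
        linear_combination hv - h + hσX
      · apply mul_left_cancel₀ hg0
        linear_combination hv + h - hσX
    have hκ : S.σ • ((v : 𝓞 K) * S.σ • (v : 𝓞 K)) = (v : 𝓞 K) * S.σ • (v : 𝓞 K) := by
      rw [smul_mul', S.smul_smul_self, mul_comm]
    obtain ⟨w, hw, -, l, b, hlb⟩ := U.exists_of_smul_eq hd8
      (v.isUnit.mul (S.smul_isUnit v.isUnit S.σ)) hκ
    obtain ⟨w', hw'⟩ := hw.exists_right_inv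
    have hw'u : IsUnit w' := IsUnit.of_mul_eq_one_right _ hw'
    have hV : η * (1 + S.r2) ^ b * S.ζ ^ l = ((v : 𝓞 K) * w') ^ 2 ∨
        η * (1 + S.r2) ^ b * S.ζ ^ l = -((v : 𝓞 K) * w') ^ 2 := by
      refine hvσ.imp (fun h => ?_) fun h => ?_
      · have h2 : (v : 𝓞 K) ^ 2 = η * (S.ζ ^ l * (1 + S.r2) ^ b * w ^ 2) := by
          rw [← hlb]
          linear_combination (v : 𝓞 K) * h
        linear_combination (-w' ^ 2) * h2 -
          η * (1 + S.r2) ^ b * S.ζ ^ l * (w * w' + 1) * hw'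
      · have h2 : (v : 𝓞 K) ^ 2 = -(η * (S.ζ ^ l * (1 + S.r2) ^ b * w ^ 2)) := by
          rw [← hlb]
          linear_combination (v : 𝓞 K) * h
        linear_combination (w' ^ 2) * h2 -
          η * (1 + S.r2) ^ b * S.ζ ^ l * (w * w' + 1) * hw'
    have hVu := v.isUnit.mul hw'u
    generalize (v : 𝓞 K) * w' = V at *
    obtain ⟨ξ', hξ', hJV⟩ := S.exists_real_unit hd8 hVu
    have hξ'u : IsUnit ξ' := IsUnit.of_mul_eq_one _ hξ'
    have hVu' := hξ'u.mul hVu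
    have hr2u : IsUnit (1 + S.r2) :=
      IsUnit.of_mul_eq_one (S.r2 - 1) (by linear_combination S.r2_sq)
    have hJr2 : S.J • (1 + S.r2) = 1 + S.r2 := by rw [smul_add, smul_one, S.J_r2]
    have hV' : ξ' ^ 2 * S.ζ ^ l * (η * (1 + S.r2) ^ b) = (ξ' * V) ^ 2 ∨
        ξ' ^ 2 * S.ζ ^ l * (η * (1 + S.r2) ^ b) = -(ξ' * V) ^ 2 :=
      hV.imp (fun h => by linear_combination ξ' ^ 2 * h) fun h => by linear_combination ξ' ^ 2 * h
    generalize ξ' * V = W at *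
    have hρJ : S.J • (ξ' ^ 2 * S.ζ ^ l) = ξ' ^ 2 * S.ζ ^ l := by
      have h0 : η * (1 + S.r2) ^ b ≠ 0 := (hηu.mul (hr2u.pow b)).ne_zero
      apply mul_right_cancel₀ h0
      have h1 : S.J • (ξ' ^ 2 * S.ζ ^ l * (η * (1 + S.r2) ^ b)) =
          ξ' ^ 2 * S.ζ ^ l * (η * (1 + S.r2) ^ b) := by
        rcases hV' with h | h <;> rw [h]
        · rw [smul_pow', hJV]
        · rw [smul_neg, smul_pow', hJV]
      rwa [smul_mul', smul_mul' _ η, smul_pow' _ (1 + S.r2), hJη, hJr2] at h1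
    have hρ1 : (ξ' ^ 2 * S.ζ ^ l) * S.J • (ξ' ^ 2 * S.ζ ^ l) = 1 := by
      rw [smul_mul', smul_pow', smul_pow']
      calc _ = (ξ' * S.J • ξ') ^ 2 * (S.ζ * S.J • S.ζ) ^ l := by ring
        _ = 1 := by rw [hξ', S.ζ_mul_J, one_pow, one_pow, one_mul]
    rw [hρJ, ← pow_two, sq_eq_one_iff] at hρ1
    have hW : η * (1 + S.r2) ^ b = W ^ 2 ∨ η * (1 + S.r2) ^ b = -W ^ 2 := by
      rcases hρ1 with h1 | h1 <;> rw [h1] at hV' <;> rcases hV' with h2 | h2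
      · exact Or.inl (by linear_combination h2)
      · exact Or.inr (by linear_combination h2)
      · exact Or.inr (by linear_combination -h2)
      · exact Or.inl (by linear_combination -h2)
    have ht : (1 + S.r2) * (S.r2 - 1) = 1 := by linear_combination S.r2_sq
    have hJt : S.J • (S.r2 - 1) = S.r2 - 1 := by rw [smul_sub, smul_one, S.J_r2]
    have htu : IsUnit (S.r2 - 1) := IsUnit.of_mul_eq_one_right _ ht
    have hpow (c : ℕ) : (1 + S.r2) ^ c * (S.r2 - 1) ^ c = 1 := by rw [← mul_pow, ht, one_pow]
    rcases Nat.even_or_odd' b with ⟨c, rfl | rfl⟩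
    · have h := (hη (W * (S.r2 - 1) ^ c) (hVu'.mul (htu.pow c))
        (by rw [smul_mul', smul_pow', hJV, hJt])).1
      rcases hW with h1 | h1
      · refine h.1 ?_
        rw [mul_pow, ← h1, mul_assoc, pow_mul', ← mul_pow, hpow, one_pow, mul_one]
      · refine h.2 ?_
        rw [mul_pow, ← neg_mul, ← h1, mul_assoc, pow_mul', ← mul_pow, hpow, one_pow, mul_one]
    · have h := (hη (W * (S.r2 - 1) ^ (c + 1)) (hVu'.mul (htu.pow _))
        (by rw [smul_mul', smul_pow', hJV, hJt])).2
      have key : (1 + S.r2) * ((1 + S.r2) ^ (2 * c + 1) * ((S.r2 - 1) ^ (c + 1)) ^ 2) = 1 := by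
        rw [← mul_assoc, ← pow_succ', show 2 * c + 1 + 1 = 2 * (c + 1) by ring, pow_mul',
          ← mul_pow, hpow, one_pow]
      rcases hW with h1 | h1
      · refine h.1 ?_
        rw [mul_pow, ← h1]
        linear_combination -η * key
      · refine h.2 ?_
        rw [mul_pow]
        linear_combination (1 + S.r2) * ((S.r2 - 1) ^ (c + 1)) ^ 2 * h1 - η * key
  · have hx' := congrArg (Ideal.map (algebraMap (𝓞 k) (𝓞 K))) hx
    rw [Ideal.map_mul, hLg, S.map_ram Q (Or.inl hQrt), Ideal.map_span, Set.image_singleton,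
      ← hspan, mul_comm] at hx'
    obtain ⟨y, hy, hBy⟩ := exists_of_mul_span_eq hg0' hx'
    refine ⟨y, mul_left_cancel₀ hg0' ?_, hBy.symm⟩
    rw [← hy, ← hJk x, hy, smul_mul', hξg]

end
end Octic

section ClassMaps
variable {k K : Type*} [Field k] [NumberField k] [Field K] [NumberField K] [Algebra k K]

theorem map_algebraMap_ne_bot {I : Ideal (𝓞 k)} (hI : I ≠ ⊥) :
    I.map (algebraMap (𝓞 k) (𝓞 K)) ≠ ⊥ := by
  rwa [Ne, Ideal.map_eq_bot_iff_of_injective algebraMap_ringOfIntegers_injective]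

theorem relNorm_ne_bot {I : Ideal (𝓞 K)} (hI : I ≠ ⊥) : Ideal.relNorm (𝓞 k) I ≠ ⊥ := by
  rwa [Ne, Ideal.relNorm_eq_bot_iff]

theorem exists_relNormHom (k K : Type*) [Field k] [NumberField k] [Field K] [NumberField K]
    [Algebra k K] : ∃ N : ClassGroup (𝓞 K) →* ClassGroup (𝓞 k),
      ∀ I : Ideal (𝓞 K), I ≠ ⊥ → N (idealClass I) = idealClass (Ideal.relNorm (𝓞 k) I) :=
  exists_classGroup_hom (fun I => I ≠ ⊥) _ (fun _ h => h)
    (fun I J hI hJ => ⟨mul_ne_zero hI hJ, by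
      rw [map_mul, idealClass_mul (relNorm_ne_bot hI) (relNorm_ne_bot hJ)]⟩)
    (fun x _ => by rw [Ideal.relNorm_singleton, idealClass_span])
    (fun I hI => by
      obtain ⟨J, hJ, -, hx⟩ := exists_mul_eq_span_coprime hI top_ne_bot
      exact ⟨J, hJ, hx⟩)

theorem exists_mapHom (k K : Type*) [Field k] [NumberField k] [Field K] [NumberField K]
    [Algebra k K] : ∃ j : ClassGroup (𝓞 k) →* ClassGroup (𝓞 K),
      ∀ I : Ideal (𝓞 k), I ≠ ⊥ → j (idealClass I) = idealClass (I.map (algebraMap (𝓞 k) (𝓞 K))) :=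
  exists_classGroup_hom (fun I => I ≠ ⊥) _ (fun _ h => h)
    (fun I J hI hJ => ⟨mul_ne_zero hI hJ, by
      rw [Ideal.map_mul, idealClass_mul (map_algebraMap_ne_bot hI) (map_algebraMap_ne_bot hJ)]⟩)
    (fun x _ => by rw [Ideal.map_span, Set.image_singleton, idealClass_span])
    (fun I hI => by
      obtain ⟨J, hJ, -, hx⟩ := exists_mul_eq_span_coprime hI top_ne_bot
      exact ⟨J, hJ, hx⟩)

theorem IsFixedField.relNorm_map {a b : Gal(K/ℚ)} {ha : a * a = 1} {hb : b * b = 1}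
    {hab : a * b = b * a} (h : IsFixedField k (quadSubgroup a b ha hb hab)) (h1 : a ≠ 1)
    (h2 : b ≠ 1) (h3 : a ≠ b) (I : Ideal (𝓞 k)) :
    Ideal.relNorm (𝓞 k) (I.map (algebraMap (𝓞 k) (𝓞 K))) = I ^ 4 := by
  apply map_algebraMap_injective (K := K)
  rw [h.map_relNorm_quad h1 h2 h3, h.smul_map (Or.inr (Or.inl rfl)),
    h.smul_map (Or.inr (Or.inr (Or.inl rfl))), h.smul_map (Or.inr (Or.inr (Or.inr rfl))),
    Ideal.map_pow]
  ring

theorem absNorm_relNorm' (I : Ideal (𝓞 K)) :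
    Ideal.absNorm (Ideal.relNorm (𝓞 k) I) = Ideal.absNorm I :=
  Ideal.absNorm_relNorm _ _ I

end ClassMaps

namespace GaussianInt

/-- The quadratic character modulo a prime factor of `p` in `ℤ[i]`. -/
noncomputable def rootChar {p : ℕ} [Fact p.Prime] {r : ZMod p} (hr : r * r = -1) :
    GaussianInt →* ℤ :=
  (quadraticChar (ZMod p)).toMonoidHom.comp
    (Zsqrtd.lift ⟨r, by rw [hr]; simp⟩ : GaussianInt →+* ZMod p).toMonoidHom

section
variable {p : ℕ} [hp : Fact p.Prime] {r : ZMod p} (hr : r * r = -1)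

theorem rootChar_apply (x : GaussianInt) :
    rootChar hr x = quadraticChar (ZMod p) (x.re + x.im * r) := rfl

theorem rootChar_natCast (n : ℕ) : rootChar hr n = quadraticChar (ZMod p) n := by
  rw [rootChar_apply]
  simp

theorem rootChar_neg_one : rootChar hr (-1) = 1 := by
  rw [rootChar_apply, show (((-1 : GaussianInt).re : ZMod p) + ((-1 : GaussianInt).im : ℤ) * r) =
    r ^ 2 by rw [pow_two, hr]; simp, quadraticChar_sq_one']
  rintro rfl
  rw [mul_zero, eq_comm, neg_eq_zero] at hr
  exact one_ne_zero hr

theorem rootChar_I (hp8 : p % 8 = 5) : rootChar hr ⟨0, 1⟩ = -1 := by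
  have hp2 : ringChar (ZMod p) ≠ 2 := by rw [ZMod.ringChar_zmod_n]; omega
  rw [rootChar_apply]
  simp only [Int.cast_zero, Int.cast_one, one_mul, zero_add]
  rw [quadraticChar_neg_one_iff_not_isSquare]
  rintro ⟨t, ht⟩
  have h1 : t ^ 4 = -1 := by rw [← hr, ht]; ring
  have ht0 : t ≠ 0 := by
    rintro rfl
    rw [zero_pow four_ne_zero, eq_comm, neg_eq_zero] at h1
    exact one_ne_zero h1
  have h2 := ZMod.pow_card_sub_one_eq_one ht0
  obtain ⟨c, hc⟩ : ∃ c, p - 1 = 4 * (2 * c + 1) := ⟨p / 8, by omega⟩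
  rw [hc, pow_mul, h1, Odd.neg_one_pow ⟨c, rfl⟩] at h2
  exact Ring.neg_one_ne_one_of_char_ne_two hp2 h2

theorem rootChar_of_sq_eq {q : ℕ} (hp2 : p ≠ 2) (hpq : p.Coprime q) {w T N : GaussianInt}
    (hw : w ^ 2 = p * q * (T ^ 2 - 4 * N)) (hN : rootChar hr N ≠ 0) : rootChar hr N = 1 := by
  have hr0 : r ≠ 0 := by
    rintro rfl
    rw [mul_zero, eq_comm, neg_eq_zero] at hr
    exact one_ne_zero hr
  have h2 : (2 : ZMod p) ≠ 0 := by
    rw [Ne, ← Nat.cast_ofNat, ZMod.natCast_eq_zero_iff]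
    intro h
    exact hp2 ((Nat.prime_dvd_prime_iff_eq hp.out Nat.prime_two).1 h)
  have hq : (q : ZMod p) ≠ 0 := by
    rw [Ne, ZMod.natCast_eq_zero_iff]
    exact fun h => hp.out.one_lt.ne' (Nat.Coprime.eq_one_of_dvd hpq h)
  set ρ : GaussianInt →+* ZMod p := Zsqrtd.lift ⟨r, by rw [hr]; simp⟩ with hρ
  have h1 (x : GaussianInt) : ρ x = x.re + x.im * r := rfl
  have hρw : ρ w = 0 := by
    rw [← pow_eq_zero_iff two_ne_zero, ← map_pow, hw, map_mul, map_mul, map_natCast]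
    simp
  have hρw' : ρ (star w) = 0 := by
    rw [← pow_eq_zero_iff two_ne_zero, ← map_pow, ← star_pow, hw, star_mul, star_mul, map_mul,
      map_mul, star_natCast, star_natCast, map_natCast, map_natCast]
    simp
  rw [h1] at hρw hρw'
  simp only [Zsqrtd.re_star, Zsqrtd.im_star, Int.cast_neg] at hρw'
  have ha : (w.re : ZMod p) = 0 := by
    apply mul_left_cancel₀ h2
    linear_combination hρw + hρw'
  have hb : (w.im : ZMod p) = 0 := by
    apply mul_right_cancel₀ hr0
    linear_combination hρw - ha
  rw [ZMod.intCast_zmod_eq_zero_iff_dvd] at ha hb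
  obtain ⟨a, ha⟩ := ha
  obtain ⟨b, hb⟩ := hb
  have hw' : w = p * ⟨a, b⟩ := by ext <;> simp [ha, hb]
  have hp0 : (p : GaussianInt) ≠ 0 := by exact_mod_cast hp.out.ne_zero
  have h3 : (p : GaussianInt) * ⟨a, b⟩ ^ 2 = q * (T ^ 2 - 4 * N) := by
    apply mul_left_cancel₀ hp0
    rw [← mul_assoc (p : GaussianInt) q, ← hw, hw']
    ring
  have h4 : ρ T ^ 2 = 4 * ρ N := by
    have := congrArg ρ h3
    simp only [map_mul, map_sub, map_pow, map_natCast, CharP.cast_eq_zero, zero_mul,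
      map_ofNat] at this
    have := (mul_eq_zero.1 this.symm).resolve_left hq
    linear_combination this
  have h5 : rootChar hr N = quadraticChar (ZMod p) (ρ N) := rfl
  rw [h5] at hN ⊢
  have hN0 : ρ N ≠ 0 := fun h => hN (by rw [h, MulChar.map_zero])
  rw [quadraticChar_one_iff_isSquare hN0]
  exact ⟨ρ T / 2, by field_simp; linear_combination -h4⟩

theorem rootChar_ne_zero {x : GaussianInt} {n : ℕ} (hx : x * star x = n) (hn : n.Coprime p) :
    rootChar hr x ≠ 0 := by
  intro h
  have h1 := rootChar_natCast hr n
  rw [← hx, map_mul, h, zero_mul, eq_comm, quadraticChar_eq_zero_iff, ZMod.natCast_eq_zero_iff] at h1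
  exact hp.out.one_lt.ne' (Nat.Coprime.eq_one_of_dvd hn.symm h1)

end

theorem eq_of_isUnit {x : GaussianInt} (hx : IsUnit x) :
    x = 1 ∨ x = -1 ∨ x = ⟨0, 1⟩ ∨ x = -1 * ⟨0, 1⟩ := by
  have h := Zsqrtd.norm_eq_one_iff.2 hx
  rw [Zsqrtd.norm_def] at h
  have h1 : x.re * x.re + x.im * x.im = 1 := by
    have := mul_self_nonneg x.re
    have := mul_self_nonneg x.im
    have h3 : x.re * x.re - -1 * x.im * x.im = x.re * x.re + x.im * x.im := by ring
    rw [h3] at h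
    omega
  have h2 : -1 ≤ x.re ∧ x.re ≤ 1 := by constructor <;> nlinarith
  have h3 : -1 ≤ x.im ∧ x.im ≤ 1 := by constructor <;> nlinarith
  obtain ⟨a, b⟩ := x
  simp only at h1 h2 h3
  obtain ⟨h2, h2'⟩ := h2
  obtain ⟨h3, h3'⟩ := h3
  interval_cases a <;> interval_cases b <;> simp_all [Zsqrtd.ext_iff]

/-- The product of the quadratic characters modulo prime factors of `p₁` and `p₂`. -/
noncomputable def biChar {p₁ p₂ : ℕ} [Fact p₁.Prime] [Fact p₂.Prime] {r₁ : ZMod p₁} {r₂ : ZMod p₂}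
    (hr₁ : r₁ * r₁ = -1) (hr₂ : r₂ * r₂ = -1) : GaussianInt →* ℤ := rootChar hr₁ * rootChar hr₂

theorem biChar_apply {p₁ p₂ : ℕ} [Fact p₁.Prime] [Fact p₂.Prime] {r₁ : ZMod p₁} {r₂ : ZMod p₂}
    (hr₁ : r₁ * r₁ = -1) (hr₂ : r₂ * r₂ = -1) (x : GaussianInt) :
    biChar hr₁ hr₂ x = rootChar hr₁ x * rootChar hr₂ x := rfl

theorem biChar_of_isUnit {p₁ p₂ : ℕ} [Fact p₁.Prime] [Fact p₂.Prime] {r₁ : ZMod p₁} {r₂ : ZMod p₂}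
    (hr₁ : r₁ * r₁ = -1) (hr₂ : r₂ * r₂ = -1) (hm₁ : p₁ % 8 = 5) (hm₂ : p₂ % 8 = 5)
    {x : GaussianInt} (hx : IsUnit x) : biChar hr₁ hr₂ x = 1 := by
  rw [biChar_apply]
  rcases eq_of_isUnit hx with rfl | rfl | rfl | rfl
  · simp
  · simp [rootChar_neg_one]
  · rw [rootChar_I _ hm₁, rootChar_I _ hm₂]
    rfl
  · rw [map_mul, map_mul, rootChar_neg_one, rootChar_neg_one, rootChar_I _ hm₁, rootChar_I _ hm₂]
    rfl

end GaussianInt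

theorem GaussianInt.exists_mul_star (x : GaussianInt) : ∃ n : ℕ, x * star x = n := by
  refine ⟨x.norm.natAbs, ?_⟩
  rw [← Int.cast_natCast, Int.natAbs_of_nonneg (GaussianInt.norm_nonneg x), Zsqrtd.norm_eq_mul_conj]

namespace Octic
variable {p₁ p₂ : ℕ} {K : Type*} [Field K] [NumberField K] (S : Octic p₁ p₂ K)
include S

theorem absNorm_span_natCast (n : ℕ) : Ideal.absNorm (Ideal.span {(n : 𝓞 K)}) = n ^ 8 := by
  rw [Ideal.absNorm_span_singleton, ← map_natCast (algebraMap ℤ (𝓞 K)) n,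
    Algebra.norm_algebraMap, RingOfIntegers.rank, S.rank, Int.natAbs_pow, Int.natAbs_natCast]

variable [hf₁ : Fact p₁.Prime] [hf₂ : Fact p₂.Prime]

/-- `x` generates the norm of the ideal `I` to `ℤ[i]`. -/
def IsGaussNorm (I : Ideal (𝓞 K)) (x : GaussianInt) : Prop :=
  I * S.σ • I * S.s • I * (S.σ * S.s) • I = Ideal.span {S.gauss x}

variable {S}

theorem IsGaussNorm.mul_star {I : Ideal (𝓞 K)} {x : GaussianInt} (h : S.IsGaussNorm I x) :
    x * star x = (Ideal.absNorm I : ℕ) := by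
  obtain ⟨n, hn⟩ := GaussianInt.exists_mul_star x
  have h1 := congrArg Ideal.absNorm h
  simp only [map_mul, absNorm_smul] at h1
  have h2 : Ideal.absNorm (Ideal.span {S.gauss (star x)}) = Ideal.absNorm I ^ 4 := by
    rw [← S.J_gauss, ← smul_span_singleton, absNorm_smul, ← h1]
    ring
  have h3 : n ^ 8 = Ideal.absNorm I ^ 8 := by
    rw [← S.absNorm_span_natCast, ← map_natCast S.gauss, ← hn, map_mul,
      ← Ideal.span_singleton_mul_span_singleton, map_mul, h2, ← h1]
    ring
  rw [hn, Nat.pow_left_injective (by norm_num : 8 ≠ 0) h3]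

theorem IsGaussNorm.mul {I I' : Ideal (𝓞 K)} {x x' : GaussianInt} (h : S.IsGaussNorm I x)
    (h' : S.IsGaussNorm I' x') : S.IsGaussNorm (I * I') (x * x') := by
  rw [IsGaussNorm] at *
  rw [map_mul, ← Ideal.span_singleton_mul_span_singleton, ← h, ← h', smul_mul', smul_mul',
    smul_mul']
  ring

theorem IsGaussNorm.associated {I : Ideal (𝓞 K)} {x y : GaussianInt} (h : S.IsGaussNorm I x)
    (hy : S.IsGaussNorm I y) (hI : I ≠ ⊥) : ∃ u, IsUnit u ∧ x = u * y := by
  have h1 := h.symm.trans hy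
  rw [Ideal.span_singleton_eq_span_singleton] at h1
  have hy0 : y ≠ 0 := by
    rintro rfl
    have := hy.mul_star
    rw [zero_mul, eq_comm, Nat.cast_eq_zero, Ideal.absNorm_eq_zero_iff] at this
    exact hI this
  obtain ⟨u, hu⟩ := h1.symm
  have hg0 : S.gauss y ≠ 0 := by rwa [Ne, map_eq_zero_iff _ S.gauss_injective]
  obtain ⟨z, hz⟩ := S.exists_gauss (x := u) (by
    apply mul_left_cancel₀ hg0
    rw [hu]
    nth_rw 1 [← S.σ_gauss y]
    rw [← smul_mul', hu, S.σ_gauss]) (by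
    apply mul_left_cancel₀ hg0
    rw [hu]
    nth_rw 1 [← S.s_gauss y]
    rw [← smul_mul', hu, S.s_gauss])
  obtain ⟨z', hz'⟩ := S.exists_gauss (x := (u⁻¹ : (𝓞 K)ˣ)) (by
    apply u.isUnit.mul_left_cancel
    nth_rw 1 [← hz]
    nth_rw 1 [← S.σ_gauss z]
    rw [← smul_mul', hz, Units.mul_inv, smul_one]) (by
    apply u.isUnit.mul_left_cancel
    nth_rw 1 [← hz]
    nth_rw 1 [← S.s_gauss z]
    rw [← smul_mul', hz, Units.mul_inv, smul_one])
  refine ⟨z, IsUnit.of_mul_eq_one z' (S.gauss_injective ?_), S.gauss_injective ?_⟩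
  · rw [map_mul, hz, hz', Units.mul_inv, map_one]
  · rw [map_mul, hz, ← hu, mul_comm]

variable (S)

theorem exists_isGaussNorm (I : Ideal (𝓞 K)) : ∃ x, S.IsGaussNorm I x := by
  obtain ⟨e, he⟩ := S.exists_gaussEquiv
  have : IsPrincipalIdealRing (𝓞 (fixedField S.subI)) :=
    IsPrincipalIdealRing.of_surjective (e : GaussianInt →+* _) e.surjective
  obtain ⟨y, hy⟩ := (IsPrincipalIdealRing.principal (Ideal.relNorm (𝓞 (fixedField S.subI)) I)).principal
  rw [Ideal.submodule_span_eq] at hy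
  refine ⟨e.symm y, ?_⟩
  rw [IsGaussNorm, ← S.isFixedField_I.map_relNorm_quad S.σ_ne_one S.s_ne_one, hy, Ideal.map_span,
    Set.image_singleton, ← he, RingEquiv.apply_symm_apply]
  intro h
  have := S.s_rd
  rw [← h, S.σ_rd] at this
  have h2 := add_eq_zero_iff_eq_neg.2 this.symm
  rw [← two_mul, mul_eq_zero] at h2
  exact h2.elim (by norm_num) S.rd_ne

theorem isGaussNorm_span {y : 𝓞 K} {x : GaussianInt}
    (h : S.gauss x = y * S.σ • y * S.s • y * (S.σ * S.s) • y) :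
    S.IsGaussNorm (Ideal.span {y}) x := by
  rw [IsGaussNorm, h]
  simp only [smul_span_singleton, Ideal.span_singleton_mul_span_singleton]

theorem exists_gauss_norm (y : 𝓞 K) :
    ∃ N, S.gauss N = y * S.σ • y * S.s • y * (S.σ * S.s) • y := by
  have hc : S.s • S.σ • y = S.σ • S.s • y := S.smul_smul_comm _ _ _
  apply S.exists_gauss
  · rw [mul_smul]
    simp only [smul_mul', S.smul_smul_self]
    ring
  · rw [mul_smul]
    simp only [smul_mul', S.smul_smul_self, hc, S.smul_smul_comm S.s S.σ (S.s • y)]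
    ring

theorem rootChar_gauss_norm {p q : ℕ} [Fact p.Prime] (hp2 : p ≠ 2) (hpq : p.Coprime q)
    (hS : S.rd ^ 2 = p * q) {r : ZMod p} (hr : r * r = -1) {y : 𝓞 K} {N : GaussianInt}
    (hgN : S.gauss N = y * S.σ • y * S.s • y * (S.σ * S.s) • y)
    (hN : GaussianInt.rootChar hr N ≠ 0) : GaussianInt.rootChar hr N = 1 := by
  have hc : S.s • S.σ • y = S.σ • S.s • y := S.smul_smul_comm _ _ _
  obtain ⟨T, hT⟩ := S.exists_gauss (x := y * S.s • y + S.σ • (y * S.s • y)) (by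
    simp only [smul_mul', S.smul_smul_self, smul_add]
    ring) (by
    simp only [smul_mul', S.smul_smul_self, smul_add, hc, S.smul_smul_comm S.s S.σ (S.s • y)]
    ring)
  obtain ⟨w, hw⟩ := S.exists_gauss (x := (y * S.s • y - S.σ • (y * S.s • y)) * S.rd) (by
    simp only [smul_mul', S.smul_smul_self, smul_sub, S.σ_rd]
    ring) (by
    simp only [smul_mul', S.smul_smul_self, smul_sub, hc, S.smul_smul_comm S.s S.σ (S.s • y),
      S.s_rd]
    ring)
  refine GaussianInt.rootChar_of_sq_eq hr hp2 hpq (w := w) (T := T) ?_ hN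
  apply S.gauss_injective
  simp only [map_mul, map_pow, map_sub, map_natCast, map_ofNat, hw, hT, hgN]
  rw [mul_pow, hS, mul_smul, smul_mul']
  ring

variable {r₁ : ZMod p₁} {r₂ : ZMod p₂} (hr₁ : r₁ * r₁ = -1) (hr₂ : r₂ * r₂ = -1)

theorem exists_gaussChar (hne : p₁ ≠ p₂) (hm₁ : p₁ % 8 = 5) (hm₂ : p₂ % 8 = 5) :
    ∃ φ : ClassGroup (𝓞 K) →* ℤ, ∀ I : Ideal (𝓞 K), I ≠ ⊥ →
      (Ideal.absNorm I).Coprime (p₁ * p₂) → ∀ x, S.IsGaussNorm I x →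
        φ (idealClass I) = GaussianInt.biChar hr₁ hr₂ x := by
  have hcop : p₁.Coprime p₂ := (Nat.coprime_primes hf₁.out hf₂.out).2 hne
  choose f hf using S.exists_isGaussNorm
  have key {I : Ideal (𝓞 K)} (hI : I ≠ ⊥) {x y} (hx : S.IsGaussNorm I x)
      (hy : S.IsGaussNorm I y) : GaussianInt.biChar hr₁ hr₂ x = GaussianInt.biChar hr₁ hr₂ y := by
    obtain ⟨u, hu, rfl⟩ := hx.associated hy hI
    rw [map_mul, GaussianInt.biChar_of_isUnit hr₁ hr₂ hm₁ hm₂ hu, one_mul]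
  obtain ⟨φ, hφ⟩ := exists_classGroup_hom
    (fun I : Ideal (𝓞 K) => I ≠ ⊥ ∧ (Ideal.absNorm I).Coprime (p₁ * p₂))
    (fun I => GaussianInt.biChar hr₁ hr₂ (f I)) (fun I h => h.1)
    (fun I I' h h' => by
      have h0 : I * I' ≠ ⊥ := mul_ne_zero h.1 h'.1
      refine ⟨⟨h0, ?_⟩, ?_⟩
      · rw [map_mul]
        exact h.2.mul_left h'.2
      · rw [← map_mul]
        exact key h0 (hf _) ((hf I).mul (hf I')))
    (fun y hy => by
      obtain ⟨N, hN⟩ := S.exists_gauss_norm y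
      have h := S.isGaussNorm_span hN
      rw [key hy.1 (hf _) h, GaussianInt.biChar_apply,
        S.rootChar_gauss_norm (by omega) hcop S.rd_sq hr₁ hN
          (GaussianInt.rootChar_ne_zero hr₁ h.mul_star hy.2.coprime_mul_right_right),
        S.rootChar_gauss_norm (by omega) hcop.symm (by rw [S.rd_sq]; ring) hr₂ hN
          (GaussianInt.rootChar_ne_zero hr₂ h.mul_star hy.2.coprime_mul_left_right), one_mul])
    (fun I hI => by
      have h0 : Ideal.span {((p₁ * p₂ : ℕ) : 𝓞 K)} ≠ ⊥ := by
        rw [Ne, Ideal.span_singleton_eq_bot, Nat.cast_eq_zero]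
        exact (Nat.mul_pos hf₁.out.pos hf₂.out.pos).ne'
      obtain ⟨J, hJ, hJc, hx⟩ := exists_mul_eq_span_coprime hI h0
      exact ⟨J, ⟨hJ, coprime_absNorm_of_sup_eq_top hJ hJc⟩, hx⟩)
  exact ⟨φ, fun I hI hc x hx => (hφ I ⟨hI, hc⟩).trans (key hI (hf I) hx)⟩

end Octic

theorem exists_coprime_rep {k : Type*} [Field k] [NumberField k] (c : ClassGroup (𝓞 k)) {N : ℕ}
    (hN : N ≠ 0) : ∃ I : Ideal (𝓞 k), I ≠ ⊥ ∧ (Ideal.absNorm I).Coprime N ∧ idealClass I = c := by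
  obtain ⟨I, hI, hc⟩ := exists_idealClass_eq c⁻¹
  have h0 : Ideal.span {(N : 𝓞 k)} ≠ ⊥ := by
    rwa [Ne, Ideal.span_singleton_eq_bot, Nat.cast_eq_zero]
  obtain ⟨J, hJ, hJc, x, hx⟩ := exists_mul_eq_span_coprime hI h0
  refine ⟨J, hJ, coprime_absNorm_of_sup_eq_top hJ hJc, ?_⟩
  have := idealClass_mul hI hJ
  rw [hx, idealClass_span, hc, eq_comm, inv_mul_eq_one] at this
  exact this.symm

section
variable {k K : Type*} [Field k] [NumberField k] [Field K] [NumberField K] [Algebra k K]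

theorem IsFixedField.absNorm_map {a b : Gal(K/ℚ)} {ha : a * a = 1} {hb : b * b = 1}
    {hab : a * b = b * a} (h : IsFixedField k (quadSubgroup a b ha hb hab)) (h1 : a ≠ 1)
    (h2 : b ≠ 1) (h3 : a ≠ b) (I : Ideal (𝓞 k)) :
    Ideal.absNorm (I.map (algebraMap (𝓞 k) (𝓞 K))) = Ideal.absNorm I ^ 4 := by
  rw [← absNorm_relNorm' (k := k), h.relNorm_map h1 h2 h3, map_pow]

theorem smul_map_eq_map_smul {τ : Gal(k/ℚ)} {g : Gal(K/ℚ)}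
    (h : ∀ y : 𝓞 k, algebraMap (𝓞 k) (𝓞 K) (τ • y) = g • algebraMap (𝓞 k) (𝓞 K) y)
    (I : Ideal (𝓞 k)) :
    g • I.map (algebraMap (𝓞 k) (𝓞 K)) = (τ • I).map (algebraMap (𝓞 k) (𝓞 K)) := by
  rw [Ideal.pointwise_smul_def, Ideal.pointwise_smul_def, Ideal.map_map, Ideal.map_map]
  congr 1
  exact RingHom.ext fun y => (h y).symm

end

namespace Octic
variable {p₁ p₂ : ℕ} {K : Type*} [Field K] [NumberField K] {S : Octic p₁ p₂ K}
variable [hf₁ : Fact p₁.Prime] [hf₂ : Fact p₂.Prime]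
variable {k : Type*} [Field k] [NumberField k] [Algebra k K]

theorem map_mul_σ {D : ℤ} (Q : QuadField D k)
    (hQ : ∀ y : 𝓞 k, algebraMap (𝓞 k) (𝓞 K) (Q.τ • y) = S.σ • algebraMap (𝓞 k) (𝓞 K) y)
    (I : Ideal (𝓞 k)) :
    I.map (algebraMap (𝓞 k) (𝓞 K)) * S.σ • I.map (algebraMap (𝓞 k) (𝓞 K)) =
      Ideal.span {(Ideal.absNorm I : 𝓞 K)} := by
  rw [smul_map_eq_map_smul hQ, ← Ideal.map_mul, Q.mul_smul_eq_span, Ideal.map_span,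
    Set.image_singleton, map_natCast]

theorem isGaussNorm_map {D : ℤ} (Q : QuadField D k)
    (hQ : ∀ y : 𝓞 k, algebraMap (𝓞 k) (𝓞 K) (Q.τ • y) = S.σ • algebraMap (𝓞 k) (𝓞 K) y)
    {I : Ideal (𝓞 k)}
    (hs : S.s • I.map (algebraMap (𝓞 k) (𝓞 K)) = I.map (algebraMap (𝓞 k) (𝓞 K))) :
    S.IsGaussNorm (I.map (algebraMap (𝓞 k) (𝓞 K))) ((Ideal.absNorm I : ℕ) ^ 2) := by
  rw [IsGaussNorm, mul_smul, hs, mul_assoc, map_mul_σ Q hQ, Ideal.span_singleton_mul_span_singleton,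
    map_pow, map_natCast, pow_two]

theorem exists_eq_span_of_span_smul (hd : (p₁ * p₂) % 8 = 1) (hk : S.IsReal k) {g : 𝓞 K}
    (hg : g ≠ 0) (hJ : S.J • Ideal.span {g} = Ideal.span {g}) {I : Ideal (𝓞 k)}
    (hI : Ideal.span {g * S.s • g} = I.map (algebraMap (𝓞 k) (𝓞 K))) : ∃ y, I = Ideal.span {y} := by
  rw [smul_span_singleton, Ideal.span_singleton_eq_span_singleton] at hJ
  obtain ⟨u, hu⟩ := hJ
  obtain ⟨ξ, hξ, -, hξg⟩ := S.exists_smul_eq_of_mul_smul_eq_map hd hk hg (θ := u)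
    (by rw [mul_comm, hu]) hI
  have hξu : IsUnit ξ := IsUnit.of_mul_eq_one _ hξ
  have hξu' : IsUnit (S.s • ξ) := IsUnit.of_mul_eq_one (S.s • S.J • ξ) (by
    rw [← smul_mul', hξ, smul_one])
  obtain ⟨y, hy⟩ := hk.exists_of_smul_eq_quad (x := ξ * g * S.s • (ξ * g))
    (by rw [smul_mul', hξg, S.smul_smul_comm, hξg])
    (by rw [smul_mul', S.smul_smul_self, mul_comm])
  refine ⟨y, map_algebraMap_injective (K := K) ?_⟩
  rw [← hI, Ideal.map_span, Set.image_singleton, hy, Ideal.span_singleton_eq_span_singleton]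
  obtain ⟨v, hv⟩ := hξu.mul hξu'
  refine ⟨v, ?_⟩
  rw [hv, smul_mul']
  ring

theorem relNorm_eq_span_of_sq_eq (hd : (p₁ * p₂) % 8 = 1) (hk : S.IsReal k) {I : Ideal (𝓞 K)}
    (hI : I ≠ ⊥) (hJ : S.J • I = I) {g : 𝓞 K} (hg : I ^ 2 = Ideal.span {g}) :
    ∃ y, Ideal.relNorm (𝓞 k) I = Ideal.span {y} := by
  have hg0 : g ≠ 0 := by
    rintro rfl
    rw [Ideal.span_singleton_eq_bot.2 rfl] at hg
    exact pow_ne_zero 2 hI hg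
  refine exists_eq_span_of_span_smul hd hk hg0 ?_ ?_
  · rw [← hg, pow_two, smul_mul', hJ]
  · rw [hk.map_relNorm_quad S.J_ne_one S.s_ne_one S.J_ne_s, S.comm, mul_smul, hJ,
      ← Ideal.span_singleton_mul_span_singleton, ← smul_span_singleton, ← hg, pow_two, smul_mul']
    ring

omit hf₁ hf₂ in
theorem exists_absNorm_eq_two (hd : (p₁ * p₂) % 8 = 1) :
    ∃ I : Ideal (𝓞 K), I ≠ ⊥ ∧ S.J • I = I ∧ Ideal.absNorm I = 2 := by
  obtain ⟨ω, hω⟩ := S.exists_half (by omega)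
  have h2 : (2 : 𝓞 K) ≠ 0 := two_ne_zero
  have hσω : S.σ • ω = 1 - ω := by
    apply mul_left_cancel₀ h2
    rw [← S.smul_two S.σ, ← smul_mul', hω, smul_add, smul_one, S.σ_rd, S.smul_two]
    linear_combination hω
  have hJω : S.J • ω = ω := by
    apply mul_left_cancel₀ h2
    rw [← S.smul_two S.J, ← smul_mul', hω, smul_add, smul_one, S.J_rd, S.smul_two, hω]
  obtain ⟨t, ht⟩ : ∃ t, p₁ * p₂ = 8 * t + 1 := ⟨p₁ * p₂ / 8, by omega⟩
  have ht' : (p₁ : 𝓞 K) * p₂ = 8 * t + 1 := by exact_mod_cast congrArg (Nat.cast : ℕ → 𝓞 K) ht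
  have hω2 : ω * (1 - ω) = -2 * t := by
    apply mul_left_cancel₀ (mul_ne_zero h2 h2)
    linear_combination (1 - 2 * ω - S.rd) * hω - S.rd_sq - ht'
  have hζ4 : S.ζ ^ 4 = -1 := S.ζ_pow_four
  have hI := span_pair_mul_span_pair (p := 1 - S.ζ) (x := ω) (y := 1 - ω)
    (t := -t * (1 + S.ζ) * (1 + S.ζ ^ 2)) (a := 0) (b := 1) (c := 1)
    (by linear_combination hω2 - t * hζ4) (by ring)
  have hσI : S.σ • Ideal.span {1 - S.ζ, ω} = Ideal.span {1 - S.ζ, 1 - ω} := by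
    rw [smul_span_pair, smul_sub, smul_one, S.σ_ζ, hσω]
  have hn1 : Ideal.absNorm (Ideal.span {1 - S.ζ}) ^ 2 = Ideal.absNorm (Ideal.span {1 - S.im}) := by
    calc _ = Ideal.absNorm (Ideal.span {1 - S.ζ} * S.s • Ideal.span {1 - S.ζ}) := by
          rw [map_mul, absNorm_smul, pow_two]
      _ = _ := by
          rw [smul_span_singleton, Ideal.span_singleton_mul_span_singleton, smul_sub, smul_one,
            S.s_ζ]
          congr 3
          linear_combination -S.ζ_sq
  have hn2 : Ideal.absNorm (Ideal.span {1 - S.im}) ^ 2 = 2 ^ 8 := by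
    calc _ = Ideal.absNorm (Ideal.span {1 - S.im} * S.J • Ideal.span {1 - S.im}) := by
          rw [map_mul, absNorm_smul, pow_two]
      _ = Ideal.absNorm (Ideal.span {((2 : ℕ) : 𝓞 K)}) := by
          rw [smul_span_singleton, Ideal.span_singleton_mul_span_singleton, smul_sub, smul_one,
            S.J_im]
          congr 3
          rw [Nat.cast_ofNat]
          linear_combination -S.im_sq
      _ = _ := S.absNorm_span_natCast 2
  have hn : Ideal.absNorm (Ideal.span {1 - S.ζ, ω}) = 2 := by
    have h1 : Ideal.absNorm (Ideal.span {1 - S.ζ, ω}) ^ 2 = Ideal.absNorm (Ideal.span {1 - S.ζ}) := by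
      rw [← hI, ← hσI, map_mul, absNorm_smul, pow_two]
    rw [← hn1, ← h1] at hn2
    apply Nat.pow_left_injective (by norm_num : 8 ≠ 0)
    simp only
    rw [← hn2]
    ring
  refine ⟨_, ?_, ?_, hn⟩
  · intro h
    rw [h, Ideal.absNorm_bot] at hn
    omega
  · apply smul_eq_of_smul_le
    rw [smul_span_pair, hJω, Ideal.span_le]
    rintro x (rfl | rfl)
    · have h1 : S.J • (1 - S.ζ) = -(S.J • S.ζ) * (1 - S.ζ) := by
        rw [smul_sub, smul_one]
        linear_combination -S.ζ_mul_J
      rw [h1]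
      exact Ideal.mul_mem_left _ _ (Ideal.subset_span (Or.inl rfl))
    · exact Ideal.subset_span (Or.inr rfl)

end Octic

theorem exists_prime_quadraticChar {p₁ p₂ : ℕ} [hf₁ : Fact p₁.Prime] [hf₂ : Fact p₂.Prime]
    (hne : p₁ ≠ p₂) (hm₁ : p₁ % 8 = 5) (hm₂ : p₂ % 8 = 5) :
    ∃ l : ℕ, l.Prime ∧ l % 8 = 7 ∧ p₁ ≠ l ∧ p₂ ≠ l ∧ quadraticChar (ZMod p₁) (l : ZMod p₁) = 1 ∧
      quadraticChar (ZMod p₂) (l : ZMod p₂) = -1 := by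
  obtain ⟨a, ha⟩ := quadraticChar_exists_neg_one (F := ZMod p₂)
    (by rw [ZMod.ringChar_zmod_n]; omega)
  obtain ⟨a, rfl⟩ := ZMod.natCast_zmod_surjective a
  have hc1 : Nat.Coprime 8 p₁ := by
    rw [show 8 = 2 ^ 3 from rfl]
    apply Nat.Coprime.pow_left
    exact (Nat.coprime_primes Nat.prime_two hf₁.out).2 (by omega)
  have hc2 : Nat.Coprime 8 p₂ := by
    rw [show 8 = 2 ^ 3 from rfl]
    apply Nat.Coprime.pow_left
    exact (Nat.coprime_primes Nat.prime_two hf₂.out).2 (by omega)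
  have hc3 : Nat.Coprime (8 * p₁) p₂ :=
    hc2.mul_left ((Nat.coprime_primes hf₁.out hf₂.out).2 hne)
  obtain ⟨x, hx8, hx1⟩ := Nat.chineseRemainder hc1 7 1
  obtain ⟨y, hyx, hy2⟩ := Nat.chineseRemainder hc3 x a
  have hy8 : y ≡ 7 [MOD 8] := (hyx.of_mul_right p₁).trans hx8
  have hy1 : y ≡ 1 [MOD p₁] := (hyx.of_mul_left 8).trans hx1
  have hcop : y.Coprime (8 * p₁ * p₂) := by
    refine ((Nat.Coprime.mul_right ?_ ?_).mul_right ?_)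
    · exact (Nat.ModEq.gcd_eq hy8).trans (by norm_num)
    · exact (Nat.ModEq.gcd_eq hy1).trans (Nat.gcd_one_left _)
    · rw [Nat.coprime_comm, hf₂.out.coprime_iff_not_dvd, ← ZMod.natCast_eq_zero_iff,
        (ZMod.natCast_eq_natCast_iff _ _ _).2 hy2]
      intro h
      rw [h, MulChar.map_zero] at ha
      omega
  have : NeZero (8 * p₁ * p₂) :=
    ⟨mul_ne_zero (mul_ne_zero (by norm_num) hf₁.out.ne_zero) hf₂.out.ne_zero⟩
  obtain ⟨l, hlgt, hl, hly⟩ := Nat.forall_exists_prime_gt_and_eq_mod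
    ((ZMod.isUnit_iff_coprime y _).2 hcop) (p₁ + p₂)
  rw [ZMod.natCast_eq_natCast_iff] at hly
  have h8 : l ≡ 7 [MOD 8] := ((hly.of_mul_right p₂).of_mul_right p₁).trans hy8
  have h1 : l ≡ 1 [MOD p₁] := ((hly.of_mul_right p₂).of_mul_left 8).trans hy1
  have h2 : l ≡ a [MOD p₂] := (hly.of_mul_left (8 * p₁)).trans hy2
  refine ⟨l, hl, h8, by omega, by omega, ?_, ?_⟩
  · rw [(ZMod.natCast_eq_natCast_iff _ _ _).2 h1, Nat.cast_one, map_one]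
  · rw [(ZMod.natCast_eq_natCast_iff _ _ _).2 h2, ha]

theorem isSquare_neg_mul {p₁ p₂ l : ℕ} [hf₁ : Fact p₁.Prime] [hf₂ : Fact p₂.Prime]
    [hl : Fact l.Prime] (hm₁ : p₁ % 8 = 5) (hm₂ : p₂ % 8 = 5) (hl8 : l % 8 = 7)
    (h1 : quadraticChar (ZMod p₁) (l : ZMod p₁) = 1)
    (h2 : quadraticChar (ZMod p₂) (l : ZMod p₂) = -1) : IsSquare (-(p₁ * p₂) : ZMod l) := by
  have r1 := legendreSym.quadratic_reciprocity_one_mod_four (p := p₁) (q := l) (by omega) (by omega)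
  have r2 := legendreSym.quadratic_reciprocity_one_mod_four (p := p₂) (q := l) (by omega) (by omega)
  rw [legendreSym, legendreSym, Int.cast_natCast, Int.cast_natCast] at r1 r2
  have r3 : quadraticChar (ZMod l) (-1) = -1 := by
    rw [quadraticChar_neg_one_iff_not_isSquare, ZMod.exists_sq_eq_neg_one_iff]
    omega
  have h : quadraticChar (ZMod l) (-(p₁ * p₂)) = 1 := by
    rw [neg_eq_neg_one_mul, map_mul, map_mul, r1, r2, r3, h1, h2]
    norm_num
  by_cases h0 : (-(p₁ * p₂) : ZMod l) = 0
  · rw [h0]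
    exact ⟨0, by simp⟩
  · exact (quadraticChar_one_iff_isSquare h0).1 h

theorem exists_sq_sub_of_isSquare {l : ℕ} [hl : Fact l.Prime] (hl2 : l ≠ 2) {D : ℤ}
    (h : IsSquare (D : ZMod l)) (h0 : ¬ (l : ℤ) ∣ D) :
    ∃ c : ℤ, (l : ℤ) ∣ D - c ^ 2 ∧ IsCoprime (l : ℤ) (2 * c) := by
  obtain ⟨y, hy⟩ := h
  obtain ⟨c, rfl⟩ := ZMod.intCast_surjective y
  have h1 : (l : ℤ) ∣ D - c ^ 2 := by
    rw [← ZMod.intCast_zmod_eq_zero_iff_dvd]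
    push_cast
    rw [hy]
    ring
  refine ⟨c, h1, ?_⟩
  rw [(Nat.prime_iff_prime_int.1 hl.out).coprime_iff_not_dvd]
  intro h2
  rcases (Nat.prime_iff_prime_int.1 hl.out).dvd_or_dvd h2 with h2 | h2
  · exact hl2 ((Nat.prime_dvd_prime_iff_eq hl.out Nat.prime_two).1 (by exact_mod_cast h2))
  · exact h0 ((Int.dvd_iff_dvd_of_dvd_sub h1).2 (dvd_pow h2 two_ne_zero))

theorem span_sub_mul_span_neg_sub {R : Type*} [CommRing R] {l x c t u v : R}
    (hx : x ^ 2 - c ^ 2 = l * t) (h : u * l + v * (2 * c) = 1) :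
    Ideal.span {l, x - c} * Ideal.span {l, -x - c} = Ideal.span {l} ∧
      Ideal.span {l, x - c} ⊔ Ideal.span {l, -x - c} = ⊤ := by
  refine ⟨span_pair_mul_span_pair (t := -t) (a := u) (b := -v) (c := -v)
    (by linear_combination -hx) (by linear_combination -l * h), ?_⟩
  rw [Ideal.eq_top_iff_one, ← h, show u * l + v * (2 * c) = u * l + (-v * (x - c) + -v * (-x - c)) by ring]
  refine add_mem (Ideal.mem_sup_left (Ideal.mul_mem_left _ _ (Ideal.subset_span (Or.inl rfl))))
    (add_mem (Ideal.mem_sup_left (Ideal.mul_mem_left _ _ (Ideal.subset_span (Or.inr rfl))))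
    (Ideal.mem_sup_right (Ideal.mul_mem_left _ _ (Ideal.subset_span (Or.inr rfl)))))

theorem Ideal.sup_mul_sup_of_sup_eq_top {R : Type*} [CommRing R] {A C C' : Ideal R}
    (h : C ⊔ C' = ⊤) (hA : C * C' ≤ A) : (A ⊔ C) * (A ⊔ C') = A := by
  apply le_antisymm
  · rw [Ideal.sup_mul, Ideal.mul_sup C]
    exact sup_le Ideal.mul_le_left (sup_le Ideal.mul_le_right hA)
  · calc A = A * (C ⊔ C') := by rw [h, Ideal.mul_top]
      _ = A * C' ⊔ C * A := by rw [Ideal.mul_sup, sup_comm, mul_comm A C]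
      _ ≤ _ := sup_le (Ideal.mul_mono le_sup_left le_sup_right)
        (Ideal.mul_mono le_sup_right le_sup_left)

namespace Octic
variable {p₁ p₂ : ℕ} {K : Type*} [Field K] [NumberField K] {S : Octic p₁ p₂ K}
variable [hf₁ : Fact p₁.Prime] [hf₂ : Fact p₂.Prime]

theorem exists_isGaussNorm_natCast {l : ℕ} [hl : Fact l.Prime] (hl8 : l % 8 = 7)
    (h1 : p₁ ≠ l) (h2 : p₂ ≠ l) (h : IsSquare (-(p₁ * p₂) : ZMod l)) :
    ∃ I : Ideal (𝓞 K), I ≠ ⊥ ∧ Ideal.absNorm I = l ^ 2 ∧ S.IsGaussNorm I l := by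
  have hl' := Nat.prime_iff_prime_int.1 hl.out
  have hl0 : (l : GaussianInt) ≠ 0 := Nat.cast_ne_zero.2 hl.out.ne_zero
  obtain ⟨b, ⟨t, ht⟩, u, v, hb⟩ := exists_sq_sub_of_isSquare (l := l) (D := 2) (by omega)
    (by rw [Int.cast_ofNat, ZMod.exists_sq_eq_two_iff (by omega)]; exact Or.inr hl8)
    (fun h => by have := Int.le_of_dvd (by norm_num) h; omega)
  obtain ⟨c, ⟨t', ht'⟩, u', v', hc⟩ := exists_sq_sub_of_isSquare (l := l) (D := -(p₁ * p₂))
    (by omega) (by push_cast; exact h) (fun h => by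
      rw [dvd_neg] at h
      rcases hl'.dvd_or_dvd h with h | h
      · exact h1 ((Nat.prime_dvd_prime_iff_eq hl.out hf₁.out).1 (by exact_mod_cast h)).symm
      · exact h2 ((Nat.prime_dvd_prime_iff_eq hl.out hf₂.out).1 (by exact_mod_cast h)).symm)
  have ht := congrArg (Int.cast : ℤ → 𝓞 K) ht
  have hb := congrArg (Int.cast : ℤ → 𝓞 K) hb
  have ht' := congrArg (Int.cast : ℤ → 𝓞 K) ht'
  have hc := congrArg (Int.cast : ℤ → 𝓞 K) hc
  push_cast at ht hb ht' hc
  obtain ⟨hA, -⟩ := span_sub_mul_span_neg_sub (l := (l : 𝓞 K)) (x := S.r2) (c := b) (t := t)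
    (by rw [S.r2_sq, ht]) hb
  obtain ⟨hC, hC'⟩ := span_sub_mul_span_neg_sub (l := (l : 𝓞 K)) (x := S.im * S.rd) (c := c)
    (t := t') (by rw [mul_pow, S.im_sq, S.rd_sq, ← ht']; ring) hc
  set A := Ideal.span {(l : 𝓞 K), S.r2 - b} with hAdef
  set C := Ideal.span {(l : 𝓞 K), S.im * S.rd - c}
  have hsA : S.s • A = Ideal.span {(l : 𝓞 K), -S.r2 - b} := by
    rw [smul_span_pair, S.smul_natCast, smul_sub, S.s_r2, S.smul_intCast]
  have hσA : S.σ • A = A := by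
    rw [smul_span_pair, S.smul_natCast, smul_sub, S.σ_r2, S.smul_intCast]
  have hσC : S.σ • C = Ideal.span {(l : 𝓞 K), -(S.im * S.rd) - c} := by
    rw [smul_span_pair, S.smul_natCast, smul_sub, smul_mul', S.σ_im, S.σ_rd, S.smul_intCast,
      mul_neg]
  have h3 : (A ⊔ C) * S.σ • (A ⊔ C) = A := by
    rw [Ideal.smul_sup, hσA]
    apply Ideal.sup_mul_sup_of_sup_eq_top
    · rw [hσC, hC']
    · rw [hσC, hC, Ideal.span_singleton_le_iff_mem]
      exact Ideal.subset_span (Or.inl rfl)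
  have hN : S.IsGaussNorm (A ⊔ C) l := by
    rw [IsGaussNorm, S.comm, mul_smul, mul_assoc, ← smul_mul', h3, hsA, hA, map_natCast]
  have hn : Ideal.absNorm (A ⊔ C) = l ^ 2 := by
    have := hN.mul_star
    rw [star_natCast] at this
    rw [pow_two]
    exact_mod_cast this.symm
  refine ⟨_, fun h0 => ?_, hn, hN⟩
  rw [h0, Ideal.absNorm_bot, eq_comm] at hn
  exact hl.out.ne_zero (pow_eq_zero_iff two_ne_zero |>.1 hn)

end Octic

namespace Octic
variable {p₁ p₂ : ℕ} {K : Type*} [Field K] [NumberField K] {S : Octic p₁ p₂ K}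
variable [hf₁ : Fact p₁.Prime] [hf₂ : Fact p₂.Prime]

omit hf₁ hf₂ in
variable (S) in
theorem one_im : (1 : Gal(K/ℚ)) • S.im = S.im := one_smul _ _

omit hf₁ hf₂ in
variable (S) in
theorem J_mul_ne {g h : Gal(K/ℚ)} (hg : g • S.im = S.im) (hh : h • S.im = S.im) : S.J * g ≠ h :=
  fun e => by
    have := hh
    rw [← e, mul_smul, hg, S.J_im] at this
    exact S.im_ne (neg_eq_self.1 this)

variable (S) in
theorem exists_mul_σ_eq (I : Ideal (𝓞 K)) :
    ∃ f : 𝓞 K, I * S.σ • I = Ideal.span {f} ∧ S.σ • f = f := by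
  have := S.isPrincipalIdealRing_F
  obtain ⟨y, hy⟩ := (IsPrincipalIdealRing.principal
    (Ideal.relNorm (𝓞 (fixedField S.subF)) I)).principal
  rw [Ideal.submodule_span_eq] at hy
  refine ⟨algebraMap _ (𝓞 K) y, ?_, S.isFixedField_F.smul_algebraMap (Or.inr rfl) y⟩
  rw [← S.isFixedField_F.map_relNorm_pair S.σ_ne_one, hy, Ideal.map_span, Set.image_singleton]

theorem mapHom_even_eq_one (U : S.Units) (hne : p₁ ≠ p₂) (hm₁ : p₁ % 8 = 5) (hm₂ : p₂ % 8 = 5)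
    {k : Type*} [Field k] [NumberField k] [Algebra k K] {D : ℤ} (Q : QuadField D k)
    (hD : D = 2 * p₁ * p₂ ∨ D = -(2 * p₁ * p₂)) (hs : D < 0 ∨ ∃ η : 𝓞 k, IsUnit η ∧ η * Q.τ • η = -1)
    {j : ClassGroup (𝓞 k) →* ClassGroup (𝓞 K)}
    (hj : ∀ I : Ideal (𝓞 k), I ≠ ⊥ → j (idealClass I) = idealClass (I.map (algebraMap (𝓞 k) (𝓞 K))))
    {c : ClassGroup (𝓞 k)} {t : ℕ} (hc : c ^ 2 ^ t = 1) : j c = 1 := by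
  obtain ⟨⟨q, hq, hq'⟩, ⟨q₁, hq₁, hq₁'⟩, -⟩ := Q.even_decomp hne hm₁ hm₂ hD
  have h2 := Q.ram_sq hq hq'
  have h1 := Q.ram_sq hq₁ hq₁'
  have n2 := Q.ram_ne_bot (two_ne_zero)
  have n1 := Q.ram_ne_bot hf₁.out.ne_zero
  have e2 : (Q.ram 2).map (algebraMap (𝓞 k) (𝓞 K)) = Ideal.span {S.r2} := by
    apply Ideal.sq_inj
    rw [← Ideal.map_pow, h2, Ideal.map_span, Set.image_singleton, map_natCast,
      Ideal.span_singleton_pow, S.r2_sq, Nat.cast_ofNat]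
  have e1 : (Q.ram p₁).map (algebraMap (𝓞 k) (𝓞 K)) = S.B p₁ := by
    apply Ideal.sq_inj
    rw [← Ideal.map_pow, h1, Ideal.map_span, Set.image_singleton, map_natCast,
      S.B_sq ((Nat.coprime_primes hf₁.out hf₂.out).2 hne) S.rd_sq]
  obtain ⟨g, -, hg⟩ := U.exists_B_eq hne hm₁ hm₂
  obtain ⟨e, f, h⟩ := Q.even_class hne hm₁ hm₂ hD hs hc
  have := congrArg j h
  rwa [map_mul, map_mul, map_pow, map_pow, hj _ n2, hj _ n1, e2, e1, ← hg, idealClass_span,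
    idealClass_span, one_pow, one_pow, mul_one, mul_one, map_one] at this

theorem exists_unit_2d (U : S.Units) (hne : p₁ ≠ p₂) (hm₁ : p₁ % 8 = 5) (hm₂ : p₂ % 8 = 5)
    {Q : QuadField (2 * p₁ * p₂) (fixedField S.sub2d)}
    (hQ : ∀ y : 𝓞 (fixedField S.sub2d), algebraMap _ (𝓞 K) (Q.τ • y) = S.σ • algebraMap _ (𝓞 K) y) :
    ∃ η : 𝓞 (fixedField S.sub2d), IsUnit η ∧ η * Q.τ • η = -1 := by
  obtain ⟨η, hη⟩ := S.isFixedField_2d.exists_of_smul_eq_quad U.J_e2d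
    (by rw [mul_smul, U.sσ_e2d])
  have h : η * Q.τ • η = -1 := by
    apply algebraMap_ringOfIntegers_injective (K := K)
    rw [map_mul, hQ, hη, U.e2d_mul_σ hne hm₁ hm₂, map_neg, map_one]
  exact ⟨η, IsUnit.of_mul_eq_one (-(Q.τ • η)) (by rw [mul_neg, h, neg_neg]), h⟩

theorem pow_four_eq (U : S.Units) (hne : p₁ ≠ p₂) (hm₁ : p₁ % 8 = 5) (hm₂ : p₂ % 8 = 5)
    {kd km : Type*} [Field kd] [NumberField kd] [Algebra kd K] [Field km] [NumberField km]
    [Algebra km K] (hd : S.IsReal kd) (hm : S.IsImag km)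
    {jd : ClassGroup (𝓞 kd) →* ClassGroup (𝓞 K)} {jm : ClassGroup (𝓞 km) →* ClassGroup (𝓞 K)}
    (hjd : ∀ I : Ideal (𝓞 kd), I ≠ ⊥ →
      jd (idealClass I) = idealClass (I.map (algebraMap (𝓞 kd) (𝓞 K))))
    (hjm : ∀ I : Ideal (𝓞 km), I ≠ ⊥ →
      jm (idealClass I) = idealClass (I.map (algebraMap (𝓞 km) (𝓞 K))))
    {Nd : ClassGroup (𝓞 K) →* ClassGroup (𝓞 kd)} {Nm : ClassGroup (𝓞 K) →* ClassGroup (𝓞 km)}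
    (hNd : ∀ I : Ideal (𝓞 K), I ≠ ⊥ → Nd (idealClass I) = idealClass (Ideal.relNorm (𝓞 kd) I))
    (hNm : ∀ I : Ideal (𝓞 K), I ≠ ⊥ → Nm (idealClass I) = idealClass (Ideal.relNorm (𝓞 km) I))
    {a : ClassGroup (𝓞 K)} {t : ℕ} (ha : a ^ 2 ^ t = 1) : a ^ 4 = jd (Nd a) * jm (Nm a) := by
  obtain ⟨Q2, -, hQ2⟩ := S.exists_quadField_2d
  obtain ⟨Qm2, -, hQm2⟩ := S.exists_quadField_m2d
  have hu := exists_unit_2d U hne hm₁ hm₂ hQ2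
  have h2 := S.isFixedField_2d
  have hm2 := S.isFixedField_m2d
  clear hQ2 hQm2
  generalize (fixedField S.sub2d) = k2 at *
  generalize (fixedField S.subm2d) = km2 at *
  obtain ⟨j2, hj2⟩ := exists_mapHom k2 K
  obtain ⟨jm2, hjm2⟩ := exists_mapHom km2 K
  obtain ⟨N2, hN2⟩ := exists_relNormHom k2 K
  obtain ⟨Nm2, hNm2⟩ := exists_relNormHom km2 K
  have t2 : j2 (N2 a) = 1 := mapHom_even_eq_one U hne hm₁ hm₂ Q2 (Or.inl rfl) (Or.inr hu) hj2
    (t := t) (by rw [← map_pow, ha, map_one])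
  have tm2 : jm2 (Nm2 a) = 1 := mapHom_even_eq_one U hne hm₁ hm₂ Qm2 (Or.inr rfl) (Or.inl (by
    have := hf₁.out.pos
    have := hf₂.out.pos
    rw [neg_lt_zero]
    positivity)) hjm2 (t := t) (by rw [← map_pow, ha, map_one])
  rw [← mul_one (jd (Nd a) * jm (Nm a)), ← mul_one (jd (Nd a) * jm (Nm a) * 1)]
  nth_rw 1 [← t2]
  rw [← tm2]
  clear t2 tm2 ha
  obtain ⟨I, hI, rfl⟩ := exists_idealClass_eq a
  obtain ⟨f, hf, -⟩ := S.exists_mul_σ_eq I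
  have q1 : S.J * S.σ ≠ 1 := S.J_mul_ne S.σ_im S.one_im
  have q2 : S.s * S.σ ≠ 1 := fun h => by
    have := congrArg (fun g : Gal(K/ℚ) => g • S.r2) h
    simp only [mul_smul, S.σ_r2, S.s_r2, one_smul] at this
    exact S.r2_ne (neg_eq_self.1 this)
  have q3 : S.J * S.σ ≠ S.s := S.J_mul_ne S.σ_im S.s_im
  have q4 : S.J ≠ S.s * S.σ := by
    rw [← mul_one S.J]
    exact S.J_mul_ne S.one_im (by rw [mul_smul, S.σ_im, S.s_im])
  have q5 : S.J * S.σ ≠ S.s * S.σ := S.J_mul_ne S.σ_im (by rw [mul_smul, S.σ_im, S.s_im])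
  rw [hNd _ hI, hNm _ hI, hN2 _ hI, hNm2 _ hI, hjd _ (relNorm_ne_bot hI), hjm _ (relNorm_ne_bot hI),
    hj2 _ (relNorm_ne_bot hI), hjm2 _ (relNorm_ne_bot hI),
    ← idealClass_mul (map_algebraMap_ne_bot (relNorm_ne_bot hI)) (map_algebraMap_ne_bot (relNorm_ne_bot hI)),
    ← idealClass_mul (mul_ne_zero (map_algebraMap_ne_bot (relNorm_ne_bot hI)) (map_algebraMap_ne_bot (relNorm_ne_bot hI))) (map_algebraMap_ne_bot (relNorm_ne_bot hI)),
    ← idealClass_mul (mul_ne_zero (mul_ne_zero (map_algebraMap_ne_bot (relNorm_ne_bot hI)) (map_algebraMap_ne_bot (relNorm_ne_bot hI))) (map_algebraMap_ne_bot (relNorm_ne_bot hI))) (map_algebraMap_ne_bot (relNorm_ne_bot hI)),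
    hd.map_relNorm_quad S.J_ne_one S.s_ne_one S.J_ne_s,
    hm.map_relNorm_quad q1 S.s_ne_one q3,
    h2.map_relNorm_quad S.J_ne_one q2 q4,
    hm2.map_relNorm_quad q1 q2 q5]
  have key : I * S.J • I * S.s • I * (S.J * S.s) • I *
      (I * (S.J * S.σ) • I * S.s • I * (S.J * S.σ * S.s) • I) *
      (I * S.J • I * (S.s * S.σ) • I * (S.J * (S.s * S.σ)) • I) *
      (I * (S.J * S.σ) • I * (S.s * S.σ) • I * (S.J * S.σ * (S.s * S.σ)) • I) =
      I ^ 4 * Ideal.span {(S.J • f * S.s • f * S.J • S.s • f) ^ 2} := by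
    have e1 : S.J * S.σ * (S.s * S.σ) = S.J * S.s := by
      rw [S.comm S.s, mul_assoc, ← mul_assoc S.σ S.σ, S.invol, one_mul]
    have e2 : S.J * S.σ * S.s = S.J * (S.s * S.σ) := by rw [mul_assoc, S.comm S.σ]
    rw [e1, e2, ← Ideal.span_singleton_pow, ← Ideal.span_singleton_mul_span_singleton,
      ← Ideal.span_singleton_mul_span_singleton, ← smul_span_singleton, ← smul_span_singleton,
      ← smul_span_singleton, ← smul_span_singleton, ← hf]
    simp only [smul_mul', mul_smul]
    ring
  rw [key, idealClass_mul (pow_ne_zero 4 hI) ?_, idealClass_span, mul_one, idealClass_pow hI]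
  have hf0 : f ≠ 0 := by
    rintro rfl
    rw [Ideal.span_singleton_eq_bot.2 rfl, Ideal.mul_eq_bot] at hf
    rcases hf with h | h
    · exact hI h
    · rw [← S.smul_smul_self S.σ I, h, Ideal.smul_bot] at hI
      exact hI rfl
  rw [Ne, Ideal.span_singleton_eq_bot]
  refine pow_ne_zero 2 (mul_ne_zero (mul_ne_zero ?_ ?_) ?_)
  all_goals simpa only [Ne, smul_eq_zero_iff_eq] using hf0

end Octic

namespace Octic
variable {p₁ p₂ : ℕ} {K : Type*} [Field K] [NumberField K] {S : Octic p₁ p₂ K}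
variable [hf₁ : Fact p₁.Prime] [hf₂ : Fact p₂.Prime]
variable {k : Type*} [Field k] [NumberField k] [Algebra k K]

theorem idealClass_B_eq_one (U : S.Units) (hne : p₁ ≠ p₂) (hm₁ : p₁ % 8 = 5) (hm₂ : p₂ % 8 = 5) :
    idealClass (S.B p₁) = 1 ∧ idealClass (S.B p₂) = 1 := by
  obtain ⟨g, -, hg⟩ := U.exists_B_eq hne hm₁ hm₂
  have hc := (Nat.coprime_primes hf₁.out hf₂.out).2 hne
  have h2 := S.B_sq hc.symm (by rw [S.rd_sq, mul_comm])
  have h1 := S.B_sq hc S.rd_sq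
  have hprod : S.B p₁ * S.B p₂ = Ideal.span {S.rd} := by
    apply Ideal.sq_inj
    rw [mul_pow, h1, h2, Ideal.span_singleton_mul_span_singleton, Ideal.span_singleton_pow, S.rd_sq]
  have hB1 : idealClass (S.B p₁) = 1 := by rw [← hg, idealClass_span]
  have hn : S.B p₁ * S.B p₂ ≠ ⊥ := by
    rw [hprod, Ne, Ideal.span_singleton_eq_bot]; exact S.rd_ne
  refine ⟨hB1, ?_⟩
  rw [← one_mul (idealClass (S.B p₂)), ← hB1, ← idealClass_mul (left_ne_zero_of_mul hn)
    (right_ne_zero_of_mul hn), hprod, idealClass_span, hB1]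

/-- An ideal invariant under `σ` and `J` is principal. -/
theorem idealClass_eq_one_of_smul_eq (U : S.Units) (hne : p₁ ≠ p₂) (hm₁ : p₁ % 8 = 5)
    (hm₂ : p₂ % 8 = 5) {I : Ideal (𝓞 K)} (hI : I ≠ ⊥) (hσ : S.σ • I = I) (hJ : S.J • I = I) :
    idealClass I = 1 := by
  have hd8 : (p₁ * p₂) % 8 = 1 := by rw [Nat.mul_mod, hm₁, hm₂]
  have := S.isPrincipalIdealRing_F
  obtain ⟨ω, hω⟩ := S.exists_half (by omega)
  obtain ⟨f, hf, J, hIJ, hωJ, hJJ⟩ := S.isFixedField_F.exists_mul_eq_span ω hI hσ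
  have hrd : ω - S.σ • ω = S.rd := by
    apply mul_left_cancel₀ (two_ne_zero (α := 𝓞 K))
    have : (2 : 𝓞 K) * S.σ • ω = 1 - S.rd := by
      rw [← S.smul_two S.σ, ← smul_mul', hω, smul_add, smul_one, S.σ_rd, sub_eq_add_neg]
    linear_combination hω - this
  rw [hrd] at hωJ
  have hn : I * J ≠ ⊥ := by
    rw [hIJ, Ne, Ideal.span_singleton_eq_bot]
    exact fun h => hf (algebraMap_ringOfIntegers_injective (K := K) (by rw [h, map_zero]))
  have hJ0 : J ≠ ⊥ := right_ne_zero_of_mul hn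
  have hk : S.IsReal (fixedField (quadSubgroup S.J S.s (S.invol _) (S.invol _) (S.comm _ _))) :=
    isFixedField_fixedField _
  obtain ⟨Q, hQrt, -⟩ := S.exists_quadField_real hk
  obtain ⟨L, hL, hLJ⟩ := S.exists_map_eq hne hm₁ hm₂ Q (Or.inl hQrt) hJ0 (hJJ _ (S.comm _ _) hJ) hωJ
  have hmap := S.map_ram Q (Or.inl hQrt)
  obtain ⟨h1, h2⟩ := idealClass_B_eq_one U hne hm₁ hm₂
  have hL1 : L ≠ ⊥ ∧ idealClass (L.map (algebraMap _ (𝓞 K))) = 1 := by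
    clear hLJ
    induction hL using Submonoid.closure_induction with
    | mem x hx =>
      rcases hx with rfl | rfl
      · exact ⟨Q.ram_ne_bot hf₁.out.ne_zero, by rw [hmap, h1]⟩
      · exact ⟨Q.ram_ne_bot hf₂.out.ne_zero, by rw [hmap, h2]⟩
    | one =>
      refine ⟨one_ne_zero, ?_⟩
      rw [Ideal.one_eq_top, Ideal.map_top, ← Ideal.one_eq_top, idealClass_one]
    | mul x y _ _ hx hy =>
      refine ⟨mul_ne_zero hx.1 hy.1, ?_⟩
      rw [Ideal.map_mul, idealClass_mul (map_algebraMap_ne_bot hx.1) (map_algebraMap_ne_bot hy.1),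
        hx.2, hy.2, one_mul]
  have := idealClass_mul hI hJ0
  rwa [hIJ, idealClass_span, ← hLJ, hL1.2, mul_one, eq_comm] at this

theorem mapHom_real_eq_one_iff (U : S.Units) (hne : p₁ ≠ p₂) (hm₁ : p₁ % 8 = 5) (hm₂ : p₂ % 8 = 5)
    (hk : S.IsReal k) {j : ClassGroup (𝓞 k) →* ClassGroup (𝓞 K)}
    (hj : ∀ I : Ideal (𝓞 k), I ≠ ⊥ → j (idealClass I) = idealClass (I.map (algebraMap (𝓞 k) (𝓞 K))))
    (c : ClassGroup (𝓞 k)) : j c = 1 ↔ c ^ 2 = 1 := by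
  have hd8 : (p₁ * p₂) % 8 = 1 := by rw [Nat.mul_mod, hm₁, hm₂]
  obtain ⟨I, hI, rfl⟩ := exists_idealClass_eq c
  have hI' := map_algebraMap_ne_bot (K := K) hI
  have hIJ : S.J • I.map (algebraMap (𝓞 k) (𝓞 K)) = I.map (algebraMap (𝓞 k) (𝓞 K)) :=
    hk.smul_map (Or.inr (Or.inl rfl)) I
  rw [hj _ hI, ← idealClass_pow hI, idealClass_eq_one_iff hI', idealClass_eq_one_iff (pow_ne_zero 2 hI)]
  constructor
  · rintro ⟨g, hg⟩
    refine exists_eq_span_of_span_smul hd8 hk (g := g) ?_ ?_ ?_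
    · rintro rfl
      rw [Ideal.span_singleton_eq_bot.2 rfl] at hg
      exact hI' hg
    · rw [← hg, hIJ]
    · rw [← Ideal.span_singleton_mul_span_singleton, ← smul_span_singleton, ← hg,
        hk.smul_map (Or.inr (Or.inr (Or.inl rfl))), ← pow_two, Ideal.map_pow]
  · rintro ⟨z, hz⟩
    obtain ⟨Q, -, hQ⟩ := S.exists_quadField_real hk
    have hJk (y : 𝓞 k) : S.J • algebraMap (𝓞 k) (𝓞 K) y = algebraMap (𝓞 k) (𝓞 K) y :=
      hk.smul_algebraMap (Or.inr (Or.inl rfl)) y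
    obtain ⟨z', hz', hJz, hNz⟩ : ∃ z' : 𝓞 K, I.map (algebraMap (𝓞 k) (𝓞 K)) ^ 2 = Ideal.span {z'} ∧
        S.J • z' = z' ∧ (Ideal.absNorm I : 𝓞 K) ^ 2 = z' * S.σ • z' := by
      have h1 : I.map (algebraMap (𝓞 k) (𝓞 K)) ^ 2 = Ideal.span {algebraMap (𝓞 k) (𝓞 K) z} := by
        rw [← Ideal.map_pow, hz, Ideal.map_span, Set.image_singleton]
      rcases Q.exists_sign hz with h | h
      · refine ⟨algebraMap _ _ z, h1, hJk z, ?_⟩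
        rw [← hQ, ← map_mul, ← h, map_pow, map_natCast]
      · refine ⟨algebraMap _ _ z * U.e2d, ?_, ?_, ?_⟩
        · rw [Ideal.span_singleton_mul_right_unit U.e2d_isUnit, h1]
        · rw [smul_mul', hJk, U.J_e2d]
        · have h' : (Ideal.absNorm I : 𝓞 K) ^ 2 =
              -(algebraMap (𝓞 k) (𝓞 K) z * S.σ • algebraMap (𝓞 k) (𝓞 K) z) := by
            rw [← hQ, ← map_mul, ← map_neg, ← h, map_pow, map_natCast]
          have he := U.e2d_mul_σ hne hm₁ hm₂
          rw [smul_mul']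
          linear_combination h' - algebraMap (𝓞 k) (𝓞 K) z * S.σ • algebraMap (𝓞 k) (𝓞 K) z * he
    obtain ⟨c, hc0, hc, hcI⟩ := exists_smul_mul_eq (S.invol S.σ) hI' hz' (map_mul_σ Q hQ I)
      (S.smul_natCast _ _) hNz
    have hJc : S.J • c = c := by
      rcases hc with rfl | rfl
      · exact smul_one _
      · rw [smul_mul', S.smul_smul_comm, smul_add, hJz, S.smul_natCast]
    have hn : Ideal.span {c} ≠ ⊥ := by rwa [Ne, Ideal.span_singleton_eq_bot]
    have := idealClass_eq_one_of_smul_eq U hne hm₁ hm₂ (mul_ne_zero hn hI') hcI (by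
      rw [smul_mul', smul_span_singleton, hJc, hIJ])
    rwa [idealClass_mul hn hI', idealClass_span, one_mul, idealClass_eq_one_iff hI'] at this

end Octic

section SylowTwo
variable {G H : Type*} [CommGroup G] [Finite G] [CommGroup H] [Finite H]

theorem Sylow.mem_iff_exists_two_pow (P : Sylow 2 G) {x : G} : x ∈ P ↔ ∃ t : ℕ, x ^ 2 ^ t = 1 := by
  constructor
  · intro h
    obtain ⟨t, ht⟩ := P.2 ⟨x, h⟩
    exact ⟨t, by simpa using congrArg Subtype.val ht⟩
  · rintro ⟨t, ht⟩
    have hp : IsPGroup 2 (Subgroup.zpowers x) := by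
      rintro ⟨y, k, rfl⟩
      refine ⟨t, Subtype.ext ?_⟩
      change (x ^ k) ^ 2 ^ t = 1
      rw [← zpow_natCast, ← zpow_mul, mul_comm, zpow_mul, zpow_natCast, ht, one_zpow]
    obtain ⟨Q, hQ⟩ := hp.exists_le_sylow
    have := Sylow.unique_of_normal P inferInstance
    rw [Subsingleton.elim P Q]
    exact hQ (Subgroup.mem_zpowers x)

/-- Restriction of a homomorphism to Sylow `2`-subgroups. -/
def Sylow.restrictHom (f : G →* H) (P : Sylow 2 G) (Q : Sylow 2 H) : P →* Q :=
  (f.comp P.toSubgroup.subtype).codRestrict Q.toSubgroup fun x => Q.mem_iff_exists_two_pow.2 <| by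
    obtain ⟨t, ht⟩ := P.mem_iff_exists_two_pow.1 x.2
    exact ⟨t, by rw [← map_pow]; exact (congrArg f ht).trans (map_one f)⟩

theorem exists_odd_pow_mem_sylow (P : Sylow 2 G) :
    ∃ N : ℕ, Odd N ∧ ∀ x : G, x ^ N ∈ P := by
  obtain ⟨t, N, hN, h⟩ := Nat.exists_eq_two_pow_mul_odd (Nat.card_pos (α := G)).ne'
  refine ⟨N, hN, fun x => P.mem_iff_exists_two_pow.2 ⟨t, ?_⟩⟩
  rw [← pow_mul, mul_comm, ← h, pow_card_eq_one']

end SylowTwo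

theorem sylow_two_structure {A D B : Type*} [CommGroup A] [CommGroup D] [CommGroup B] [Finite A]
    [Finite D] [Finite B] {n m : ℕ} (hn : 1 ≤ n) (hm : 2 ≤ m)
    (hA4 : Nat.card (powMonoidHom 2 : A →* A).ker ≤ 4)
    (φ₁ φ₃ : A →* ℤ) {u v : A} (hu : φ₁ u = -1) (hv : φ₁ v = 1) (hv' : φ₃ v = -1)
    (jd : D →* A) (jm : B →* A) (Nd : A →* D) (Nm : A →* B)
    (hjd₁ : ∀ c, φ₁ (jd c) = 1) (hjd₃ : ∀ c, φ₃ (jd c) = 1)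
    (hjm₁ : ∀ c, φ₁ (jm c) = 1) (hjm₃ : ∀ c, φ₃ (jm c) = 1)
    (h4 : ∀ (a : A) (t : ℕ), a ^ 2 ^ t = 1 → a ^ 4 = jd (Nd a) * jm (Nm a))
    (hjd : ∀ c, jd c = 1 ↔ c ^ 2 = 1)
    (hD : ∀ Q : Sylow 2 D, Nat.card Q = 2 ^ n) {b₀ : D}
    (hD2 : ∀ c : D, c ^ 2 = 1 → c = 1 ∨ c = b₀)
    (χ : D →* ℤ) (hχ : ∀ a, χ (Nd a) = φ₁ a)
    (hB : ∀ Q : Sylow 2 B, Nat.card Q = 2 ^ (m + 1)) {q r : B} (hq2 : q ^ 2 = 1) (hr2 : r ^ 2 = 1)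
    (hB2 : ∀ c : B, c ^ 2 = 1 → c = 1 ∨ c = q ∨ c = r ∨ c = q * r)
    (hjq : jm q = 1) (hjr : jm r = 1) (χp χ4 : B →* ℤ) (hχpq : χp q = -1) (hχ4q : χ4 q = 1)
    {w : B} (hχ4w : χ4 w = -1) (hχ4 : ∀ a, χ4 (Nm a) = 1)
    (M : Subgroup A) (hM : ∀ c, jd c ∈ M) (hM' : ∀ c : B, c ^ 2 = r ∨ c ^ 2 = q * r → jm c ∉ M)
    (huM : u ∈ M) (hM2 : ∀ c ∈ M, c ^ 2 = 1 → φ₁ c = 1) (P : Sylow 2 A) :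
    Nonempty (Additive P ≃+ (ZMod (2 ^ m) × ZMod (2 ^ (n + 1)))) := by
  obtain ⟨PD⟩ : Nonempty (Sylow 2 D) := inferInstance
  obtain ⟨PB⟩ : Nonempty (Sylow 2 B) := inferInstance
  obtain ⟨N, hN, hNP⟩ := exists_odd_pow_mem_sylow P
  obtain ⟨NB, hNB, hNPB⟩ := exists_odd_pow_mem_sylow PB
  have hqP : q ∈ PB := PB.mem_iff_exists_two_pow.2 ⟨1, by simpa using hq2⟩
  have hrP : r ∈ PB := PB.mem_iff_exists_two_pow.2 ⟨1, by simpa using hr2⟩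
  have hodd : ∀ {x : A} {φ : A →* ℤ}, φ x = -1 → φ (x ^ N) = -1 := fun h => by
    rw [map_pow, h, hN.neg_one_pow]
  have hD2' : ∃ b : PD, ∀ c : PD, c ^ 2 = 1 → c = 1 ∨ c = b := by
    by_cases hb : b₀ ∈ PD
    · exact ⟨⟨b₀, hb⟩, fun c hc => (hD2 c (congrArg Subtype.val hc)).imp Subtype.ext
        (fun h => Subtype.ext h)⟩
    · refine ⟨1, fun c hc => Or.inl (Subtype.ext ((hD2 c (congrArg Subtype.val hc)).resolve_right ?_))⟩
      intro h
      exact hb (h ▸ c.2)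
  obtain ⟨b, hb⟩ := hD2'
  refine two_group_structure (A := P) (D := PD) (B := PB) hn hm ?_ ?_ (φ₁.comp P.toSubgroup.subtype)
    (φ₃.comp P.toSubgroup.subtype) (u := ⟨u ^ N, hNP u⟩) (v := ⟨v ^ N, hNP v⟩) (hodd hu) ?_ (hodd hv')
    (Sylow.restrictHom jd PD P) (Sylow.restrictHom jm PB P) (Sylow.restrictHom Nd P PD)
    (Sylow.restrictHom Nm P PB) (fun c => hjd₁ c) (fun c => hjd₃ c) (fun c => hjm₁ c)
    (fun c => hjm₃ c) ?_ ?_ (hD PD) hb (χ.comp PD.toSubgroup.subtype) (fun a => hχ a) (hB PB)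
    (q := ⟨q, hqP⟩) (r := ⟨r, hrP⟩) (Subtype.ext hq2) (Subtype.ext hr2) ?_ (Subtype.ext hjq)
    (Subtype.ext hjr) (χp.comp PB.toSubgroup.subtype) (χ4.comp PB.toSubgroup.subtype) hχpq hχ4q (w := ⟨w ^ NB, hNPB w⟩)
    ?_ (fun a => hχ4 a) (M.comap P.toSubgroup.subtype) (fun c => hM c) ?_
    (x₀ := ⟨u ^ N, hNP u⟩ ^ 2) ?_ ?_ ?_ ?_
  · exact P.2
  · refine le_trans ?_ hA4
    refine Nat.card_le_card_of_injective (fun x => ⟨(x.1 : A), congrArg Subtype.val x.2⟩) ?_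
    intro x y h
    have h' : (x.1 : A) = y.1 := (Subtype.mk.injEq _ _ _ _).mp h
    exact Subtype.ext (Subtype.ext h')
  · change φ₁ (v ^ N) = 1
    rw [map_pow, hv, one_pow]
  · intro a
    obtain ⟨t, ht⟩ := P.mem_iff_exists_two_pow.1 a.2
    exact Subtype.ext (h4 a t ht)
  · intro c
    rw [Subtype.ext_iff, Subtype.ext_iff]
    exact hjd c
  · intro c hc
    simp only [Subtype.ext_iff]
    exact hB2 c (congrArg Subtype.val hc)
  · change χ4 (w ^ NB) = -1
    rw [map_pow, hχ4w, hNB.neg_one_pow]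
  · intro c hc
    refine hM' c ?_
    exact hc.imp (congrArg Subtype.val) (congrArg Subtype.val)
  · exact (M.pow_mem (M.pow_mem huM N) 2 :)
  · intro h
    have := hM2 (u ^ N) (M.pow_mem huM N) (congrArg Subtype.val h)
    rw [hodd hu] at this
    norm_num at this
  · rw [map_pow, sq_eq_one_of_monoidHom]
  · rw [map_pow, sq_eq_one_of_monoidHom]

section
variable {k K : Type*} [Field k] [NumberField k] [Field K] [NumberField K] [Algebra k K]

theorem normChar_map_eq_one {a b : Gal(K/ℚ)} {ha : a * a = 1} {hb : b * b = 1}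
    {hab : a * b = b * a} (hk : IsFixedField k (quadSubgroup a b ha hb hab)) (h1 : a ≠ 1)
    (h2 : b ≠ 1) (h3 : a ≠ b) {p : ℕ} [hp : Fact p.Prime] {φ : ClassGroup (𝓞 K) →* ℤ}
    (hφ : ∀ I : Ideal (𝓞 K), I ≠ ⊥ → (Ideal.absNorm I).Coprime p →
      φ (idealClass I) = quadraticChar (ZMod p) (Ideal.absNorm I : ℕ))
    {j : ClassGroup (𝓞 k) →* ClassGroup (𝓞 K)}
    (hj : ∀ I : Ideal (𝓞 k), I ≠ ⊥ → j (idealClass I) = idealClass (I.map (algebraMap (𝓞 k) (𝓞 K))))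
    (c : ClassGroup (𝓞 k)) : φ (j c) = 1 := by
  obtain ⟨I, hI, hc, rfl⟩ := exists_coprime_rep c hp.out.ne_zero
  have hn := hk.absNorm_map h1 h2 h3 I
  rw [hj _ hI, hφ _ (map_algebraMap_ne_bot hI) (by rw [hn]; exact hc.pow_left 4), hn, Nat.cast_pow,
    show ((Ideal.absNorm I : ZMod p)) ^ 4 = ((Ideal.absNorm I : ZMod p) ^ 2) ^ 2 by ring,
    quadraticChar_sq_one']
  apply pow_ne_zero
  rw [Ne, ZMod.natCast_eq_zero_iff]
  intro h
  exact hp.out.one_lt.ne' (Nat.Coprime.eq_one_of_dvd hc.symm h)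

end

namespace Octic
variable {p₁ p₂ : ℕ} {K : Type*} [Field K] [NumberField K] {S : Octic p₁ p₂ K}
variable [hf₁ : Fact p₁.Prime] [hf₂ : Fact p₂.Prime]
variable {k : Type*} [Field k] [NumberField k] [Algebra k K]

theorem gaussChar_map_eq_one {a b : Gal(K/ℚ)} {ha : a * a = 1} {hb : b * b = 1}
    {hab : a * b = b * a} (hk : IsFixedField k (quadSubgroup a b ha hb hab)) (h1 : a ≠ 1)
    (h2 : b ≠ 1) (h3 : a ≠ b) (hs : S.s ∈ quadSubgroup a b ha hb hab) {D : ℤ} (Q : QuadField D k)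
    (hQ : ∀ y : 𝓞 k, algebraMap (𝓞 k) (𝓞 K) (Q.τ • y) = S.σ • algebraMap (𝓞 k) (𝓞 K) y)
    {r₁ : ZMod p₁} {r₂ : ZMod p₂} (hr₁ : r₁ * r₁ = -1) (hr₂ : r₂ * r₂ = -1)
    {φ : ClassGroup (𝓞 K) →* ℤ}
    (hφ : ∀ I : Ideal (𝓞 K), I ≠ ⊥ → (Ideal.absNorm I).Coprime (p₁ * p₂) →
      ∀ x, S.IsGaussNorm I x → φ (idealClass I) = GaussianInt.biChar hr₁ hr₂ x)
    {j : ClassGroup (𝓞 k) →* ClassGroup (𝓞 K)}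
    (hj : ∀ I : Ideal (𝓞 k), I ≠ ⊥ → j (idealClass I) = idealClass (I.map (algebraMap (𝓞 k) (𝓞 K))))
    (c : ClassGroup (𝓞 k)) : φ (j c) = 1 := by
  obtain ⟨I, hI, hc, rfl⟩ := exists_coprime_rep c (mul_ne_zero hf₁.out.ne_zero hf₂.out.ne_zero)
  have hn := hk.absNorm_map h1 h2 h3 I
  rw [hj _ hI, hφ _ (map_algebraMap_ne_bot hI) (by rw [hn]; exact hc.pow_left 4) _
    (isGaussNorm_map Q hQ (hk.smul_map hs I)), map_pow, GaussianInt.biChar_apply,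
    GaussianInt.rootChar_natCast, GaussianInt.rootChar_natCast, mul_pow, ← map_pow, ← map_pow,
    quadraticChar_sq_one', quadraticChar_sq_one', one_mul]
  · rw [Ne, ZMod.natCast_eq_zero_iff]
    intro h
    exact hf₂.out.one_lt.ne' (Nat.Coprime.eq_one_of_dvd hc.coprime_mul_left_right.symm h)
  · rw [Ne, ZMod.natCast_eq_zero_iff]
    intro h
    exact hf₁.out.one_lt.ne' (Nat.Coprime.eq_one_of_dvd hc.coprime_mul_right_right.symm h)

include S hf₁ hf₂ in
variable (S) in
theorem χ₄_absNorm {I : Ideal (𝓞 K)} (hI : (Ideal.absNorm I).Coprime 4) :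
    ZMod.χ₄ (Ideal.absNorm I : ℕ) = 1 := by
  obtain ⟨x, hx⟩ := S.exists_isGaussNorm I
  have h := congrArg Zsqrtd.re hx.mul_star
  simp only [Zsqrtd.re_mul, Zsqrtd.re_star, Zsqrtd.im_star, Zsqrtd.re_natCast] at h
  have hodd : Ideal.absNorm I % 2 = 1 := by
    rw [Nat.coprime_comm, Nat.Coprime, show (4 : ℕ) = 2 ^ 2 by norm_num] at hI
    exact Nat.odd_iff.1 ((Nat.coprime_pow_left_iff (by norm_num) 2 _).1 hI).odd_of_left
  rw [ZMod.χ₄_nat_one_mod_four]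
  have h' : (Ideal.absNorm I : ℤ) = x.re * x.re + x.im * x.im := by rw [← h]; ring
  rcases Int.even_or_odd' x.re with ⟨a, ha | ha⟩ <;> rcases Int.even_or_odd' x.im with ⟨b, hb | hb⟩ <;>
    rw [ha, hb] at h' <;> ring_nf at h' <;> omega

end Octic

namespace Octic
variable {p₁ p₂ : ℕ} {K : Type*} [Field K] [NumberField K] {S : Octic p₁ p₂ K}

theorem sq_ne_of_smul_eq {p : ℕ} (hp : p.Prime) {m : ℤ} (hm : ¬ (p : ℤ) ∣ m) {x : 𝓞 K}
    (hσ : S.σ • x = x) (hJ : S.J • x = x) (hs : S.s • x = x) : x ^ 2 ≠ ((p * m : ℤ) : 𝓞 K) := by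
  intro h
  obtain ⟨n, rfl⟩ := S.exists_int hσ hJ hs
  have h1 : n ^ 2 = p * m := by exact_mod_cast h
  have hp' := Nat.prime_iff_prime_int.1 hp
  obtain ⟨c, rfl⟩ := hp'.dvd_of_dvd_pow (Dvd.intro _ h1.symm)
  apply hm
  refine ⟨c ^ 2, mul_left_cancel₀ hp'.ne_zero ?_⟩
  rw [← h1]; ring

theorem smul_eq_or_of_sq_eq_intCast (g : Gal(K/ℚ)) {x : 𝓞 K} {m : ℤ} (h : x ^ 2 = (m : 𝓞 K)) :
    g • x = x ∨ g • x = -x := by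
  rw [← sq_eq_sq_iff_eq_or_eq_neg, ← smul_pow', h]
  exact map_intCast (MulSemiringAction.toRingHom Gal(K/ℚ) (𝓞 K) g) m

theorem sq_ne_of_smul_σ_eq {p : ℕ} (hp : p.Prime) (hp2 : p ≠ 2) {m : ℤ} (hm : ¬ (p : ℤ) ∣ m)
    {x : 𝓞 K} (hσ : S.σ • x = x) : x ^ 2 ≠ ((p * m : ℤ) : 𝓞 K) := by
  have key : ∀ {m : ℤ} {x : 𝓞 K}, ¬ (p : ℤ) ∣ m → S.σ • x = x → S.s • x = x →
      x ^ 2 ≠ ((p * m : ℤ) : 𝓞 K) := by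
    intro m x hm hσ hs h
    rcases smul_eq_or_of_sq_eq_intCast S.J h with hJ | hJ
    · exact sq_ne_of_smul_eq hp hm hσ hJ hs h
    · refine sq_ne_of_smul_eq (S := S) hp (m := -m) (x := x * S.im) (by rwa [dvd_neg]) ?_ ?_ ?_ ?_
      · rw [smul_mul', hσ, S.σ_im]
      · rw [smul_mul', hJ, S.J_im, neg_mul_neg]
      · rw [smul_mul', hs, S.s_im]
      · rw [mul_pow, h, S.im_sq]; push_cast; ring
  intro h
  rcases smul_eq_or_of_sq_eq_intCast S.s h with hs | hs
  · exact key hm hσ hs h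
  · refine key (m := m * 2) (x := x * S.r2) ?_ ?_ ?_ ?_
    · intro hd
      rcases (Nat.prime_iff_prime_int.1 hp).dvd_or_dvd hd with hd | hd
      · exact hm hd
      · exact hp2 ((Nat.prime_dvd_prime_iff_eq hp Nat.prime_two).1 (by exact_mod_cast hd))
    · rw [smul_mul', hσ, S.σ_r2]
    · rw [smul_mul', hs, S.s_r2, neg_mul_neg]
    · rw [mul_pow, h, S.r2_sq]; push_cast; ring

variable [hf₁ : Fact p₁.Prime] [hf₂ : Fact p₂.Prime]

variable (S) in
include S in
theorem sq_ne_prime (hne : p₁ ≠ p₂) (hp₁ : p₁ ≠ 2) (hp₂ : p₂ ≠ 2) (x : 𝓞 K) : x ^ 2 ≠ p₁ := by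
  intro h
  have h' : x ^ 2 = ((p₁ * 1 : ℤ) : 𝓞 K) := by rw [h]; push_cast; ring
  rcases smul_eq_or_of_sq_eq_intCast S.σ h' with hσ | hσ
  · refine sq_ne_of_smul_σ_eq hf₁.out hp₁ (m := 1) ?_ hσ h'
    intro hd
    exact hf₁.out.one_lt.ne' (Nat.dvd_one.1 (by exact_mod_cast hd))
  · refine sq_ne_of_smul_σ_eq (S := S) hf₂.out hp₂ (m := p₁ ^ 2) (x := x * S.rd) ?_ ?_ ?_
    · intro hd
      have := hf₂.out.dvd_of_dvd_pow (n := 2) (m := p₁) (by exact_mod_cast hd)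
      exact hne ((Nat.prime_dvd_prime_iff_eq hf₂.out hf₁.out).1 this).symm
    · rw [smul_mul', hσ, S.σ_rd, neg_mul_neg]
    · rw [mul_pow, h, S.rd_sq]; push_cast; ring

variable (S) in
/-- The classes containing an ideal invariant under complex conjugation. -/
noncomputable def conjSubgroup : Subgroup (ClassGroup (𝓞 K)) where
  carrier := {c | ∃ I : Ideal (𝓞 K), I ≠ ⊥ ∧ S.J • I = I ∧ idealClass I = c}
  one_mem' := ⟨1, one_ne_zero, smul_one _, idealClass_one⟩
  mul_mem' := by
    rintro _ _ ⟨I, hI, hJ, rfl⟩ ⟨I', hI', hJ', rfl⟩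
    exact ⟨I * I', mul_ne_zero hI hI', by rw [smul_mul', hJ, hJ'], idealClass_mul hI hI'⟩
  inv_mem' := by
    rintro _ ⟨I, hI, hJ, rfl⟩
    refine ⟨I ^ (orderOf (idealClass I) - 1), pow_ne_zero _ hI, by rw [smul_pow', hJ], ?_⟩
    rw [idealClass_pow hI, eq_inv_iff_mul_eq_one, ← pow_succ, Nat.sub_add_cancel (orderOf_pos _),
      pow_orderOf_eq_one]

theorem mapHom_mem_conjSubgroup {k : Type*} [Field k] [NumberField k] [Algebra k K]
    (hk : S.IsReal k) {j : ClassGroup (𝓞 k) →* ClassGroup (𝓞 K)}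
    (hj : ∀ I : Ideal (𝓞 k), I ≠ ⊥ → j (idealClass I) = idealClass (I.map (algebraMap (𝓞 k) (𝓞 K))))
    (c : ClassGroup (𝓞 k)) : j c ∈ S.conjSubgroup := by
  obtain ⟨I, hI, rfl⟩ := exists_idealClass_eq c
  exact ⟨_, map_algebraMap_ne_bot hI, hk.smul_map (Or.inr (Or.inl rfl)) I, (hj _ hI).symm⟩

theorem idealClass_eq_iff {R : Type*} [CommRing R] [IsDedekindDomain R] {I I' : Ideal R} (hI : I ≠ ⊥)
    (hI' : I' ≠ ⊥) (h : idealClass I = idealClass I') :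
    ∃ a b : R, a ≠ 0 ∧ b ≠ 0 ∧ Ideal.span {a} * I = Ideal.span {b} * I' := by
  rw [idealClass_of_ne hI, idealClass_of_ne hI', ClassGroup.mk0_eq_mk0_iff] at h
  obtain ⟨x, y, hx, hy, h⟩ := h
  exact ⟨x, y, hx, hy, h⟩

theorem mapHom_notMem_conjSubgroup (hne : p₁ ≠ p₂) (hm₁ : p₁ % 8 = 5) (hm₂ : p₂ % 8 = 5)
    {k : Type*} [Field k] [NumberField k] [Algebra k K] (hk : S.IsImag k) {D : ℤ} (Q : QuadField D k)
    (hQ : ∀ y : 𝓞 k, algebraMap (𝓞 k) (𝓞 K) (Q.τ • y) = S.σ • algebraMap (𝓞 k) (𝓞 K) y)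
    {j : ClassGroup (𝓞 k) →* ClassGroup (𝓞 K)}
    (hj : ∀ I : Ideal (𝓞 k), I ≠ ⊥ → j (idealClass I) = idealClass (I.map (algebraMap (𝓞 k) (𝓞 K))))
    {R : Ideal (𝓞 k)} (hR0 : R ≠ ⊥) {ρ g : 𝓞 K} {n : ℕ} (hn : n ≠ 0)
    (hR : R.map (algebraMap (𝓞 k) (𝓞 K)) = Ideal.span {ρ}) (hρ : ρ * S.J • ρ = n * g ^ 2)
    (hRn : Ideal.absNorm R = n * p₁) (hR2 : idealClass R ^ 2 = 1)
    {c : ClassGroup (𝓞 k)} (hc : c ^ 2 = idealClass R) : j c ∉ S.conjSubgroup := by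
  rintro ⟨C, hC0, hC, hCc⟩
  obtain ⟨I, hI, rfl⟩ := exists_idealClass_eq c
  have hI' := map_algebraMap_ne_bot (K := K) hI
  obtain ⟨γ, hγ⟩ : ∃ γ, I ^ 2 * R = Ideal.span {γ} := by
    rw [← idealClass_eq_one_iff (mul_ne_zero (pow_ne_zero 2 hI) hR0),
      idealClass_mul (pow_ne_zero 2 hI) hR0, idealClass_pow hI, hc, ← pow_two, hR2]
  obtain ⟨a, b, ha, hb, hab⟩ := idealClass_eq_iff hI' hC0 (by rw [← hj _ hI, hCc])
  have hσJ (y : 𝓞 k) : S.J • algebraMap (𝓞 k) (𝓞 K) y = S.σ • algebraMap (𝓞 k) (𝓞 K) y := by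
    have := hk.smul_algebraMap (g := S.J * S.σ) (Or.inr (Or.inl rfl)) y
    nth_rw 1 [← this]
    rw [mul_smul, S.smul_smul_self]
  have hσJI : S.J • I.map (algebraMap (𝓞 k) (𝓞 K)) = S.σ • I.map (algebraMap (𝓞 k) (𝓞 K)) := by
    have := hk.smul_map (g := S.J * S.σ) (Or.inr (Or.inl rfl)) I
    nth_rw 1 [← this]
    rw [mul_smul, S.smul_smul_self]
  have hN := map_mul_σ Q hQ I
  have hγ' : I.map (algebraMap (𝓞 k) (𝓞 K)) ^ 2 * Ideal.span {ρ} =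
      Ideal.span {algebraMap (𝓞 k) (𝓞 K) γ} := by
    rw [← hR, ← Ideal.map_pow, ← Ideal.map_mul, hγ, Ideal.map_span, Set.image_singleton]
  have hJab := congrArg (S.J • ·) hab
  simp only [smul_mul', smul_span_singleton, hC, hσJI] at hJab
  have h1 : Ideal.span {a * S.J • b * algebraMap (𝓞 k) (𝓞 K) γ} =
      Ideal.span {b * S.J • a * (Ideal.absNorm I : 𝓞 K) * ρ} := by
    simp only [← Ideal.span_singleton_mul_span_singleton]
    rw [← hγ', ← hN]
    generalize I.map (algebraMap (𝓞 k) (𝓞 K)) = I' at hab hJab ⊢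
    calc Ideal.span {a} * Ideal.span {S.J • b} * (I' ^ 2 * Ideal.span {ρ}) =
          Ideal.span {a} * I' * Ideal.span {S.J • b} * I' * Ideal.span {ρ} := by ring
      _ = Ideal.span {b} * (Ideal.span {S.J • b} * C) * I' * Ideal.span {ρ} := by rw [hab]; ring
      _ = _ := by rw [← hJab]; ring
  obtain ⟨η, hη⟩ := (Ideal.span_singleton_eq_span_singleton.1 h1).symm
  obtain ⟨ξ, hξ, hξη⟩ := S.exists_real_unit (by rw [Nat.mul_mod, hm₁, hm₂]) η.isUnit
  have hηη : (η : 𝓞 K) * S.J • (η : 𝓞 K) = (ξ * η) ^ 2 := by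
    have h2 := hξη
    rw [smul_mul'] at h2
    linear_combination (ξ * η) * h2 - (η * S.J • (η : 𝓞 K)) * hξ
  obtain ⟨M, hM⟩ : ∃ M : ℤ, γ * Q.τ • γ = M := by
    obtain ⟨M, hM⟩ := Q.exists_int (x := γ * Q.τ • γ) (by rw [smul_mul', Q.ττ, mul_comm])
    exact ⟨M, hM.symm⟩
  have hMn := Q.absNorm_span hM
  rw [← hγ, map_mul, map_pow, hRn] at hMn
  have hγJ : algebraMap (𝓞 k) (𝓞 K) γ * S.J • algebraMap (𝓞 k) (𝓞 K) γ = (M : 𝓞 K) := by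
    rw [hσJ, ← hQ, ← map_mul, hM, map_intCast]
  have hJη := congrArg (S.J • ·) hη
  simp only [smul_mul', S.smul_smul_self, S.smul_natCast] at hJη
  have hA0 : (Ideal.absNorm I : 𝓞 K) ≠ 0 := by
    rwa [Nat.cast_ne_zero, Ne, Ideal.absNorm_eq_zero_iff]
  have hn0 : (n : 𝓞 K) ≠ 0 := Nat.cast_ne_zero.2 hn
  have hJa : S.J • a ≠ 0 := by rwa [Ne, smul_eq_zero_iff_eq]
  have hJb : S.J • b ≠ 0 := by rwa [Ne, smul_eq_zero_iff_eq]
  have key : (M : 𝓞 K) = (Ideal.absNorm I : 𝓞 K) ^ 2 * n * (ξ * η * g) ^ 2 := by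
    apply mul_left_cancel₀ (mul_ne_zero (mul_ne_zero ha hJa) (mul_ne_zero hb hJb))
    linear_combination -(a * S.J • a * (b * S.J • b)) * hγJ -
      hη * (S.J • b * a * Ideal.absNorm I * S.J • ρ * S.J • (η : 𝓞 K)) -
      (a * S.J • b * algebraMap (𝓞 k) (𝓞 K) γ) * hJη +
      (a * S.J • a * (b * S.J • b)) * (Ideal.absNorm I : 𝓞 K) ^ 2 * (η * S.J • (η : 𝓞 K)) * hρ +
      (a * S.J • a * (b * S.J • b)) * (Ideal.absNorm I : 𝓞 K) ^ 2 * n * g ^ 2 * hηη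
  have hAn := mul_ne_zero (pow_ne_zero 2 hA0) hn0
  rcases Int.natAbs_eq M with h | h
  · refine S.sq_ne_prime hne (by omega) (by omega) (ξ * η * g) (mul_left_cancel₀ hAn ?_)
    rw [← key, h, ← hMn]
    push_cast
    ring
  · refine S.sq_ne_prime hne (by omega) (by omega) (S.im * (ξ * η * g)) (mul_left_cancel₀ hAn ?_)
    rw [mul_pow, S.im_sq, neg_one_mul, mul_neg, ← key, h, ← hMn]
    push_cast
    ring

end Octic

namespace Octic
variable {p₁ p₂ : ℕ} {K : Type*} [Field K] [NumberField K] {S : Octic p₁ p₂ K}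
variable [hf₁ : Fact p₁.Prime] [hf₂ : Fact p₂.Prime]

theorem Units.exists_B_eq_second (U : S.Units) (hne : p₁ ≠ p₂) (hm₁ : p₁ % 8 = 5)
    (hm₂ : p₂ % 8 = 5) : ∃ g : 𝓞 K, S.J • g = g ∧ Ideal.span {g} = S.B p₂ := by
  obtain ⟨g, hJg, hg⟩ := U.exists_B_eq hne hm₁ hm₂
  have hc := (Nat.coprime_primes hf₁.out hf₂.out).2 hne
  have h2 := S.B_sq hc.symm (by rw [S.rd_sq, mul_comm])
  have h1 := S.B_sq hc S.rd_sq
  have hprod : S.B p₂ * Ideal.span {g} = Ideal.span {S.rd} := by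
    apply Ideal.sq_inj
    rw [hg, mul_pow, h1, h2, Ideal.span_singleton_mul_span_singleton, Ideal.span_singleton_pow,
      S.rd_sq, mul_comm]
  have hg0 : g ≠ 0 := by
    rintro rfl
    rw [Ideal.span_singleton_eq_bot.2 rfl, Ideal.mul_bot, eq_comm, Ideal.span_singleton_eq_bot] at hprod
    exact S.rd_ne hprod
  obtain ⟨y, hy, hBy⟩ := exists_of_mul_span_eq hg0 hprod
  refine ⟨y, mul_left_cancel₀ hg0 ?_, hBy.symm⟩
  have := congrArg (S.J • ·) hy
  simp only [smul_mul', S.J_rd, hJg] at this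
  rw [← this, hy]

variable (S) in
theorem gauss_ne {y : GaussianInt} (hy : y ≠ 0) : S.gauss y ≠ 0 := fun h =>
  hy (S.gauss_injective (by rw [h, map_zero]))

theorem ne_zero_of_mul_star {p : ℕ} (hp : p ≠ 0) {x : GaussianInt} (hx : x * star x = p) : x ≠ 0 := by
  rintro rfl
  rw [zero_mul] at hx
  exact hp (by exact_mod_cast hx.symm)

theorem ne_zero_of_span_eq_B {p : ℕ} (hp : p ≠ 0) {g : 𝓞 K} (hg : Ideal.span {g} = S.B p) :
    g ≠ 0 := by
  rintro rfl
  rw [Ideal.span_singleton_eq_bot.2 rfl] at hg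
  have : (p : 𝓞 K) ∈ S.B p := Ideal.subset_span (Or.inl rfl)
  rw [← hg, Ideal.mem_bot] at this
  exact hp (by exact_mod_cast this)

/-- Up to elements of `ℤ[i]` and elements fixed by `J`, every product of primes containing
`√(p₁p₂)` is a product of powers of two chosen ones. -/
theorem exists_normal_form (U : S.Units) (hne : p₁ ≠ p₂) (hm₁ : p₁ % 8 = 5) (hm₂ : p₂ % 8 = 5)
    {x₁ x₂ : GaussianInt} (hx₁ : x₁ * star x₁ = p₁) (hx₂ : x₂ * star x₂ = p₂)
    {L : Ideal (𝓞 K)} (hL : L ∈ Submonoid.closure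
      {Q | (Q = S.P x₁ ∨ Q = S.P (star x₁)) ∨ (Q = S.P x₂ ∨ Q = S.P (star x₂))}) :
    ∃ (y : GaussianInt) (h : 𝓞 K) (e₁ e₂ : ℕ), y ≠ 0 ∧ h ≠ 0 ∧ S.J • h = h ∧
      Ideal.span {S.gauss y} * L = Ideal.span {h} * S.P x₁ ^ e₁ * S.P x₂ ^ e₂ := by
  obtain ⟨g₁, hJ₁, hg₁⟩ := U.exists_B_eq hne hm₁ hm₂
  obtain ⟨g₂, hJ₂, hg₂⟩ := U.exists_B_eq_second hne hm₁ hm₂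
  have hc := (Nat.coprime_primes hf₁.out hf₂.out).2 hne
  have hS' : S.rd ^ 2 = p₂ * p₁ := by rw [S.rd_sq, mul_comm]
  induction hL using Submonoid.closure_induction with
  | mem x hx =>
    rcases hx with (rfl | rfl) | rfl | rfl
    · exact ⟨1, 1, 1, 0, one_ne_zero, one_ne_zero, smul_one _, by simp⟩
    · refine ⟨x₁, g₁, 1, 0, ne_zero_of_mul_star hf₁.out.ne_zero hx₁,
        ne_zero_of_span_eq_B hf₁.out.ne_zero hg₁, hJ₁, ?_⟩
      rw [← S.P_sq hf₁.out hm₁ hc S.rd_sq hx₁, hg₁, ← S.P_mul_P_star hf₁.out hm₁ hc S.rd_sq hx₁]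
      ring
    · exact ⟨1, 1, 0, 1, one_ne_zero, one_ne_zero, smul_one _, by simp⟩
    · refine ⟨x₂, g₂, 0, 1, ne_zero_of_mul_star hf₂.out.ne_zero hx₂,
        ne_zero_of_span_eq_B hf₂.out.ne_zero hg₂, hJ₂, ?_⟩
      rw [← S.P_sq hf₂.out hm₂ hc.symm hS' hx₂, hg₂, ← S.P_mul_P_star hf₂.out hm₂ hc.symm hS' hx₂]
      ring
  | one => exact ⟨1, 1, 0, 0, one_ne_zero, one_ne_zero, smul_one _, by simp⟩
  | mul L L' _ _ hL hL' =>
    obtain ⟨y, h, e₁, e₂, hy, hh, hJ, hE⟩ := hL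
    obtain ⟨y', h', e₁', e₂', hy', hh', hJ', hE'⟩ := hL'
    refine ⟨y * y', h * h', e₁ + e₁', e₂ + e₂', mul_ne_zero hy hy', mul_ne_zero hh hh',
      by rw [smul_mul', hJ, hJ'], ?_⟩
    rw [map_mul, ← Ideal.span_singleton_mul_span_singleton, ← Ideal.span_singleton_mul_span_singleton]
    calc _ = (Ideal.span {S.gauss y} * L) * (Ideal.span {S.gauss y'} * L') := by ring
      _ = _ := by rw [hE, hE']; ring

theorem σ_sub_eq_rd {ω : 𝓞 K} (hω : 2 * ω = 1 + S.rd) : ω - S.σ • ω = S.rd := by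
  apply mul_left_cancel₀ (two_ne_zero (α := 𝓞 K))
  have : (2 : 𝓞 K) * S.σ • ω = 1 - S.rd := by
    rw [← S.smul_two S.σ, ← smul_mul', hω, smul_add, smul_one, S.σ_rd, sub_eq_add_neg]
  linear_combination hω - this

theorem mem_closure_of_rd_mem (hne : p₁ ≠ p₂) (hm₁ : p₁ % 8 = 5) (hm₂ : p₂ % 8 = 5)
    {x₁ x₂ : GaussianInt} (hx₁ : x₁ * star x₁ = p₁) (hx₂ : x₂ * star x₂ = p₂)
    {L : Ideal (𝓞 K)} (hL : L ≠ ⊥) (hrd : S.rd ∈ L) : L ∈ Submonoid.closure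
      {Q | (Q = S.P x₁ ∨ Q = S.P (star x₁)) ∨ (Q = S.P x₂ ∨ Q = S.P (star x₂))} :=
  mem_closure_of_forall_prime hL fun _ hP hle =>
    S.eq_P_of_rd_mem hne hm₁ hm₂ hx₁ hx₂ hP (hle hrd)

/-- The classes of ideals invariant under `σ` are generated by two classes of order at most two. -/
theorem exists_idealClass_eq_of_smul_eq (U : S.Units) (hne : p₁ ≠ p₂) (hm₁ : p₁ % 8 = 5)
    (hm₂ : p₂ % 8 = 5) {x₁ x₂ : GaussianInt} (hx₁ : x₁ * star x₁ = p₁) (hx₂ : x₂ * star x₂ = p₂)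
    {I : Ideal (𝓞 K)} (hI : I ≠ ⊥) (hσ : S.σ • I = I) :
    ∃ e₁ e₂ : ℕ, idealClass I * (idealClass (S.P x₁) ^ e₁ * idealClass (S.P x₂) ^ e₂) = 1 := by
  have hd8 : (p₁ * p₂) % 8 = 1 := by rw [Nat.mul_mod, hm₁, hm₂]
  have := S.isPrincipalIdealRing_F
  obtain ⟨ω, hω⟩ := S.exists_half (by omega)
  obtain ⟨f, hf, J, hIJ, hωJ, -⟩ := S.isFixedField_F.exists_mul_eq_span ω hI hσ
  rw [σ_sub_eq_rd hω] at hωJ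
  have hn : I * J ≠ ⊥ := by
    rw [hIJ, Ne, Ideal.span_singleton_eq_bot]
    exact fun h => hf (algebraMap_ringOfIntegers_injective (K := K) (by rw [h, map_zero]))
  have hJ0 : J ≠ ⊥ := right_ne_zero_of_mul hn
  obtain ⟨y, h, e₁, e₂, hy, hh, -, hE⟩ := exists_normal_form U hne hm₁ hm₂ hx₁ hx₂
    (mem_closure_of_rd_mem hne hm₁ hm₂ hx₁ hx₂ hJ0 hωJ)
  have h3 : S.P x₁ ≠ ⊥ := fun h => S.rd_ne (by simpa [h] using S.rd_mem_P x₁)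
  have h4 : S.P x₂ ≠ ⊥ := fun h => S.rd_ne (by simpa [h] using S.rd_mem_P x₂)
  have h1 : Ideal.span {S.gauss y} ≠ ⊥ := by
    rw [Ne, Ideal.span_singleton_eq_bot]; exact S.gauss_ne hy
  have h2 : Ideal.span {h} ≠ ⊥ := by rwa [Ne, Ideal.span_singleton_eq_bot]
  refine ⟨e₁, e₂, ?_⟩
  have hE' := congrArg idealClass hE
  rw [idealClass_mul h1 hJ0, idealClass_span, one_mul, idealClass_mul (mul_ne_zero h2 (pow_ne_zero _ h3))
    (pow_ne_zero _ h4), idealClass_mul h2 (pow_ne_zero _ h3), idealClass_span, one_mul,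
    idealClass_pow h3, idealClass_pow h4] at hE'
  rw [← hE', ← idealClass_mul hI hJ0, hIJ, idealClass_span]

theorem no_twisted_real (hd8 : (p₁ * p₂) % 8 = 1) (U : S.Units) {v h : 𝓞 K} (hv : IsUnit v)
    (hh : h ≠ 0) (hJ : S.J • h = h) : S.im * U.e2d * v * h ≠ S.σ • v * S.σ • h := by
  intro hE
  obtain ⟨ξ, hξ, hw⟩ := S.exists_real_unit hd8 hv
  have hξ' : S.σ • ξ * S.J • S.σ • ξ = 1 := by
    rw [S.smul_smul_comm, ← smul_mul', hξ, smul_one]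
  obtain ⟨ρ, hρ⟩ : ∃ ρ, ρ = ξ * S.J • S.σ • ξ := ⟨_, rfl⟩
  have hJρ : S.J • ρ = S.J • ξ * S.σ • ξ := by rw [hρ, smul_mul', S.smul_smul_self]
  have h1 : S.im * (U.e2d * (ξ * v) * h) = S.σ • (ξ * v) * S.σ • h * ρ := by
    rw [hρ, smul_mul']
    linear_combination ξ * hE - ξ * S.σ • v * S.σ • h * hξ'
  have h2 : -S.im * (U.e2d * (ξ * v) * h) = S.σ • (ξ * v) * S.σ • h * S.J • ρ := by
    have hx (x : 𝓞 K) (hx : S.J • x = x) : S.J • S.σ • x = S.σ • x := by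
      rw [S.smul_smul_comm, hx]
    have := congrArg (S.J • ·) h1
    rwa [smul_mul' S.J S.im, smul_mul' S.J (U.e2d * _), smul_mul' S.J U.e2d, S.J_im, U.J_e2d, hw, hJ,
      smul_mul' S.J _ ρ, smul_mul' S.J (S.σ • _), hx _ hw, hx _ hJ] at this
  have hne : S.σ • (ξ * v) * S.σ • h ≠ 0 := by
    rw [← smul_mul', Ne, smul_eq_zero_iff_eq]
    exact mul_ne_zero (mul_ne_zero (left_ne_zero_of_mul_eq_one hξ) hv.ne_zero) hh
  have h3 : ρ + S.J • ρ = 0 := by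
    refine (mul_eq_zero.1 (?_ : S.σ • (ξ * v) * S.σ • h * (ρ + S.J • ρ) = 0)).resolve_left hne
    linear_combination -h1 - h2
  have h4 : ρ * S.J • ρ = 1 := by
    rw [hJρ, hρ]
    linear_combination S.σ • ξ * S.J • S.σ • ξ * hξ + hξ'
  have h5 : (ρ - S.im) * (ρ + S.im) = 0 := by
    linear_combination ρ * h3 - h4 - S.im_sq
  have hσρ : S.σ • ρ = ρ := by
    rcases mul_eq_zero.1 h5 with h | h
    · rw [sub_eq_zero.1 h, S.σ_im]
    · rw [eq_neg_of_add_eq_zero_left h, smul_neg, S.σ_im]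
  have h6 : ξ = ρ * S.σ • ξ := by
    rw [hρ]; linear_combination -ξ * hξ'
  have h7 : S.σ • ξ = ρ * ξ := by
    conv_lhs => rw [h6, smul_mul', hσρ, S.smul_smul_self]
  have h8 : (2 : 𝓞 K) * ξ = 0 := by
    linear_combination h6 + ρ * h7 + ξ * (ρ * h3 - h4)
  exact mul_ne_zero two_ne_zero (left_ne_zero_of_mul_eq_one hξ) h8

/-- One nontrivial relation between the two generating classes. -/
theorem idealClass_P_relation (U : S.Units) (hne : p₁ ≠ p₂) (hm₁ : p₁ % 8 = 5)
    (hm₂ : p₂ % 8 = 5) {x₁ x₂ : GaussianInt} (hx₁ : x₁ * star x₁ = p₁) (hx₂ : x₂ * star x₂ = p₂) :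
    idealClass (S.P x₁) = 1 ∨ idealClass (S.P x₂) = 1 ∨
      idealClass (S.P x₁) * idealClass (S.P x₂) = 1 := by
  have hd8 : (p₁ * p₂) % 8 = 1 := by rw [Nat.mul_mod, hm₁, hm₂]
  have hc := (Nat.coprime_primes hf₁.out hf₂.out).2 hne
  have hS' : S.rd ^ 2 = p₂ * p₁ := by rw [S.rd_sq, mul_comm]
  have := S.isPrincipalIdealRing_F
  obtain ⟨η, hη⟩ : ∃ η, η = S.im * U.e2d := ⟨_, rfl⟩
  have hησ : η * S.σ • η = 1 := by
    rw [hη, smul_mul', S.σ_im]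
    linear_combination U.e2d * S.σ • U.e2d * S.im_sq - U.e2d_mul_σ hne hm₁ hm₂
  have ha0 : 1 + η ≠ 0 := by
    intro h
    have h' := congrArg (S.J • ·) h
    simp only [hη, smul_add, smul_one, smul_mul', S.J_im, U.J_e2d, smul_zero] at h'
    have : (2 : 𝓞 K) = 0 := by linear_combination h + h' - hη
    exact two_ne_zero this
  have haη : S.σ • (1 + η) * η = 1 + η := by
    rw [smul_add, smul_one]; linear_combination hησ
  have hηu : IsUnit η := IsUnit.of_mul_eq_one _ hησ
  have hI0 : Ideal.span {1 + η} ≠ ⊥ := by rwa [Ne, Ideal.span_singleton_eq_bot]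
  have hσI : S.σ • Ideal.span {1 + η} = Ideal.span {1 + η} := by
    rw [smul_span_singleton]
    conv_rhs => rw [← haη, Ideal.span_singleton_mul_right_unit hηu]
  obtain ⟨ω, hω⟩ := S.exists_half (by omega)
  obtain ⟨f, hf, J, hIJ, hωJ, -⟩ := S.isFixedField_F.exists_mul_eq_span ω hI0 hσI
  rw [σ_sub_eq_rd hω] at hωJ
  have hn : Ideal.span {1 + η} * J ≠ ⊥ := by
    rw [hIJ, Ne, Ideal.span_singleton_eq_bot]
    exact fun h => hf (algebraMap_ringOfIntegers_injective (K := K) (by rw [h, map_zero]))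
  have hJ0 : J ≠ ⊥ := right_ne_zero_of_mul hn
  obtain ⟨g, hfg, rfl⟩ := exists_of_mul_span_eq ha0 (by rw [mul_comm]; exact hIJ)
  have hσg : S.σ • g = η * g := by
    apply mul_left_cancel₀ ha0
    have := congrArg (S.σ • ·) hfg
    simp only [smul_mul' S.σ, S.isFixedField_F.smul_algebraMap (Or.inr rfl) f] at this
    rw [hfg] at this
    linear_combination -η * this - S.σ • g * haη
  obtain ⟨y, h, e₁, e₂, hy, hh, hJh, hE⟩ := exists_normal_form U hne hm₁ hm₂ hx₁ hx₂
    (mem_closure_of_rd_mem hne hm₁ hm₂ hx₁ hx₂ hJ0 hωJ)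
  have h3 : S.P x₁ ≠ ⊥ := fun h => S.rd_ne (by simpa [h] using S.rd_mem_P x₁)
  have h4 : S.P x₂ ≠ ⊥ := fun h => S.rd_ne (by simpa [h] using S.rd_mem_P x₂)
  have h1 : Ideal.span {S.gauss y} ≠ ⊥ := by
    rw [Ne, Ideal.span_singleton_eq_bot]; exact S.gauss_ne hy
  have h2 : Ideal.span {h} ≠ ⊥ := by rwa [Ne, Ideal.span_singleton_eq_bot]
  have hP1 := S.P_sq hf₁.out hm₁ hc S.rd_sq hx₁
  have hP2 := S.P_sq hf₂.out hm₂ hc.symm hS' hx₂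
  have hs1 : idealClass (S.P x₁) ^ 2 = 1 := by rw [← idealClass_pow h3, hP1, idealClass_span]
  have hs2 : idealClass (S.P x₂) ^ 2 = 1 := by rw [← idealClass_pow h4, hP2, idealClass_span]
  have hE' := congrArg idealClass hE
  rw [idealClass_mul h1 hJ0, idealClass_span, one_mul, idealClass_mul (mul_ne_zero h2 (pow_ne_zero _ h3))
    (pow_ne_zero _ h4), idealClass_mul h2 (pow_ne_zero _ h3), idealClass_span, idealClass_span, one_mul,
    idealClass_pow h3, idealClass_pow h4] at hE'
  rcases Nat.even_or_odd' e₁ with ⟨a₁, rfl | rfl⟩ <;> rcases Nat.even_or_odd' e₂ with ⟨a₂, rfl | rfl⟩ <;>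
    simp only [pow_add, pow_mul, hs1, hs2, one_pow, one_mul, mul_one, pow_one] at hE'
  · exfalso
    rw [pow_mul, pow_mul, hP1, hP2, Ideal.span_singleton_pow, Ideal.span_singleton_pow,
      Ideal.span_singleton_mul_span_singleton, Ideal.span_singleton_mul_span_singleton,
      Ideal.span_singleton_mul_span_singleton, Ideal.span_singleton_eq_span_singleton] at hE
    obtain ⟨v, hv⟩ := hE.symm
    have hg := congrArg (S.σ • ·) hv
    simp only [smul_mul', smul_pow', S.σ_gauss, hσg] at hg
    refine no_twisted_real hd8 U v.isUnit hh hJh ?_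
    apply mul_left_cancel₀ (mul_ne_zero (pow_ne_zero a₁ (S.gauss_ne (ne_zero_of_mul_star hf₁.out.ne_zero hx₁)))
      (pow_ne_zero a₂ (S.gauss_ne (ne_zero_of_mul_star hf₂.out.ne_zero hx₂))))
    rw [← hη]
    linear_combination η * hv - hg
  · exact Or.inr (Or.inl hE'.symm)
  · exact Or.inl hE'.symm
  · exact Or.inr (Or.inr hE'.symm)

end Octic

namespace Octic
variable {p₁ p₂ : ℕ} {K : Type*} [Field K] [NumberField K] {S : Octic p₁ p₂ K}
variable [hf₁ : Fact p₁.Prime] [hf₂ : Fact p₂.Prime]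

theorem exists_of_sq_eq_mul {t f X : 𝓞 K} (ht : IsUnit t) (hσt : S.σ • t = t) (hσ : S.σ • f = f)
    (h : f ^ 2 = t ^ 2 * X) :
    ∃ f' : 𝓞 K, Ideal.span {f} = Ideal.span {f'} ∧ S.σ • f' = f' ∧ f' ^ 2 = X := by
  obtain ⟨v, hv⟩ := ht.exists_right_inv
  have hvu : IsUnit v := IsUnit.of_mul_eq_one t (by rw [mul_comm, hv])
  refine ⟨f * v, (Ideal.span_singleton_mul_right_unit hvu f).symm, ?_, ?_⟩
  · have h1 := congrArg (S.σ • ·) hv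
    simp only [smul_mul', hσt, smul_one] at h1
    rw [smul_mul', hσ]
    linear_combination f * v * h1 - f * S.σ • v * hv
  · linear_combination v ^ 2 * h + X * (t * v + 1) * hv

theorem one_add_r2_isUnit : IsUnit (1 + S.r2) :=
  IsUnit.of_mul_eq_one (S.r2 - 1) (by linear_combination S.r2_sq)

theorem σ_one_add_r2 : S.σ • (1 + S.r2) = 1 + S.r2 := by rw [smul_add, smul_one, S.σ_r2]

variable (S) in
/-- The class `c` contains an ideal whose square is generated by `z` and whose relative norm is
generated by a square root of `(1 + √2) ^ b * N(z)`. -/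
def IsAmbiguous (b : ℕ) (c : ClassGroup (𝓞 K)) : Prop :=
  ∃ (I : Ideal (𝓞 K)) (z f : 𝓞 K), I ≠ ⊥ ∧ idealClass I = c ∧ I ^ 2 = Ideal.span {z} ∧
    I * S.σ • I = Ideal.span {f} ∧ S.σ • f = f ∧ f ^ 2 = (1 + S.r2) ^ b * (z * S.σ • z)

theorem IsAmbiguous.mul {b b' : ℕ} {c c' : ClassGroup (𝓞 K)} (h : S.IsAmbiguous b c)
    (h' : S.IsAmbiguous b' c') : S.IsAmbiguous (b + b') (c * c') := by
  obtain ⟨I, z, f, hI, rfl, hz, hf, hσ, hE⟩ := h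
  obtain ⟨I', z', f', hI', rfl, hz', hf', hσ', hE'⟩ := h'
  refine ⟨I * I', z * z', f * f', mul_ne_zero hI hI', idealClass_mul hI hI', ?_, ?_, ?_, ?_⟩
  · rw [mul_pow, hz, hz', Ideal.span_singleton_mul_span_singleton]
  · rw [smul_mul', ← Ideal.span_singleton_mul_span_singleton, ← hf, ← hf']
    ring
  · rw [smul_mul', hσ, hσ']
  · rw [mul_pow, hE, hE', smul_mul']
    ring

theorem IsAmbiguous.of_add_two_mul {a b : ℕ} {c : ClassGroup (𝓞 K)}
    (h : S.IsAmbiguous (b + 2 * a) c) : S.IsAmbiguous b c := by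
  obtain ⟨I, z, f, hI, hc, hz, hf, hσ, hE⟩ := h
  obtain ⟨f', h1, h2, h3⟩ := exists_of_sq_eq_mul (S := S) (t := (1 + S.r2) ^ a)
    (X := (1 + S.r2) ^ b * (z * S.σ • z)) (one_add_r2_isUnit.pow a)
    (by rw [smul_pow', σ_one_add_r2]) hσ (by rw [hE]; ring)
  exact ⟨I, z, f', hI, hc, hz, hf.trans h1, h2, h3⟩

theorem even_of_sq_eq (hne : p₁ ≠ p₂) (hm₁ : p₁ % 8 = 5)
    {I : Ideal (𝓞 K)} (hcop : (Ideal.absNorm I).Coprime p₁)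
    {z f : 𝓞 K} {l b : ℕ} (hz : I ^ 2 = Ideal.span {z}) (hσ : S.σ • f = f)
    (hE : f ^ 2 = S.ζ ^ l * (1 + S.r2) ^ b * (z * S.σ • z)) : Even l := by
  have hcc := (Nat.coprime_primes hf₁.out hf₂.out).2 hne
  obtain ⟨r, hr⟩ : ∃ r : ZMod p₁, r * r = -1 := by
    obtain ⟨r, hr⟩ := (ZMod.exists_sq_eq_neg_one_iff (p := p₁)).2 (by omega)
    exact ⟨r, hr.symm⟩
  obtain ⟨N, hN⟩ := S.exists_gauss_norm z
  have hNN := (S.isGaussNorm_span hN).mul_star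
  rw [← hz, map_pow] at hNN
  have hN0 := GaussianInt.rootChar_ne_zero hr hNN (hcop.pow_left 2)
  have hN1 := S.rootChar_gauss_norm (by rintro rfl; omega) hcc S.rd_sq hr hN hN0
  obtain ⟨F, hF⟩ := S.exists_gauss (x := f * S.s • f)
    (by rw [smul_mul', hσ, S.smul_smul_comm, hσ]) (by rw [smul_mul', S.smul_smul_self, mul_comm])
  have hF2 : F ^ 2 = (⟨0, -1⟩ : GaussianInt) ^ l * (-1) ^ b * N := by
    apply S.gauss_injective
    have h1 := congrArg (S.s • ·) hE
    simp only [smul_mul', smul_pow', S.s_ζ, smul_add, smul_one, S.s_r2] at h1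
    have hi : S.gauss ⟨0, -1⟩ = -S.im := by rw [S.gauss_apply]; simp
    have h2 : S.ζ * -S.ζ = -S.im := by rw [← S.ζ_sq]; ring
    have h3 : (1 + S.r2) * (1 + -S.r2) = -1 := by linear_combination -S.r2_sq
    rw [map_mul, map_mul, map_pow, map_pow, map_pow, hF, hN, hi, map_neg, map_one, ← h2, ← h3, mul_pow,
      hE, h1, S.smul_smul_comm S.s S.σ, ← mul_smul, mul_pow, mul_pow]
    ring
  have hi : GaussianInt.rootChar hr ⟨0, -1⟩ = -1 := by
    rw [show (⟨0, -1⟩ : GaussianInt) = -1 * ⟨0, 1⟩ by ext <;> simp, map_mul,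
      GaussianInt.rootChar_neg_one, GaussianInt.rootChar_I hr hm₁, one_mul]
  have h4 := congrArg (GaussianInt.rootChar hr) hF2
  rw [map_mul, map_mul, map_pow, map_pow, map_pow, hi, GaussianInt.rootChar_neg_one, hN1, one_pow,
    mul_one, mul_one] at h4
  by_contra hl
  rw [(Nat.not_even_iff_odd.1 hl).neg_one_pow] at h4
  have := sq_nonneg (GaussianInt.rootChar hr F)
  omega

theorem exists_isAmbiguous (U : S.Units) (hne : p₁ ≠ p₂) (hm₁ : p₁ % 8 = 5) (hm₂ : p₂ % 8 = 5)
    {c : ClassGroup (𝓞 K)} (hc : c ^ 2 = 1) : S.IsAmbiguous 0 c ∨ S.IsAmbiguous 1 c := by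
  have hd8 : (p₁ * p₂) % 8 = 1 := by rw [Nat.mul_mod, hm₁, hm₂]
  obtain ⟨I, hI, hcop, rfl⟩ := exists_coprime_rep c hf₁.out.ne_zero
  rw [← idealClass_pow hI, idealClass_eq_one_iff (pow_ne_zero 2 hI)] at hc
  obtain ⟨z, hz⟩ := hc
  obtain ⟨f, hf, hσf⟩ := S.exists_mul_σ_eq I
  have hass : Ideal.span {z * S.σ • z} = Ideal.span {f ^ 2} := by
    rw [← Ideal.span_singleton_mul_span_singleton, ← Ideal.span_singleton_pow, ← hf,
      ← smul_span_singleton, ← hz, mul_pow, smul_pow']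
  obtain ⟨u, hu⟩ := Ideal.span_singleton_eq_span_singleton.1 hass
  have hz0 : z ≠ 0 := by
    rintro rfl
    rw [Ideal.span_singleton_eq_bot.2 rfl] at hz
    exact pow_ne_zero 2 hI hz
  have hσz0 : S.σ • z ≠ 0 := by rwa [Ne, smul_eq_zero_iff_eq]
  have hσu : S.σ • (u : 𝓞 K) = u := by
    apply mul_left_cancel₀ (mul_ne_zero hz0 hσz0)
    have := congrArg (S.σ • ·) hu
    simp only [smul_mul', smul_pow', S.smul_smul_self, hσf] at this
    linear_combination this - hu
  obtain ⟨w, hw, hσw, l, b, hE⟩ := U.exists_of_smul_eq hd8 u.isUnit hσu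
  obtain ⟨f₁, h1, h2, h3⟩ := exists_of_sq_eq_mul (S := S) (X := S.ζ ^ l * (1 + S.r2) ^ b * (z * S.σ • z))
    hw hσw hσf (by rw [← hu, hE]; ring)
  obtain ⟨a, rfl⟩ := even_of_sq_eq hne hm₁ hcop hz h2 h3
  obtain ⟨f₂, h1', h2', h3'⟩ := exists_of_sq_eq_mul (S := S) (X := (1 + S.r2) ^ b * (z * S.σ • z))
    (t := S.ζ ^ a) (S.ζ_isUnit.pow a) (by rw [smul_pow', S.σ_ζ]) h2 (by rw [h3]; ring)
  have key : S.IsAmbiguous b (idealClass I) :=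
    ⟨I, z, f₂, hI, rfl, hz, (hf.trans h1).trans h1', h2', h3'⟩
  rcases Nat.even_or_odd' b with ⟨e, rfl | rfl⟩
  · exact Or.inl (IsAmbiguous.of_add_two_mul (a := e) (by rwa [zero_add]))
  · exact Or.inr (IsAmbiguous.of_add_two_mul (a := e) (by rwa [add_comm]))

theorem exists_eq_one_or_eq_of_isAmbiguous (U : S.Units) (hne : p₁ ≠ p₂) (hm₁ : p₁ % 8 = 5)
    (hm₂ : p₂ % 8 = 5) : ∃ t : ClassGroup (𝓞 K), ∀ c, S.IsAmbiguous 0 c → c = 1 ∨ c = t := by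
  have hcc := (Nat.coprime_primes hf₁.out hf₂.out).2 hne
  have hS' : S.rd ^ 2 = p₂ * p₁ := by rw [S.rd_sq, mul_comm]
  obtain ⟨x₁, hx₁⟩ := exists_mul_star_eq hf₁.out hm₁
  obtain ⟨x₂, hx₂⟩ := exists_mul_star_eq hf₂.out hm₂
  have h3 : S.P x₁ ≠ ⊥ := fun h => S.rd_ne (by simpa [h] using S.rd_mem_P x₁)
  have h4 : S.P x₂ ≠ ⊥ := fun h => S.rd_ne (by simpa [h] using S.rd_mem_P x₂)
  have hs1 : idealClass (S.P x₁) ^ 2 = 1 := by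
    rw [← idealClass_pow h3, S.P_sq hf₁.out hm₁ hcc S.rd_sq hx₁, idealClass_span]
  have hs2 : idealClass (S.P x₂) ^ 2 = 1 := by
    rw [← idealClass_pow h4, S.P_sq hf₂.out hm₂ hcc.symm hS' hx₂, idealClass_span]
  have hrel := idealClass_P_relation U hne hm₁ hm₂ hx₁ hx₂
  have key (c : ClassGroup (𝓞 K)) (hc : S.IsAmbiguous 0 c) :
      ∃ e₁ e₂ : ℕ, c * (idealClass (S.P x₁) ^ e₁ * idealClass (S.P x₂) ^ e₂) = 1 := by
    obtain ⟨I, z, f, hI, rfl, hz, hf, hσ, hE⟩ := hc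
    rw [pow_zero, one_mul] at hE
    obtain ⟨d, hd, -, hdI⟩ := exists_smul_mul_eq (S.invol S.σ) hI hz hf hσ hE
    have hd' : Ideal.span {d} ≠ ⊥ := by rwa [Ne, Ideal.span_singleton_eq_bot]
    have := exists_idealClass_eq_of_smul_eq U hne hm₁ hm₂ hx₁ hx₂ (mul_ne_zero hd' hI) hdI
    rwa [idealClass_mul hd' hI, idealClass_span, one_mul] at this
  generalize idealClass (S.P x₁) = a at *
  generalize idealClass (S.P x₂) = b at *
  have red {a : ClassGroup (𝓞 K)} (h : a ^ 2 = 1) (e : ℕ) : a ^ e = 1 ∨ a ^ e = a := by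
    rcases Nat.even_or_odd' e with ⟨e, rfl | rfl⟩ <;> simp [pow_add, pow_mul, h]
  have inv {a c : ClassGroup (𝓞 K)} (h : a ^ 2 = 1) (h' : c * a = 1) : c = a := by
    rw [eq_inv_of_mul_eq_one_left h', inv_eq_of_mul_eq_one_left (by rwa [← pow_two])]
  rcases hrel with rfl | rfl | hab
  · refine ⟨b, fun c hc => ?_⟩
    obtain ⟨e₁, e₂, h⟩ := key c hc
    rw [one_pow, one_mul] at h
    rcases red hs2 e₂ with h' | h' <;> rw [h'] at h
    · exact Or.inl (by rwa [mul_one] at h)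
    · exact Or.inr (inv hs2 h)
  · refine ⟨a, fun c hc => ?_⟩
    obtain ⟨e₁, e₂, h⟩ := key c hc
    rw [one_pow, mul_one] at h
    rcases red hs1 e₁ with h' | h' <;> rw [h'] at h
    · exact Or.inl (by rwa [mul_one] at h)
    · exact Or.inr (inv hs1 h)
  · refine ⟨a, fun c hc => ?_⟩
    obtain rfl := inv hs2 hab
    obtain ⟨e₁, e₂, h⟩ := key c hc
    rw [← pow_add] at h
    rcases red hs1 (e₁ + e₂) with h' | h' <;> rw [h'] at h
    · exact Or.inl (by rwa [mul_one] at h)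
    · exact Or.inr (inv hs1 h)

theorem card_ker_sq_le_four (U : S.Units) (hne : p₁ ≠ p₂) (hm₁ : p₁ % 8 = 5) (hm₂ : p₂ % 8 = 5) :
    Nat.card (powMonoidHom 2 : ClassGroup (𝓞 K) →* ClassGroup (𝓞 K)).ker ≤ 4 := by
  classical
  obtain ⟨t, ht⟩ := exists_eq_one_or_eq_of_isAmbiguous U hne hm₁ hm₂
  by_cases h : ∃ c₁ : ClassGroup (𝓞 K), c₁ ^ 2 = 1 ∧ S.IsAmbiguous 1 c₁
  · obtain ⟨c₁, hc₁, hA₁⟩ := h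
    refine card_ker_two_le {1, t, c₁, c₁ * t} Finset.card_le_four fun c hc => ?_
    simp only [Finset.mem_insert, Finset.mem_singleton]
    rcases exists_isAmbiguous U hne hm₁ hm₂ hc with h0 | h1
    · rcases ht c h0 with h | h <;> simp [h]
    · have h2 : c = c₁ * (c₁ * c) := by rw [← mul_assoc, ← pow_two, hc₁, one_mul]
      rcases ht _ (IsAmbiguous.of_add_two_mul (a := 1) (hA₁.mul h1)) with h | h <;> rw [h] at h2 <;>
        simp [h2]
  · refine card_ker_two_le {1, t} (Finset.card_le_two.trans (by norm_num)) fun c hc => ?_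
    simp only [Finset.mem_insert, Finset.mem_singleton]
    rcases exists_isAmbiguous U hne hm₁ hm₂ hc with h0 | h1
    · exact ht c h0
    · exact absurd ⟨c, hc, h1⟩ h

end Octic

namespace Octic
variable {p₁ p₂ : ℕ} {K : Type*} [Field K] [NumberField K] {S : Octic p₁ p₂ K}
variable [hf₁ : Fact p₁.Prime] [hf₂ : Fact p₂.Prime]

theorem Units.real_two_torsion (U : S.Units) (hne : p₁ ≠ p₂) (hm₁ : p₁ % 8 = 5) (hm₂ : p₂ % 8 = 5)
    {k : Type*} [Field k] [NumberField k] [Algebra k K] (hk : S.IsReal k)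
    (Q : QuadField (p₁ * p₂) k) :
    ∃ b : ClassGroup (𝓞 k), ∀ c, c ^ 2 = 1 → c = 1 ∨ c = b := by
  have hd8 : (p₁ * p₂) % 8 = 1 := by rw [Nat.mul_mod, hm₁, hm₂]
  obtain ⟨ω, hω⟩ := Q.exists_half (by zify at hd8; omega)
  have inj := algebraMap_ringOfIntegers_injective (k := k) (K := K)
  obtain ⟨v, hv⟩ := U.ed_isUnit.exists_right_inv
  have hfix (g : Gal(K/ℚ)) (hg : g • U.ed = U.ed) : g • v = v := by
    apply U.ed_isUnit.mul_left_cancel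
    nth_rw 1 [← hg]
    rw [← smul_mul', hv, smul_one]
  obtain ⟨η, hη⟩ := hk.exists_of_smul_eq_quad U.J_ed U.s_ed
  obtain ⟨η', hη'⟩ := hk.exists_of_smul_eq_quad (hfix _ U.J_ed) (hfix _ U.s_ed)
  have hu : IsUnit η := IsUnit.of_mul_eq_one η' (inj (by rw [map_mul, hη, hη', hv, map_one]))
  refine Q.real_two_torsion hne rfl hω hu fun w hw => ?_
  have := U.ed_ne (algebraMap _ _ w) (hw.map _) (hk.smul_algebraMap (Or.inr (Or.inl rfl)) w)
    (hk.smul_algebraMap (Or.inr (Or.inr (Or.inl rfl))) w)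
  constructor
  · rintro rfl
    exact this.1 (by rw [← hη, map_pow])
  · rintro rfl
    exact this.2 (by rw [← hη, map_neg, map_pow])

theorem map_two {k : Type*} [Field k] [NumberField k] [Algebra k K] {D : ℤ} (Q : QuadField D k)
    (hD : D % 4 = 3) : Q.two.map (algebraMap (𝓞 k) (𝓞 K)) = Ideal.span {1 + S.im} := by
  apply Ideal.sq_inj
  rw [← Ideal.map_pow, Q.two_sq hD, Ideal.map_span, Set.image_singleton, map_ofNat,
    Ideal.span_singleton_pow, ← Ideal.span_singleton_mul_right_unit S.im_isUnit 2]
  congr 2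
  linear_combination -S.im_sq

theorem structure_sylow (U : S.Units) (hne : p₁ ≠ p₂) (hm₁ : p₁ % 8 = 5) (hm₂ : p₂ % 8 = 5)
    {kd km : Type*} [Field kd] [NumberField kd] [Algebra kd K] [Field km] [NumberField km]
    [Algebra km K] (hkd : S.IsReal kd) (hkm : S.IsImag km) {n m : ℕ} (hn : 1 ≤ n) (hm : 2 ≤ m)
    (hhp : ∀ Q : Sylow 2 (ClassGroup (𝓞 kd)), Nat.card Q = 2 ^ n)
    (hhm : ∀ Q : Sylow 2 (ClassGroup (𝓞 km)), Nat.card Q = 2 ^ (m + 1))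
    (P : Sylow 2 (ClassGroup (𝓞 K))) :
    Nonempty (Additive P ≃+ (ZMod (2 ^ m) × ZMod (2 ^ (n + 1)))) := by
  have hd8 : (p₁ * p₂) % 8 = 1 := by rw [Nat.mul_mod, hm₁, hm₂]
  have hcop := (Nat.coprime_primes hf₁.out hf₂.out).2 hne
  have hcop' : IsCoprime (p₁ : ℤ) p₂ := Nat.isCoprime_iff_coprime.2 hcop
  obtain ⟨Qd, hQd, hτd⟩ := S.exists_quadField_real hkd
  obtain ⟨Qm, hQm, hτm⟩ := S.exists_quadField_imag hkm
  have hDm : (-(p₁ * p₂) : ℤ) = p₁ * (-p₂) := by ring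
  have hmod : (-(p₁ * p₂) : ℤ) % 8 = 7 := QuadField.imag_mod hm₁ hm₂ rfl
  obtain ⟨jd, hjd⟩ := exists_mapHom kd K
  obtain ⟨jm, hjm⟩ := exists_mapHom km K
  obtain ⟨Nd, hNd⟩ := exists_relNormHom kd K
  obtain ⟨Nm, hNm⟩ := exists_relNormHom km K
  obtain ⟨χ, hχ⟩ := Qd.exists_primeChar (Qd.odd_squarefree hne (Or.inl rfl)) (p := p₁) (by omega)
    (Dvd.intro _ rfl)
  obtain ⟨χp, hχp⟩ := Qm.exists_primeChar (Qm.odd_squarefree hne (Or.inr rfl)) (p := p₁) (by omega)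
    (hDm ▸ Dvd.intro _ rfl)
  obtain ⟨χ4, hχ4⟩ := Qm.exists_fourChar hne hm₁ hm₂ rfl
  have hφ₁ (I : Ideal (𝓞 K)) (hI : I ≠ ⊥) (hc : (Ideal.absNorm I).Coprime p₁) :
      (χ.comp Nd) (idealClass I) = quadraticChar (ZMod p₁) (Ideal.absNorm I : ℕ) := by
    rw [MonoidHom.comp_apply, hNd _ hI, hχ _ (relNorm_ne_bot hI) (by rwa [absNorm_relNorm']),
      absNorm_relNorm']
  obtain ⟨r₁, hr₁⟩ : ∃ r : ZMod p₁, r * r = -1 := by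
    obtain ⟨r, hr⟩ := (ZMod.exists_sq_eq_neg_one_iff (p := p₁)).2 (by omega)
    exact ⟨r, hr.symm⟩
  obtain ⟨r₂, hr₂⟩ : ∃ r : ZMod p₂, r * r = -1 := by
    obtain ⟨r, hr⟩ := (ZMod.exists_sq_eq_neg_one_iff (p := p₂)).2 (by omega)
    exact ⟨r, hr.symm⟩
  obtain ⟨φ₃, hφ₃⟩ := S.exists_gaussChar hr₁ hr₂ hne hm₁ hm₂
  obtain ⟨l, hl, hl8, hl1, hl2, hχ1, hχ2⟩ := exists_prime_quadraticChar hne hm₁ hm₂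
  have : Fact l.Prime := ⟨hl⟩
  have hsq := isSquare_neg_mul hm₁ hm₂ hl8 hχ1 hχ2
  have hlp : l.Coprime (p₁ * p₂) := Nat.Coprime.mul_right ((Nat.coprime_primes hl hf₁.out).2 hl1.symm)
    ((Nat.coprime_primes hl hf₂.out).2 hl2.symm)
  obtain ⟨A, hA0, hJA, hA2⟩ := S.exists_absNorm_eq_two hd8
  obtain ⟨L, hL0, hLN, hLg⟩ := S.exists_isGaussNorm_natCast hl8 hl1 hl2 hsq
  have hNdvd : ¬ (l : ℤ) ∣ -(p₁ * p₂) := by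
    rw [dvd_neg]
    intro h
    exact hl.one_lt.ne' (Nat.Coprime.eq_one_of_dvd hlp (by exact_mod_cast h))
  obtain ⟨c, hc, hlc⟩ := exists_sq_sub_of_isSquare (l := l) (D := -(p₁ * p₂)) (by omega)
    (by push_cast; exact hsq) hNdvd
  obtain ⟨W, hW⟩ := Qm.exists_absNorm_eq hc hlc
  have hW0 : W ≠ ⊥ := by
    rintro rfl
    rw [Ideal.absNorm_bot] at hW
    exact hl.ne_zero hW.symm
  obtain ⟨b₀, hb₀⟩ := U.real_two_torsion hne hm₁ hm₂ hkd Qd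
  have h1 : Ideal.absNorm Qm.two = 2 := Qm.absNorm_of_sq (p := 2) (by
    rw [Qm.two_sq (by omega)]; norm_num)
  have ht0 : Qm.two ≠ ⊥ := Qm.two_ne_bot hne hm₁ hm₂ rfl
  have hr0 := Qm.ram_ne_bot hf₁.out.ne_zero
  have hrN := Qm.absNorm_ram hDm hcop'.neg_right
  have hq2 : idealClass Qm.two ^ 2 = 1 := by
    rw [← idealClass_pow ht0, Qm.two_sq (by omega), idealClass_span]
  have hr2 : idealClass (Qm.ram p₁) ^ 2 = 1 := by
    rw [← idealClass_pow hr0, Qm.ram_sq hDm hcop'.neg_right, idealClass_span]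
  have hjq : Qm.two.map (algebraMap (𝓞 km) (𝓞 K)) = Ideal.span {1 + S.im} :=
    map_two Qm (by omega)
  have hjr : (Qm.ram p₁).map (algebraMap (𝓞 km) (𝓞 K)) = S.B p₁ := S.map_ram Qm (Or.inr hQm) p₁
  obtain ⟨g, hJg, hg⟩ := U.exists_B_eq hne hm₁ hm₂
  have hJσ1 : S.J * S.σ ≠ 1 := S.J_mul_ne S.σ_im S.one_im
  have hJσs : S.J * S.σ ≠ S.s := S.J_mul_ne S.σ_im S.s_im
  have h2p : Nat.Coprime 2 p₁ := (Nat.coprime_primes Nat.prime_two hf₁.out).2 (by rintro rfl; omega)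
  refine sylow_two_structure hn hm (card_ker_sq_le_four U hne hm₁ hm₂) (χ.comp Nd) φ₃
    (u := idealClass A) (v := idealClass L) ?_ ?_ ?_ jd jm Nd Nm
    (fun c => normChar_map_eq_one hkd S.J_ne_one S.s_ne_one S.J_ne_s hφ₁ hjd c)
    (fun c => S.gaussChar_map_eq_one hkd S.J_ne_one S.s_ne_one S.J_ne_s (Or.inr (Or.inr (Or.inl rfl)))
      Qd hτd hr₁ hr₂ hφ₃ hjd c)
    (fun c => normChar_map_eq_one hkm hJσ1 S.s_ne_one hJσs hφ₁ hjm c)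
    (fun c => S.gaussChar_map_eq_one hkm hJσ1 S.s_ne_one hJσs (Or.inr (Or.inr (Or.inl rfl)))
      Qm hτm hr₁ hr₂ hφ₃ hjm c)
    (fun a t ha => pow_four_eq U hne hm₁ hm₂ hkd hkm hjd hjm hNd hNm ha)
    (mapHom_real_eq_one_iff U hne hm₁ hm₂ hkd hjd) hhp hb₀ χ (fun _ => rfl) hhm hq2 hr2
    (fun c hc => Qm.imag_two_torsion hne hm₁ hm₂ rfl hc) ?_ ?_ χp χ4 ?_ ?_
    (w := idealClass W) ?_ ?_ S.conjSubgroup (mapHom_mem_conjSubgroup hkd hjd) ?_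
    ⟨A, hA0, hJA, rfl⟩ ?_ P
  · rw [hφ₁ _ hA0 (by rwa [hA2]), hA2, quadraticChar_two_eq hm₁]
  · rw [hφ₁ _ hL0 (by rw [hLN]; exact (hlp.coprime_mul_right_right).pow_left 2), hLN, Nat.cast_pow, map_pow,
      hχ1, one_pow]
  · rw [hφ₃ _ hL0 (by rw [hLN]; exact hlp.pow_left 2) _ hLg, GaussianInt.biChar_apply,
      GaussianInt.rootChar_natCast, GaussianInt.rootChar_natCast, hχ1, hχ2, one_mul]
  · rw [hjm _ ht0, hjq, idealClass_span]
  · rw [hjm _ hr0, hjr, ← hg, idealClass_span]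
  · rw [hχp _ ht0 (by rwa [h1]), h1, quadraticChar_two_eq hm₁]
  · exact Qm.fourChar_two hne hm₁ hm₂ rfl hχ4
  · have hl4 : l.Coprime 4 := by
      rw [Nat.coprime_comm, show 4 = 2 ^ 2 by norm_num]
      exact Nat.Coprime.pow_left 2 ((Nat.coprime_primes Nat.prime_two hl).2 (by omega))
    rw [hχ4 _ hW0 (by rwa [hW]), hW, ZMod.χ₄_nat_three_mod_four (by omega)]
  · intro a
    obtain ⟨I, hI, hc, rfl⟩ := exists_coprime_rep a four_ne_zero
    rw [hNm _ hI, hχ4 _ (relNorm_ne_bot hI) (by rwa [absNorm_relNorm']), absNorm_relNorm',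
      S.χ₄_absNorm hc]
  · rintro c (hc | hc)
    · exact mapHom_notMem_conjSubgroup hne hm₁ hm₂ hkm Qm hτm hjm hr0 (n := 1) (g := g) one_ne_zero
        (hjr.trans hg.symm) (by rw [hJg, Nat.cast_one]; ring) (by rw [hrN, one_mul]) hr2 hc
    · rw [← idealClass_mul ht0 hr0] at hc
      refine mapHom_notMem_conjSubgroup hne hm₁ hm₂ hkm Qm hτm hjm (mul_ne_zero ht0 hr0)
        (n := 2) (g := g) (ρ := (1 + S.im) * g) two_ne_zero ?_ ?_ ?_ ?_ hc
      · rw [Ideal.map_mul, hjq, hjr, ← hg, Ideal.span_singleton_mul_span_singleton]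
      · rw [smul_mul', hJg, smul_add, smul_one, S.J_im, Nat.cast_ofNat]
        linear_combination -g ^ 2 * S.im_sq
      · rw [map_mul, h1, hrN]
      · rw [idealClass_mul ht0 hr0, mul_pow, hq2, hr2, one_mul]
  · rintro a ⟨I, hI, hJI, rfl⟩ ha
    rw [← idealClass_pow hI, idealClass_eq_one_iff (pow_ne_zero 2 hI)] at ha
    obtain ⟨x, hx⟩ := ha
    obtain ⟨y, hy⟩ := relNorm_eq_span_of_sq_eq hd8 hkd hI hJI hx
    rw [MonoidHom.comp_apply, hNd _ hI, hy, idealClass_span, map_one]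

end Octic

theorem exists_half_of_sq {K : Type*} [Field K] [NumberField K] {r : 𝓞 K} {D : ℤ} (hr : r ^ 2 = D)
    {x y e : ℤ} (h : x ^ 2 - D * y ^ 2 = 4 * e) : ∃ E : 𝓞 K, 2 * E = x + y * r := by
  have hr' : (r : K) ^ 2 = D := by simpa using congrArg (algebraMap (𝓞 K) K) hr
  have h' : (x : K) ^ 2 - D * y ^ 2 = 4 * e := by exact_mod_cast h
  have hint : IsIntegral ℤ ((x + y * (r : K)) / 2) := by
    refine ⟨Polynomial.X ^ 2 - Polynomial.C x * Polynomial.X + Polynomial.C e, by monicity!, ?_⟩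
    simp only [Polynomial.eval₂_add, Polynomial.eval₂_sub, Polynomial.eval₂_mul, Polynomial.eval₂_pow,
      Polynomial.eval₂_X, Polynomial.eval₂_C]
    simp only [eq_intCast]
    linear_combination (y ^ 2 / 4 : K) * hr' - (1 / 4 : K) * h'
  obtain ⟨z, hz⟩ := (IsIntegralClosure.isIntegral_iff (A := 𝓞 K)).1 hint
  refine ⟨z, RingOfIntegers.ext ?_⟩
  change algebraMap (𝓞 K) K _ = algebraMap (𝓞 K) K _
  rw [map_mul, hz, map_ofNat, map_add, map_mul, map_intCast, map_intCast]
  ring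

namespace Octic
variable {p₁ p₂ : ℕ} {K : Type*} [Field K] [NumberField K] (S : Octic p₁ p₂ K)
include S

theorem exists_coords_of_isUnit {r : 𝓞 K} {D : ℤ} (hr : r ^ 2 = D) (hD : Squarefree D)
    {g₁ g₂ τ : Gal(K/ℚ)} (hτ : τ • r = -r) (h₁ : g₁ • r = r) (h₂ : g₂ • r = r)
    (hint : ∀ x : 𝓞 K, g₁ • x = x → g₂ • x = x → τ • x = x → ∃ n : ℤ, (n : 𝓞 K) = x)
    {u : 𝓞 K} (hu : IsUnit u) (hu₁ : g₁ • u = u) (hu₂ : g₂ • u = u) :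
    ∃ x y : ℤ, 2 * u = x + y * r ∧ (x ^ 2 - D * y ^ 2 = 4 ∨ x ^ 2 - D * y ^ 2 = -4) := by
  have hr0 : r ≠ 0 := by
    rintro rfl
    rw [zero_pow two_ne_zero, eq_comm, Int.cast_eq_zero] at hr
    exact hD.ne_zero hr
  have hττ (x : 𝓞 K) : τ • τ • x = x := S.smul_smul_self τ x
  have hc (g : Gal(K/ℚ)) (hg : g • u = u) : g • τ • u = τ • u := by
    rw [S.smul_smul_comm, hg]
  obtain ⟨a, ha⟩ := hint (u + τ • u) (by rw [smul_add, hu₁, hc _ hu₁])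
    (by rw [smul_add, hu₂, hc _ hu₂]) (by rw [smul_add, hττ, add_comm])
  obtain ⟨N, hN⟩ := hint (u * τ • u) (by rw [smul_mul', hu₁, hc _ hu₁])
    (by rw [smul_mul', hu₂, hc _ hu₂]) (by rw [smul_mul', hττ, mul_comm])
  obtain ⟨w, hw⟩ := hint ((u - τ • u) * r) (by rw [smul_mul', smul_sub, hu₁, hc _ hu₁, h₁])
    (by rw [smul_mul', smul_sub, hu₂, hc _ hu₂, h₂])
    (by rw [smul_mul', smul_sub, hττ, hτ]; ring)
  have h1 : w ^ 2 = D * (a ^ 2 - 4 * N) := by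
    have : ((w ^ 2 : ℤ) : 𝓞 K) = ((D * (a ^ 2 - 4 * N) : ℤ) : 𝓞 K) := by
      push_cast
      rw [hw, ha, hN, ← hr]
      ring
    exact_mod_cast this
  obtain ⟨b, rfl⟩ := (hD.dvd_pow_iff_dvd two_ne_zero).1 ⟨_, h1⟩
  have hNu : N = 1 ∨ N = -1 := by
    have h3 : IsUnit ((N : ℤ) : 𝓞 K) := hN ▸ hu.mul (hu.map (MulSemiringAction.toRingHom Gal(K/ℚ) (𝓞 K) τ))
    have h4 := h3.map (Algebra.norm ℤ)
    rw [← eq_intCast (algebraMap ℤ (𝓞 K)), Algebra.norm_algebraMap] at h4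
    exact Int.isUnit_iff.1 ((isUnit_pow_iff (Module.finrank_pos (R := ℤ) (M := 𝓞 K)).ne').1 h4)
  have h2 : a ^ 2 - D * b ^ 2 = 4 * N := by
    apply mul_left_cancel₀ hD.ne_zero
    linear_combination -h1
  refine ⟨a, b, ?_, ?_⟩
  · apply mul_right_cancel₀ hr0
    have h3 : ((D * b : ℤ) : 𝓞 K) = b * r * r := by
      push_cast; rw [← hr]; ring
    rw [h3] at hw
    rw [add_mul, hw, ha]
    ring
  · rcases hNu with rfl | rfl
    · exact Or.inl h2
    · exact Or.inr h2

theorem exists_fundUnit {r : 𝓞 K} {D : ℕ} (hr : r ^ 2 = D) (hD : Squarefree (D : ℤ))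
    {g₁ g₂ τ : Gal(K/ℚ)} (hτ : τ • r = -r) (h₁ : g₁ • r = r) (h₂ : g₂ • r = r)
    (hint : ∀ x : 𝓞 K, g₁ • x = x → g₂ • x = x → τ • x = x → ∃ n : ℤ, (n : 𝓞 K) = x)
    {φ : K →+* ℂ} (hφ : φ r = (Real.sqrt D : ℝ)) {ε : ℝ} (hε : IsFundUnit D ε) :
    ∃ E : 𝓞 K, IsUnit E ∧ g₁ • E = E ∧ g₂ • E = E ∧ φ E = ε ∧
      ∀ u : 𝓞 K, IsUnit u → g₁ • u = u → g₂ • u = u → ∃ y : ℝ, φ u = y ∧ (1 < y → ε ≤ y) := by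
  obtain ⟨-, ⟨x, y, hxy, hN⟩, hmin⟩ := hε
  have hr' : r ^ 2 = ((D : ℤ) : 𝓞 K) := by rw [hr, Int.cast_natCast]
  have hval {u : 𝓞 K} {a b : ℤ} (h : 2 * u = a + b * r) :
      φ u = (((a : ℝ) + (b : ℝ) * Real.sqrt D) / 2 : ℝ) := by
    have := congrArg (fun z : 𝓞 K => φ (algebraMap (𝓞 K) K z)) h
    simp only [map_mul, map_add, map_ofNat, map_intCast] at this
    rw [hφ] at this
    push_cast
    linear_combination this / 2
  have hN' : ∃ e : ℤ, x ^ 2 - D * y ^ 2 = 4 * e ∧ e * e = 1 := by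
    rcases hN with h | h
    · exact ⟨1, h, rfl⟩
    · exact ⟨-1, by rw [h]; rfl, rfl⟩
  obtain ⟨e, he, hee⟩ := hN'
  obtain ⟨E, hE⟩ := exists_half_of_sq hr' he
  have hne : (2 : 𝓞 K) ≠ 0 := two_ne_zero
  have hfix {g : Gal(K/ℚ)} (hg : g • r = r) : g • E = E := by
    apply mul_left_cancel₀ hne
    have := congrArg (g • ·) hE
    simp only [smul_mul', smul_add, S.smul_two, S.smul_intCast, hg] at this
    rw [this, hE]
  have hτE : 2 * τ • E = x - y * r := by
    have := congrArg (τ • ·) hE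
    simp only [smul_mul', smul_add, S.smul_two, S.smul_intCast, hτ] at this
    rw [this]
    ring
  refine ⟨E, IsUnit.of_mul_eq_one (τ • E * e) ?_, hfix h₁, hfix h₂, ?_, fun u hu hu₁ hu₂ => ?_⟩
  · apply mul_left_cancel₀ (mul_ne_zero hne hne)
    have he' : (x : 𝓞 K) ^ 2 - D * y ^ 2 = 4 * e := by exact_mod_cast congrArg (Int.cast : ℤ → 𝓞 K) he
    have hee' : (e : 𝓞 K) * e = 1 := by exact_mod_cast congrArg (Int.cast : ℤ → 𝓞 K) hee
    linear_combination (2 * τ • E * e : 𝓞 K) * hE + ((x + y * r) * e : 𝓞 K) * hτE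
      + (-e * y ^ 2 : 𝓞 K) * hr + (e : 𝓞 K) * he' + 4 * hee'
  · rw [hval hE, hxy]
  · obtain ⟨a, b, hab, h⟩ := S.exists_coords_of_isUnit hr' hD hτ h₁ h₂ hint hu hu₁ hu₂
    exact ⟨_, hval hab, hmin a b h⟩

end Octic

namespace Octic
variable {p₁ p₂ : ℕ} {K : Type*} [Field K] [NumberField K] (S : Octic p₁ p₂ K)
include S

theorem exists_rat_coords {g₁ g₂ τ : Gal(K/ℚ)} {r : K} {D : ℚ} (hr : r ^ 2 = algebraMap ℚ K D)
    (hr0 : r ≠ 0) (hτ : τ r = -r) (h₁ : g₁ r = r) (h₂ : g₂ r = r)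
    (hfix : ∀ x : K, g₁ x = x → g₂ x = x → τ x = x → x ∈ Set.range (algebraMap ℚ K))
    {x : K} (hx₁ : g₁ x = x) (hx₂ : g₂ x = x) :
    ∃ a b : ℚ, x = algebraMap ℚ K a + algebraMap ℚ K b * r := by
  have hττ (x : K) : τ (τ x) = x := S.smul_smul_self τ x
  have hc (g : Gal(K/ℚ)) (hg : g x = x) : g (τ x) = τ x := by
    rw [show g (τ x) = τ (g x) from S.smul_smul_comm g τ x, hg]
  obtain ⟨a, ha⟩ := hfix (x + τ x) (by rw [map_add, hx₁, hc _ hx₁])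
    (by rw [map_add, hx₂, hc _ hx₂]) (by rw [map_add, hττ, add_comm])
  obtain ⟨b, hb⟩ := hfix ((x - τ x) * r) (by rw [map_mul, map_sub, hx₁, hc _ hx₁, h₁])
    (by rw [map_mul, map_sub, hx₂, hc _ hx₂, h₂]) (by rw [map_mul, map_sub, hττ, hτ]; ring)
  have hD : algebraMap ℚ K D ≠ 0 := hr ▸ pow_ne_zero 2 hr0
  refine ⟨a / 2, b / (2 * D), ?_⟩
  rw [map_div₀, map_div₀, map_mul, ha, hb, map_ofNat, ← hr]
  field_simp
  ring

variable [hf₁ : Fact p₁.Prime] [hf₂ : Fact p₂.Prime]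

theorem exists_coords_real {x : K} (hJ : S.J x = x) (hs : S.s x = x) :
    ∃ a b : ℚ, x = algebraMap ℚ K a + algebraMap ℚ K b * S.rd := by
  refine S.exists_rat_coords (τ := S.σ) (D := p₁ * p₂) ?_ (fun h => S.rd_ne (RingOfIntegers.ext h))
    (congrArg (algebraMap (𝓞 K) K) S.σ_rd) (congrArg (algebraMap (𝓞 K) K) S.J_rd)
    (congrArg (algebraMap (𝓞 K) K) S.s_rd) (fun x h h' h'' => S.fix x h'' h h') hJ hs
  simpa using congrArg (algebraMap (𝓞 K) K) S.rd_sq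

theorem exists_coords_imag {x : K} (hJ : S.J (S.σ x) = x) (hs : S.s x = x) :
    ∃ a b : ℚ, x = algebraMap ℚ K a + algebraMap ℚ K b * (S.rd * S.im) := by
  have h1 : S.J • (S.rd * S.im) = -(S.rd * S.im) := by rw [smul_mul', S.J_rd, S.J_im]; ring
  have h2 : S.σ • (S.rd * S.im) = -(S.rd * S.im) := by rw [smul_mul', S.σ_rd, S.σ_im]; ring
  have h3 : S.s • (S.rd * S.im) = S.rd * S.im := by rw [smul_mul', S.s_rd, S.s_im]
  have h4 : (S.J * S.σ) • (S.rd * S.im) = S.rd * S.im := by rw [mul_smul, h2, smul_neg, h1, neg_neg]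
  have := S.exists_rat_coords (g₁ := S.J * S.σ) (r := ((S.rd * S.im : 𝓞 K) : K)) (τ := S.σ) (D := -(p₁ * p₂)) ?_
    (fun h => mul_ne_zero S.rd_ne S.im_ne (RingOfIntegers.ext h))
    (congrArg (algebraMap (𝓞 K) K) h2) (congrArg (algebraMap (𝓞 K) K) h4)
    (congrArg (algebraMap (𝓞 K) K) h3) (fun x h h' h'' => S.fix x h'' ?_ h') hJ hs
  · simpa using this
  · have h5 : (S.rd * S.im) ^ 2 = -(p₁ * p₂) := by
      linear_combination S.im ^ 2 * S.rd_sq + (p₁ * p₂ : 𝓞 K) * S.im_sq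
    simpa using congrArg (algebraMap (𝓞 K) K) h5
  · rwa [AlgEquiv.mul_apply, h''] at h

theorem exists_coords_plus {x : K} (hJ : S.J x = x) : ∃ a b c d : ℚ,
    x = algebraMap ℚ K a + algebraMap ℚ K b * S.rd
      + (algebraMap ℚ K c + algebraMap ℚ K d * S.rd) * S.r2 := by
  have hc : S.J (S.s x) = S.s x := by
    rw [show S.J (S.s x) = S.s (S.J x) from S.smul_smul_comm S.J S.s x, hJ]
  have hss : S.s (S.s x) = x := S.smul_smul_self S.s x
  have h1 : S.J (S.r2 : K) = S.r2 := congrArg (algebraMap (𝓞 K) K) S.J_r2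
  have h2 : S.s (S.r2 : K) = -S.r2 := congrArg (algebraMap (𝓞 K) K) S.s_r2
  have h3 : (S.r2 : K) ^ 2 = 2 := congrArg (algebraMap (𝓞 K) K) S.r2_sq
  obtain ⟨a, b, hab⟩ := S.exists_coords_real (x := x + S.s x) (by rw [map_add, hJ, hc])
    (by rw [map_add, hss, add_comm])
  obtain ⟨c, d, hcd⟩ := S.exists_coords_real (x := (x - S.s x) * S.r2)
    (by rw [map_mul, map_sub, hJ, hc, h1]) (by rw [map_mul, map_sub, hss, h2]; ring)
  refine ⟨a / 2, b / 2, c / 4, d / 4, ?_⟩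
  simp only [map_div₀, map_ofNat]
  linear_combination (1 / 2 : K) * hab + (S.r2 / 4 : K) * hcd - ((x - S.s x) / 4) * h3

variable {S}

omit S in
theorem ne_sq_of_isLeast {φ : K →+* ℂ} {ε : ℝ} (hε : 1 < ε) {E : 𝓞 K} (hE : φ E = ε)
    {g₁ g₂ : Gal(K/ℚ)} (hmin : ∀ u : 𝓞 K, IsUnit u → g₁ • u = u → g₂ • u = u →
      ∃ y : ℝ, φ u = y ∧ (1 < y → ε ≤ y))
    (v : 𝓞 K) (hv : IsUnit v) (h₁ : g₁ • v = v) (h₂ : g₂ • v = v) : E ≠ v ^ 2 ∧ E ≠ -v ^ 2 := by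
  obtain ⟨y, hy, hy'⟩ := hmin v hv h₁ h₂
  obtain ⟨z, hz, hz'⟩ := hmin (-v) hv.neg (by rw [smul_neg, h₁]) (by rw [smul_neg, h₂])
  have hzy : z = -y := by
    have h : -φ v = z := (map_neg (φ.comp (algebraMap (𝓞 K) K)) v).symm.trans hz
    rw [hy] at h
    exact_mod_cast h.symm
  subst hzy
  constructor
  · rintro rfl
    have h : φ v ^ 2 = ε := (map_pow (φ.comp (algebraMap (𝓞 K) K)) v 2).symm.trans hE
    rw [hy] at h
    replace h : y ^ 2 = ε := by exact_mod_cast h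
    rcases le_total 0 y with h0 | h0
    · have h1 : 1 < y := by nlinarith
      nlinarith [hy' h1]
    · have h1 : 1 < -y := by nlinarith
      nlinarith [hz' h1]
  · rintro rfl
    have h : -φ v ^ 2 = ε := by
      rw [← hE, ← map_pow, ← map_neg, ← map_pow, ← map_neg]
    rw [hy] at h
    replace h : -y ^ 2 = ε := by exact_mod_cast h
    nlinarith [sq_nonneg y]

omit S in
theorem exists_eq_sq_of_isLeast {φ : K →+* ℂ} {ε : ℝ} (hε : 1 < ε) {E : 𝓞 K} (hEu : IsUnit E)
    (hE : φ E = ε) {g₁ g₂ : Gal(K/ℚ)} (hE₁ : g₁ • E = E) (hE₂ : g₂ • E = E)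
    (hmin : ∀ u : 𝓞 K, IsUnit u → g₁ • u = u → g₂ • u = u → ∃ y : ℝ, φ u = y ∧ (1 < y → ε ≤ y))
    {u : 𝓞 K} (hu : IsUnit u) (hu₁ : g₁ • u = u) (hu₂ : g₂ • u = u) :
    ∃ w : 𝓞 K, IsUnit w ∧ g₁ • w = w ∧ g₂ • w = w ∧
      (u = w ^ 2 ∨ u = -w ^ 2 ∨ u = E * w ^ 2 ∨ u = -(E * w ^ 2)) := by
  obtain ⟨e, rfl⟩ := hEu
  have hfix (g : Gal(K/ℚ)) {a : (𝓞 K)ˣ} (ha : g • (a : 𝓞 K) = a) (l : ℤ) :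
      g • ((a ^ l : (𝓞 K)ˣ) : 𝓞 K) = (a ^ l : (𝓞 K)ˣ) := by
    have h1 : Units.map (MulSemiringAction.toRingHom Gal(K/ℚ) (𝓞 K) g : 𝓞 K →* 𝓞 K) a = a :=
      Units.ext ha
    have h2 := congrArg (· ^ l) h1
    simp only [← map_zpow] at h2
    exact congrArg Units.val h2
  have hφ (l : ℤ) : φ ((e ^ l : (𝓞 K)ˣ) : 𝓞 K) = ((ε ^ l : ℝ) : ℂ) := by
    have h1 := congrArg Units.val
      (map_zpow (Units.map ((φ.comp (algebraMap (𝓞 K) K) : 𝓞 K →+* ℂ) : 𝓞 K →* ℂ)) e l)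
    rw [Units.val_zpow_eq_zpow_val] at h1
    rw [Complex.ofReal_zpow, ← hE]
    exact h1
  have hε0 : 0 < ε := by linarith
  -- positive units are powers of `E`
  have key : ∀ v : (𝓞 K)ˣ, g₁ • (v : 𝓞 K) = v → g₂ • (v : 𝓞 K) = v → ∀ y : ℝ, 0 < y →
      φ (v : 𝓞 K) = y → ∃ l : ℤ, v = e ^ l := by
    intro v hv₁ hv₂ y hy hvy
    obtain ⟨l, hl⟩ := exists_mem_Ico_zpow hy hε
    refine ⟨l, ?_⟩
    obtain ⟨z, hz, hz'⟩ := hmin (v * (e ^ (-l) : (𝓞 K)ˣ) : 𝓞 K) (v.isUnit.mul (Units.isUnit _))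
      (by rw [smul_mul', hv₁, hfix _ hE₁]) (by rw [smul_mul', hv₂, hfix _ hE₂])
    have hzy : z = y * ε ^ (-l) := by
      have h : φ (v : 𝓞 K) * φ ((e ^ (-l) : (𝓞 K)ˣ) : 𝓞 K) = z :=
        (map_mul (φ.comp (algebraMap (𝓞 K) K)) _ _).symm.trans hz
      rw [hvy, hφ] at h
      exact_mod_cast h.symm
    have hp : 0 < ε ^ l := zpow_pos hε0 l
    rw [zpow_neg, ← div_eq_mul_inv] at hzy
    have h1 : 1 ≤ z := by rw [hzy, le_div_iff₀ hp, one_mul]; exact hl.1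
    have h2 : z < ε := by
      rw [hzy, div_lt_iff₀ hp, mul_comm, ← zpow_add_one₀ hε0.ne']; exact hl.2
    have h3 : z = 1 := by
      rcases h1.eq_or_lt with h | h
      · exact h.symm
      · exact absurd (hz' h) (not_le.2 h2)
    have h4 : (v * (e ^ (-l) : (𝓞 K)ˣ) : 𝓞 K) = 1 := by
      apply RingOfIntegers.ext
      apply φ.injective
      rw [hz, h3, Complex.ofReal_one]
      exact (map_one (φ.comp (algebraMap (𝓞 K) K))).symm
    rw [zpow_neg] at h4
    exact mul_inv_eq_one.1 (Units.ext h4)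
  have fin : ∀ v : (𝓞 K)ˣ, (∃ l : ℤ, v = e ^ l) → ∃ w : 𝓞 K, IsUnit w ∧ g₁ • w = w ∧ g₂ • w = w ∧
      ((v : 𝓞 K) = w ^ 2 ∨ (v : 𝓞 K) = e * w ^ 2) := by
    rintro v ⟨l, rfl⟩
    rcases Int.even_or_odd' l with ⟨k, rfl | rfl⟩
    · refine ⟨(e ^ k : (𝓞 K)ˣ), Units.isUnit _, hfix _ hE₁ k, hfix _ hE₂ k, Or.inl ?_⟩
      rw [← Units.val_pow_eq_pow_val, ← zpow_natCast, ← zpow_mul, mul_comm]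
      rfl
    · refine ⟨(e ^ k : (𝓞 K)ˣ), Units.isUnit _, hfix _ hE₁ k, hfix _ hE₂ k, Or.inr ?_⟩
      rw [← Units.val_pow_eq_pow_val, ← Units.val_mul, ← zpow_natCast, ← zpow_mul, ← zpow_one_add]
      congr 2
      push_cast
      ring
  obtain ⟨y, hy, -⟩ := hmin u hu hu₁ hu₂
  obtain ⟨v, rfl⟩ := hu
  have hy0 : y ≠ 0 := by
    rintro rfl
    rw [Complex.ofReal_zero, map_eq_zero] at hy
    exact v.ne_zero (RingOfIntegers.ext hy)
  rcases lt_or_gt_of_ne hy0 with h0 | h0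
  · obtain ⟨w, hw, h1, h2, h3⟩ := fin (-v) (key (-v) (by rw [Units.val_neg, smul_neg, hu₁])
      (by rw [Units.val_neg, smul_neg, hu₂]) (-y) (by linarith)
      (by
        rw [Complex.ofReal_neg, ← hy]
        exact map_neg (φ.comp (algebraMap (𝓞 K) K)) _))
    rw [Units.val_neg, neg_eq_iff_eq_neg, neg_eq_iff_eq_neg] at h3
    exact ⟨w, hw, h1, h2, by tauto⟩
  · obtain ⟨w, hw, h1, h2, h3⟩ := fin v (key v hu₁ hu₂ y h0 hy)
    exact ⟨w, hw, h1, h2, by tauto⟩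

end Octic

theorem IsFundUnit.two_eq {ε : ℝ} (h : IsFundUnit 2 ε) : ε = 1 + Real.sqrt 2 := by
  obtain ⟨h1, ⟨x, y, rfl, hN⟩, hmin⟩ := h
  have h2 := hmin 2 2 (Or.inr (by norm_num)) (by
    push_cast
    have : 0 < Real.sqrt 2 := by positivity
    linarith)
  push_cast at h2 h1 ⊢
  set r := Real.sqrt 2
  have hr : r ^ 2 = 2 := Real.sq_sqrt zero_le_two
  have hr1 : 1 < r := by rw [Real.lt_sqrt] <;> norm_num
  obtain ⟨e, he⟩ : ∃ e : ℝ, ((x : ℝ) + y * r) / 2 * (((x : ℝ) - y * r) / 2) = e ∧ (e = 1 ∨ e = -1) := by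
    rcases hN with h | h
    · refine ⟨1, ?_, Or.inl rfl⟩
      have : (x : ℝ) ^ 2 - 2 * y ^ 2 = 4 := by exact_mod_cast h
      linear_combination this / 4 - (y ^ 2 / 4 : ℝ) * hr
    · refine ⟨-1, ?_, Or.inr rfl⟩
      have : (x : ℝ) ^ 2 - 2 * y ^ 2 = -4 := by exact_mod_cast h
      linear_combination this / 4 - (y ^ 2 / 4 : ℝ) * hr
  set u := ((x : ℝ) + y * r) / 2 with hu
  set v := ((x : ℝ) - y * r) / 2 with hv
  have hv1 : v < 1 ∧ -1 < v := by
    obtain ⟨h3, rfl | rfl⟩ := he <;> constructor <;> nlinarith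
  have hx : (0 : ℝ) < x := by linarith
  have hy : (0 : ℝ) < y := by
    have : 0 < y * r := by linarith
    exact pos_of_mul_pos_left this (by linarith)
  obtain ⟨a, rfl⟩ : (2 : ℤ) ∣ x := by
    have : (2 : ℤ) ∣ x ^ 2 := by
      rcases hN with h | h
      · exact ⟨y ^ 2 + 2, by push_cast at h; linarith⟩
      · exact ⟨y ^ 2 - 2, by push_cast at h; linarith⟩
    exact Int.prime_two.dvd_of_dvd_pow this
  obtain ⟨b, rfl⟩ : (2 : ℤ) ∣ y := by
    have : (2 : ℤ) ∣ y ^ 2 := by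
      rcases hN with h | h
      · exact ⟨a ^ 2 - 1, by push_cast at h; linarith⟩
      · exact ⟨a ^ 2 + 1, by push_cast at h; linarith⟩
    exact Int.prime_two.dvd_of_dvd_pow this
  have ha : 1 ≤ a := by
    have : (0 : ℤ) < 2 * a := by exact_mod_cast hx
    omega
  have hb : 1 ≤ b := by
    have : (0 : ℤ) < 2 * b := by exact_mod_cast hy
    omega
  have ha' : (1 : ℝ) ≤ a := by exact_mod_cast ha
  have hb' : (1 : ℝ) ≤ b := by exact_mod_cast hb
  refine le_antisymm (by linarith) ?_
  rw [hu]
  push_cast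
  nlinarith

theorem squarefree_mul_primes {p₁ p₂ : ℕ} (hp₁ : p₁.Prime) (hp₂ : p₂.Prime) (hne : p₁ ≠ p₂) :
    Squarefree (p₁ * p₂) :=
  (Nat.squarefree_mul ((Nat.coprime_primes hp₁ hp₂).2 hne)).2
    ⟨hp₁.prime.squarefree, hp₂.prime.squarefree⟩

namespace Octic
variable {p₁ p₂ : ℕ} {K : Type*} [Field K] [NumberField K] (S : Octic p₁ p₂ K)
variable [hf₁ : Fact p₁.Prime] [hf₂ : Fact p₂.Prime]
include S

theorem nonempty_units (hne : p₁ ≠ p₂) (hm₁ : p₁ % 8 = 5) (hm₂ : p₂ % 8 = 5) {φ : K →+* ℂ}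
    (hφ2 : φ S.r2 = (Real.sqrt 2 : ℝ)) (hφd : φ S.rd = (Real.sqrt ((p₁ : ℝ) * p₂) : ℝ))
    {ε₂ εp εd : ℝ}
    (hε₂ : IsFundUnit 2 ε₂) (hεp : IsFundUnit (p₁ * p₂) εp) (hεd : IsFundUnit (2 * p₁ * p₂) εd)
    (hsq : ¬ ∃ t : ℝ, t ∈ ℚ⟮Real.sqrt 2, Real.sqrt ((p₁ : ℝ) * p₂)⟯ ∧ t ^ 2 = ε₂ * εp * εd) :
    Nonempty S.Units := by
  have hsf := squarefree_mul_primes hf₁.out hf₂.out hne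
  have hodd : Nat.Coprime 2 (p₁ * p₂) := by
    rw [Nat.coprime_two_left, Nat.odd_mul, Nat.odd_iff, Nat.odd_iff]; omega
  have hsf2 : Squarefree (2 * p₁ * p₂) := by
    rw [mul_assoc, Nat.squarefree_mul hodd]
    exact ⟨Nat.prime_two.prime.squarefree, hsf⟩
  obtain ⟨E2, hu2, hσ2, hJ2, hv2, hmin2⟩ := S.exists_fundUnit (r := S.r2) (D := 2) (φ := φ)
    (by rw [S.r2_sq]; rfl) (Int.squarefree_natCast.2 Nat.prime_two.prime.squarefree)
    S.s_r2 S.σ_r2 S.J_r2 (fun x h h' h'' => S.exists_int h h' h'') (by rw [hφ2, Nat.cast_ofNat]) hε₂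
  obtain ⟨Ed, hud, hJd, hsd, hvd, hmind⟩ := S.exists_fundUnit (r := S.rd) (D := p₁ * p₂) (φ := φ)
    (by rw [S.rd_sq, Nat.cast_mul]) (Int.squarefree_natCast.2 hsf)
    S.σ_rd S.J_rd S.s_rd (fun x h h' h'' => S.exists_int h'' h h') (by rw [hφd, Nat.cast_mul]) hεp
  obtain ⟨Ee, hue, hJe, hse, hve, hmine⟩ := S.exists_fundUnit (r := S.r2 * S.rd)
    (D := 2 * p₁ * p₂) (φ := φ) (g₁ := S.J) (g₂ := S.s * S.σ) (τ := S.σ)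
    (by rw [mul_pow, S.r2_sq, S.rd_sq]; push_cast; ring) (Int.squarefree_natCast.2 hsf2)
    (by rw [smul_mul', S.σ_r2, S.σ_rd]; ring) (by rw [smul_mul', S.J_r2, S.J_rd])
    (by rw [mul_smul, smul_mul', S.σ_r2, S.σ_rd, smul_mul', smul_neg, S.s_r2, S.s_rd]; ring)
    (fun x h h' h'' => S.exists_int h'' h (by rwa [mul_smul, h''] at h'))
    (by
      have : φ (S.r2 * S.rd : 𝓞 K) = φ S.r2 * φ S.rd := map_mul (φ.comp (algebraMap (𝓞 K) K)) _ _
      rw [this, hφ2, hφd, ← Complex.ofReal_mul, ← Real.sqrt_mul zero_le_two]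
      push_cast
      rw [mul_assoc]) hεd
  have hE2 : E2 = 1 + S.r2 := by
    apply RingOfIntegers.ext
    apply φ.injective
    have : φ (1 + S.r2 : 𝓞 K) = 1 + φ S.r2 := by
      have := map_add (φ.comp (algebraMap (𝓞 K) K)) 1 S.r2
      rwa [map_one] at this
    rw [this, hv2, hφ2, hε₂.two_eq]
    push_cast
    rfl
  subst hE2
  have hprod (w : 𝓞 K) (hw : S.J • w = w) (e : ℤ) (he : e = 1 ∨ e = -1)
      (h : w ^ 2 = e * ((1 + S.r2) * Ed * Ee)) : False := by
    obtain ⟨a, b, c, d, hcoord⟩ := S.exists_coords_plus (congrArg (algebraMap (𝓞 K) K) hw)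
    set r := Real.sqrt 2
    set q := Real.sqrt ((p₁ : ℝ) * p₂)
    obtain ⟨t, ht⟩ : ∃ t : ℝ, t = a + b * q + (c + d * q) * r := ⟨_, rfl⟩
    have hwt : φ w = t := by
      have := congrArg φ hcoord
      simp only [map_add, map_mul, hφ2, hφd, eq_ratCast, map_ratCast] at this
      refine this.trans ?_
      rw [ht]
      push_cast
      rfl
    have h2 : φ w ^ 2 = e * (ε₂ * εp * εd : ℝ) := by
      have := congrArg (φ.comp (algebraMap (𝓞 K) K)) h
      simp only [map_mul, map_pow, map_intCast] at this
      refine this.trans ?_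
      push_cast
      rw [← hv2, ← hvd, ← hve]
      rfl
    rw [hwt] at h2
    have h3 : t ^ 2 = e * (ε₂ * εp * εd) := by exact_mod_cast h2
    have hpos : 0 < ε₂ * εp * εd := by
      have h4 := hε₂.1
      have h5 := hεp.1
      have h6 := hεd.1
      positivity
    rcases he with rfl | rfl
    · refine hsq ⟨t, ?_, by rw [h3]; simp⟩
      have hr : r ∈ ℚ⟮r, q⟯ := subset_adjoin _ _ (by simp)
      have hq : q ∈ ℚ⟮r, q⟯ := subset_adjoin _ _ (by simp)
      have hQ (x : ℚ) : (x : ℝ) ∈ ℚ⟮r, q⟯ := by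
        rw [← eq_ratCast (algebraMap ℚ ℝ) x]
        exact IntermediateField.algebraMap_mem _ _
      rw [ht]
      exact add_mem (add_mem (hQ a) (mul_mem (hQ b) hq))
        (mul_mem (add_mem (hQ c) (mul_mem (hQ d) hq)) hr)
    · push_cast at h3
      nlinarith [sq_nonneg t]
  exact ⟨{
    two := fun u hu h1 h2 => exists_eq_sq_of_isLeast hε₂.1 hu2 hv2 hσ2 hJ2 hmin2 hu h1 h2
    ed := Ed
    ed_isUnit := hud
    J_ed := hJd
    s_ed := hsd
    ed_ne := fun v hv h1 h2 => ne_sq_of_isLeast hεp.1 hvd hmind v hv h1 h2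
    e2d := Ee
    e2d_isUnit := hue
    J_e2d := hJe
    sσ_e2d := by rw [← mul_smul]; exact hse
    e2d_ne := fun v hv h1 h2 => ne_sq_of_isLeast hεd.1 hve hmine v hv h1 (by rwa [mul_smul])
    sq_ne := fun w hw => ⟨fun h => hprod w hw 1 (Or.inl rfl) (by rw [h]; push_cast; ring),
      fun h => hprod w hw (-1) (Or.inr rfl) (by rw [h]; push_cast; ring)⟩ }⟩

end Octic

theorem notMem_range_of_sq {K : Type*} [Field K] [CharZero K] {x : K} {D : ℕ} (hx : x ^ 2 = D)
    (hD : Squarefree D) (h1 : D ≠ 1) : x ∉ Set.range (algebraMap ℚ K) := by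
  rintro ⟨q, rfl⟩
  rw [← map_pow, ← map_natCast (algebraMap ℚ K)] at hx
  have h : IsSquare (D : ℚ) := ⟨q, by rw [← sq, (algebraMap ℚ K).injective hx]⟩
  obtain ⟨d, rfl⟩ := Rat.isSquare_natCast_iff.1 h
  exact h1 (by rw [Nat.isUnit_iff.1 (hD d dvd_rfl)])

section Generators
variable {K : Type*} [Field K] [NumberField K] {φ : K →+* ℂ}

theorem exists_gal_of_forall_mem_range (hnorm : ∀ (f : K →+* ℂ) (x : K), ∃ y, φ y = f x)
    (f : K →+* ℂ) : ∃ g : Gal(K/ℚ), ∀ x, φ (g x) = f x := by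
  let e : K ≃+* φ.range := RingEquiv.ofBijective φ.rangeRestrict
    ⟨fun x y h => φ.injective (congrArg Subtype.val h), φ.rangeRestrict_surjective⟩
  let g : K →+* K := (e.symm : φ.range →+* K).comp (f.codRestrict φ.range fun x => hnorm f x)
  have hg (x : K) : φ (g x) = f x :=
    congrArg Subtype.val (e.apply_symm_apply ⟨f x, hnorm f x⟩)
  exact ⟨AlgEquiv.ofBijective g.toRatAlgHom (Algebra.IsAlgebraic.algHom_bijective _), hg⟩

theorem isGalois_of_forall_mem_range (hnorm : ∀ (f : K →+* ℂ) (x : K), ∃ y, φ y = f x) :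
    IsGalois ℚ K := by
  apply IsGalois.of_card_aut_eq_finrank
  choose F hF using exists_gal_of_forall_mem_range hnorm
  refine le_antisymm ?_ ?_
  · rw [Nat.card_eq_fintype_card]
    exact AlgEquiv.card_le
  · rw [← Embeddings.card K ℂ, ← Nat.card_eq_fintype_card]
    refine Nat.card_le_card_of_injective F fun f f' h => RingHom.ext fun x => ?_
    rw [← hF f, ← hF f', h]

set_option maxHeartbeats 800000 in
theorem exists_octic {p₁ p₂ : ℕ} (hp₁ : p₁.Prime) (hp₂ : p₂.Prime) (hne : p₁ ≠ p₂)
    (hm₁ : p₁ % 8 = 5) (hm₂ : p₂ % 8 = 5) {i a b : K}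
    (hi : φ i = Complex.I) (ha : φ a = (Real.sqrt 2 : ℝ)) (hb : φ b = (Real.sqrt ((p₁ : ℝ) * p₂) : ℝ))
    (hext : ∀ f g : K →+* ℂ, f i = g i → f a = g a → f b = g b → f = g)
    (hnorm : ∀ (f : K →+* ℂ) (x : K), ∃ y, φ y = f x) :
    ∃ S : Octic p₁ p₂ K, (S.im : K) = i ∧ (S.r2 : K) = a ∧ (S.rd : K) = b := by
  classical
  have hsf := squarefree_mul_primes hp₁ hp₂ hne
  have hodd : Nat.Coprime 2 (p₁ * p₂) := by
    rw [Nat.coprime_two_left, Nat.odd_mul, Nat.odd_iff, Nat.odd_iff]; omega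
  have hsf2 : Squarefree (2 * (p₁ * p₂)) := by
    rw [Nat.squarefree_mul hodd]
    exact ⟨Nat.prime_two.prime.squarefree, hsf⟩
  have hi2 : i ^ 2 = -1 := φ.injective (by rw [map_pow, hi, Complex.I_sq, map_neg, map_one])
  have ha2 : a ^ 2 = (2 : ℕ) := φ.injective (by
    rw [map_pow, ha, map_natCast, ← Complex.ofReal_pow, Real.sq_sqrt zero_le_two]; rfl)
  have hb2 : b ^ 2 = (p₁ * p₂ : ℕ) := φ.injective (by
    rw [map_pow, hb, map_natCast, ← Complex.ofReal_pow, Real.sq_sqrt (by positivity)]; push_cast; rfl)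
  have hd1 : p₁ * p₂ ≠ 1 := by
    intro h
    have := Nat.eq_one_of_mul_eq_one_right h
    omega
  have hi0 : i ≠ 0 := by rintro rfl; simp at hi2
  have ha0 : a ≠ 0 := by rintro rfl; norm_num at ha2
  have hb0 : b ≠ 0 := by
    rintro rfl
    rw [zero_pow two_ne_zero, eq_comm, Nat.cast_eq_zero] at hb2
    exact hsf.ne_zero hb2
  have hG := isGalois_of_forall_mem_range hnorm
  have hE := exists_gal_of_forall_mem_range hnorm
  have sgn {x : K} {q : K} (hx : x ^ 2 = q) (hq : ∀ g : Gal(K/ℚ), g q = q) (g : Gal(K/ℚ)) :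
      g x = x ∨ g x = -x := by
    apply sq_eq_sq_iff_eq_or_eq_neg.1
    rw [← map_pow, hx, hq]
  have sI : ∀ g : Gal(K/ℚ), g i = i ∨ g i = -i := sgn hi2 fun g => by rw [map_neg, map_one]
  have sA : ∀ g : Gal(K/ℚ), g a = a ∨ g a = -a := sgn ha2 fun g => map_natCast g _
  have sB : ∀ g : Gal(K/ℚ), g b = b ∨ g b = -b := sgn hb2 fun g => map_natCast g _
  have ext' {g h : Gal(K/ℚ)} (h1 : g i = h i) (h2 : g a = h a) (h3 : g b = h b) : g = h := by
    have := hext (φ.comp (g : K →+* K)) (φ.comp (h : K →+* K)) (congrArg φ h1) (congrArg φ h2)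
      (congrArg φ h3)
    exact AlgEquiv.ext fun x => φ.injective (RingHom.congr_fun this x)
  have comm (g h : Gal(K/ℚ)) : g * h = h * g := by
    apply ext'
    · rcases sI g with h1 | h1 <;> rcases sI h with h2 | h2 <;> simp [h1, h2]
    · rcases sA g with h1 | h1 <;> rcases sA h with h2 | h2 <;> simp [h1, h2]
    · rcases sB g with h1 | h1 <;> rcases sB h with h2 | h2 <;> simp [h1, h2]
  have invol (g : Gal(K/ℚ)) : g * g = 1 := by
    apply ext'
    · rcases sI g with h1 | h1 <;> simp [h1]
    · rcases sA g with h1 | h1 <;> simp [h1]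
    · rcases sB g with h1 | h1 <;> simp [h1]
  obtain ⟨J, hJ⟩ := hE ((starRingEnd ℂ).comp φ)
  have hJi : J i = -i := φ.injective (by simp [hJ, hi])
  have hJa : J a = a := φ.injective (by simp [hJ, ha])
  have hJb : J b = b := φ.injective (by simp [hJ, hb])
  have moves {x : K} {D : ℕ} (hx : x ^ 2 = D) (hD : Squarefree D) (h1 : D ≠ 1) :
      ∃ g : Gal(K/ℚ), g x ≠ x := by
    by_contra! h
    exact notMem_range_of_sq hx hD h1 ((IsGalois.mem_range_algebraMap_iff_fixed x).2 h)
  obtain ⟨g₁, hg₁⟩ := moves ha2 Nat.prime_two.prime.squarefree (by norm_num)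
  obtain ⟨g₂, hg₂⟩ := moves hb2 hsf hd1
  obtain ⟨g₃, hg₃⟩ := moves (x := a * b) (D := 2 * (p₁ * p₂))
    (by rw [mul_pow, ha2, hb2, ← Nat.cast_mul]) hsf2 (by omega)
  have h₁a := (sA g₁).resolve_left hg₁
  have h₂b := (sB g₂).resolve_left hg₂
  have adj {g : Gal(K/ℚ)} : ∃ g' : Gal(K/ℚ), g' i = i ∧ g' a = g a ∧ g' b = g b := by
    rcases sI g with h | h
    · exact ⟨g, h, rfl, rfl⟩
    · refine ⟨g * J, ?_, ?_, ?_⟩ <;> simp [h, hJi, hJa, hJb]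
  obtain ⟨σ, hσi, hσa, hσb⟩ : ∃ σ : Gal(K/ℚ), σ i = i ∧ σ a = a ∧ σ b = -b := by
    obtain ⟨g, h1, h2⟩ : ∃ g : Gal(K/ℚ), g a = a ∧ g b = -b := by
      rcases sA g₃ with h | h <;> rcases sB g₃ with h' | h'
      · exact absurd (by rw [map_mul, h, h']) hg₃
      · exact ⟨g₃, h, h'⟩
      · rcases sA g₂ with h'' | h''
        · exact ⟨g₂, h'', h₂b⟩
        · exact ⟨g₂ * g₃, by simp [h, h''], by simp [h', h₂b]⟩
      · exact absurd (by rw [map_mul, h, h', neg_mul_neg]) hg₃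
    obtain ⟨g', h3, h4, h5⟩ := adj (g := g)
    exact ⟨g', h3, h4.trans h1, h5.trans h2⟩
  obtain ⟨s, hsi, hsa, hsb⟩ : ∃ s : Gal(K/ℚ), s i = i ∧ s a = -a ∧ s b = b := by
    obtain ⟨g', h3, h4, h5⟩ := adj (g := g₁)
    rcases sB g' with h | h
    · exact ⟨g', h3, h4.trans h₁a, h⟩
    · exact ⟨σ * g', by simp [h3, hσi], by simp [h4, h₁a, hσa], by simp [h, hσb]⟩
  have hrank : Module.finrank ℚ K = 8 := by
    rw [← IsGalois.card_aut_eq_finrank]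
    have hbij : Function.Bijective fun g : Gal(K/ℚ) =>
        ((decide (g i = i), decide (g a = a), decide (g b = b)) : Bool × Bool × Bool) := by
      have ni : -i ≠ i := neg_ne_self.2 hi0
      have na : -a ≠ a := neg_ne_self.2 ha0
      have nb : -b ≠ b := neg_ne_self.2 hb0
      have same {x u v : K} (hu : u = x ∨ u = -x) (hv : v = x ∨ v = -x) (h : u = x ↔ v = x) :
          u = v := by
        by_cases hc : u = x
        · exact hc.trans (h.1 hc).symm
        · exact (hu.resolve_left hc).trans (hv.resolve_left (mt h.2 hc)).symm
      constructor
      · intro g h hgh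
        simp only [Prod.mk.injEq, decide_eq_decide] at hgh
        obtain ⟨h1, h2, h3⟩ := hgh
        apply ext'
        · exact same (sI g) (sI h) h1
        · exact same (sA g) (sA h) h2
        · exact same (sB g) (sB h) h3
      · rintro ⟨_ | _, _ | _, _ | _⟩
        · exact ⟨J * s * σ, by simp [hJi, hJa, hJb, hσi, hσa, hσb, hsi, hsa, hsb, ni, na, nb]⟩
        · exact ⟨J * s, by simp [hJi, hJa, hJb, hsi, hsa, hsb, ni, na]⟩
        · exact ⟨J * σ, by simp [hJi, hJa, hJb, hσi, hσa, hσb, ni, nb]⟩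
        · exact ⟨J, by simp [hJi, hJa, hJb, ni]⟩
        · exact ⟨s * σ, by simp [hσi, hσa, hσb, hsi, hsa, hsb, na, nb]⟩
        · exact ⟨s, by simp [hsi, hsa, hsb, na]⟩
        · exact ⟨σ, by simp [hσi, hσa, hσb, nb]⟩
        · exact ⟨1, by simp⟩
    rw [Nat.card_congr (Equiv.ofBijective _ hbij)]
    simp
  have fix (x : K) (h1 : σ x = x) (h2 : J x = x) (h3 : s x = x) :
      x ∈ Set.range (algebraMap ℚ K) := by
    have step {t g : Gal(K/ℚ)} (ht : t x = x) (h : (t * g) x = x) : g x = x := by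
      rw [AlgEquiv.mul_apply] at h
      exact t.injective (h.trans ht.symm)
    have hB (g : Gal(K/ℚ)) (hgi : g i = i) (hga : g a = a) : g x = x := by
      rcases sB g with h | h
      · rw [ext' (g := g) (h := 1) hgi hga h, AlgEquiv.one_apply]
      · rw [ext' (g := g) (h := σ) (hgi.trans hσi.symm) (hga.trans hσa.symm) (h.trans hσb.symm), h1]
    have hA (g : Gal(K/ℚ)) (hgi : g i = i) : g x = x := by
      rcases sA g with h | h
      · exact hB g hgi h
      · exact step h3 (hB (s * g) (by simp [hgi, hsi]) (by simp [h, hsa]))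
    refine (IsGalois.mem_range_algebraMap_iff_fixed x).2 fun g => ?_
    rcases sI g with h | h
    · exact hA g h
    · exact step h2 (hA (J * g) (by simp [h, hJi]))
  have lift {x : K} {n : ℤ} (hx : x ^ 2 = n) : ∃ y : 𝓞 K, (y : K) = x := by
    have h : IsIntegral ℤ (x ^ 2) := by
      rw [hx]
      exact_mod_cast isIntegral_algebraMap (R := ℤ) (A := K) (x := n)
    exact (IsIntegralClosure.isIntegral_iff (A := 𝓞 K)).1 (h.of_pow two_pos)
  obtain ⟨im, rfl⟩ := lift (x := i) (n := -1) (by rw [hi2]; simp)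
  obtain ⟨r2, rfl⟩ := lift (x := a) (n := 2) (by rw [ha2]; simp)
  obtain ⟨rd, rfl⟩ := lift (x := b) (n := p₁ * p₂) (by rw [hb2]; simp)
  exact ⟨{
    im := im
    r2 := r2
    rd := rd
    im_sq := RingOfIntegers.ext (by simpa using hi2)
    r2_sq := RingOfIntegers.ext (by
      change algebraMap (𝓞 K) K _ = algebraMap (𝓞 K) K _
      rw [map_pow, map_ofNat]
      simpa using ha2)
    rd_sq := RingOfIntegers.ext (by simpa using hb2)
    σ := σ
    J := J
    s := s
    σ_im := RingOfIntegers.ext hσi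
    σ_r2 := RingOfIntegers.ext hσa
    σ_rd := RingOfIntegers.ext hσb
    J_im := RingOfIntegers.ext hJi
    J_r2 := RingOfIntegers.ext hJa
    J_rd := RingOfIntegers.ext hJb
    s_im := RingOfIntegers.ext hsi
    s_r2 := RingOfIntegers.ext hsa
    s_rd := RingOfIntegers.ext hsb
    comm := comm
    invol := invol
    fix := fix
    conj := fun ψ x => by
      obtain ⟨g, hg⟩ := hE ψ
      have h : g (J x) = J (g x) := AlgEquiv.congr_fun (comm g J) x
      rw [← hg, ← hg, h]
      exact hJ _
    rank := hrank }, rfl, rfl, rfl⟩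

end Generators

theorem apply_eq_of_mem_adjoin {K : Type*} [Field K] [NumberField K] {φ : K →+* ℂ} {w x : K}
    {g : Gal(K/ℚ)} (hw : g w = w) (hx : φ x ∈ ℚ⟮φ w⟯) : g x = x := by
  have h : ℚ⟮φ w⟯ = ℚ⟮w⟯.map φ.toRatAlgHom := by
    rw [adjoin_map, Set.image_singleton]
    rfl
  rw [h] at hx
  obtain ⟨y, hy, hyx⟩ := hx
  obtain rfl : y = x := φ.injective hyx
  refine adjoin_induction ℚ (p := fun z _ => g z = z) ?_ ?_ ?_ ?_ ?_ hy
  · rintro z rfl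
    exact hw
  · exact fun q => g.commutes q
  · intro a b _ _ ha hb
    rw [map_add, ha, hb]
  · intro a _ ha
    rw [map_inv₀, ha]
  · intro a b _ _ ha hb
    rw [map_mul, ha, hb]

theorem exists_eq_of_mem_adjoin {K : IntermediateField ℚ ℂ} {s : Set ℂ}
    (hK : K = adjoin ℚ s) (hs : ∀ z ∈ s, ∃ q : ℚ, z ^ 2 = q)
    (f : K →+* ℂ) (x : K) : ∃ y : K, (y : ℂ) = f x := by
  subst hK
  suffices h : ∀ z (hz : z ∈ adjoin ℚ s), f ⟨z, hz⟩ ∈ adjoin ℚ s from ⟨⟨_, h x x.2⟩, rfl⟩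
  intro z hz
  refine adjoin_induction ℚ (p := fun z hz => f ⟨z, hz⟩ ∈ adjoin ℚ s) ?_ ?_ ?_ ?_ ?_ hz
  · intro z hz
    obtain ⟨q, hq⟩ := hs z hz
    have hz' := subset_adjoin ℚ s hz
    have h : (⟨z, hz'⟩ : adjoin ℚ s) ^ 2 = (q : ℚ) := Subtype.ext (by simpa using hq)
    have h' : f ⟨z, hz'⟩ ^ 2 = z ^ 2 := by rw [← map_pow, h, map_ratCast, hq]
    rcases sq_eq_sq_iff_eq_or_eq_neg.1 h' with h | h <;> rw [h]
    · exact hz'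
    · exact neg_mem hz'
  · intro q
    have h : (⟨algebraMap ℚ ℂ q, IntermediateField.algebraMap_mem _ q⟩ : adjoin ℚ s) = (q : ℚ) :=
      Subtype.ext (by simp)
    rw [h, map_ratCast]
    exact SubfieldClass.ratCast_mem _ q
  · intro a b ha hb ha' hb'
    exact (map_add f ⟨a, ha⟩ ⟨b, hb⟩).symm ▸ add_mem ha' hb'
  · intro a ha ha'
    exact (map_inv₀ f ⟨a, ha⟩).symm ▸ inv_mem ha'
  · intro a b ha hb ha' hb'
    exact (map_mul f ⟨a, ha⟩ ⟨b, hb⟩).symm ▸ mul_mem ha' hb'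

namespace Octic
variable {p₁ p₂ : ℕ} {K : Type*} [Field K] [NumberField K] (S : Octic p₁ p₂ K)
variable [hf₁ : Fact p₁.Prime] [hf₂ : Fact p₂.Prime]
variable {k : Type*} [Field k] [Algebra k K] {φ : K →+* ℂ}
include S

theorem isReal_of_mem_range_iff
    (hk : ∀ x : K, x ∈ Set.range (algebraMap k K) ↔ φ x ∈ ℚ⟮φ S.rd⟯) : S.IsReal k := by
  intro x
  rw [hk]
  constructor
  · rintro hx g (rfl | rfl | rfl | rfl) <;> refine apply_eq_of_mem_adjoin ?_ hx
    · rfl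
    · exact congrArg (algebraMap (𝓞 K) K) S.J_rd
    · exact congrArg (algebraMap (𝓞 K) K) S.s_rd
    · exact congrArg (algebraMap (𝓞 K) K) (a₁ := (S.J * S.s) • S.rd)
        (by rw [mul_smul, S.s_rd, S.J_rd])
  · intro h
    obtain ⟨a, b, rfl⟩ := S.exists_coords_real (h _ (Or.inr (Or.inl rfl)))
      (h _ (Or.inr (Or.inr (Or.inl rfl))))
    rw [map_add, map_mul, eq_ratCast, eq_ratCast, map_ratCast, map_ratCast]
    exact add_mem (SubfieldClass.ratCast_mem _ a) (mul_mem (SubfieldClass.ratCast_mem _ b) (mem_adjoin_simple_self ℚ _))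

theorem isImag_of_mem_range_iff
    (hk : ∀ x : K, x ∈ Set.range (algebraMap k K) ↔ φ x ∈ ℚ⟮φ (S.rd * S.im)⟯) : S.IsImag k := by
  have h1 : (S.J * S.σ) (S.rd * S.im : K) = S.rd * S.im :=
    congrArg (algebraMap (𝓞 K) K) (a₁ := (S.J * S.σ) • (S.rd * S.im)) (a₂ := S.rd * S.im)
      (by rw [mul_smul, smul_mul', smul_mul', S.σ_rd, S.σ_im, smul_neg, S.J_rd, S.J_im, neg_mul_neg])
  have h2 : S.s (S.rd * S.im : K) = S.rd * S.im :=
    congrArg (algebraMap (𝓞 K) K) (a₁ := S.s • (S.rd * S.im)) (a₂ := S.rd * S.im)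
      (by rw [smul_mul', S.s_rd, S.s_im])
  intro x
  rw [hk]
  constructor
  · rintro hx g (rfl | rfl | rfl | rfl) <;> refine apply_eq_of_mem_adjoin ?_ hx
    · rfl
    · exact h1
    · exact h2
    · exact (congrArg _ h2).trans h1
  · intro h
    obtain ⟨a, b, rfl⟩ := S.exists_coords_imag (h _ (Or.inr (Or.inl rfl)))
      (h _ (Or.inr (Or.inr (Or.inl rfl))))
    rw [map_add, map_mul _ (algebraMap ℚ K b), eq_ratCast, eq_ratCast, map_ratCast, map_ratCast]
    exact add_mem (SubfieldClass.ratCast_mem _ a) (mul_mem (SubfieldClass.ratCast_mem _ b) (mem_adjoin_simple_self ℚ _))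

end Octic

theorem mem_range_inclusion_iff {E F : IntermediateField ℚ ℂ} (h : E ≤ F) (x : F) :
    x ∈ Set.range (inclusion h) ↔ (x : ℂ) ∈ E :=
  ⟨fun ⟨y, hy⟩ => hy ▸ y.2, fun hx => ⟨⟨x, hx⟩, rfl⟩⟩

/-- With `2ⁿ = h₂(p₁p₂)`, `2^{m+1} = h₂(-p₁p₂)` (`n ≥ 1`, `m ≥ 2`): if
`ε₂·ε_{p₁p₂}·ε_{2p₁p₂}` is not a square in `K₃⁺ = ℚ(√2, √(p₁p₂))`, then
`Cl₂(K₃) ≃ ℤ/2^m ℤ × ℤ/2^{n+1} ℤ` where `K₃ = ℚ(√2, √(p₁p₂), i)`. -/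
theorem stmt_4 (p₁ p₂ : ℕ) (hp₁ : p₁.Prime) (hp₂ : p₂.Prime) (hne : p₁ ≠ p₂)
    (hm₁ : p₁ % 8 = 5) (hm₂ : p₂ % 8 = 5)
    (n m : ℕ) (hn : 1 ≤ n) (hm : 2 ≤ m)
    (Fp Fm K₃ : IntermediateField ℚ ℂ)
    (hFp : Fp = ℚ⟮((Real.sqrt ((p₁ : ℝ) * p₂) : ℝ) : ℂ)⟯)
    (hFm : Fm = ℚ⟮((Real.sqrt ((p₁ : ℝ) * p₂) : ℝ) : ℂ) * Complex.I⟯)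
    (hK₃ : K₃ = ℚ⟮((Real.sqrt 2 : ℝ) : ℂ), ((Real.sqrt ((p₁ : ℝ) * p₂) : ℝ) : ℂ), Complex.I⟯)
    [NumberField Fp] [NumberField Fm] [NumberField K₃]
    (hhp : ∀ P : Sylow 2 (ClassGroup (RingOfIntegers Fp)), Nat.card P = 2 ^ n)
    (hhm : ∀ P : Sylow 2 (ClassGroup (RingOfIntegers Fm)), Nat.card P = 2 ^ (m + 1))
    (ε₂ εp εd : ℝ)
    (hε₂ : IsFundUnit 2 ε₂) (hεp : IsFundUnit (p₁ * p₂) εp) (hεd : IsFundUnit (2 * p₁ * p₂) εd)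
    (hsq : ¬ ∃ t : ℝ, t ∈ ℚ⟮Real.sqrt 2, Real.sqrt ((p₁ : ℝ) * p₂)⟯ ∧ t ^ 2 = ε₂ * εp * εd) :
    ∀ P : Sylow 2 (ClassGroup (RingOfIntegers K₃)),
      Nonempty (Additive P ≃+ (ZMod (2 ^ m) × ZMod (2 ^ (n + 1)))) := by
  subst hFp hFm
  have hf₁ : Fact p₁.Prime := ⟨hp₁⟩
  have hf₂ : Fact p₂.Prime := ⟨hp₂⟩
  have hmem : ∀ z ∈ ({((Real.sqrt 2 : ℝ) : ℂ), ((Real.sqrt ((p₁ : ℝ) * p₂) : ℝ) : ℂ), Complex.I} :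
      Set ℂ), z ∈ K₃ := fun z hz => hK₃ ▸ subset_adjoin ℚ _ hz
  have ha := hmem _ (Or.inl rfl)
  have hb := hmem _ (Or.inr (Or.inl rfl))
  have hi := hmem _ (Or.inr (Or.inr rfl))
  let φ : K₃ →+* ℂ := K₃.val
  have hext (f g : K₃ →+* ℂ) (h1 : f ⟨_, hi⟩ = g ⟨_, hi⟩) (h2 : f ⟨_, ha⟩ = g ⟨_, ha⟩)
      (h3 : f ⟨_, hb⟩ = g ⟨_, hb⟩) : f = g := by
    have h := algHom_ext_of_eq_adjoin ℚ hK₃ (φ₁ := f.toRatAlgHom) (φ₂ := g.toRatAlgHom) (by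
      rintro _ (rfl | rfl | rfl)
      exacts [h2, h3, h1])
    exact RingHom.ext fun x => AlgHom.congr_fun h x
  have hnorm (f : K₃ →+* ℂ) (x : K₃) : ∃ y, φ y = f x := by
    refine exists_eq_of_mem_adjoin hK₃ ?_ f x
    rintro _ (rfl | rfl | rfl)
    · refine ⟨2, ?_⟩
      rw [← Complex.ofReal_pow, Real.sq_sqrt zero_le_two]
      norm_num
    · refine ⟨p₁ * p₂, ?_⟩
      rw [← Complex.ofReal_pow, Real.sq_sqrt (by positivity)]
      push_cast
      rfl
    · exact ⟨-1, by rw [Complex.I_sq]; norm_num⟩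
  obtain ⟨S, hSi, hSa, hSb⟩ := exists_octic (φ := φ) hp₁ hp₂ hne hm₁ hm₂ (i := ⟨_, hi⟩)
    (a := ⟨_, ha⟩) (b := ⟨_, hb⟩) rfl rfl rfl hext hnorm
  obtain ⟨U⟩ := S.nonempty_units hne hm₁ hm₂ (φ := φ) (by rw [hSa]; rfl) (by rw [hSb]; rfl)
    hε₂ hεp hεd hsq
  have hp : ℚ⟮((Real.sqrt ((p₁ : ℝ) * p₂) : ℝ) : ℂ)⟯ ≤ K₃ := adjoin_simple_le_iff.2 hb
  have hm' : ℚ⟮((Real.sqrt ((p₁ : ℝ) * p₂) : ℝ) : ℂ) * Complex.I⟯ ≤ K₃ :=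
    adjoin_simple_le_iff.2 (mul_mem hb hi)
  let _ := (inclusion hp).toRingHom.toAlgebra
  let _ := (inclusion hm').toRingHom.toAlgebra
  refine S.structure_sylow U hne hm₁ hm₂ (S.isReal_of_mem_range_iff (φ := φ) fun x => ?_)
    (S.isImag_of_mem_range_iff (φ := φ) fun x => ?_) hn hm hhp hhm
  · rw [hSb]
    exact mem_range_inclusion_iff hp x
  · rw [hSb, hSi]
    exact mem_range_inclusion_iff hm' x
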